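/- (1-d global existence for 1 < γ ≤ 3.) Fix 1 < γ ≤ 3, an integer a > (3γ−2)/(γ−1), and an integer L with 0 ≤ L < a − (a(γ−1)−1)/(2γ−2). There exist ε₀ > 0 and C ≥ 1 such that for every 0 < ε ≤ ε₀ and every u₀ ∈ C^∞([−1,1]) with Σ_{b=0}^{a} ∫_{−1}^{1} d(x)^{(1+b(γ−1))/(γ−1)} |∂_x^b u₀(x)|² dx < ε, there exists a global-in-time solution (η, v) of the 1-d γ-perturbation system on Ω₀ × [0,∞) with initial data η(x,0) = x, v(x,0) = u₀(x), satisfying E_γ(t) ≤ C·ε for all t ≥ 0. -/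

import Mathlib

open Set MeasureTheory Filter

noncomputable section

open scoped Classical

/-- The spatial domain `Ω₀ = (−1, 1)`. -/
def Ω₀ : Set ℝ := Ioo (-1) 1

/-- The weight `d(x) = ((γ−1)/(2γ))(1 − x²)`. -/
def ddg (γ : ℝ) (x : ℝ) : ℝ := (γ - 1) / (2 * γ) * (1 - x ^ 2)

/-- Squared integer Sobolev norm `‖f‖_{H^n(Ω₀)}²`. -/
def HSq (n : ℕ) (f : ℝ → ℝ) : ℝ :=
  ∑ j ∈ Finset.range (n + 1), ∫ x in Ω₀, (iteratedDeriv j f x) ^ 2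

/-- Squared `W^{1,∞}(Ω₀)` norm. -/
def W1InfSq (f : ℝ → ℝ) : ℝ :=
  (sSup ((fun x => |f x|) '' Ω₀)) ^ 2 + (sSup ((fun x => |deriv f x|) '' Ω₀)) ^ 2

/-- Squared (fractional) Sobolev norm `‖f‖_s²` on `Ω₀`: for non-integer `s` it is
`‖f‖_{H^{⌊s⌋}}²` plus the Gagliardo seminorm of `∂_x^{⌊s⌋} f`; for integer `s` it is the
integer Sobolev norm. -/
def SobSq (s : ℝ) (f : ℝ → ℝ) : ℝ :=
  HSq ⌊s⌋₊ f +
    if (⌊s⌋₊ : ℝ) = s then 0 else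
      ∫ x in Ω₀, ∫ y in Ω₀,
        (iteratedDeriv ⌊s⌋₊ f x - iteratedDeriv ⌊s⌋₊ f y) ^ 2 /
          |x - y| ^ (1 + 2 * (s - (⌊s⌋₊ : ℝ)))

/-- The higher-order energy `e_γ(t)` for `1 < γ ≤ 3` in 1-d, built from `a + 1` spatial
derivatives. -/
def eγLow (γ : ℝ) (a : ℕ) (α : ℝ → ℝ) (η v : ℝ → ℝ → ℝ) (t : ℝ) : ℝ :=
  (∫ x in Ω₀, ddg γ x ^ ((1 + ((a : ℝ) + 1) * (γ - 1)) / (γ - 1)) *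
      (iteratedDeriv (a + 1) (fun y => η y t - y) x) ^ 2) +
    ∑ b ∈ Finset.range (a + 1),
      ((α t ^ (γ + 1) * ∫ x in Ω₀, ddg γ x ^ ((1 + (b : ℝ) * (γ - 1)) / (γ - 1)) *
          (iteratedDeriv b (fun y => v y t) x) ^ 2) +
        ∫ x in Ω₀, ddg γ x ^ ((1 + (b : ℝ) * (γ - 1)) / (γ - 1)) *
          (iteratedDeriv b (fun y => η y t - y) x) ^ 2)

/-- The norm `E_γ(t)` for `1 < γ ≤ 3` in 1-d. -/
def EγLow (γ : ℝ) (a L : ℕ) (α : ℝ → ℝ) (η v : ℝ → ℝ → ℝ) (t : ℝ) : ℝ :=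
  eγLow γ a α η v t + W1InfSq (fun y => η y t - y) +
    α t ^ (γ + 1) * W1InfSq (fun y => v y t) +
    ∑ b ∈ Finset.range (L + 1),
      (α t ^ (γ + 1) *
          SobSq (((a : ℝ) * (γ - 1) - 1) / (2 * γ - 2) + b) (fun y => ddg γ y ^ b * v y t) +
        SobSq (((a : ℝ) * (γ - 1) - 1) / (2 * γ - 2) + b)
          (fun y => ddg γ y ^ b * (η y t - y)))

/-- `(η, v)` is a (sufficiently smooth, globally defined) solution of the 1-d
`γ`-perturbation system: `∂_t η = v`, `∂_x η > 0`, and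
`α^{γ+1} ∂_t v + 2α^γ α' v + η + (γ/(γ−1)) d' (∂_x η)^{−γ} − γ d (∂_x η)^{−γ−1} ∂_x² η = 0`. -/
def IsSolγ (γ : ℝ) (α α' : ℝ → ℝ) (η v : ℝ → ℝ → ℝ) : Prop :=
  (∀ t ∈ Ici (0 : ℝ), ContDiffOn ℝ 2 (fun y => η y t) Ω₀) ∧
  (∀ x ∈ Ω₀, ∀ t ∈ Ici (0 : ℝ), 0 < deriv (fun y => η y t) x) ∧
  (∀ x ∈ Ω₀, ∀ t ∈ Ici (0 : ℝ), HasDerivWithinAt (fun s => η x s) (v x t) (Ici 0) t) ∧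
  (∀ x ∈ Ω₀, ∀ t > (0 : ℝ), DifferentiableAt ℝ (fun s => v x s) t) ∧
  (∀ x ∈ Ω₀, ∀ t > (0 : ℝ),
    α t ^ (γ + 1) * deriv (fun s => v x s) t + 2 * α t ^ γ * α' t * v x t + η x t
      + γ / (γ - 1) * deriv (ddg γ) x * (deriv (fun y => η y t) x) ^ (-γ)
      - γ * ddg γ x * (deriv (fun y => η y t) x) ^ (-γ - 1) *
          iteratedDeriv 2 (fun y => η y t) x = 0)

section EulerAux

open scoped Topology ContDiff

open scoped Topology ContDiff

/-- The quadratic weight `c (1 - x²)`. -/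
def dw (c x : ℝ) : ℝ := c * (1 - x ^ 2)

/-- Weighted squared `L²` norm on `Ω₀`. -/
def W (c p : ℝ) (f : ℝ → ℝ) : ℝ := ∫ x in Ω₀, dw c x ^ p * f x ^ 2

/-- Graded weighted Sobolev norm, squared. -/
def N (c ρ : ℝ) (A : ℕ) (f : ℝ → ℝ) : ℝ :=
  ∑ j ∈ Finset.range (A + 1), W c (ρ + j) (iteratedDeriv j f)

/-- The first order operator `d g' + (ρ + 1) d' g`. -/
def DD (c ρ : ℝ) (g : ℝ → ℝ) (x : ℝ) : ℝ :=
  dw c x * deriv g x + (ρ + 1) * (-2 * c * x) * g x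

lemma measurableSet_Ω₀ : MeasurableSet Ω₀ := measurableSet_Ioo

lemma dw_continuous (c : ℝ) : Continuous (dw c) := by
  unfold dw; fun_prop

lemma dw_contDiff (c : ℝ) : ContDiff ℝ ∞ (dw c) := by
  unfold dw; fun_prop

lemma dw_hasDerivAt (c x : ℝ) : HasDerivAt (dw c) (-2 * c * x) x := by
  have h := ((hasDerivAt_pow 2 x).const_sub 1).const_mul c
  refine h.congr_deriv ?_
  push_cast; ring

lemma dw_pos {c : ℝ} (hc : 0 < c) {x : ℝ} (hx : x ∈ Ω₀) : 0 < dw c x := by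
  obtain ⟨h1, h2⟩ := hx
  unfold dw
  have : 0 < 1 - x ^ 2 := by nlinarith
  positivity

lemma dw_le {c : ℝ} (hc : 0 < c) (x : ℝ) : dw c x ≤ c := by
  unfold dw; nlinarith [sq_nonneg x]

lemma dw_rpow_continuous (c : ℝ) {p : ℝ} (hp : 0 ≤ p) : Continuous (fun x => dw c x ^ p) :=
  (dw_continuous c).rpow_const fun _ => Or.inr hp

lemma integrableOn_Ω₀ {f : ℝ → ℝ} (hf : Continuous f) : IntegrableOn f Ω₀ :=
  (hf.integrableOn_Icc (a := -1) (b := 1)).mono_set Ioo_subset_Icc_self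

lemma integrableOn_Ω₀_dw {c p : ℝ} (hp : 0 ≤ p) {f : ℝ → ℝ} (hf : Continuous f) :
    IntegrableOn (fun x => dw c x ^ p * f x) Ω₀ :=
  integrableOn_Ω₀ ((dw_rpow_continuous c hp).mul hf)

lemma W_nonneg {c : ℝ} (hc : 0 < c) (p : ℝ) (f : ℝ → ℝ) : 0 ≤ W c p f := by
  refine setIntegral_nonneg measurableSet_Ω₀ fun x hx => ?_
  have := (dw_pos hc hx).le
  positivity

lemma N_nonneg {c : ℝ} (hc : 0 < c) (ρ : ℝ) (A : ℕ) (f : ℝ → ℝ) : 0 ≤ N c ρ A f :=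
  Finset.sum_nonneg fun _ _ => W_nonneg hc _ _

lemma W_le_N {c : ℝ} (hc : 0 < c) (ρ : ℝ) {A j : ℕ} (hj : j ≤ A) (f : ℝ → ℝ) :
    W c (ρ + j) (iteratedDeriv j f) ≤ N c ρ A f :=
  Finset.single_le_sum (f := fun j : ℕ => W c (ρ + j) (iteratedDeriv j f))
    (fun _ _ => W_nonneg hc _ _) (Finset.mem_range.2 (by omega))

/-- Monotonicity in the exponent. -/
lemma W_mono_exp {c : ℝ} (hc : 0 < c) {p q : ℝ} (hp : 0 ≤ p) (hpq : p ≤ q) {f : ℝ → ℝ}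
    (hf : Continuous f) : W c q f ≤ c ^ (q - p) * W c p f := by
  unfold W
  rw [← integral_const_mul]
  refine setIntegral_mono_on (integrableOn_Ω₀_dw (hp.trans hpq) (hf.pow 2))
    ((integrableOn_Ω₀_dw hp (hf.pow 2)).const_mul _) measurableSet_Ω₀ fun x hx => ?_
  have h0 := dw_pos hc hx
  have h1 : dw c x ^ q = dw c x ^ (q - p) * dw c x ^ p := by
    rw [← Real.rpow_add h0]; congr 1; ring
  have h2 : dw c x ^ (q - p) ≤ c ^ (q - p) :=
    Real.rpow_le_rpow h0.le (dw_le hc x) (by linarith)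
  rw [h1, mul_assoc]
  exact mul_le_mul_of_nonneg_right h2 (by positivity)

lemma setIntegral_Ω₀_eq (f : ℝ → ℝ) : ∫ x in Ω₀, f x = ∫ x in (-1 : ℝ)..1, f x := by
  rw [intervalIntegral.integral_of_le (by norm_num), integral_Ioc_eq_integral_Ioo]; rfl

/-- A weighted exact derivative integrates to zero. -/
lemma integral_exact {c ρ : ℝ} (hc : 0 < c) (hρ : 0 ≤ ρ) {h : ℝ → ℝ}
    (hh : ContDiff ℝ 1 h) : ∫ x in Ω₀, dw c x ^ ρ * DD c ρ h x = 0 := by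
  have hd : Continuous (deriv h) := hh.continuous_deriv le_rfl
  rw [setIntegral_Ω₀_eq]
  have hcont : Continuous (fun x => dw c x ^ (ρ + 1) * h x) :=
    (dw_rpow_continuous c (by linarith)).mul hh.continuous
  have hcont' : Continuous (fun x => dw c x ^ ρ * DD c ρ h x) := by
    refine (dw_rpow_continuous c hρ).mul ?_
    unfold DD
    exact ((dw_continuous c).mul hd).add ((by fun_prop : Continuous fun x : ℝ =>
      (ρ + 1) * (-2 * c * x)).mul hh.continuous)
  rw [intervalIntegral.integral_eq_sub_of_hasDerivAt_of_le (f := fun x => dw c x ^ (ρ + 1) * h x)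
    (by norm_num) hcont.continuousOn _ (hcont'.intervalIntegrable _ _)]
  · have : dw c 1 = 0 := by simp [dw]
    have h' : dw c (-1) = 0 := by simp [dw]
    rw [this, h', Real.zero_rpow (by linarith)]; simp
  · intro x hx
    have h0 := dw_pos hc (show x ∈ Ω₀ from hx)
    have h1 := (dw_hasDerivAt c x).rpow_const (p := ρ + 1) (Or.inl h0.ne')
    have h2 := h1.mul ((hh.differentiable one_ne_zero) x).hasDerivAt
    refine h2.congr_deriv ?_
    rw [Real.rpow_add_one h0.ne' ρ, show ρ + 1 - 1 = ρ by ring]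
    unfold DD
    ring

lemma DD_mul {c ρ : ℝ} {f g : ℝ → ℝ} {x : ℝ} (hf : DifferentiableAt ℝ f x)
    (hg : DifferentiableAt ℝ g x) :
    DD c ρ (fun y => g y * f y) x = DD c ρ g x * f x + dw c x * (g x * deriv f x) := by
  unfold DD
  rw [deriv_fun_mul hg hf]; ring

lemma DD_continuous {c ρ : ℝ} {h : ℝ → ℝ} (hh : ContDiff ℝ 1 h) : Continuous (DD c ρ h) := by
  have hd : Continuous (deriv h) := hh.continuous_deriv le_rfl
  unfold DD
  exact ((dw_continuous c).mul hd).add ((by fun_prop : Continuous fun x : ℝ =>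
      (ρ + 1) * (-2 * c * x)).mul hh.continuous)

/-- Weighted integration by parts. -/
lemma integral_DD_mul {c ρ : ℝ} (hc : 0 < c) (hρ : 0 ≤ ρ) {f g : ℝ → ℝ}
    (hf : ContDiff ℝ 1 f) (hg : ContDiff ℝ 1 g) :
    ∫ x in Ω₀, dw c x ^ ρ * (DD c ρ g x * f x) =
      -∫ x in Ω₀, dw c x ^ (ρ + 1) * (g x * deriv f x) := by
  have hfd : Continuous (deriv f) := hf.continuous_deriv le_rfl
  have h := integral_exact hc hρ (hg.mul hf)
  have e : ∀ x ∈ Ω₀, dw c x ^ ρ * DD c ρ (fun y => g y * f y) x =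
      dw c x ^ ρ * (DD c ρ g x * f x) + dw c x ^ (ρ + 1) * (g x * deriv f x) := by
    intro x hx
    rw [DD_mul (hf.differentiable one_ne_zero x) (hg.differentiable one_ne_zero x),
      Real.rpow_add_one (dw_pos hc hx).ne' ρ]
    ring
  have i1 : IntegrableOn (fun x => dw c x ^ ρ * (DD c ρ g x * f x)) Ω₀ :=
    integrableOn_Ω₀_dw hρ ((DD_continuous hg).mul hf.continuous)
  have i2 : IntegrableOn (fun x => dw c x ^ (ρ + 1) * (g x * deriv f x)) Ω₀ :=
    integrableOn_Ω₀_dw (by linarith) (hg.continuous.mul hfd)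
  rw [setIntegral_congr_fun measurableSet_Ω₀ e, integral_add i1 i2] at h
  linarith

/-- Hardy inequality, one step. -/
lemma hardy_step {c q : ℝ} (hc : 0 < c) (hq : 0 ≤ q) {f : ℝ → ℝ} (hf : ContDiff ℝ 1 f) :
    W c q f ≤ (2 * q + 3) / (c * (q + 1)) * W c (q + 1) f +
      1 / (c * (q + 1)) ^ 2 * W c (q + 2) (deriv f) := by
  have hfd : Continuous (deriv f) := hf.continuous_deriv le_rfl
  have hcf := hf.continuous
  have h := integral_exact (ρ := q) hc hq (h := fun x => x * f x ^ 2)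
    (contDiff_id.mul (hf.pow 2))
  have e : ∀ x ∈ Ω₀, dw c x ^ q * DD c q (fun x => x * f x ^ 2) x =
      (2 * q + 3) * (dw c x ^ (q + 1) * f x ^ 2) - 2 * c * (q + 1) * (dw c x ^ q * f x ^ 2)
        + dw c x ^ (q + 1) * (2 * x * f x * deriv f x) := by
    intro x hx
    have hfx := (hf.differentiable one_ne_zero x)
    have h1 : HasDerivAt (fun x => x * f x ^ 2) (f x ^ 2 + x * (2 * f x * deriv f x)) x := by
      refine ((hasDerivAt_id x).mul (hfx.hasDerivAt.pow 2)).congr_deriv ?_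
      simp
    unfold DD
    rw [h1.deriv, Real.rpow_add_one (dw_pos hc hx).ne' q]
    unfold dw; ring
  have hb : 0 < c * (q + 1) := by positivity
  have i1 : IntegrableOn (fun x => dw c x ^ (q + 1) * f x ^ 2) Ω₀ :=
    integrableOn_Ω₀_dw (by linarith) (hcf.pow 2)
  have i0 : IntegrableOn (fun x => dw c x ^ q * f x ^ 2) Ω₀ := integrableOn_Ω₀_dw hq (hcf.pow 2)
  have i2 : IntegrableOn (fun x => dw c x ^ (q + 2) * deriv f x ^ 2) Ω₀ :=
    integrableOn_Ω₀_dw (by linarith) (hfd.pow 2)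
  have i3 : IntegrableOn (fun x => dw c x ^ (q + 1) * (2 * x * f x * deriv f x)) Ω₀ :=
    integrableOn_Ω₀_dw (by linarith) (((continuous_const.mul continuous_id).mul hcf).mul hfd)
  have i4 : IntegrableOn (fun x => (2 * q + 3) * (dw c x ^ (q + 1) * f x ^ 2)) Ω₀ :=
    i1.const_mul _
  have i5 : IntegrableOn (fun x => 2 * c * (q + 1) * (dw c x ^ q * f x ^ 2)) Ω₀ := i0.const_mul _
  have i6 : IntegrableOn (fun x => (2 * q + 3) * (dw c x ^ (q + 1) * f x ^ 2)
      - 2 * c * (q + 1) * (dw c x ^ q * f x ^ 2)) Ω₀ := i4.sub i5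
  rw [setIntegral_congr_fun measurableSet_Ω₀ e, integral_add i6 i3, integral_sub i4 i5,
    integral_const_mul, integral_const_mul] at h
  have key : ∫ x in Ω₀, dw c x ^ (q + 1) * (2 * x * f x * deriv f x) ≤
      ∫ x in Ω₀, (c * (q + 1) * (dw c x ^ q * f x ^ 2) +
        1 / (c * (q + 1)) * (dw c x ^ (q + 2) * deriv f x ^ 2)) := by
    refine setIntegral_mono_on i3 ((i0.const_mul _).add (i2.const_mul _)) measurableSet_Ω₀ ?_
    intro x hx
    have h0 := dw_pos hc hx
    have e1 : dw c x ^ (q + 1) = dw c x ^ q * dw c x := Real.rpow_add_one h0.ne' q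
    have e2 : dw c x ^ (q + 2) = dw c x ^ q * dw c x ^ 2 := by
      rw [Real.rpow_add h0]; norm_num
    rw [e1, e2]
    set D := dw c x
    set b := c * (q + 1)
    have hP : 0 ≤ D ^ q := by positivity
    have : D * (2 * x * f x * deriv f x) ≤ b * f x ^ 2 + 1 / b * (D ^ 2 * deriv f x ^ 2) := by
      have hx2 : x ^ 2 ≤ 1 := by obtain ⟨a1, a2⟩ := hx; nlinarith
      have s1 : b * f x ^ 2 + 1 / b * (D ^ 2 * deriv f x ^ 2) - D * (2 * x * f x * deriv f x)
        = 1 / b * ((b * f x - x * D * deriv f x) ^ 2 + (1 - x ^ 2) * (D * deriv f x) ^ 2) := by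
        field_simp; ring
      have : 0 ≤ 1 / b * ((b * f x - x * D * deriv f x) ^ 2 + (1 - x ^ 2) * (D * deriv f x) ^ 2) := by
        have : 0 ≤ 1 - x ^ 2 := by linarith
        positivity
      linarith
    calc D ^ q * D * (2 * x * f x * deriv f x) = D ^ q * (D * (2 * x * f x * deriv f x)) := by ring
      _ ≤ D ^ q * (b * f x ^ 2 + 1 / b * (D ^ 2 * deriv f x ^ 2)) :=
        mul_le_mul_of_nonneg_left this hP
      _ = _ := by ring
  rw [integral_add (i0.const_mul _) (i2.const_mul _), integral_const_mul, integral_const_mul] at key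
  unfold W
  set I0 := ∫ x in Ω₀, dw c x ^ q * f x ^ 2
  set I1 := ∫ x in Ω₀, dw c x ^ (q + 1) * f x ^ 2
  set I2 := ∫ x in Ω₀, dw c x ^ (q + 2) * deriv f x ^ 2
  set b := c * (q + 1) with hbdef
  have h' : b * I0 ≤ (2 * q + 3) * I1 + 1 / b * I2 := by
    have : 2 * c * (q + 1) * I0 = 2 * (b * I0) := by rw [hbdef]; ring
    linarith
  have : I0 ≤ (1 / b) * ((2 * q + 3) * I1 + 1 / b * I2) := by
    rw [one_div_mul_eq_div, le_div_iff₀ hb]; linarith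
  calc I0 ≤ _ := this
    _ = _ := by field_simp

/-- Hardy inequality with an arbitrarily degenerate lower order term. -/
lemma hardy {c q : ℝ} (hc : 0 < c) (hq : 0 ≤ q) (n : ℕ) :
    ∃ C : ℝ, 0 ≤ C ∧ ∀ f : ℝ → ℝ, ContDiff ℝ 1 f →
      W c q f ≤ C * (W c (q + n) f + W c (q + 2) (deriv f)) := by
  induction n with
  | zero =>
    refine ⟨1, by norm_num, fun f hf => ?_⟩
    have := W_nonneg hc (q + 2) (deriv f)
    simp only [Nat.cast_zero, add_zero]; linarith
  | succ n ih =>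
    obtain ⟨C, hC, ih⟩ := ih
    have hqn : 0 ≤ q + n := by positivity
    refine ⟨C * ((2 * (q + n) + 3) / (c * (q + n + 1)) + (1 / (c * (q + n + 1)) ^ 2 * c ^ (n : ℝ) + 1)),
      by positivity, fun f hf => ?_⟩
    have h1 := ih f hf
    have h2 := hardy_step hc hqn hf
    have h3 := W_mono_exp hc (p := q + 2) (q := q + n + 2) (by linarith) (by linarith [Nat.cast_nonneg (α := ℝ) n])
      (hf.continuous_deriv le_rfl)
    rw [show q + n + 2 - (q + 2) = (n : ℝ) by ring] at h3
    push_cast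
    rw [show q + (n + 1 : ℝ) = q + n + 1 by ring]
    have a1 := W_nonneg hc (q + n + 1) f
    have a2 := W_nonneg hc (q + 2) (deriv f)
    have hB : (0 : ℝ) ≤ (2 * (q + n) + 3) / (c * (q + n + 1)) := by positivity
    have hD : (0 : ℝ) ≤ 1 / (c * (q + n + 1)) ^ 2 := by positivity
    have hE : (0 : ℝ) ≤ c ^ (n : ℝ) := by positivity
    refine h1.trans ?_
    rw [mul_assoc]
    refine mul_le_mul_of_nonneg_left ?_ hC
    generalize (2 * (q + n) + 3) / (c * (q + n + 1)) = B at *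
    generalize 1 / (c * (q + n + 1)) ^ 2 = D at *
    generalize c ^ (n : ℝ) = E at *
    have h4 := mul_le_mul_of_nonneg_left h3 hD
    nlinarith [mul_nonneg hB a2, mul_nonneg (mul_nonneg hD hE) a1]

lemma smooth_iteratedDeriv {f : ℝ → ℝ} (hf : ContDiff ℝ ∞ f) (j : ℕ) :
    ContDiff ℝ ∞ (iteratedDeriv j f) := by
  rw [iteratedDeriv_eq_iterate]
  exact hf.iterate_deriv j

lemma continuous_iteratedDeriv' {f : ℝ → ℝ} (hf : ContDiff ℝ ∞ f) (j : ℕ) :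
    Continuous (iteratedDeriv j f) := (smooth_iteratedDeriv hf j).continuous

lemma hasDerivAt_iteratedDeriv {f : ℝ → ℝ} (hf : ContDiff ℝ ∞ f) (j : ℕ) (x : ℝ) :
    HasDerivAt (iteratedDeriv j f) (iteratedDeriv (j + 1) f x) x := by
  rw [iteratedDeriv_succ]
  exact ((smooth_iteratedDeriv hf j).differentiable (by simp) x).hasDerivAt

lemma W_le_const_N_aux {c ρ : ℝ} (hc : 0 < c) (hρ : 0 ≤ ρ) {A : ℕ} (m : ℕ) :
    ∀ j : ℕ, j + m = A → ∀ q : ℝ, 0 ≤ q → ρ + 2 * j - A ≤ q →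
    ∃ C : ℝ, 0 ≤ C ∧ ∀ f : ℝ → ℝ, ContDiff ℝ ∞ f →
      W c q (iteratedDeriv j f) ≤ C * N c ρ A f := by
  induction m with
  | zero =>
    intro j hj q hq hq'
    have hjA : j = A := by omega
    subst hjA
    refine ⟨c ^ (q - (ρ + j)), by positivity, fun f hf => ?_⟩
    refine (W_mono_exp hc (p := ρ + j) (by positivity) (by linarith)
      (continuous_iteratedDeriv' hf j)).trans ?_
    exact mul_le_mul_of_nonneg_left (W_le_N hc ρ le_rfl f) (by positivity)
  | succ m ih =>
    intro j hj q hq hq'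
    obtain ⟨C₁, hC₁, h₁⟩ := ih (j + 1) (by omega) (q + 2) (by linarith) (by push_cast; linarith)
    obtain ⟨n, hn⟩ := exists_nat_ge (ρ + j - q)
    obtain ⟨C₂, hC₂, h₂⟩ := hardy hc hq n
    refine ⟨C₂ * (c ^ (q + n - (ρ + j)) + C₁), by positivity, fun f hf => ?_⟩
    refine (h₂ _ ((smooth_iteratedDeriv hf j).of_le (by exact_mod_cast le_top))).trans ?_
    rw [mul_assoc, ← iteratedDeriv_succ, add_mul]
    refine mul_le_mul_of_nonneg_left (add_le_add ?_ (h₁ f hf)) hC₂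
    refine (W_mono_exp hc (p := ρ + j) (by positivity) (by linarith)
      (continuous_iteratedDeriv' hf j)).trans ?_
    exact mul_le_mul_of_nonneg_left (W_le_N hc ρ (by omega) f) (by positivity)

/-- Weighted `L²` bound of a lower order derivative with improved weight. -/
lemma W_le_const_N {c ρ : ℝ} (hc : 0 < c) (hρ : 0 ≤ ρ) {A j : ℕ} (hj : j ≤ A) {q : ℝ}
    (hq : 0 ≤ q) (hq' : ρ + 2 * j - A ≤ q) :
    ∃ C : ℝ, 0 ≤ C ∧ ∀ f : ℝ → ℝ, ContDiff ℝ ∞ f →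
      W c q (iteratedDeriv j f) ≤ C * N c ρ A f :=
  W_le_const_N_aux hc hρ (A - j) j (by omega) q hq hq'

/-- Weighted pointwise bound. -/
lemma sup_le_W {c σ : ℝ} (hc : 0 < c) (hσ : 1 ≤ σ) {f : ℝ → ℝ} (hf : ContDiff ℝ 1 f) {x : ℝ}
    (hx : x ∈ Ω₀) : dw c x ^ σ * f x ^ 2 ≤
      (2 * c * σ + 1) * W c (σ - 1) f + W c (σ + 1) (deriv f) := by
  have hfd : Continuous (deriv f) := hf.continuous_deriv le_rfl
  set g' : ℝ → ℝ := fun y => σ * (-2 * c * y) * dw c y ^ (σ - 1) * f y ^ 2 +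
    dw c y ^ σ * (2 * f y * deriv f y) with hg'
  have hg'c : Continuous g' := by
    have h1 := dw_rpow_continuous c (p := σ - 1) (by linarith)
    have h2 := dw_rpow_continuous c (p := σ) (by linarith)
    have h3 := hf.continuous
    simp only [hg']; fun_prop
  have hgc : Continuous (fun y => dw c y ^ σ * f y ^ 2) :=
    (dw_rpow_continuous c (by linarith)).mul (hf.continuous.pow 2)
  have hderiv : ∀ y ∈ Ioo (-1) x, HasDerivAt (fun y => dw c y ^ σ * f y ^ 2) (g' y) y := by
    intro y hy
    have hy' : y ∈ Ω₀ := ⟨hy.1, hy.2.trans hx.2⟩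
    have h1 := (dw_hasDerivAt c y).rpow_const (p := σ) (Or.inl (dw_pos hc hy').ne')
    have h2 := h1.mul (((hf.differentiable one_ne_zero) y).hasDerivAt.pow 2)
    refine h2.congr_deriv ?_
    simp only [hg']
    simp only [Pi.pow_apply]; norm_num; ring_nf; simp
  have hftc := intervalIntegral.integral_eq_sub_of_hasDerivAt_of_le hx.1.le hgc.continuousOn hderiv
    (hg'c.intervalIntegrable _ _)
  have hz : dw c (-1) = 0 := by simp [dw]
  rw [hz, Real.zero_rpow (by linarith), zero_mul, sub_zero] at hftc
  rw [← hftc, intervalIntegral.integral_of_le hx.1.le, integral_Ioc_eq_integral_Ioo]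
  have i0 : IntegrableOn (fun x => dw c x ^ (σ - 1) * f x ^ 2) Ω₀ :=
    integrableOn_Ω₀_dw (by linarith) (hf.continuous.pow 2)
  have i1 : IntegrableOn (fun x => dw c x ^ (σ + 1) * deriv f x ^ 2) Ω₀ :=
    integrableOn_Ω₀_dw (by linarith) (hfd.pow 2)
  have i2 : IntegrableOn (fun x => (2 * c * σ + 1) * (dw c x ^ (σ - 1) * f x ^ 2)) Ω₀ :=
    i0.const_mul _
  unfold W
  rw [← integral_const_mul, ← integral_add i2 i1]
  have hsub : Ioo (-1) x ⊆ Ω₀ := fun y hy => ⟨hy.1, hy.2.trans hx.2⟩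
  refine (setIntegral_mono_on ((integrableOn_Ω₀ hg'c).mono_set hsub) ((i2.add i1).mono_set hsub)
    measurableSet_Ioo fun y hy => ?_).trans
    (setIntegral_mono_set (i2.add i1) ?_ (Filter.Eventually.of_forall hsub))
  · have hy' := hsub hy
    have h0 := dw_pos hc hy'
    have e1 : dw c y ^ σ = dw c y ^ (σ - 1) * dw c y := by
      rw [← Real.rpow_add_one h0.ne']; ring_nf
    have e2 : dw c y ^ (σ + 1) = dw c y ^ (σ - 1) * dw c y ^ 2 := by
      rw [Real.rpow_add_one h0.ne', e1]; ring
    simp only [hg', Pi.add_apply]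
    rw [e1, e2]
    set D := dw c y
    have hP : 0 ≤ D ^ (σ - 1) := by positivity
    have key : σ * (-2 * c * y) * f y ^ 2 + D * (2 * f y * deriv f y) ≤
        (2 * c * σ + 1) * f y ^ 2 + D ^ 2 * deriv f y ^ 2 := by
      have : -y ≤ 1 := by linarith [hy'.1]
      have h5 : σ * c * f y ^ 2 * (-y) ≤ σ * c * f y ^ 2 * 1 :=
        mul_le_mul_of_nonneg_left this (by positivity)
      nlinarith [sq_nonneg (f y - D * deriv f y)]
    have := mul_le_mul_of_nonneg_left key hP
    linarith
  · refine (ae_restrict_iff' measurableSet_Ω₀).2 (Filter.Eventually.of_forall fun y hy => ?_)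
    have := dw_pos hc hy
    simp only [Pi.zero_apply, Pi.add_apply]
    positivity

lemma sup_le_const_N {c ρ σ : ℝ} (hc : 0 < c) (hρ : 0 ≤ ρ) {A i : ℕ} (hi : i < A)
    (hσ : 1 ≤ σ) (hσ' : ρ + 1 + 2 * i - A ≤ σ) :
    ∃ C : ℝ, 0 ≤ C ∧ ∀ f : ℝ → ℝ, ContDiff ℝ ∞ f → ∀ x ∈ Ω₀,
      dw c x ^ σ * iteratedDeriv i f x ^ 2 ≤ C * N c ρ A f := by
  obtain ⟨C₁, hC₁, h₁⟩ := W_le_const_N hc hρ hi.le (q := σ - 1) (by linarith) (by linarith)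
  obtain ⟨C₂, hC₂, h₂⟩ := W_le_const_N hc hρ (j := i + 1) hi (q := σ + 1) (by linarith)
    (by push_cast; linarith)
  refine ⟨(2 * c * σ + 1) * C₁ + C₂, by positivity, fun f hf x hx => ?_⟩
  refine (sup_le_W hc hσ ((smooth_iteratedDeriv hf i).of_le (by exact_mod_cast le_top)) hx).trans ?_
  rw [← iteratedDeriv_succ]
  have h3 : (2 * c * σ + 1) * W c (σ - 1) (iteratedDeriv i f) ≤
      (2 * c * σ + 1) * (C₁ * N c ρ A f) := mul_le_mul_of_nonneg_left (h₁ f hf) (by positivity)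
  linarith [h₂ f hf]

/-- Integrability of a negative power of the weight. -/
lemma integrableOn_dw_neg {c q : ℝ} (hc : 0 < c) (hq0 : 0 ≤ q) (hq : q < 1) :
    IntegrableOn (fun x => dw c x ^ (-q)) Ω₀ := by
  have i1 : IntegrableOn (fun x : ℝ => (1 - x) ^ (-q)) Ω₀ := by
    have h := (intervalIntegral.intervalIntegrable_rpow' (a := 2) (b := 0) (r := -q) (by linarith))
    have h2 := h.comp_sub_left (1 : ℝ)
    norm_num at h2
    rw [intervalIntegrable_iff_integrableOn_Ioo_of_le (by norm_num)] at h2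
    exact h2
  have i2 : IntegrableOn (fun x : ℝ => (1 + x) ^ (-q)) Ω₀ := by
    have h := (intervalIntegral.intervalIntegrable_rpow' (a := 0) (b := 2) (r := -q) (by linarith))
    have h2 := h.comp_add_left (1 : ℝ)
    norm_num at h2
    rw [intervalIntegrable_iff_integrableOn_Ioo_of_le (by norm_num)] at h2
    exact h2
  have i3 : IntegrableOn (fun x : ℝ => c ^ (-q) * ((1 - x) ^ (-q) + (1 + x) ^ (-q))) Ω₀ :=
    (i1.add i2).const_mul _
  refine Integrable.mono' i3 ?_ ?_
  · refine ContinuousOn.aestronglyMeasurable ?_ measurableSet_Ω₀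
    exact (dw_continuous c).continuousOn.rpow_const fun x hx => Or.inl (dw_pos hc hx).ne'
  · refine (ae_restrict_iff' measurableSet_Ω₀).2 (Filter.Eventually.of_forall fun x hx => ?_)
    have h1 : 0 < 1 - x := by linarith [hx.2]
    have h2 : 0 < 1 + x := by linarith [hx.1]
    have h0 := dw_pos hc hx
    rw [Real.norm_of_nonneg (by positivity)]
    have e : dw c x ^ (-q) = c ^ (-q) * ((1 - x) ^ (-q) * (1 + x) ^ (-q)) := by
      rw [← Real.mul_rpow h1.le h2.le, ← Real.mul_rpow hc.le (by positivity)]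
      unfold dw; congr 1; ring
    rw [e]
    refine mul_le_mul_of_nonneg_left ?_ (by positivity)
    have p1 : 0 < (1 - x) ^ (-q) := by positivity
    have p2 : 0 < (1 + x) ^ (-q) := by positivity
    rcases le_total x 0 with h | h
    · have : (1 - x) ^ (-q) ≤ 1 := Real.rpow_le_one_of_one_le_of_nonpos (by linarith) (by linarith)
      nlinarith
    · have : (1 + x) ^ (-q) ≤ 1 := Real.rpow_le_one_of_one_le_of_nonpos (by linarith) (by linarith)
      nlinarith

lemma sq_le_mul_of_forall {X I J : ℝ} (hI : 0 ≤ I) (hJ : 0 ≤ J)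
    (h : ∀ s > 0, X ≤ s * I + s⁻¹ * J) (hX : 0 ≤ X) : X ^ 2 ≤ 4 * I * J := by
  rcases hX.eq_or_lt with h0 | h0
  · rw [← h0, zero_pow two_ne_zero]; positivity
  rcases hI.eq_or_lt with hI0 | hI0
  · exfalso
    have := h ((2 * J + 1) / X) (by positivity)
    rw [← hI0, inv_div] at this
    have h2 : X / (2 * J + 1) * J ≤ X / 2 := by
      rw [div_mul_eq_mul_div, div_le_div_iff₀ (by positivity) (by norm_num)]; nlinarith
    linarith
  · have := h (X / (2 * I)) (by positivity)
    have e : X / (2 * I) * I = X / 2 := by field_simp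
    rw [e, inv_div] at this
    have : X / 2 ≤ 2 * I / X * J := by linarith
    rw [div_mul_eq_mul_div, le_div_iff₀ h0] at this
    nlinarith

/-- Weighted Cauchy–Schwarz on a subinterval. -/
lemma sq_sub_le_weighted {c q : ℝ} (hc : 0 < c) (hq0 : 0 ≤ q) (hq : q < 1) {f : ℝ → ℝ}
    (hf : ContDiff ℝ 1 f) {x y : ℝ} (hx : x ∈ Ω₀) (hy : y ∈ Ω₀) (hxy : x ≤ y) :
    (f y - f x) ^ 2 ≤ 4 * (∫ s in Ioo x y, dw c s ^ (-q)) *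
      ∫ s in Ioo x y, dw c s ^ q * deriv f s ^ 2 := by
  have hfd : Continuous (deriv f) := hf.continuous_deriv le_rfl
  have hsub : Ioo x y ⊆ Ω₀ := fun s hs => ⟨hx.1.trans hs.1, hs.2.trans hy.2⟩
  have i0 : IntegrableOn (fun s => dw c s ^ (-q)) (Ioo x y) :=
    (integrableOn_dw_neg hc hq0 hq).mono_set hsub
  have i1 : IntegrableOn (fun s => dw c s ^ q * deriv f s ^ 2) (Ioo x y) :=
    (integrableOn_Ω₀_dw hq0 (hfd.pow 2)).mono_set hsub
  rw [← sq_abs]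
  refine sq_le_mul_of_forall ?_ ?_ (fun r hr => ?_) (abs_nonneg _)
  · refine setIntegral_nonneg measurableSet_Ioo fun s hs => ?_
    have := dw_pos hc (hsub hs); positivity
  · refine setIntegral_nonneg measurableSet_Ioo fun s hs => ?_
    have := dw_pos hc (hsub hs); positivity
  · have e : f y - f x = ∫ s in Ioo x y, deriv f s := by
      rw [← integral_Ioc_eq_integral_Ioo, ← intervalIntegral.integral_of_le hxy,
        intervalIntegral.integral_deriv_eq_sub (fun s _ => hf.differentiable one_ne_zero s)
          (hfd.intervalIntegrable _ _)]
    rw [e]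
    refine (abs_integral_le_integral_abs).trans ?_
    have i2 : IntegrableOn (fun s => r * dw c s ^ (-q)) (Ioo x y) := i0.const_mul _
    have i3 : IntegrableOn (fun s => r⁻¹ * (dw c s ^ q * deriv f s ^ 2)) (Ioo x y) :=
      i1.const_mul _
    rw [← integral_const_mul, ← integral_const_mul, ← integral_add i2 i3]
    refine setIntegral_mono_on ((integrableOn_Ω₀ hfd.abs).mono_set hsub) (i2.add i3)
      measurableSet_Ioo fun s hs => ?_
    have h0 := dw_pos hc (hsub hs)
    have e1 : dw c s ^ (-q) = (dw c s ^ q)⁻¹ := Real.rpow_neg h0.le q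
    simp only [e1]
    set P := dw c s ^ q with hPdef
    have hP : 0 < P := by positivity
    have : r * P⁻¹ + r⁻¹ * (P * deriv f s ^ 2) - |deriv f s| =
        r⁻¹ * P * ((r * P⁻¹ - |deriv f s| / 2) ^ 2 + 3 / 4 * |deriv f s| ^ 2) := by
      rw [← sq_abs (deriv f s)]
      field_simp; ring
    have h2 : 0 ≤ r⁻¹ * P * ((r * P⁻¹ - |deriv f s| / 2) ^ 2 + 3 / 4 * |deriv f s| ^ 2) := by
      positivity
    linarith

/-- Unweighted sup bound. -/
lemma sup0_le_const_N {c ρ : ℝ} (hc : 0 < c) (hρ : 0 ≤ ρ) {A : ℕ} (hA : 1 ≤ A)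
    (h : ρ + 2 - A < 1) :
    ∃ C : ℝ, 0 ≤ C ∧ ∀ f : ℝ → ℝ, ContDiff ℝ ∞ f → ∀ x ∈ Ω₀, f x ^ 2 ≤ C * N c ρ A f := by
  set q := max 0 (ρ + 2 - A) with hqdef
  have hq0 : 0 ≤ q := le_max_left _ _
  have hq1 : q < 1 := max_lt (by norm_num) h
  obtain ⟨C₁, hC₁, h₁⟩ := W_le_const_N hc hρ (j := 1) hA hq0 (by push_cast; linarith [le_max_right 0 (ρ + 2 - A)])
  obtain ⟨C₂, hC₂, h₂⟩ := sup_le_const_N hc hρ (i := 0) hA (σ := ρ + 1) (by linarith)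
    (by push_cast; linarith [Nat.cast_nonneg (α := ℝ) A])
  set I := ∫ s in Ω₀, dw c s ^ (-q) with hI
  have hI0 : 0 ≤ I := setIntegral_nonneg measurableSet_Ω₀ fun s hs => by
    have := dw_pos hc hs; positivity
  refine ⟨2 * (c ^ (ρ + 1))⁻¹ * C₂ + 8 * I * C₁, by positivity, fun f hf x hx => ?_⟩
  have hf1 : ContDiff ℝ 1 f := hf.of_le (by exact_mod_cast le_top)
  have hfd : Continuous (deriv f) := hf1.continuous_deriv le_rfl
  have m0 : (0 : ℝ) ∈ Ω₀ := ⟨by norm_num, by norm_num⟩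
  have hb : (f x - f 0) ^ 2 ≤ 4 * I * W c q (deriv f) := by
    have key : ∀ u v : ℝ, u ∈ Ω₀ → v ∈ Ω₀ → u ≤ v → (f v - f u) ^ 2 ≤ 4 * I * W c q (deriv f) := by
      intro u v hu hv huv
      have hsub : Ioo u v ⊆ Ω₀ := fun s hs => ⟨hu.1.trans hs.1, hs.2.trans hv.2⟩
      refine (sq_sub_le_weighted hc hq0 hq1 hf1 hu hv huv).trans ?_
      refine mul_le_mul (mul_le_mul_of_nonneg_left ?_ (by norm_num)) ?_ ?_ (by positivity)
      · refine setIntegral_mono_set (integrableOn_dw_neg hc hq0 hq1) ?_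
          (Filter.Eventually.of_forall hsub)
        refine (ae_restrict_iff' measurableSet_Ω₀).2 (Filter.Eventually.of_forall fun s hs => ?_)
        have := dw_pos hc hs
        simp only [Pi.zero_apply]; positivity
      · refine setIntegral_mono_set (integrableOn_Ω₀_dw hq0 (hfd.pow 2)) ?_
          (Filter.Eventually.of_forall hsub)
        refine (ae_restrict_iff' measurableSet_Ω₀).2 (Filter.Eventually.of_forall fun s hs => ?_)
        have := dw_pos hc hs
        simp only [Pi.zero_apply]; positivity
      · refine setIntegral_nonneg measurableSet_Ioo fun s hs => ?_
        have := dw_pos hc (hsub hs); positivity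
    rcases le_total 0 x with h | h
    · exact key 0 x m0 hx h
    · have := key x 0 hx m0 h
      nlinarith
  have h3 := h₂ f hf 0 m0
  have e0 : dw c 0 = c := by simp [dw]
  rw [e0, iteratedDeriv_zero] at h3
  have h4 := h₁ f hf
  rw [iteratedDeriv_one] at h4
  have h5 : f 0 ^ 2 ≤ (c ^ (ρ + 1))⁻¹ * (C₂ * N c ρ A f) := by
    rw [le_inv_mul_iff₀ (by positivity)]; exact h3
  have h6 : 4 * I * W c q (deriv f) ≤ 4 * I * (C₁ * N c ρ A f) :=
    mul_le_mul_of_nonneg_left h4 (by positivity)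
  nlinarith [sq_nonneg (f x - 2 * f 0)]

lemma W_mul_le {c p σ q S : ℝ} (hc : 0 < c) (hp : 0 ≤ p) (hσq : σ + q ≤ p) (hq : 0 ≤ q)
    {f g : ℝ → ℝ} (hf : Continuous f) (hg : Continuous g)
    (hS : ∀ x ∈ Ω₀, dw c x ^ σ * f x ^ 2 ≤ S) :
    W c p (fun x => f x * g x) ≤ c ^ (p - σ - q) * S * W c q g := by
  unfold W
  rw [← integral_const_mul]
  refine setIntegral_mono_on (integrableOn_Ω₀_dw hp ((hf.mul hg).pow 2))
    ((integrableOn_Ω₀_dw hq (hg.pow 2)).const_mul _) measurableSet_Ω₀ fun x hx => ?_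
  have h0 := dw_pos hc hx
  have e : dw c x ^ p = dw c x ^ (p - σ - q) * dw c x ^ σ * dw c x ^ q := by
    rw [← Real.rpow_add h0, ← Real.rpow_add h0]; congr 1; ring
  have h1 : dw c x ^ (p - σ - q) ≤ c ^ (p - σ - q) :=
    Real.rpow_le_rpow h0.le (dw_le hc x) (by linarith)
  rw [e]
  calc dw c x ^ (p - σ - q) * dw c x ^ σ * dw c x ^ q * (f x * g x) ^ 2
      = dw c x ^ (p - σ - q) * (dw c x ^ σ * f x ^ 2) * (dw c x ^ q * g x ^ 2) := by ring
    _ ≤ c ^ (p - σ - q) * S * (dw c x ^ q * g x ^ 2) := by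
        refine mul_le_mul_of_nonneg_right ?_ (by positivity)
        exact mul_le_mul h1 (hS x hx) (by positivity) (by positivity)

/-- The range of admissible exponents in the bilinear estimate. -/
def BilinOK (κ : ℝ) (a i j : ℕ) (p : ℝ) : Prop :=
  ((i = 0 ∨ j = 0) ∧ i + j ≤ a ∧ κ + i + j ≤ p) ∨
    (1 ≤ i ∧ 1 ≤ j ∧ ((i + j ≤ a + 1 ∧ κ + i + j ≤ p) ∨ (i + j ≤ a ∧ κ + i + j - 1 ≤ p)))

lemma bilin_aux {c κ : ℝ} (hc : 0 < c) (hκ : 1 ≤ κ) {a : ℕ} (ha : κ + 2 < a) {i j : ℕ} {p : ℝ}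
    (hij : i ≤ j) (h : BilinOK κ a i j p) :
    ∃ C : ℝ, 0 ≤ C ∧ ∀ f g : ℝ → ℝ, ContDiff ℝ ∞ f → ContDiff ℝ ∞ g →
      W c p (fun x => iteratedDeriv i f x * iteratedDeriv j g x) ≤ C * N c κ a f * N c κ a g := by
  have ha4 : 4 ≤ a := by
    have : (3 : ℝ) < a := by linarith
    exact_mod_cast this
  have hj : j ≤ a := by rcases h with h | h <;> omega
  have hij' : (i : ℝ) ≤ j := by exact_mod_cast hij
  have hja : (j : ℝ) ≤ a := by exact_mod_cast hj
  have hi0 : (0 : ℝ) ≤ i := by positivity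
  have ha4' : (4 : ℝ) ≤ a := by exact_mod_cast ha4
  set q := max 0 (κ + 2 * j - a) with hqdef
  have hq0 : 0 ≤ q := le_max_left _ _
  obtain ⟨C₂, hC₂, h₂⟩ := W_le_const_N hc (by linarith : 0 ≤ κ) hj hq0 (le_max_right _ _)
  have key : ∃ σ : ℝ, σ + q ≤ p ∧ 0 ≤ p ∧ ∃ C : ℝ, 0 ≤ C ∧ ∀ f : ℝ → ℝ, ContDiff ℝ ∞ f → ∀ x ∈ Ω₀,
      dw c x ^ σ * iteratedDeriv i f x ^ 2 ≤ C * N c κ a f := by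
    rcases Nat.eq_zero_or_pos i with hi | hi
    · subst hi
      have hm : κ + j ≤ p := by
        rcases h with ⟨_, _, h⟩ | ⟨h, _⟩
        · simpa using h
        · omega
      refine ⟨0, ?_, by linarith, ?_⟩
      · rw [zero_add]; refine max_le (by linarith) (by linarith)
      · obtain ⟨C, hC, hS⟩ := sup0_le_const_N hc (by linarith : 0 ≤ κ) (A := a) (by omega) (by linarith)
        exact ⟨C, hC, fun f hf x hx => by simpa using hS f hf x hx⟩
    · have hi1 : (1 : ℝ) ≤ i := by exact_mod_cast hi
      have hia : i < a := by
        rcases h with h | h <;> omega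
      have hp : (i + j ≤ a + 1 ∧ κ + i + j ≤ p) ∨ (i + j ≤ a ∧ κ + i + j - 1 ≤ p) := by
        rcases h with ⟨h, _⟩ | ⟨_, _, h⟩
        · omega
        · exact h
      have hp' : κ + i + j - 1 ≤ p := by rcases hp with h | h <;> linarith [h.2]
      refine ⟨max 1 (κ + 1 + 2 * i - a), ?_, by linarith,
        sup_le_const_N hc (by linarith : 0 ≤ κ) hia (le_max_left _ _) (le_max_right _ _)⟩
      have h1 : (j : ℝ) + 1 ≤ a → κ + i + j - 1 ≤ p → 1 + (κ + 2 * j - a) ≤ p := by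
        intros; linarith
      rcases hp with ⟨hm, hp⟩ | ⟨hm, hp⟩
      · have hm' : (i : ℝ) + j ≤ a + 1 := by exact_mod_cast hm
        rcases max_cases 1 (κ + 1 + 2 * i - a) with h1 | h1 <;>
          rcases max_cases 0 (κ + 2 * j - a) with h2 | h2 <;> rw [h1.1, hqdef, h2.1] <;> linarith
      · have hm' : (i : ℝ) + j ≤ a := by exact_mod_cast hm
        rcases max_cases 1 (κ + 1 + 2 * i - a) with h1 | h1 <;>
          rcases max_cases 0 (κ + 2 * j - a) with h2 | h2 <;> rw [h1.1, hqdef, h2.1] <;> linarith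
  obtain ⟨σ, hσ, hp, C₁, hC₁, h₁⟩ := key
  refine ⟨c ^ (p - σ - q) * C₁ * C₂, by positivity, fun f g hf hg => ?_⟩
  refine (W_mul_le hc hp hσ hq0 (continuous_iteratedDeriv' hf i) (continuous_iteratedDeriv' hg j)
    (h₁ f hf)).trans ?_
  have n1 := N_nonneg hc κ a f
  calc _ ≤ c ^ (p - σ - q) * (C₁ * N c κ a f) * (C₂ * N c κ a g) :=
        mul_le_mul_of_nonneg_left (h₂ g hg) (by positivity)
    _ = _ := by ring

/-- Weighted bilinear estimate. -/
lemma bilin {c κ : ℝ} (hc : 0 < c) (hκ : 1 ≤ κ) {a : ℕ} (ha : κ + 2 < a) {i j : ℕ} {p : ℝ}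
    (h : BilinOK κ a i j p) :
    ∃ C : ℝ, 0 ≤ C ∧ ∀ f g : ℝ → ℝ, ContDiff ℝ ∞ f → ContDiff ℝ ∞ g →
      W c p (fun x => iteratedDeriv i f x * iteratedDeriv j g x) ≤ C * N c κ a f * N c κ a g := by
  rcases le_total i j with hij | hij
  · exact bilin_aux hc hκ ha hij h
  · have h' : BilinOK κ a j i p := by
      rcases h with ⟨h1, h2, h3⟩ | ⟨h1, h2, h3⟩
      · exact Or.inl ⟨h1.symm, by omega, by linarith⟩
      · refine Or.inr ⟨h2, h1, ?_⟩
        rcases h3 with h3 | h3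
        · exact Or.inl ⟨by omega, by linarith [h3.2]⟩
        · exact Or.inr ⟨by omega, by linarith [h3.2]⟩
    obtain ⟨C, hC, hh⟩ := bilin_aux hc hκ ha hij h'
    refine ⟨C, hC, fun f g hf hg => ?_⟩
    have := hh g f hg hf
    rw [mul_right_comm] at this
    refine le_trans (le_of_eq ?_) this
    congr 1; funext x; ring

lemma le_smooth {n : ℕ} : ((n : ℕ∞) : WithTop ℕ∞) ≤ (∞ : WithTop ℕ∞) := by
  exact_mod_cast le_top

lemma iD_mul {f g : ℝ → ℝ} (hf : ContDiff ℝ ∞ f) (hg : ContDiff ℝ ∞ g) (n : ℕ) (x : ℝ) :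
    iteratedDeriv n (fun x => f x * g x) x = ∑ i ∈ Finset.range (n + 1),
      n.choose i * iteratedDeriv i f x * iteratedDeriv (n - i) g x :=
  iteratedDeriv_fun_mul (hf.of_le le_smooth).contDiffAt (hg.of_le le_smooth).contDiffAt

lemma iD_add {f g : ℝ → ℝ} (hf : ContDiff ℝ ∞ f) (hg : ContDiff ℝ ∞ g) (n : ℕ) (x : ℝ) :
    iteratedDeriv n (fun x => f x + g x) x = iteratedDeriv n f x + iteratedDeriv n g x :=
  iteratedDeriv_fun_add (hf.of_le le_smooth).contDiffAt (hg.of_le le_smooth).contDiffAt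

lemma smooth_deriv {f : ℝ → ℝ} (hf : ContDiff ℝ ∞ f) : ContDiff ℝ ∞ (deriv f) := by
  rw [← iteratedDeriv_one]; exact smooth_iteratedDeriv hf 1

lemma W_congr {c p : ℝ} {f g : ℝ → ℝ} (h : ∀ x ∈ Ω₀, f x = g x) : W c p f = W c p g :=
  setIntegral_congr_fun measurableSet_Ω₀ fun x hx => by simp only [h x hx]

lemma W_const_mul (c p r : ℝ) (f : ℝ → ℝ) : W c p (fun x => r * f x) = r ^ 2 * W c p f := by
  unfold W
  rw [← integral_const_mul]
  congr 1; funext x; ring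

lemma W_mono {c p : ℝ} (hc : 0 < c) (hp : 0 ≤ p) {f g : ℝ → ℝ} (hf : Continuous f)
    (hg : Continuous g) (h : ∀ x ∈ Ω₀, f x ^ 2 ≤ g x ^ 2) : W c p f ≤ W c p g := by
  refine setIntegral_mono_on (integrableOn_Ω₀_dw hp (hf.pow 2))
    (integrableOn_Ω₀_dw hp (hg.pow 2)) measurableSet_Ω₀ fun x hx => ?_
  have := dw_pos hc hx
  exact mul_le_mul_of_nonneg_left (h x hx) (by positivity)

lemma W_sum_le {c p : ℝ} (hc : 0 < c) (hp : 0 ≤ p) {ι : Type*} (s : Finset ι) {f : ι → ℝ → ℝ}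
    (hf : ∀ i ∈ s, Continuous (f i)) :
    W c p (fun x => ∑ i ∈ s, f i x) ≤ s.card * ∑ i ∈ s, W c p (f i) := by
  unfold W
  have hi : ∀ i ∈ s, IntegrableOn (fun x => dw c x ^ p * f i x ^ 2) Ω₀ := fun i h =>
    integrableOn_Ω₀_dw hp ((hf i h).pow 2)
  rw [← integral_finsetSum s hi, ← integral_const_mul]
  refine setIntegral_mono_on (integrableOn_Ω₀_dw hp ((continuous_finsetSum s hf).pow 2))
    ((integrable_finsetSum s hi).const_mul _) measurableSet_Ω₀ fun x hx => ?_
  have := dw_pos hc hx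
  rw [← Finset.mul_sum]
  have h2 := sq_sum_le_card_mul_sum_sq (s := s) (f := fun i => f i x)
  have h3 := mul_le_mul_of_nonneg_left h2 (by positivity : 0 ≤ dw c x ^ p)
  linarith

lemma W_add_le {c p : ℝ} (hc : 0 < c) (hp : 0 ≤ p) {f g : ℝ → ℝ} (hf : Continuous f)
    (hg : Continuous g) : W c p (fun x => f x + g x) ≤ 2 * W c p f + 2 * W c p g := by
  have i1 : IntegrableOn (fun x => 2 * (dw c x ^ p * f x ^ 2)) Ω₀ :=
    (integrableOn_Ω₀_dw hp (hf.pow 2)).const_mul _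
  have i2 : IntegrableOn (fun x => 2 * (dw c x ^ p * g x ^ 2)) Ω₀ :=
    (integrableOn_Ω₀_dw hp (hg.pow 2)).const_mul _
  unfold W
  rw [← integral_const_mul, ← integral_const_mul, ← integral_add i1 i2]
  refine setIntegral_mono_on (integrableOn_Ω₀_dw hp ((hf.add hg).pow 2)) (i1.add i2)
    measurableSet_Ω₀ fun x hx => ?_
  have := dw_pos hc hx
  have h2 : (f x + g x) ^ 2 ≤ 2 * f x ^ 2 + 2 * g x ^ 2 := by nlinarith [sq_nonneg (f x - g x)]
  have h3 := mul_le_mul_of_nonneg_left h2 (by positivity : 0 ≤ dw c x ^ p)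
  linarith

lemma bilin_unif {c κ : ℝ} (hc : 0 < c) (hκ : 1 ≤ κ) {a : ℕ} (ha : κ + 2 < a) :
    ∃ C : ℝ, 0 ≤ C ∧ ∀ i j : ℕ, (i + j ≤ a ∨ (1 ≤ i ∧ 1 ≤ j ∧ i + j ≤ a + 1)) →
      ∀ f g : ℝ → ℝ, ContDiff ℝ ∞ f → ContDiff ℝ ∞ g →
      W c (κ + (i + j : ℕ)) (fun x => iteratedDeriv i f x * iteratedDeriv j g x) ≤
        C * N c κ a f * N c κ a g := by
  have H : ∀ i j : ℕ, ∃ C : ℝ, 0 ≤ C ∧ ((i + j ≤ a ∨ (1 ≤ i ∧ 1 ≤ j ∧ i + j ≤ a + 1)) →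
      ∀ f g : ℝ → ℝ, ContDiff ℝ ∞ f → ContDiff ℝ ∞ g →
      W c (κ + (i + j : ℕ)) (fun x => iteratedDeriv i f x * iteratedDeriv j g x) ≤
        C * N c κ a f * N c κ a g) := by
    intro i j
    by_cases h : i + j ≤ a ∨ (1 ≤ i ∧ 1 ≤ j ∧ i + j ≤ a + 1)
    · have hb : BilinOK κ a i j (κ + (i + j : ℕ)) := by
        push_cast
        by_cases h1 : 1 ≤ i ∧ 1 ≤ j
        · exact Or.inr ⟨h1.1, h1.2, Or.inl ⟨by omega, by linarith⟩⟩
        · exact Or.inl ⟨by omega, by omega, by linarith⟩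
      obtain ⟨C, hC, hh⟩ := bilin hc hκ ha hb
      exact ⟨C, hC, fun _ => hh⟩
    · exact ⟨0, le_rfl, fun h' => absurd h' h⟩
  choose C hC hh using H
  refine ⟨∑ i ∈ Finset.range (a + 2), ∑ j ∈ Finset.range (a + 2), C i j,
    Finset.sum_nonneg fun i _ => Finset.sum_nonneg fun j _ => hC i j,
    fun i j h f g hf hg => (hh i j h f g hf hg).trans ?_⟩
  have h1 : C i j ≤ ∑ j ∈ Finset.range (a + 2), C i j :=
    Finset.single_le_sum (f := fun j => C i j) (fun j _ => hC i j)
      (Finset.mem_range.2 (by omega))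
  have h2 : ∑ j ∈ Finset.range (a + 2), C i j ≤
      ∑ i ∈ Finset.range (a + 2), ∑ j ∈ Finset.range (a + 2), C i j :=
    Finset.single_le_sum (f := fun i => ∑ j ∈ Finset.range (a + 2), C i j)
      (fun i _ => Finset.sum_nonneg fun j _ => hC i j) (Finset.mem_range.2 (by omega))
  have n1 := N_nonneg hc κ a f
  have n2 := N_nonneg hc κ a g
  gcongr
  exact h1.trans h2

lemma bilin_unif' {c κ : ℝ} (hc : 0 < c) (hκ : 1 ≤ κ) {a : ℕ} (ha : κ + 2 < a) :
    ∃ C : ℝ, 0 ≤ C ∧ ∀ i j : ℕ, (1 ≤ i ∧ 1 ≤ j ∧ i + j ≤ a) →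
      ∀ f g : ℝ → ℝ, ContDiff ℝ ∞ f → ContDiff ℝ ∞ g →
      W c (κ + (i + j : ℕ) - 1) (fun x => iteratedDeriv i f x * iteratedDeriv j g x) ≤
        C * N c κ a f * N c κ a g := by
  have H : ∀ i j : ℕ, ∃ C : ℝ, 0 ≤ C ∧ ((1 ≤ i ∧ 1 ≤ j ∧ i + j ≤ a) →
      ∀ f g : ℝ → ℝ, ContDiff ℝ ∞ f → ContDiff ℝ ∞ g →
      W c (κ + (i + j : ℕ) - 1) (fun x => iteratedDeriv i f x * iteratedDeriv j g x) ≤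
        C * N c κ a f * N c κ a g) := by
    intro i j
    by_cases h : 1 ≤ i ∧ 1 ≤ j ∧ i + j ≤ a
    · have hb : BilinOK κ a i j (κ + (i + j : ℕ) - 1) := by
        push_cast
        exact Or.inr ⟨h.1, h.2.1, Or.inr ⟨by omega, by linarith⟩⟩
      obtain ⟨C, hC, hh⟩ := bilin hc hκ ha hb
      exact ⟨C, hC, fun _ => hh⟩
    · exact ⟨0, le_rfl, fun h' => absurd h' h⟩
  choose C hC hh using H
  refine ⟨∑ i ∈ Finset.range (a + 2), ∑ j ∈ Finset.range (a + 2), C i j,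
    Finset.sum_nonneg fun i _ => Finset.sum_nonneg fun j _ => hC i j,
    fun i j h f g hf hg => (hh i j h f g hf hg).trans ?_⟩
  have h1 : C i j ≤ ∑ j ∈ Finset.range (a + 2), C i j :=
    Finset.single_le_sum (f := fun j => C i j) (fun j _ => hC i j)
      (Finset.mem_range.2 (by omega))
  have h2 : ∑ j ∈ Finset.range (a + 2), C i j ≤
      ∑ i ∈ Finset.range (a + 2), ∑ j ∈ Finset.range (a + 2), C i j :=
    Finset.single_le_sum (f := fun i => ∑ j ∈ Finset.range (a + 2), C i j)
      (fun i _ => Finset.sum_nonneg fun j _ => hC i j) (Finset.mem_range.2 (by omega))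
  have n1 := N_nonneg hc κ a f
  have n2 := N_nonneg hc κ a g
  gcongr
  exact h1.trans h2

/-- The bump function used to truncate the nonlinearity. -/
def cutBump : ContDiffBump (0 : ℝ) := ⟨5 / 8, 3 / 4, by norm_num, by norm_num⟩

/-- The truncated nonlinearity `1 - (1 + s)^(-γ)`. -/
def Fc (γ s : ℝ) : ℝ := 1 - (1 + cutBump s * s) ^ (-γ)

lemma cutBump_arg_pos (s : ℝ) : 0 < 1 + cutBump s * s := by
  by_cases h : |s| < 3 / 4
  · have h1 : |cutBump s * s| ≤ |s| := by
      rw [abs_mul, abs_of_nonneg cutBump.nonneg]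
      exact mul_le_of_le_one_left (abs_nonneg _) cutBump.le_one
    have := (abs_le.1 (h1.trans h.le)).1
    linarith
  · have : cutBump s = 0 := by
      apply cutBump.zero_of_le_dist
      simp only [dist_zero_right, Real.norm_eq_abs]
      exact not_lt.1 h
    rw [this]; norm_num

lemma Fc_smooth (γ : ℝ) : ContDiff ℝ ∞ (Fc γ) := by
  unfold Fc
  refine contDiff_const.sub (ContDiff.rpow_const_of_ne ?_ fun s => (cutBump_arg_pos s).ne')
  exact contDiff_const.add (cutBump.contDiff.mul contDiff_id)

lemma Fc_zero (γ : ℝ) : Fc γ 0 = 0 := by simp [Fc]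

lemma Fc_eq {γ s : ℝ} (hs : |s| < 5 / 8) : Fc γ s = 1 - (1 + s) ^ (-γ) := by
  have : cutBump s = 1 := cutBump.one_of_mem_closedBall (by
    simp only [mem_closedBall_zero_iff, Real.norm_eq_abs]; exact hs.le)
  simp [Fc, this]

lemma Fc_compact (γ : ℝ) : HasCompactSupport (Fc γ) := by
  refine HasCompactSupport.intro (isCompact_closedBall (0 : ℝ) (3 / 4)) fun s hs => ?_
  have : cutBump s = 0 := by
    apply cutBump.zero_of_le_dist
    simp only [Metric.mem_closedBall, not_le] at hs
    exact hs.le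
  simp [Fc, this]

lemma Fc_hasDerivAt {γ s : ℝ} (hs : |s| < 5 / 8) :
    HasDerivAt (Fc γ) (γ * (1 + s) ^ (-γ - 1)) s := by
  have hpos : 0 < 1 + s := by have := (abs_lt.1 hs).1; linarith
  have h1 : HasDerivAt (fun s : ℝ => 1 - (1 + s) ^ (-γ)) (γ * (1 + s) ^ (-γ - 1)) s := by
    have := (((hasDerivAt_id s).const_add 1).rpow_const (p := -γ) (Or.inl hpos.ne')).const_sub 1
    refine this.congr_deriv ?_
    simp
  refine h1.congr_of_eventuallyEq ?_
  have : ∀ᶠ s' in 𝓝 s, |s'| < 5 / 8 := (continuous_abs.tendsto s).eventually (gt_mem_nhds hs)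
  filter_upwards [this] with s' hs' using Fc_eq hs'

/-- The coefficient `(1 + w)^(-γ-1) - 1`, truncated. -/
def zc (γ : ℝ) (w : ℝ → ℝ) (x : ℝ) : ℝ := deriv (Fc γ) (w x) / γ - 1

lemma zc_smooth (γ : ℝ) {w : ℝ → ℝ} (hw : ContDiff ℝ ∞ w) : ContDiff ℝ ∞ (zc γ w) :=
  (((smooth_deriv (Fc_smooth γ)).comp hw).div_const γ).sub contDiff_const

lemma zc_eq {γ : ℝ} (hγ : γ ≠ 0) {w : ℝ → ℝ} {x : ℝ} (hx : |w x| < 5 / 8) :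
    zc γ w x = (1 + w x) ^ (-γ - 1) - 1 := by
  unfold zc
  rw [(Fc_hasDerivAt hx).deriv]
  field_simp

lemma Fc_lipschitz (γ : ℝ) : ∃ K : ℝ, 0 ≤ K ∧ ∀ s t, |Fc γ s - Fc γ t| ≤ K * |s - t| := by
  obtain ⟨K, hK⟩ := ContDiff.lipschitzWith_of_hasCompactSupport (Fc_compact γ)
    ((Fc_smooth γ)) (by simp)
  exact ⟨K, K.2, fun s t => by simpa [Real.dist_eq] using hK.dist_le_mul s t⟩

lemma deriv_Fc_lipschitz (γ : ℝ) :
    ∃ K : ℝ, 0 ≤ K ∧ ∀ s t, |deriv (Fc γ) s - deriv (Fc γ) t| ≤ K * |s - t| := by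
  obtain ⟨K, hK⟩ := ContDiff.lipschitzWith_of_hasCompactSupport (Fc_compact γ).deriv
    (smooth_deriv (Fc_smooth γ)) (by simp)
  exact ⟨K, K.2, fun s t => by simpa [Real.dist_eq] using hK.dist_le_mul s t⟩

lemma deriv_deriv_Fc_bdd (γ : ℝ) : ∃ K : ℝ, 0 ≤ K ∧ ∀ s, |deriv (deriv (Fc γ)) s| ≤ K := by
  obtain ⟨K, hK⟩ := (Fc_compact γ).deriv.deriv.exists_bound_of_continuous
    (smooth_deriv (smooth_deriv (Fc_smooth γ))).continuous
  exact ⟨K, (norm_nonneg _).trans (hK 0), hK⟩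

lemma deriv_Fc_zero (γ : ℝ) : deriv (Fc γ) 0 = γ := by
  rw [(Fc_hasDerivAt (γ := γ) (s := 0) (by norm_num)).deriv]; simp

lemma zc_abs_le {γ : ℝ} (hγ : 0 < γ) :
    ∃ K : ℝ, 0 ≤ K ∧ ∀ (w : ℝ → ℝ) (x : ℝ), |zc γ w x| ≤ K * |w x| := by
  obtain ⟨K, hK, h⟩ := deriv_Fc_lipschitz γ
  refine ⟨K / γ, by positivity, fun w x => ?_⟩
  have h1 := h (w x) 0
  rw [deriv_Fc_zero, sub_zero] at h1
  have : zc γ w x = (deriv (Fc γ) (w x) - γ) / γ := by unfold zc; field_simp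
  rw [this, abs_div, abs_of_pos hγ, div_mul_eq_mul_div]
  gcongr

/-- The chain rule for the truncated nonlinearity. -/
lemma deriv_Fc_comp {γ : ℝ} (hγ : γ ≠ 0) {w : ℝ → ℝ} (hw : ContDiff ℝ ∞ w) (x : ℝ) :
    deriv (fun x => Fc γ (w x)) x = γ * ((1 + zc γ w x) * deriv w x) := by
  have h1 := ((Fc_smooth γ).differentiable (by simp) (w x)).hasDerivAt
  have h2 := (hw.differentiable (by simp) x).hasDerivAt
  have h := (h1.comp x h2).deriv
  simp only [Function.comp_def] at h
  rw [h]; unfold zc; field_simp; ring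

lemma zc_deriv_eq {γ : ℝ} (hγ : γ ≠ 0) {w : ℝ → ℝ} (hw : ContDiff ℝ ∞ w)
    (hsmall : ∀ x ∈ Ω₀, |w x| < 5 / 8) {x : ℝ} (hx : x ∈ Ω₀) :
    deriv (zc γ w) x = -(γ + 1) * deriv w x - ((γ + 1) * (deriv w x * zc γ w x) +
      w x * deriv (zc γ w) x) := by
  have hpos : 0 < 1 + w x := by have := (abs_lt.1 (hsmall x hx)).1; linarith
  have e : zc γ w =ᶠ[𝓝 x] fun y => (1 + w y) ^ (-γ - 1) - 1 := by
    filter_upwards [isOpen_Ioo.mem_nhds hx] with y hy using zc_eq hγ (hsmall y hy)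
  have h1 : HasDerivAt (fun y => (1 + w y) ^ (-γ - 1) - 1)
      (deriv w x * (-γ - 1) * (1 + w x) ^ (-γ - 1 - 1)) x :=
    (((hw.differentiable (by simp) x).hasDerivAt.const_add 1).rpow_const
      (Or.inl hpos.ne')).sub_const 1
  have h2 : deriv (zc γ w) x = deriv w x * (-γ - 1) * (1 + w x) ^ (-γ - 1 - 1) := by
    rw [e.deriv_eq, h1.deriv]
  have h3 : zc γ w x = (1 + w x) ^ (-γ - 1) - 1 := zc_eq hγ (hsmall x hx)
  have h4 : (1 + w x) ^ (-γ - 1) = (1 + w x) ^ (-γ - 1 - 1) * (1 + w x) := by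
    rw [← Real.rpow_add_one hpos.ne']; ring_nf
  rw [h2, h3, h4]; ring

lemma choose_sq_le {n i a : ℕ} (h : n ≤ a) : ((n.choose i : ℝ)) ^ 2 ≤ 4 ^ a := by
  have h1 : n.choose i ≤ 2 ^ a := (Nat.choose_le_two_pow n i).trans (Nat.pow_le_pow_right (by norm_num) h)
  have h2 : (n.choose i : ℝ) ≤ 2 ^ a := by exact_mod_cast h1
  calc ((n.choose i : ℝ)) ^ 2 ≤ ((2 : ℝ) ^ a) ^ 2 := by gcongr
    _ = 4 ^ a := by rw [← pow_mul, mul_comm, pow_mul]; norm_num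

/-- A Leibniz-type sum of products. -/
lemma W_leibniz_le {c p B : ℝ} (hc : 0 < c) (hp : 0 ≤ p) {a n : ℕ} (hn : n ≤ a)
    (s : Finset ℕ) (hs : s.card ≤ a + 2) {F : ℕ → ℝ → ℝ} (hF : ∀ i ∈ s, Continuous (F i))
    (hB : ∀ i ∈ s, W c p (F i) ≤ B) (hB0 : 0 ≤ B) :
    W c p (fun x => ∑ i ∈ s, n.choose i * F i x) ≤ (a + 2) ^ 2 * 4 ^ a * B := by
  refine (W_sum_le hc hp s (f := fun i x => n.choose i * F i x)
    fun i hi => continuous_const.mul (hF i hi)).trans ?_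
  have h1 : ∑ i ∈ s, W c p (fun x => n.choose i * F i x) ≤ ∑ i ∈ s, (4 : ℝ) ^ a * B := by
    refine Finset.sum_le_sum fun i hi => ?_
    rw [W_const_mul]
    exact mul_le_mul (choose_sq_le hn) (hB i hi) (W_nonneg hc _ _) (by positivity)
  rw [Finset.sum_const, nsmul_eq_mul] at h1
  have hs' : (s.card : ℝ) ≤ a + 2 := by exact_mod_cast hs
  calc (s.card : ℝ) * ∑ i ∈ s, W c p (fun x => n.choose i * F i x)
      ≤ s.card * (s.card * (4 ^ a * B)) := by gcongr
    _ ≤ (a + 2) * ((a + 2) * (4 ^ a * B)) := by gcongr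
    _ = _ := by ring

lemma W_leibniz_deriv_le {c κ : ℝ} (hc : 0 < c) (hκ : 1 ≤ κ) {a : ℕ} (ha : κ + 2 < a) :
    ∃ C : ℝ, 0 ≤ C ∧ ∀ m : ℕ, m + 1 ≤ a → ∀ f g : ℝ → ℝ, ContDiff ℝ ∞ f → ContDiff ℝ ∞ g →
      W c (κ + (m + 1 : ℕ)) (iteratedDeriv m (fun x => deriv f x * g x)) ≤
        C * (N c κ a f * N c κ a g) := by
  obtain ⟨C, hC, h⟩ := bilin_unif hc hκ ha
  refine ⟨(a + 2) ^ 2 * 4 ^ a * C, by positivity, fun m hm f g hf hg => ?_⟩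
  have e : iteratedDeriv m (fun x => deriv f x * g x) = fun x => ∑ i ∈ Finset.range (m + 1),
      m.choose i * (iteratedDeriv (i + 1) f x * iteratedDeriv (m - i) g x) := by
    funext x
    rw [iD_mul (smooth_deriv hf) hg]
    refine Finset.sum_congr rfl fun i _ => ?_
    rw [iteratedDeriv_succ', mul_assoc]
  rw [e]
  have n1 := N_nonneg hc κ a f
  have n2 := N_nonneg hc κ a g
  refine (W_leibniz_le (B := C * N c κ a f * N c κ a g) (a := a) hc (by positivity) (by omega) _
    (by rw [Finset.card_range]; omega)
    (fun i _ => (continuous_iteratedDeriv' hf _).mul (continuous_iteratedDeriv' hg _)) ?_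
    (by positivity)).trans (le_of_eq (by ring))
  intro i hi
  have hi' : i ≤ m := by have := Finset.mem_range.1 hi; omega
  have := h (i + 1) (m - i) (by omega) f g hf hg
  rwa [show i + 1 + (m - i) = m + 1 by omega] at this

set_option maxHeartbeats 1000000 in
/-- The static estimate for the nonlinear coefficient. -/
lemma N_zc_le {c κ γ : ℝ} (hc : 0 < c) (hκ : 1 ≤ κ) (hγ : 0 < γ) {a : ℕ} (ha : κ + 2 < a) :
    ∃ ν > (0 : ℝ), ∃ C : ℝ, 0 ≤ C ∧ ∀ w : ℝ → ℝ, ContDiff ℝ ∞ w → N c κ a w ≤ ν →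
      (∀ x ∈ Ω₀, |w x| ≤ 1 / 2 ∧ |zc γ w x| ≤ 1 / 2) ∧ N c κ a (zc γ w) ≤ C * N c κ a w := by
  have ha4 : 1 ≤ a := by
    have : (1 : ℝ) ≤ a := by linarith
    exact_mod_cast this
  obtain ⟨K, hK, hzK⟩ := zc_abs_le hγ
  obtain ⟨C₀, hC₀, hS⟩ := sup0_le_const_N hc (by linarith : 0 ≤ κ) ha4 (by linarith)
  obtain ⟨C₁, hC₁, hL⟩ := W_leibniz_deriv_le hc hκ ha
  set Q : ℝ := 4 * (γ + 1) ^ 2 + 4 with hQ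
  set M : ℝ := Q * (C₁ + 1) * (a + 1) + K ^ 2 with hM
  have hQ0 : 0 ≤ Q := by positivity
  have hM0 : 0 ≤ M := by positivity
  set ν : ℝ := 1 / (4 * (C₀ + 1) * (K + 1) ^ 2 + 2 * M) with hν
  have hD : 0 < 4 * (C₀ + 1) * (K + 1) ^ 2 + 2 * M := by positivity
  refine ⟨ν, by positivity, 2 * M, by positivity, fun w hw hN => ?_⟩
  have hNw := N_nonneg hc κ a w
  have hN' : N c κ a w * (4 * (C₀ + 1) * (K + 1) ^ 2 + 2 * M) ≤ 1 := by
    rwa [hν, le_div_iff₀ hD] at hN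
  have hsup : ∀ x ∈ Ω₀, |w x| * (K + 1) ≤ 1 / 2 := by
    intro x hx
    have h1 := hS w hw x hx
    have h2 : (|w x| * (K + 1)) ^ 2 ≤ (1 / 2) ^ 2 := by
      rw [mul_pow, sq_abs]
      have h3 : w x ^ 2 * (K + 1) ^ 2 ≤ C₀ * N c κ a w * (K + 1) ^ 2 :=
        mul_le_mul_of_nonneg_right h1 (by positivity)
      have h4 : 0 ≤ N c κ a w * (K + 1) ^ 2 := by positivity
      have h5 : 0 ≤ N c κ a w * M := by positivity
      nlinarith
    exact (abs_le_of_sq_le_sq' h2 (by norm_num)).2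
  have hw2 : ∀ x ∈ Ω₀, |w x| ≤ 1 / 2 := fun x hx => by
    have := hsup x hx
    nlinarith [abs_nonneg (w x), mul_nonneg (abs_nonneg (w x)) hK]
  refine ⟨fun x hx => ⟨hw2 x hx, (hzK w x).trans ?_⟩, ?_⟩
  · have := hsup x hx
    nlinarith [abs_nonneg (w x)]
  have hz := zc_smooth γ hw
  set z := zc γ w with hzdef
  have hNz := N_nonneg hc κ a z
  have hterm : ∀ j ∈ Finset.range (a + 1), W c (κ + j) (iteratedDeriv j z) ≤
      K ^ 2 * W c (κ + j) (iteratedDeriv j w) +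
        Q * (C₁ + 1) * (N c κ a w + N c κ a w * N c κ a z) := by
    intro j hj
    have hj' : j ≤ a := by have := Finset.mem_range.1 hj; omega
    rcases j with _ | m
    · have : W c (κ + (0 : ℕ)) (iteratedDeriv 0 z) ≤ K ^ 2 * W c (κ + (0 : ℕ)) (iteratedDeriv 0 w) := by
        rw [← W_const_mul]
        refine W_mono hc (by simp; linarith) (by simpa using hz.continuous)
          (by simp only [iteratedDeriv_zero]; exact continuous_const.mul hw.continuous) fun x _ => ?_
        simp only [iteratedDeriv_zero]
        rw [← sq_abs, ← sq_abs (K * w x), abs_mul, abs_of_nonneg hK]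
        exact pow_le_pow_left₀ (abs_nonneg _) (hzK w x) 2
      refine this.trans (le_add_of_nonneg_right (by positivity))
    · have e : ∀ x ∈ Ω₀, iteratedDeriv (m + 1) z x =
          (-(γ + 1) * iteratedDeriv (m + 1) w x) + (-(γ + 1) *
            iteratedDeriv m (fun x => deriv w x * z x) x +
              (-1) * iteratedDeriv m (fun x => deriv z x * w x) x) := by
        intro x hx
        have hdw := smooth_deriv hw
        have hdz := smooth_deriv hz
        have h1 : ContDiff ℝ ∞ (fun x => deriv w x * z x) := hdw.mul hz
        have h2 : ContDiff ℝ ∞ (fun x => deriv z x * w x) := hdz.mul hw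
        have ev : deriv z =ᶠ[𝓝 x] fun y => -(γ + 1) * deriv w y + (-(γ + 1) *
            (deriv w y * z y) + (-1) * (deriv z y * w y)) := by
          filter_upwards [isOpen_Ioo.mem_nhds hx] with y hy
          have := zc_deriv_eq hγ.ne' hw (fun x hx => lt_of_le_of_lt (hw2 x hx) (by norm_num)) hy
          rw [← hzdef] at this
          linarith
        rw [iteratedDeriv_succ', ev.iteratedDeriv_eq, iD_add (contDiff_const.mul hdw)
          ((contDiff_const.mul h1).add (contDiff_const.mul h2)), iD_add (contDiff_const.mul h1)
          (contDiff_const.mul h2), iteratedDeriv_const_mul_field, iteratedDeriv_const_mul_field,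
          iteratedDeriv_const_mul_field, iteratedDeriv_succ' (f := w)]
      have hp : 0 ≤ κ + (m + 1 : ℕ) := by positivity
      have c1 := (continuous_iteratedDeriv' hw (m + 1))
      have c2 := continuous_iteratedDeriv' ((smooth_deriv hw).mul hz) m
      have c3 := continuous_iteratedDeriv' ((smooth_deriv hz).mul hw) m
      rw [W_congr e]
      have a1 := W_add_le hc hp (f := fun x => -(γ + 1) * iteratedDeriv (m + 1) w x)
        (g := fun x => -(γ + 1) * iteratedDeriv m (fun x => deriv w x * z x) x +
              (-1) * iteratedDeriv m (fun x => deriv z x * w x) x)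
        (continuous_const.mul c1) ((continuous_const.mul c2).add (continuous_const.mul c3))
      have a2 := W_add_le hc hp (f := fun x => -(γ + 1) * iteratedDeriv m (fun x => deriv w x * z x) x)
        (g := fun x => (-1) * iteratedDeriv m (fun x => deriv z x * w x) x)
        (continuous_const.mul c2) (continuous_const.mul c3)
      rw [W_const_mul, W_const_mul] at a2
      rw [W_const_mul] at a1
      have b1 := hL m hj' w z hw hz
      have b2 := hL m hj' z w hz hw
      have b3 := W_le_N hc κ hj' w
      set X1 := W c (κ + (m + 1 : ℕ)) (iteratedDeriv m fun x => deriv w x * z x)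
      set X2 := W c (κ + (m + 1 : ℕ)) (iteratedDeriv m fun x => deriv z x * w x)
      set X3 := W c (κ + (m + 1 : ℕ)) (iteratedDeriv (m + 1) w)
      have hX3 : 0 ≤ X3 := W_nonneg hc _ _
      set P := N c κ a w * N c κ a z with hP
      have hP0 : 0 ≤ P := by positivity
      rw [mul_comm (N c κ a z), ← hP] at b2
      have s1 : (γ + 1) ^ 2 * X1 ≤ (γ + 1) ^ 2 * (C₁ * P) := mul_le_mul_of_nonneg_left b1 (by positivity)
      have s3 : (γ + 1) ^ 2 * X3 ≤ (γ + 1) ^ 2 * N c κ a w := mul_le_mul_of_nonneg_left b3 (by positivity)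
      have : (0 : ℝ) ≤ K ^ 2 * X3 := by positivity
      have t1 : 0 ≤ (γ + 1) ^ 2 * N c κ a w := by positivity
      have t2 : 0 ≤ (γ + 1) ^ 2 * P := by positivity
      have t3 : 0 ≤ C₁ * N c κ a w := by positivity
      have t4 : 0 ≤ (γ + 1) ^ 2 * (C₁ * N c κ a w) := by positivity
      have t5 : 0 ≤ C₁ * P := by positivity
      rw [hQ]
      nlinarith
  have hsum := Finset.sum_le_sum hterm
  rw [Finset.sum_add_distrib, ← Finset.mul_sum, Finset.sum_const, Finset.card_range,
    nsmul_eq_mul] at hsum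
  change N c κ a z ≤ K ^ 2 * N c κ a w + _ at hsum
  push_cast at hsum
  set X := N c κ a w
  set Z := N c κ a z
  have h6 : Z ≤ M * X + M * X * Z := by
    have : 0 ≤ K ^ 2 * (X * Z) := by positivity
    rw [hM]; nlinarith
  have h7 : M * X ≤ 1 / 2 := by
    have : 0 ≤ X * (4 * (C₀ + 1) * (K + 1) ^ 2) := by positivity
    nlinarith
  nlinarith

/-- The commutator terms in the `b`-th derivative of the nonlinearity. -/
def Rb (b : ℕ) (z w : ℝ → ℝ) (x : ℝ) : ℝ :=
  ∑ i ∈ Finset.Ico 1 b, (b - 1).choose i * (iteratedDeriv i z x * iteratedDeriv (b - i) w x)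

lemma Rb_smooth (b : ℕ) {z w : ℝ → ℝ} (hz : ContDiff ℝ ∞ z) (hw : ContDiff ℝ ∞ w) :
    ContDiff ℝ ∞ (Rb b z w) := by
  unfold Rb
  exact ContDiff.sum fun i _ => contDiff_const.mul
    ((smooth_iteratedDeriv hz _).mul (smooth_iteratedDeriv hw _))

lemma iteratedDeriv_one_add {z : ℝ → ℝ} (hz : ContDiff ℝ ∞ z) {i : ℕ} (hi : 1 ≤ i) (x : ℝ) :
    iteratedDeriv i (fun x => 1 + z x) x = iteratedDeriv i z x := by
  rw [iD_add contDiff_const hz, iteratedDeriv_const]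
  simp [show i ≠ 0 by omega]

lemma iteratedDeriv_Fc_comp {γ : ℝ} (hγ : γ ≠ 0) {w : ℝ → ℝ} (hw : ContDiff ℝ ∞ w) {b : ℕ}
    (hb : 1 ≤ b) (x : ℝ) :
    iteratedDeriv b (fun x => Fc γ (w x)) x =
      γ * ((1 + zc γ w x) * iteratedDeriv b w x + Rb b (zc γ w) w x) := by
  obtain ⟨m, rfl⟩ : ∃ m, b = m + 1 := ⟨b - 1, by omega⟩
  have hz := zc_smooth γ hw
  rw [iteratedDeriv_succ', funext (deriv_Fc_comp hγ hw), iteratedDeriv_const_mul_field,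
    iD_mul (contDiff_const.add hz) (smooth_deriv hw), Finset.range_eq_Ico,
    Finset.sum_eq_sum_Ico_succ_bot (by omega)]
  congr 1
  simp only [Nat.choose_zero_right, Nat.cast_one, one_mul, iteratedDeriv_zero, Nat.sub_zero, zero_add]
  rw [← iteratedDeriv_succ']
  congr 1
  unfold Rb
  refine Finset.sum_congr rfl fun i hi => ?_
  obtain ⟨h1, h2⟩ := Finset.mem_Ico.1 hi
  rw [iteratedDeriv_one_add hz h1, ← iteratedDeriv_succ', mul_assoc, Nat.add_sub_cancel,
    show m - i + 1 = m + 1 - i by omega]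

lemma deriv_Rb (b : ℕ) {z w : ℝ → ℝ} (hz : ContDiff ℝ ∞ z) (hw : ContDiff ℝ ∞ w) (x : ℝ) :
    deriv (Rb b z w) x =
      ∑ i ∈ Finset.Ico 1 b, (b - 1).choose i * (iteratedDeriv (i + 1) z x * iteratedDeriv (b - i) w x
        + iteratedDeriv i z x * iteratedDeriv (b - i + 1) w x) := by
  unfold Rb
  have h : ∀ i ∈ Finset.Ico 1 b, HasDerivAt (fun x => ((b - 1).choose i : ℝ) *
      (iteratedDeriv i z x * iteratedDeriv (b - i) w x)) ((b - 1).choose i *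
      (iteratedDeriv (i + 1) z x * iteratedDeriv (b - i) w x
        + iteratedDeriv i z x * iteratedDeriv (b - i + 1) w x)) x := fun i _ =>
    ((hasDerivAt_iteratedDeriv hz i x).mul (hasDerivAt_iteratedDeriv hw (b - i) x)).const_mul _
  exact (HasDerivAt.fun_sum h).deriv

lemma W_dw_mul {c p : ℝ} (hc : 0 < c) (f : ℝ → ℝ) :
    W c p (fun x => dw c x * f x) = W c (p + 2) f := by
  unfold W
  refine setIntegral_congr_fun measurableSet_Ω₀ fun x hx => ?_
  have h0 := dw_pos hc hx
  simp only
  rw [Real.rpow_add h0]; norm_num; ring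

lemma W_DD_le {c p : ℝ} (hc : 0 < c) (hp : 0 ≤ p) {g : ℝ → ℝ} (hg : ContDiff ℝ 1 g) :
    W c p (DD c p g) ≤ 2 * W c (p + 2) (deriv g) + 2 * ((p + 1) * (2 * c)) ^ 2 * W c p g := by
  have hd : Continuous (deriv g) := hg.continuous_deriv le_rfl
  have hg0 := hg.continuous
  have h := W_add_le hc hp (f := fun x => dw c x * deriv g x)
    (g := fun x => (p + 1) * (-2 * c * x) * g x) ((dw_continuous c).mul hd)
    ((by fun_prop : Continuous fun x : ℝ => (p + 1) * (-2 * c * x)).mul hg0)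
  rw [W_dw_mul hc] at h
  have h2 : W c p (fun x => (p + 1) * (-2 * c * x) * g x) ≤
      W c p (fun x => ((p + 1) * (2 * c)) * g x) := by
    refine W_mono hc hp ((by fun_prop : Continuous fun x : ℝ => (p + 1) * (-2 * c * x)).mul hg0)
      (continuous_const.mul hg0) fun x hx => ?_
    have hx2 : x ^ 2 ≤ 1 := by obtain ⟨a1, a2⟩ := hx; nlinarith
    have : 0 ≤ ((p + 1) * (2 * c) * g x) ^ 2 := sq_nonneg _
    nlinarith
  rw [W_const_mul] at h2
  have h3 : W c p (DD c p g) ≤ 2 * W c (p + 2) (deriv g) +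
    2 * W c p (fun x => (p + 1) * (-2 * c * x) * g x) := h
  linarith

lemma W_DD_Rb_le {c k : ℝ} (hc : 0 < c) (hk : 0 ≤ k) {a : ℕ} (ha : k + 3 < a) :
    ∃ C : ℝ, 0 ≤ C ∧ ∀ b : ℕ, b ≤ a → ∀ z w : ℝ → ℝ, ContDiff ℝ ∞ z → ContDiff ℝ ∞ w →
      W c (k + b) (DD c (k + b) (Rb b z w)) ≤ C * (N c (k + 1) a z * N c (k + 1) a w) := by
  obtain ⟨C₁, hC₁, h₁⟩ := bilin_unif hc (by linarith : 1 ≤ k + 1) (a := a) (by linarith)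
  obtain ⟨C₂, hC₂, h₂⟩ := bilin_unif' hc (by linarith : 1 ≤ k + 1) (a := a) (by linarith)
  refine ⟨2 * ((a + 2) ^ 2 * 4 ^ a * (4 * C₁)) + 2 * ((k + a + 1) * (2 * c)) ^ 2 *
    ((a + 2) ^ 2 * 4 ^ a * C₂), by positivity, fun b hb z w hz hw => ?_⟩
  have n1 := N_nonneg hc (k + 1) a z
  have n2 := N_nonneg hc (k + 1) a w
  set Z := N c (k + 1) a z with hZ
  set X := N c (k + 1) a w with hX
  have hp : 0 ≤ k + b := by positivity
  have hR := Rb_smooth b hz hw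
  have hcard : (Finset.Ico 1 b).card ≤ a + 2 := by rw [Nat.card_Ico]; omega
  refine (W_DD_le hc hp (hR.of_le (by exact_mod_cast le_top))).trans ?_
  have e1 : W c (k + b + 2) (deriv (Rb b z w)) ≤ (a + 2) ^ 2 * 4 ^ a * (4 * C₁ * Z * X) := by
    rw [funext (deriv_Rb b hz hw)]
    refine W_leibniz_le hc (by linarith) (by omega) _ hcard (fun i _ =>
      ((continuous_iteratedDeriv' hz _).mul (continuous_iteratedDeriv' hw _)).add
      ((continuous_iteratedDeriv' hz _).mul (continuous_iteratedDeriv' hw _))) ?_ (by positivity)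
    intro i hi
    obtain ⟨hi1, hi2⟩ := Finset.mem_Ico.1 hi
    refine (W_add_le hc (by linarith)
      (f := fun x => iteratedDeriv (i + 1) z x * iteratedDeriv (b - i) w x)
      (g := fun x => iteratedDeriv i z x * iteratedDeriv (b - i + 1) w x)
      ((continuous_iteratedDeriv' hz _).mul (continuous_iteratedDeriv' hw _))
      ((continuous_iteratedDeriv' hz _).mul (continuous_iteratedDeriv' hw _))).trans ?_
    have f1 := h₁ (i + 1) (b - i) (by omega) z w hz hw
    have f2 := h₁ i (b - i + 1) (by omega) z w hz hw
    rw [show k + 1 + ((i + 1 + (b - i) : ℕ) : ℝ) = k + b + 2 by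
      rw [show i + 1 + (b - i) = b + 1 by omega]; push_cast; ring] at f1
    rw [show k + 1 + ((i + (b - i + 1) : ℕ) : ℝ) = k + b + 2 by
      rw [show i + (b - i + 1) = b + 1 by omega]; push_cast; ring] at f2
    linarith
  have e2 : W c (k + b) (Rb b z w) ≤ (a + 2) ^ 2 * 4 ^ a * (C₂ * Z * X) := by
    unfold Rb
    refine W_leibniz_le hc hp (by omega) _ hcard (fun i _ =>
      (continuous_iteratedDeriv' hz _).mul (continuous_iteratedDeriv' hw _)) ?_ (by positivity)
    intro i hi
    obtain ⟨hi1, hi2⟩ := Finset.mem_Ico.1 hi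
    have f1 := h₂ i (b - i) ⟨hi1, by omega, by omega⟩ z w hz hw
    rwa [show k + 1 + ((i + (b - i) : ℕ) : ℝ) - 1 = k + b by
      rw [show i + (b - i) = b by omega]; ring] at f1
  have hba : (b : ℝ) ≤ a := by exact_mod_cast hb
  have e3 : 2 * ((k + b + 1) * (2 * c)) ^ 2 ≤ 2 * ((k + a + 1) * (2 * c)) ^ 2 := by gcongr
  calc _ ≤ 2 * ((a + 2) ^ 2 * 4 ^ a * (4 * C₁ * Z * X)) + 2 * ((k + a + 1) * (2 * c)) ^ 2 *
      ((a + 2) ^ 2 * 4 ^ a * (C₂ * Z * X)) := by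
        refine add_le_add (by linarith) (mul_le_mul e3 e2 (W_nonneg hc _ _) (by positivity))
    _ = _ := by ring

/-- The superlinear part of the nonlinearity. -/
def mF (γ : ℝ) (w : ℝ → ℝ) (x : ℝ) : ℝ := Fc γ (w x) - γ * w x

lemma mF_smooth (γ : ℝ) {w : ℝ → ℝ} (hw : ContDiff ℝ ∞ w) : ContDiff ℝ ∞ (mF γ w) :=
  ((Fc_smooth γ).comp hw).sub (contDiff_const.mul hw)

lemma mF_abs_le (γ : ℝ) : ∃ K : ℝ, 0 ≤ K ∧ ∀ s : ℝ, |Fc γ s - γ * s| ≤ K * s ^ 2 := by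
  obtain ⟨K, hK, h⟩ := deriv_Fc_lipschitz γ
  refine ⟨K, hK, fun s => ?_⟩
  have hd : ∀ u ∈ uIcc 0 s, HasDerivWithinAt (fun u => Fc γ u - γ * u) (deriv (Fc γ) u - γ)
      (uIcc 0 s) u := fun u _ => by
    have h1 := ((Fc_smooth γ).differentiable (by simp) u).hasDerivAt
    have h2 := h1.sub ((hasDerivAt_id u).const_mul γ)
    exact (h2.congr_deriv (by simp)).hasDerivWithinAt
  have hb : ∀ u ∈ uIcc 0 s, ‖deriv (Fc γ) u - γ‖ ≤ K * |s| := fun u hu => by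
    have h1 := h u 0
    rw [deriv_Fc_zero, sub_zero] at h1
    have h2 := abs_sub_left_of_mem_uIcc hu
    simp only [sub_zero] at h2
    exact h1.trans (mul_le_mul_of_nonneg_left h2 hK)
  have := Convex.norm_image_sub_le_of_norm_hasDerivWithin_le hd hb (convex_uIcc 0 s)
    left_mem_uIcc right_mem_uIcc
  simp only [Fc_zero, mul_zero, sub_zero, Real.norm_eq_abs] at this
  rw [mul_assoc, ← sq, sq_abs] at this
  exact this

lemma W_mF_le {c κ γ : ℝ} (hc : 0 < c) (hκ : 1 ≤ κ) (hγ : 0 < γ) {a : ℕ} (ha : κ + 2 < a) :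
    ∃ C : ℝ, 0 ≤ C ∧ ∀ b : ℕ, b ≤ a → ∀ w : ℝ → ℝ, ContDiff ℝ ∞ w →
      W c (κ + b) (iteratedDeriv b (mF γ w)) ≤
        C * (N c κ a w * N c κ a w + N c κ a w * N c κ a (zc γ w)) := by
  obtain ⟨K, hK, hm⟩ := mF_abs_le γ
  obtain ⟨C₁, hC₁, h₁⟩ := bilin_unif hc hκ ha
  obtain ⟨C₂, hC₂, h₂⟩ := W_leibniz_deriv_le hc hκ ha
  refine ⟨K ^ 2 * C₁ + γ ^ 2 * C₂, by positivity, fun b hb w hw => ?_⟩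
  have hz := zc_smooth γ hw
  have n1 := N_nonneg hc κ a w
  have n2 := N_nonneg hc κ a (zc γ w)
  have p1 : 0 ≤ N c κ a w * N c κ a w := by positivity
  have p2 : 0 ≤ N c κ a w * N c κ a (zc γ w) := by positivity
  rcases b with _ | m
  · have h := h₁ 0 0 (by omega) w w hw hw
    simp only [iteratedDeriv_zero, add_zero] at h ⊢
    have h2 : W c (κ + (0 : ℕ)) (mF γ w) ≤ W c (κ + (0 : ℕ)) (fun x => K * (w x * w x)) := by
      refine W_mono hc (by simp; linarith) (mF_smooth γ hw).continuous
        (continuous_const.mul (hw.continuous.mul hw.continuous)) fun x _ => ?_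
      rw [← sq_abs]
      have := hm (w x)
      rw [sq (w x)] at this
      exact pow_le_pow_left₀ (abs_nonneg _) this 2
    rw [W_const_mul] at h2
    have h3 : K ^ 2 * W c (κ + (0 : ℕ)) (fun x => w x * w x) ≤
        K ^ 2 * (C₁ * N c κ a w * N c κ a w) := mul_le_mul_of_nonneg_left h (by positivity)
    have : 0 ≤ γ ^ 2 * C₂ * (N c κ a w * N c κ a w + N c κ a w * N c κ a (zc γ w)) := by positivity
    have : 0 ≤ K ^ 2 * C₁ * (N c κ a w * N c κ a (zc γ w)) := by positivity
    linarith
  · have e : iteratedDeriv (m + 1) (mF γ w) =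
        fun x => γ * iteratedDeriv m (fun x => deriv w x * zc γ w x) x := by
      funext x
      have hd : deriv (mF γ w) = fun x => γ * (deriv w x * zc γ w x) := by
        funext y
        have h1 : DifferentiableAt ℝ (fun y => Fc γ (w y)) y :=
          ((Fc_smooth γ).comp hw).differentiable (by simp) y
        have h2 : DifferentiableAt ℝ w y := hw.differentiable (by simp) y
        have : deriv (mF γ w) y = deriv (fun y => Fc γ (w y)) y - γ * deriv w y := by
          unfold mF
          rw [deriv_fun_sub h1 (h2.const_mul γ), deriv_const_mul_field]
        rw [this, deriv_Fc_comp hγ.ne' hw]; ring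
      rw [iteratedDeriv_succ', hd, iteratedDeriv_const_mul_field]
    rw [e, W_const_mul]
    have := mul_le_mul_of_nonneg_left (h₂ m hb w _ hw hz) (sq_nonneg γ)
    have t1 : 0 ≤ γ ^ 2 * C₂ * (N c κ a w * N c κ a w) := by positivity
    have t2 : 0 ≤ K ^ 2 * C₁ * (N c κ a w * N c κ a w + N c κ a w * N c κ a (zc γ w)) := by positivity
    linarith

/-- All static nonlinear estimates. -/
lemma static_est {c k γ : ℝ} (hc : 0 < c) (hk : 0 ≤ k) (hγ : 0 < γ) {a : ℕ} (ha : k + 3 < a) :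
    ∃ ν > (0 : ℝ), ∃ C : ℝ, 0 ≤ C ∧ ∀ w : ℝ → ℝ, ContDiff ℝ ∞ w → N c (k + 1) a w ≤ ν →
      (∀ x ∈ Ω₀, |w x| ≤ 1 / 2 ∧ |zc γ w x| ≤ 1 / 2) ∧
      (∀ b ≤ a, W c (k + b) (DD c (k + b) (Rb b (zc γ w) w)) ≤ C * N c (k + 1) a w ^ 2) ∧
      (∀ b ≤ a, W c (k + 1 + b) (iteratedDeriv b (mF γ w)) ≤ C * N c (k + 1) a w ^ 2) := by
  obtain ⟨ν, hν, C₀, hC₀, h₀⟩ := N_zc_le hc (by linarith : 1 ≤ k + 1) hγ (a := a) (by linarith)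
  obtain ⟨C₁, hC₁, h₁⟩ := W_DD_Rb_le hc hk ha
  obtain ⟨C₂, hC₂, h₂⟩ := W_mF_le hc (by linarith : 1 ≤ k + 1) hγ (a := a) (by linarith)
  refine ⟨ν, hν, C₁ * C₀ + C₂ * (1 + C₀), by positivity, fun w hw hN => ?_⟩
  obtain ⟨hs, hz⟩ := h₀ w hw hN
  have n1 := N_nonneg hc (k + 1) a w
  have hzw : N c (k + 1) a (zc γ w) * N c (k + 1) a w ≤ C₀ * N c (k + 1) a w ^ 2 := by
    rw [sq, ← mul_assoc]; exact mul_le_mul_of_nonneg_right hz n1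
  refine ⟨hs, fun b hb => ?_, fun b hb => ?_⟩
  · refine (h₁ b hb _ w (zc_smooth γ hw) hw).trans ?_
    have := mul_le_mul_of_nonneg_left hzw hC₁
    have : 0 ≤ C₂ * (1 + C₀) * N c (k + 1) a w ^ 2 := by positivity
    linarith
  · refine (h₂ b hb w hw).trans ?_
    rw [mul_comm (N c (k + 1) a w) (N c (k + 1) a (zc γ w)), ← sq]
    have := mul_le_mul_of_nonneg_left (add_le_add_right hzw (N c (k + 1) a w ^ 2)) hC₂
    have : 0 ≤ C₁ * C₀ * N c (k + 1) a w ^ 2 := by positivity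
    linarith

/-- Weighted `L²` inner product on `Ω₀`. -/
def IP (c p : ℝ) (f g : ℝ → ℝ) : ℝ := ∫ x in Ω₀, dw c x ^ p * (f x * g x)

/-- Functions given by a polynomial of degree less than `n`. -/
def PolyLT (n : ℕ) (f : ℝ → ℝ) : Prop :=
  ∃ P : Polynomial ℝ, (∀ j, n ≤ j → P.coeff j = 0) ∧ f = fun x => P.eval x

lemma PolyLT.smooth {n : ℕ} {f : ℝ → ℝ} (h : PolyLT n f) : ContDiff ℝ ∞ f := by
  obtain ⟨P, -, rfl⟩ := h
  simpa using Polynomial.contDiff_aeval P (𝕜 := ℝ) (∞ : WithTop ℕ∞)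

lemma PolyLT.deriv {n : ℕ} {f : ℝ → ℝ} (h : PolyLT n f) : PolyLT (n - 1) (deriv f) := by
  obtain ⟨P, hP, rfl⟩ := h
  refine ⟨Polynomial.derivative P, fun j hj => ?_, by funext x; simp⟩
  rw [Polynomial.coeff_derivative, hP (j + 1) (by omega), zero_mul]

lemma PolyLT.zero {f : ℝ → ℝ} (h : PolyLT 0 f) : f = fun _ => 0 := by
  obtain ⟨P, hP, rfl⟩ := h
  have : P = 0 := Polynomial.ext fun j => by simp [hP j (Nat.zero_le _)]
  simp [this]

lemma PolyLT.neg_DD {n : ℕ} {f : ℝ → ℝ} (h : PolyLT n f) (c ρ : ℝ) :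
    PolyLT (n + 1) (fun x => -DD c ρ f x) := by
  obtain ⟨P, hP, rfl⟩ := h
  refine ⟨-(Polynomial.C c * (Polynomial.derivative P - Polynomial.X * (Polynomial.X *
    Polynomial.derivative P)) + Polynomial.C ((ρ + 1) * (-2 * c)) * (Polynomial.X * P)),
    fun j hj => ?_, ?_⟩
  · obtain ⟨i, rfl⟩ : ∃ i, j = i + 1 := ⟨j - 1, by omega⟩
    have h1 : Polynomial.coeff (Polynomial.X * Polynomial.derivative P) i = i * P.coeff i := by
      rcases i with _ | l
      · simp
      · rw [Polynomial.coeff_X_mul, Polynomial.coeff_derivative]; push_cast; ring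
    rw [Polynomial.coeff_neg, Polynomial.coeff_add, Polynomial.coeff_C_mul, Polynomial.coeff_sub,
      Polynomial.coeff_X_mul, h1, Polynomial.coeff_derivative, Polynomial.coeff_C_mul,
      Polynomial.coeff_X_mul, hP i (by omega), hP (i + 1 + 1) (by omega)]
    ring
  · funext x
    unfold DD dw
    simp; ring

/-- Test functions realising higher order energies. -/
def TT (c : ℝ) : ℕ → ℝ → (ℝ → ℝ) → ℝ → ℝ
  | 0, _, p => p
  | b + 1, ρ, p => fun x => -DD c ρ (TT c b (ρ + 1) (deriv p)) x

lemma TT_polyLT (c : ℝ) (b : ℕ) : ∀ (ρ : ℝ) (n : ℕ) (p : ℝ → ℝ), PolyLT n p →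
    PolyLT n (TT c b ρ p) := by
  induction b with
  | zero => intro ρ n p hp; exact hp
  | succ b ih =>
    intro ρ n p hp
    rcases n with _ | n
    · have h1 := (ih (ρ + 1) (0 - 1) _ hp.deriv).zero
      refine ⟨0, by simp, ?_⟩
      simp only [TT]
      funext x
      rw [h1]; simp [DD]
    · exact (ih (ρ + 1) n _ hp.deriv).neg_DD c ρ

lemma DD_smooth {c ρ : ℝ} {g : ℝ → ℝ} (hg : ContDiff ℝ ∞ g) : ContDiff ℝ ∞ (DD c ρ g) := by
  unfold DD
  exact ((dw_contDiff c).mul (smooth_deriv hg)).add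
    ((by fun_prop : ContDiff ℝ ∞ fun x : ℝ => (ρ + 1) * (-2 * c * x)).mul hg)

lemma TT_smooth (c : ℝ) (b : ℕ) : ∀ (ρ : ℝ) (p : ℝ → ℝ), ContDiff ℝ ∞ p →
    ContDiff ℝ ∞ (TT c b ρ p) := by
  induction b with
  | zero => intro ρ p hp; exact hp
  | succ b ih => intro ρ p hp; exact (DD_smooth (ih _ _ (smooth_deriv hp))).neg

lemma IP_comm (c p : ℝ) (f g : ℝ → ℝ) : IP c p f g = IP c p g f := by
  unfold IP; simp only [mul_comm]

lemma one_le_smooth : (1 : WithTop ℕ∞) ≤ (∞ : WithTop ℕ∞) := by exact_mod_cast le_top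

lemma IP_DD {c ρ : ℝ} (hc : 0 < c) (hρ : 0 ≤ ρ) {f g : ℝ → ℝ} (hf : ContDiff ℝ ∞ f)
    (hg : ContDiff ℝ ∞ g) : IP c ρ (DD c ρ g) f = -IP c (ρ + 1) g (deriv f) :=
  integral_DD_mul hc hρ (hf.of_le one_le_smooth) (hg.of_le one_le_smooth)

lemma IP_TT {c : ℝ} (hc : 0 < c) (b : ℕ) : ∀ (ρ : ℝ), 0 ≤ ρ → ∀ (f p : ℝ → ℝ),
    ContDiff ℝ ∞ f → ContDiff ℝ ∞ p →
    IP c ρ f (TT c b ρ p) = IP c (ρ + b) (iteratedDeriv b f) (iteratedDeriv b p) := by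
  induction b with
  | zero => intro ρ hρ f p hf hp; simp [TT]
  | succ b ih =>
    intro ρ hρ f p hf hp
    have hT := TT_smooth c b (ρ + 1) _ (smooth_deriv hp)
    have h1 : IP c ρ f (TT c (b + 1) ρ p) = -IP c ρ (DD c ρ (TT c b (ρ + 1) (deriv p))) f := by
      unfold IP
      rw [← integral_neg]
      congr 1; funext x; simp only [TT]; ring
    rw [h1, IP_DD hc hρ hf hT, neg_neg, IP_comm, ih (ρ + 1) (by linarith) _ _ (smooth_deriv hf)
      (smooth_deriv hp), iteratedDeriv_succ', iteratedDeriv_succ']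
    congr 1; push_cast; ring

/-- Commutator constants. -/
def ee (c : ℝ) : ℕ → ℝ → ℝ
  | 0, _ => 0
  | b + 1, ρ => ee c b (ρ + 1) + 2 * c * (ρ + 1)

lemma ee_nonneg {c : ℝ} (hc : 0 < c) (b : ℕ) : ∀ ρ : ℝ, 0 ≤ ρ → 0 ≤ ee c b ρ := by
  induction b with
  | zero => intro ρ _; exact le_rfl
  | succ b ih =>
    intro ρ hρ
    have := ih (ρ + 1) (by linarith)
    unfold ee; positivity

lemma deriv_DD {c ρ : ℝ} {g : ℝ → ℝ} (hg : ContDiff ℝ ∞ g) (x : ℝ) :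
    deriv (DD c ρ g) x = DD c (ρ + 1) (deriv g) x + -(2 * c * (ρ + 1)) * g x := by
  have h1 := (dw_hasDerivAt c x).mul ((smooth_deriv hg).differentiable (by simp) x).hasDerivAt
  have h0 : HasDerivAt (fun x : ℝ => (ρ + 1) * (-2 * c * x)) ((ρ + 1) * (-2 * c)) x := by
    have := ((hasDerivAt_id x).const_mul (-2 * c)).const_mul (ρ + 1)
    simpa using this
  have h2 := h0.mul (hg.differentiable (by simp) x).hasDerivAt
  have h3 : HasDerivAt (DD c ρ g) _ x := h1.add h2
  rw [h3.deriv]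
  unfold DD; ring

lemma iteratedDeriv_DD {c : ℝ} (b : ℕ) : ∀ (ρ : ℝ) (g : ℝ → ℝ), ContDiff ℝ ∞ g → ∀ x,
    iteratedDeriv b (DD c ρ g) x =
      DD c (ρ + b) (iteratedDeriv b g) x - ee c b ρ * iteratedDeriv (b - 1) g x := by
  induction b with
  | zero => intro ρ g hg x; simp [ee]
  | succ b ih =>
    intro ρ g hg x
    rw [iteratedDeriv_succ', funext (deriv_DD hg), iD_add (DD_smooth (smooth_deriv hg))
      (contDiff_const.mul hg), iteratedDeriv_const_mul_field, ih (ρ + 1) _ (smooth_deriv hg),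
      iteratedDeriv_succ']
    have h1 : ee c b (ρ + 1) * iteratedDeriv (b - 1) (deriv g) x =
        ee c b (ρ + 1) * iteratedDeriv b g x := by
      rcases b with _ | b
      · simp [ee]
      · rw [Nat.add_sub_cancel, ← iteratedDeriv_succ']
    rw [h1, Nat.add_sub_cancel]
    have h2 : ρ + 1 + (b : ℝ) = ρ + ((b + 1 : ℕ) : ℝ) := by push_cast; ring
    rw [h2]
    simp only [ee]; ring

lemma IP_add_left {c p : ℝ} (hp : 0 ≤ p) {f g h : ℝ → ℝ} (hf : Continuous f) (hg : Continuous g)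
    (hh : Continuous h) : IP c p (fun x => f x + g x) h = IP c p f h + IP c p g h := by
  have i1 : IntegrableOn (fun x => dw c x ^ p * (f x * h x)) Ω₀ := integrableOn_Ω₀_dw hp (hf.mul hh)
  have i2 : IntegrableOn (fun x => dw c x ^ p * (g x * h x)) Ω₀ := integrableOn_Ω₀_dw hp (hg.mul hh)
  unfold IP
  rw [← integral_add i1 i2]
  congr 1; funext x; ring

lemma IP_const_mul_left (c p r : ℝ) (f g : ℝ → ℝ) :
    IP c p (fun x => r * f x) g = r * IP c p f g := by
  unfold IP
  rw [← integral_const_mul]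
  congr 1; funext x; ring

lemma IP_self (c p : ℝ) (f : ℝ → ℝ) : IP c p f f = W c p f := by
  unfold IP W; simp only [sq]

lemma IP_abs_le {c p : ℝ} (hc : 0 < c) (hp : 0 ≤ p) {f g : ℝ → ℝ} (hf : Continuous f)
    (hg : Continuous g) : |IP c p f g| ≤ 2 * (√(W c p f) * √(W c p g)) := by
  have h : |IP c p f g| ^ 2 ≤ 4 * W c p f * W c p g := by
    refine sq_le_mul_of_forall (W_nonneg hc _ _) (W_nonneg hc _ _) (fun s hs => ?_) (abs_nonneg _)
    refine abs_integral_le_integral_abs.trans ?_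
    have i1 : IntegrableOn (fun x => s * (dw c x ^ p * f x ^ 2)) Ω₀ :=
      (integrableOn_Ω₀_dw hp (hf.pow 2)).const_mul _
    have i2 : IntegrableOn (fun x => s⁻¹ * (dw c x ^ p * g x ^ 2)) Ω₀ :=
      (integrableOn_Ω₀_dw hp (hg.pow 2)).const_mul _
    unfold W
    rw [← integral_const_mul, ← integral_const_mul, ← integral_add i1 i2]
    refine setIntegral_mono_on (integrableOn_Ω₀_dw hp (hf.mul hg)).abs (i1.add i2)
      measurableSet_Ω₀ fun x hx => ?_
    have h0 := dw_pos hc hx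
    have hP : 0 ≤ dw c x ^ p := by positivity
    rw [abs_mul, abs_of_nonneg hP, abs_mul]
    have key : |f x| * |g x| ≤ s * f x ^ 2 + s⁻¹ * g x ^ 2 := by
      rw [← sq_abs (f x), ← sq_abs (g x)]
      have : s * |f x| ^ 2 + s⁻¹ * |g x| ^ 2 - |f x| * |g x| =
          s⁻¹ * ((s * |f x| - |g x| / 2) ^ 2 + 3 / 4 * |g x| ^ 2) := by
        field_simp; ring
      have h2 : 0 ≤ s⁻¹ * ((s * |f x| - |g x| / 2) ^ 2 + 3 / 4 * |g x| ^ 2) := by positivity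
      linarith
    have := mul_le_mul_of_nonneg_left key hP
    linarith
  have h1 := W_nonneg hc p f
  have h2 := W_nonneg hc p g
  refine abs_le_of_sq_le_sq' ?_ (by positivity) |>.2
  rw [mul_pow, mul_pow, Real.sq_sqrt h1, Real.sq_sqrt h2]
  linarith

/-- The Galerkin weak form at a fixed time. -/
def WeakForm (c k γ A B : ℝ) (n : ℕ) (vt v δ : ℝ → ℝ) : Prop :=
  ∀ φ : ℝ → ℝ, PolyLT n φ → A * IP c k vt φ + B * IP c k v φ + IP c k δ φ +
    IP c (k + 1) (fun x => Fc γ (deriv δ x)) (deriv φ) = 0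

lemma WeakForm.zero_order {c k γ A B : ℝ} (hk : 0 ≤ k) {n : ℕ} {vt v δ : ℝ → ℝ}
    (h : WeakForm c k γ A B n vt v δ) (hv : PolyLT n v) (hδ : PolyLT n δ) :
    A * IP c k vt v + B * W c k v + IP c k δ v + γ * IP c (k + 1) (deriv δ) (deriv v) =
      -IP c (k + 1) (mF γ (deriv δ)) (deriv v) := by
  have h1 := h v hv
  have hw := smooth_deriv hδ.smooth
  have e : (fun x => Fc γ (deriv δ x)) = fun x => γ * deriv δ x + mF γ (deriv δ) x := by
    funext x; unfold mF; ring
  rw [e, IP_add_left (f := fun x => γ * deriv δ x) (g := fun x => mF γ (deriv δ) x) (by linarith)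
    (continuous_const.mul hw.continuous) (mF_smooth γ hw).continuous
    (smooth_deriv hv.smooth).continuous, IP_const_mul_left, IP_self] at h1
  linarith

lemma WeakForm.high_order {c k γ A B : ℝ} (hc : 0 < c) (hk : 0 ≤ k) (hγ : γ ≠ 0) {n : ℕ}
    {vt v δ : ℝ → ℝ} (h : WeakForm c k γ A B n vt v δ) (hvt : PolyLT n vt) (hv : PolyLT n v)
    (hδ : PolyLT n δ) {b : ℕ} (hb : 1 ≤ b) :
    A * IP c (k + b) (iteratedDeriv b vt) (iteratedDeriv b v) +
      B * W c (k + b) (iteratedDeriv b v) +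
      (1 + γ * ee c b k) * IP c (k + b) (iteratedDeriv b δ) (iteratedDeriv b v) +
      γ * IP c (k + 1 + b) (fun x => (1 + zc γ (deriv δ) x) * iteratedDeriv b (deriv δ) x)
        (iteratedDeriv b (deriv v)) =
      γ * IP c (k + b) (DD c (k + b) (Rb b (zc γ (deriv δ)) (deriv δ))) (iteratedDeriv b v) -
      ee c b k * IP c (k + b) (iteratedDeriv (b - 1) (mF γ (deriv δ))) (iteratedDeriv b v) := by
  have h1 := h _ (TT_polyLT c b k n v hv)
  have hT := TT_smooth c b k _ hv.smooth
  set w := deriv δ with hwdef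
  have hw : ContDiff ℝ ∞ w := smooth_deriv hδ.smooth
  have hF : ContDiff ℝ ∞ (fun x => Fc γ (w x)) := (Fc_smooth γ).comp hw
  have hz := zc_smooth γ hw
  have hm := mF_smooth γ hw
  have hR := Rb_smooth b hz hw
  have hkb : 0 ≤ k + b := by positivity
  have hvb := smooth_iteratedDeriv hv.smooth b
  have hwb := smooth_iteratedDeriv hw b
  have hg1 : ContDiff ℝ ∞ (fun x => (1 + zc γ w x) * iteratedDeriv b w x) :=
    (contDiff_const.add hz).mul hwb
  have h2 := IP_DD hc hk hT hF
  rw [IP_TT hc b k hk _ _ (DD_smooth hF) hv.smooth] at h2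
  rw [IP_TT hc b k hk _ _ hvt.smooth hv.smooth, IP_TT hc b k hk _ _ hv.smooth hv.smooth,
    IP_TT hc b k hk _ _ hδ.smooth hv.smooth, IP_self] at h1
  have e : iteratedDeriv b (DD c k fun x => Fc γ (w x)) = fun x =>
      (γ * DD c (k + b) (fun x => (1 + zc γ w x) * iteratedDeriv b w x) x +
        γ * DD c (k + b) (Rb b (zc γ w) w) x) +
      (-(ee c b k * γ) * iteratedDeriv b δ x + -ee c b k * iteratedDeriv (b - 1) (mF γ w) x) := by
    funext x
    rw [iteratedDeriv_DD b k _ hF]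
    have e1 : iteratedDeriv b (fun x => Fc γ (w x)) = fun x =>
        γ * ((1 + zc γ w x) * iteratedDeriv b w x + Rb b (zc γ w) w x) :=
      funext (iteratedDeriv_Fc_comp hγ hw hb)
    have e2 : iteratedDeriv (b - 1) (fun x => Fc γ (w x)) x =
        γ * iteratedDeriv b δ x + iteratedDeriv (b - 1) (mF γ w) x := by
      have e : (fun x => Fc γ (w x)) = fun x => γ * w x + mF γ w x := by
        funext x; unfold mF; ring
      rw [e, iD_add (contDiff_const.mul hw) hm, iteratedDeriv_const_mul_field, hwdef,
        ← iteratedDeriv_succ', show b - 1 + 1 = b by omega]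
    rw [e1, e2]
    have d1 := hg1.differentiable (by simp) x
    have d2 := hR.differentiable (by simp) x
    have e3 : deriv (fun x => γ * ((1 + zc γ w x) * iteratedDeriv b w x + Rb b (zc γ w) w x)) x =
        γ * (deriv (fun x => (1 + zc γ w x) * iteratedDeriv b w x) x + deriv (Rb b (zc γ w) w) x) := by
      rw [deriv_const_mul_field, deriv_fun_add d1 d2]
    unfold DD
    rw [e3]; ring
  have cg1 := (DD_smooth (c := c) (ρ := k + b) hg1).continuous
  have cR := (DD_smooth (c := c) (ρ := k + b) hR).continuous
  have cδ := continuous_iteratedDeriv' hδ.smooth b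
  have cm := continuous_iteratedDeriv' hm (b - 1)
  have C1 : Continuous fun x => γ * DD c (k + b)
      (fun x => (1 + zc γ w x) * iteratedDeriv b w x) x := continuous_const.mul cg1
  have C2 : Continuous fun x => γ * DD c (k + b) (Rb b (zc γ w) w) x := continuous_const.mul cR
  have C3 : Continuous fun x => -(ee c b k * γ) * iteratedDeriv b δ x := continuous_const.mul cδ
  have C4 : Continuous fun x => -ee c b k * iteratedDeriv (b - 1) (mF γ w) x :=
    continuous_const.mul cm
  have C12 : Continuous fun x => γ * DD c (k + b)
      (fun x => (1 + zc γ w x) * iteratedDeriv b w x) x +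
      γ * DD c (k + b) (Rb b (zc γ w) w) x := C1.add C2
  have C34 : Continuous fun x => -(ee c b k * γ) * iteratedDeriv b δ x +
      -ee c b k * iteratedDeriv (b - 1) (mF γ w) x := C3.add C4
  rw [e, IP_add_left hkb C12 C34 hvb.continuous, IP_add_left hkb C1 C2 hvb.continuous,
    IP_add_left hkb C3 C4 hvb.continuous,
    IP_const_mul_left, IP_const_mul_left, IP_const_mul_left, IP_const_mul_left,
    IP_DD hc hkb hvb hg1, ← iteratedDeriv_succ, iteratedDeriv_succ',
    show k + (b : ℝ) + 1 = k + 1 + b by ring] at h2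
  linarith

lemma N_deriv_le {c k : ℝ} (hc : 0 < c) {a : ℕ} (v : ℝ → ℝ) :
    N c (k + 1) a (deriv v) ≤ N c k (a + 1) v := by
  have e : N c (k + 1) a (deriv v) =
      ∑ j ∈ Finset.range (a + 1), W c (k + (j + 1 : ℕ)) (iteratedDeriv (j + 1) v) := by
    refine Finset.sum_congr rfl fun j _ => ?_
    rw [iteratedDeriv_succ']
    congr 1; push_cast; ring
  have e2 := Finset.sum_range_succ' (fun j : ℕ => W c (k + (j : ℕ)) (iteratedDeriv j v)) (a + 1)
  have e3 := W_nonneg hc (k + (0 : ℕ)) (iteratedDeriv 0 v)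
  unfold N at *
  linarith

lemma sup_deriv_le {c k : ℝ} (hc : 0 < c) (hk : 0 ≤ k) {a : ℕ} (ha : k + 3 < a) :
    ∃ C : ℝ, 0 ≤ C ∧ ∀ v : ℝ → ℝ, ContDiff ℝ ∞ v → ∀ x ∈ Ω₀, deriv v x ^ 2 ≤ C * N c k a v := by
  have ha1 : 3 < a := by
    have : (3 : ℝ) < a := by linarith
    exact_mod_cast this
  obtain ⟨m, rfl⟩ : ∃ m, a = m + 1 := ⟨a - 1, by omega⟩
  obtain ⟨C, hC, h⟩ := sup0_le_const_N (ρ := k + 1) (A := m) hc (by linarith) (by omega)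
    (by push_cast at ha; linarith)
  exact ⟨C, hC, fun v hv x hx => (h _ (smooth_deriv hv) x hx).trans
    (mul_le_mul_of_nonneg_left (N_deriv_le hc v) hC)⟩

/-- The coefficient of the top order term in the energy of order `b`. -/
def zz (γ : ℝ) (b : ℕ) (w : ℝ → ℝ) (x : ℝ) : ℝ := if b = 0 then 1 else 1 + zc γ w x

/-- The remainder in the energy identity of order `b`. -/
def RR (c k γ : ℝ) (b : ℕ) (δ v : ℝ → ℝ) : ℝ :=
  if b = 0 then -IP c (k + 1) (mF γ (deriv δ)) (deriv v) else
    γ * IP c (k + b) (DD c (k + b) (Rb b (zc γ (deriv δ)) (deriv δ))) (iteratedDeriv b v) -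
      ee c b k * IP c (k + b) (iteratedDeriv (b - 1) (mF γ (deriv δ))) (iteratedDeriv b v)

lemma WeakForm.order {c k γ A B : ℝ} (hc : 0 < c) (hk : 0 ≤ k) (hγ : γ ≠ 0) {n : ℕ}
    {vt v δ : ℝ → ℝ} (h : WeakForm c k γ A B n vt v δ) (hvt : PolyLT n vt) (hv : PolyLT n v)
    (hδ : PolyLT n δ) (b : ℕ) :
    A * IP c (k + b) (iteratedDeriv b vt) (iteratedDeriv b v) +
      B * W c (k + b) (iteratedDeriv b v) +
      (1 + γ * ee c b k) * IP c (k + b) (iteratedDeriv b δ) (iteratedDeriv b v) +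
      γ * IP c (k + 1 + b) (fun x => zz γ b (deriv δ) x * iteratedDeriv b (deriv δ) x)
        (iteratedDeriv b (deriv v)) = RR c k γ b δ v := by
  rcases Nat.eq_zero_or_pos b with rfl | hb
  · have := h.zero_order hk hv hδ
    simpa [zz, RR, ee] using this
  · have h1 := h.high_order hc hk hγ hvt hv hδ hb
    have hb0 : b ≠ 0 := by omega
    simpa [zz, RR, hb0] using h1

lemma RR_le {c k γ : ℝ} (hc : 0 < c) (hk : 0 ≤ k) (hγ : 0 < γ) {a : ℕ} (ha : k + 3 < a) :
    ∃ ν > (0 : ℝ), ∃ C : ℝ, 0 ≤ C ∧ ∀ δ v : ℝ → ℝ, ContDiff ℝ ∞ δ → ContDiff ℝ ∞ v →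
      N c (k + 1) a (deriv δ) ≤ ν →
      (∀ x ∈ Ω₀, |deriv δ x| ≤ 1 / 2 ∧ |zc γ (deriv δ) x| ≤ 1 / 2) ∧
      ∀ b ≤ a, |RR c k γ b δ v| ≤ C * (N c (k + 1) a (deriv δ) * √(N c k a v)) := by
  obtain ⟨ν, hν, C, hC, h⟩ := static_est (γ := γ) hc hk hγ ha
  have ha1 : 1 ≤ a := by
    have : (1 : ℝ) ≤ a := by linarith
    exact_mod_cast this
  set S := ∑ b ∈ Finset.range (a + 1), ee c b k with hS
  have hSb : ∀ b ≤ a, ee c b k ≤ S := fun b hb =>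
    Finset.single_le_sum (f := fun b => ee c b k) (fun i _ => ee_nonneg hc i k hk)
      (Finset.mem_range.2 (by omega))
  have hS0 : 0 ≤ S := Finset.sum_nonneg fun i _ => ee_nonneg hc i k hk
  refine ⟨ν, hν, (1 + γ + S) * (2 * √C), by positivity, fun δ v hδ hv hN => ?_⟩
  have hw := smooth_deriv hδ
  obtain ⟨h1, h2, h3⟩ := h _ hw hN
  refine ⟨h1, fun b hb => ?_⟩
  set M := N c (k + 1) a (deriv δ) with hM
  have hM0 : 0 ≤ M := N_nonneg hc _ _ _
  have hm := mF_smooth γ hw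
  have hz := zc_smooth γ hw
  have key : ∀ p : ℝ, 0 ≤ p → ∀ f g : ℝ → ℝ, Continuous f → Continuous g → W c p f ≤ C * M ^ 2 →
      W c p g ≤ N c k a v → |IP c p f g| ≤ 2 * √C * (M * √(N c k a v)) := by
    intro p hp f g hf hg h1 h2
    refine (IP_abs_le hc hp hf hg).trans ?_
    have e1 : √(W c p f) ≤ √C * M := by
      rw [← Real.sqrt_sq hM0, ← Real.sqrt_mul hC]
      exact Real.sqrt_le_sqrt h1
    have e2 := Real.sqrt_le_sqrt h2
    calc 2 * (√(W c p f) * √(W c p g)) ≤ 2 * ((√C * M) * √(N c k a v)) := by gcongr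
      _ = _ := by ring
  have hX : 0 ≤ 2 * √C * (M * √(N c k a v)) := by positivity
  rcases Nat.eq_zero_or_pos b with rfl | hb1
  · simp only [RR, if_true, abs_neg]
    have e := key (k + 1) (by linarith) (mF γ (deriv δ)) (deriv v) hm.continuous
      (smooth_deriv hv).continuous (by simpa using h3 0 (by omega))
      (by simpa using W_le_N hc k ha1 v)
    refine e.trans ?_
    nlinarith [mul_nonneg hγ.le hX, mul_nonneg hS0 hX]
  · have hb0 : b ≠ 0 := by omega
    simp only [RR, hb0, if_false]
    have e1 := key (k + b) (by positivity) _ _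
      (DD_smooth (c := c) (ρ := k + b) (Rb_smooth b hz hw)).continuous
      (continuous_iteratedDeriv' hv b) (h2 b hb) (W_le_N hc k hb v)
    have h3' := h3 (b - 1) (by omega)
    have e0 : k + 1 + ((b - 1 : ℕ) : ℝ) = k + b := by
      rw [Nat.cast_sub hb1]; push_cast; ring
    rw [e0] at h3'
    have e2 := key (k + b) (by positivity) _ _ (continuous_iteratedDeriv' hm (b - 1))
      (continuous_iteratedDeriv' hv b) h3' (W_le_N hc k hb v)
    have e3 := hSb b hb
    have e4 := ee_nonneg hc b k hk
    refine (abs_sub _ _).trans ?_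
    rw [abs_mul, abs_mul, abs_of_pos hγ, abs_of_nonneg e4]
    have f1 := mul_le_mul_of_nonneg_left e1 hγ.le
    have f2 := mul_le_mul e3 e2 (abs_nonneg _) hS0
    nlinarith

lemma hasDerivAt_integral_dw {c p : ℝ} (hp : 0 ≤ p) {J : Set ℝ} (hJ : IsOpen J)
    {g g' : ℝ → ℝ → ℝ} (hd : ∀ t ∈ J, ∀ x, HasDerivAt (fun s => g s x) (g' t x) t)
    (hg : ∀ t ∈ J, Continuous (g t)) (hg' : ContinuousOn (fun z : ℝ × ℝ => g' z.1 z.2) (J ×ˢ univ))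
    {t : ℝ} (ht : t ∈ J) :
    HasDerivAt (fun s => ∫ x in Ω₀, dw c x ^ p * g s x) (∫ x in Ω₀, dw c x ^ p * g' t x) t := by
  obtain ⟨ε, hε, hb⟩ := Metric.nhds_basis_closedBall.mem_iff.1 (hJ.mem_nhds ht)
  have hK : IsCompact (Metric.closedBall t ε ×ˢ Icc (-1 : ℝ) 1) :=
    (isCompact_closedBall t ε).prod isCompact_Icc
  obtain ⟨M, hM⟩ := hK.exists_bound_of_continuousOn
    (hg'.mono (prod_mono hb (subset_univ _)))
  have hg't : ∀ s ∈ J, Continuous (g' s) := fun s hs => by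
    have : ContinuousOn (fun x : ℝ => g' s x) univ :=
      hg'.comp (f := fun x : ℝ => (s, x)) (by fun_prop) fun x _ => ⟨hs, mem_univ _⟩
    exact continuousOn_univ.1 this
  have hsm : ∀ᶠ s in 𝓝 t, s ∈ J := hJ.mem_nhds ht
  have key := hasDerivAt_integral_of_dominated_loc_of_deriv_le (μ := volume.restrict Ω₀)
    (F := fun s x => dw c x ^ p * g s x) (F' := fun s x => dw c x ^ p * g' s x) (x₀ := t)
    (s := Metric.closedBall t ε) (bound := fun x => |dw c x ^ p| * M)
    (Metric.closedBall_mem_nhds t hε) ?_ ?_ ?_ ?_ ?_ ?_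
  · exact key.2
  · filter_upwards [hsm] with s hs
    exact (integrableOn_Ω₀_dw hp (hg s hs)).aestronglyMeasurable
  · exact integrableOn_Ω₀_dw hp (hg t ht)
  · exact (integrableOn_Ω₀_dw hp (hg't t ht)).aestronglyMeasurable
  · refine (ae_restrict_iff' measurableSet_Ω₀).2 (Eventually.of_forall fun x hx s hs => ?_)
    rw [norm_mul, Real.norm_eq_abs]
    exact mul_le_mul_of_nonneg_left (hM (s, x) ⟨hs, hx.1.le, hx.2.le⟩) (abs_nonneg _)
  · exact integrableOn_Ω₀ (((dw_rpow_continuous c hp).abs).mul continuous_const)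
  · exact Eventually.of_forall fun x s hs => (hd s (hb hs) x).const_mul _

/-- The polynomial function with the given coefficients. -/
def pol {n : ℕ} (q : Fin n → ℝ) (x : ℝ) : ℝ := ∑ i, q i * x ^ (i : ℕ)

lemma pol_polyLT {n : ℕ} (q : Fin n → ℝ) : PolyLT n (pol q) := by
  refine ⟨∑ i, Polynomial.C (q i) * Polynomial.X ^ (i : ℕ), fun j hj => ?_, ?_⟩
  · rw [Polynomial.finsetSum_coeff]
    refine Finset.sum_eq_zero fun i _ => ?_
    rw [Polynomial.coeff_C_mul, Polynomial.coeff_X_pow, if_neg (by omega), mul_zero]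
  · funext x
    simp [pol, Polynomial.eval_finsetSum]

lemma PolyLT.exists_pol {n : ℕ} {f : ℝ → ℝ} (h : PolyLT n f) : ∃ q : Fin n → ℝ, f = pol q := by
  obtain ⟨P, hP, rfl⟩ := h
  refine ⟨fun i => P.coeff i, ?_⟩
  funext x
  have hd : P.natDegree < n ∨ P = 0 := by
    by_contra! h
    exact h.2 (Polynomial.leadingCoeff_eq_zero.1 (hP _ h.1))
  rcases hd with hd | rfl
  · rw [Polynomial.eval_eq_sum_range' hd, Finset.sum_range]
    rfl
  · simp [pol]

lemma pol_smooth {n : ℕ} (q : Fin n → ℝ) : ContDiff ℝ ∞ (pol q) := (pol_polyLT q).smooth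

lemma iteratedDeriv_pol {n : ℕ} (q : Fin n → ℝ) (j : ℕ) (x : ℝ) :
    iteratedDeriv j (pol q) x = ∑ i, q i * iteratedDeriv j (fun y : ℝ => y ^ (i : ℕ)) x := by
  unfold pol
  rw [iteratedDeriv_fun_sum fun i _ => by fun_prop]
  exact Finset.sum_congr rfl fun i _ => by rw [iteratedDeriv_const_mul_field]

lemma hasDerivAt_pol {n : ℕ} {q : ℝ → Fin n → ℝ} {q' : Fin n → ℝ} {t : ℝ}
    (h : HasDerivAt q q' t) (j : ℕ) (x : ℝ) :
    HasDerivAt (fun s => iteratedDeriv j (pol (q s)) x) (iteratedDeriv j (pol q') x) t := by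
  simp only [iteratedDeriv_pol]
  exact HasDerivAt.fun_sum fun i _ => ((hasDerivAt_pi.1 h) i).mul_const _

lemma continuousOn_pol {n : ℕ} {q : ℝ → Fin n → ℝ} {J : Set ℝ} (h : ContinuousOn q J) (j : ℕ) :
    ContinuousOn (fun z : ℝ × ℝ => iteratedDeriv j (pol (q z.1)) z.2) (J ×ˢ univ) := by
  simp only [iteratedDeriv_pol]
  refine continuousOn_finsetSum _ fun i _ => ?_
  have h1 : ContinuousOn (fun z : ℝ × ℝ => q z.1 i) (J ×ˢ univ) :=
    ((continuousOn_pi.1 h) i).comp continuousOn_fst fun z hz => hz.1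
  have h2 : Continuous (iteratedDeriv j (fun y : ℝ => y ^ (i : ℕ))) :=
    continuous_iteratedDeriv' (by fun_prop) j
  exact h1.mul (h2.comp continuous_snd).continuousOn

/-- Galerkin solutions on an open time interval, through their coefficients. -/
structure Gal (c k γ : ℝ) (α α' : ℝ → ℝ) (n : ℕ) (J : Set ℝ) (q e e' : ℝ → Fin n → ℝ) : Prop where
  open_J : IsOpen J
  dq : ∀ t ∈ J, HasDerivAt q (e t) t
  de : ∀ t ∈ J, HasDerivAt e (e' t) t
  ce : ContinuousOn e' J
  weak : ∀ t ∈ J, 0 ≤ t → WeakForm c k γ (α t ^ (γ + 1)) (2 * α t ^ γ * α' t) n (pol (e' t))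
    (pol (e t)) (pol (q t))

/-- The energy. -/
def EE (c k γ : ℝ) (a : ℕ) (A : ℝ) (δ v : ℝ → ℝ) : ℝ :=
  ∑ b ∈ Finset.range (a + 1), (A * W c (k + b) (iteratedDeriv b v) +
    (1 + γ * ee c b k) * W c (k + b) (iteratedDeriv b δ) +
    γ * ∫ x in Ω₀, dw c x ^ (k + 1 + b) * (zz γ b (deriv δ) x * iteratedDeriv b (deriv δ) x ^ 2))

/-- Time derivative of `zz`. -/
def zt (γ : ℝ) (b : ℕ) (w wt : ℝ → ℝ) (x : ℝ) : ℝ :=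
  if b = 0 then 0 else deriv (deriv (Fc γ)) (w x) * wt x / γ

section EnergyDerivative

variable {c k γ : ℝ} {α α' : ℝ → ℝ} {n : ℕ} {J : Set ℝ} {q e e' : ℝ → Fin n → ℝ}

lemma Gal.cq (G : Gal c k γ α α' n J q e e') : ContinuousOn q J :=
  fun t ht => (G.dq t ht).continuousAt.continuousWithinAt

lemma Gal.cv (G : Gal c k γ α α' n J q e e') : ContinuousOn e J :=
  fun t ht => (G.de t ht).continuousAt.continuousWithinAt

lemma hasDerivAt_W_pol {p : ℝ} (hp : 0 ≤ p) (hJ : IsOpen J) {r r' : ℝ → Fin n → ℝ}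
    (hr : ∀ t ∈ J, HasDerivAt r (r' t) t) (hr' : ContinuousOn r' J) (j : ℕ) {t : ℝ} (ht : t ∈ J) :
    HasDerivAt (fun s => W c p (iteratedDeriv j (pol (r s))))
      (2 * IP c p (iteratedDeriv j (pol (r' t))) (iteratedDeriv j (pol (r t)))) t := by
  have hrc : ContinuousOn r J := fun t ht => (hr t ht).continuousAt.continuousWithinAt
  have h := hasDerivAt_integral_dw (c := c) hp hJ
    (g := fun s x => iteratedDeriv j (pol (r s)) x ^ 2)
    (g' := fun s x => 2 * (iteratedDeriv j (pol (r' s)) x * iteratedDeriv j (pol (r s)) x))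
    (fun t ht x => ((hasDerivAt_pol (hr t ht) j x).pow 2).congr_deriv (by push_cast; ring))
    (fun t _ => (continuous_iteratedDeriv' (pol_smooth _) j).pow 2)
    (continuousOn_const.mul ((continuousOn_pol hr' j).mul (continuousOn_pol hrc j))) ht
  unfold W
  refine h.congr_deriv ?_
  unfold IP
  rw [← integral_const_mul]
  congr 1; funext x; ring

lemma zz_smooth (γ : ℝ) (b : ℕ) {w : ℝ → ℝ} (hw : ContDiff ℝ ∞ w) : ContDiff ℝ ∞ (zz γ b w) := by
  unfold zz
  split_ifs
  · exact contDiff_const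
  · exact contDiff_const.add (zc_smooth γ hw)

lemma Gal.hasDerivAt_zz (G : Gal c k γ α α' n J q e e') (b : ℕ) {t : ℝ} (ht : t ∈ J) (x : ℝ) :
    HasDerivAt (fun s => zz γ b (deriv (pol (q s))) x)
      (zt γ b (deriv (pol (q t))) (deriv (pol (e t))) x) t := by
  unfold zz zt
  split_ifs with hb
  · exact hasDerivAt_const _ _
  · unfold zc
    have h1 : HasDerivAt (fun s => deriv (pol (q s)) x) (deriv (pol (e t)) x) t := by
      simpa only [iteratedDeriv_one] using hasDerivAt_pol (G.dq t ht) 1 x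
    have h2 := ((smooth_deriv (Fc_smooth γ)).differentiable (by simp)
      (deriv (pol (q t)) x)).hasDerivAt
    have h3 := ((h2.comp t h1).div_const γ).sub_const 1
    exact h3.const_add 1

lemma Gal.hasDerivAt_top (G : Gal c k γ α α' n J q e e') {p : ℝ} (hp : 0 ≤ p) (b : ℕ) {t : ℝ}
    (ht : t ∈ J) :
    HasDerivAt (fun s => ∫ x in Ω₀, dw c x ^ p *
      (zz γ b (deriv (pol (q s))) x * iteratedDeriv b (deriv (pol (q s))) x ^ 2))
      ((∫ x in Ω₀, dw c x ^ p * (zt γ b (deriv (pol (q t))) (deriv (pol (e t))) x *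
        iteratedDeriv b (deriv (pol (q t))) x ^ 2)) +
      2 * IP c p (fun x => zz γ b (deriv (pol (q t))) x * iteratedDeriv b (deriv (pol (q t))) x)
        (iteratedDeriv b (deriv (pol (e t))))) t := by
  have hw1 : ContinuousOn (fun z : ℝ × ℝ => deriv (pol (q z.1)) z.2) (J ×ˢ univ) := by
    simpa only [iteratedDeriv_one] using continuousOn_pol G.cq 1
  have hv1 : ContinuousOn (fun z : ℝ × ℝ => deriv (pol (e z.1)) z.2) (J ×ˢ univ) := by
    simpa only [iteratedDeriv_one] using continuousOn_pol G.cv 1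
  have hwb : ContinuousOn (fun z : ℝ × ℝ => iteratedDeriv b (deriv (pol (q z.1))) z.2)
      (J ×ˢ univ) := by
    simpa only [iteratedDeriv_succ'] using continuousOn_pol G.cq (b + 1)
  have hvb : ContinuousOn (fun z : ℝ × ℝ => iteratedDeriv b (deriv (pol (e z.1))) z.2)
      (J ×ˢ univ) := by
    simpa only [iteratedDeriv_succ'] using continuousOn_pol G.cv (b + 1)
  have hzz : ContinuousOn (fun z : ℝ × ℝ => zz γ b (deriv (pol (q z.1))) z.2) (J ×ˢ univ) := by
    unfold zz
    split_ifs
    · exact continuousOn_const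
    · unfold zc
      exact continuousOn_const.add ((((smooth_deriv (Fc_smooth γ)).continuous.comp_continuousOn
        hw1).div_const γ).sub continuousOn_const)
  have hzt : ContinuousOn (fun z : ℝ × ℝ => zt γ b (deriv (pol (q z.1))) (deriv (pol (e z.1))) z.2)
      (J ×ˢ univ) := by
    unfold zt
    split_ifs
    · exact continuousOn_const
    · exact (((smooth_deriv (smooth_deriv (Fc_smooth γ))).continuous.comp_continuousOn
        hw1).mul hv1).div_const γ
  have hdw : ∀ t ∈ J, ∀ x, HasDerivAt (fun s => iteratedDeriv b (deriv (pol (q s))) x)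
      (iteratedDeriv b (deriv (pol (e t))) x) t := fun t ht x => by
    simpa only [iteratedDeriv_succ'] using hasDerivAt_pol (G.dq t ht) (b + 1) x
  have h := hasDerivAt_integral_dw (c := c) hp G.open_J
    (g := fun s x => zz γ b (deriv (pol (q s))) x * iteratedDeriv b (deriv (pol (q s))) x ^ 2)
    (g' := fun s x => zt γ b (deriv (pol (q s))) (deriv (pol (e s))) x *
        iteratedDeriv b (deriv (pol (q s))) x ^ 2 + 2 * (zz γ b (deriv (pol (q s))) x *
        iteratedDeriv b (deriv (pol (q s))) x * iteratedDeriv b (deriv (pol (e s))) x))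
    (fun t ht x => ((G.hasDerivAt_zz b ht x).mul ((hdw t ht x).pow 2)).congr_deriv
      (by simp only [Pi.pow_apply]; push_cast; ring))
    (fun t _ => (zz_smooth γ b (smooth_deriv (pol_smooth _))).continuous.mul
      ((continuous_iteratedDeriv' (smooth_deriv (pol_smooth _)) b).pow 2))
    ((hzt.mul (hwb.pow 2)).add (continuousOn_const.mul ((hzz.mul hwb).mul hvb))) ht
  refine h.congr_deriv ?_
  have czt : Continuous (zt γ b (deriv (pol (q t))) (deriv (pol (e t)))) := by
    refine continuousOn_univ.1 (hzt.comp (f := fun x : ℝ => (t, x)) (by fun_prop)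
      fun x _ => ⟨ht, mem_univ _⟩)
  have cw := continuous_iteratedDeriv' (smooth_deriv (pol_smooth (q t))) b
  have cv := continuous_iteratedDeriv' (smooth_deriv (pol_smooth (e t))) b
  have cz := (zz_smooth γ b (smooth_deriv (pol_smooth (q t)))).continuous
  have i1 : IntegrableOn (fun x => dw c x ^ p * (zt γ b (deriv (pol (q t))) (deriv (pol (e t))) x *
        iteratedDeriv b (deriv (pol (q t))) x ^ 2)) Ω₀ :=
    integrableOn_Ω₀_dw hp (czt.mul (cw.pow 2))
  have i2 : IntegrableOn (fun x => 2 * (dw c x ^ p * (zz γ b (deriv (pol (q t))) x *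
        iteratedDeriv b (deriv (pol (q t))) x * iteratedDeriv b (deriv (pol (e t))) x))) Ω₀ :=
    (integrableOn_Ω₀_dw hp ((cz.mul cw).mul cv)).const_mul 2
  unfold IP
  rw [← integral_const_mul, ← integral_add i1 i2]
  congr 1; funext x; ring

end EnergyDerivative

section EnergyInequality

variable {c k γ : ℝ} {α α' : ℝ → ℝ} {n : ℕ} {J : Set ℝ} {q e e' : ℝ → Fin n → ℝ}

/-- Time derivative of the energy along Galerkin solutions. -/
def EEt (c k γ : ℝ) (a : ℕ) (D : ℝ) (δ v : ℝ → ℝ) : ℝ :=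
  ∑ b ∈ Finset.range (a + 1), (D * W c (k + b) (iteratedDeriv b v) + 2 * RR c k γ b δ v +
    γ * ∫ x in Ω₀, dw c x ^ (k + 1 + b) * (zt γ b (deriv δ) (deriv v) x *
      iteratedDeriv b (deriv δ) x ^ 2))

lemma Gal.hasDerivAt_EE (hc : 0 < c) (hk : 0 ≤ k) (hγ : γ ≠ 0) (G : Gal c k γ α α' n J q e e')
    (a : ℕ) {t : ℝ} (ht : t ∈ J) (ht0 : 0 ≤ t) (hα : HasDerivAt α (α' t) t) (hpos : 0 < α t) :
    HasDerivAt (fun s => EE c k γ a (α s ^ (γ + 1)) (pol (q s)) (pol (e s)))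
      (EEt c k γ a ((γ - 3) * (α t ^ γ * α' t)) (pol (q t)) (pol (e t))) t := by
  unfold EE EEt
  refine HasDerivAt.fun_sum fun b _ => ?_
  have hkb : 0 ≤ k + b := by positivity
  have hA : HasDerivAt (fun s => α s ^ (γ + 1)) (α' t * (γ + 1) * α t ^ γ) t := by
    have := hα.rpow_const (p := γ + 1) (Or.inl hpos.ne')
    rwa [add_sub_cancel_right] at this
  have h1 := hA.mul (hasDerivAt_W_pol (c := c) hkb G.open_J G.de G.ce b ht)
  have h2 := (hasDerivAt_W_pol (c := c) hkb G.open_J G.dq G.cv b ht).const_mul (1 + γ * ee c b k)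
  have h3 := (G.hasDerivAt_top (p := k + 1 + b) (by positivity) b ht).const_mul γ
  refine ((h1.add h2).add h3).congr_deriv ?_
  have h := (G.weak t ht ht0).order hc hk hγ (pol_polyLT _) (pol_polyLT _) (pol_polyLT _) b
  rw [IP_comm c (k + b) (iteratedDeriv b (pol (q t)))] at h
  linear_combination 2 * h

lemma zt_integral_le (hc : 0 < c) (hk : 0 ≤ k) (hγ : 0 < γ) {a : ℕ} (ha : k + 3 < a) :
    ∃ C : ℝ, 0 ≤ C ∧ ∀ δ v : ℝ → ℝ, ContDiff ℝ ∞ δ → ContDiff ℝ ∞ v → ∀ b ≤ a,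
      (∫ x in Ω₀, dw c x ^ (k + 1 + b) * (zt γ b (deriv δ) (deriv v) x *
        iteratedDeriv b (deriv δ) x ^ 2)) ≤ C * (N c (k + 1) a (deriv δ) * √(N c k a v)) := by
  obtain ⟨K, hK, hK'⟩ := deriv_deriv_Fc_bdd γ
  obtain ⟨C, hC, hC'⟩ := sup_deriv_le hc hk ha
  refine ⟨K * √C / γ, by positivity, fun δ v hδ hv b hb => ?_⟩
  have hw := smooth_deriv hδ
  have hzt : ∀ x ∈ Ω₀, zt γ b (deriv δ) (deriv v) x ≤ K * √C / γ * √(N c k a v) := by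
    intro x hx
    unfold zt
    split_ifs
    · positivity
    have h1 : |deriv v x| ≤ √C * √(N c k a v) := by
      rw [← Real.sqrt_mul hC]
      exact Real.abs_le_sqrt (hC' v hv x hx)
    have h2 : deriv (deriv (Fc γ)) (deriv δ x) * deriv v x ≤ K * (√C * √(N c k a v)) := by
      refine (le_abs_self _).trans ?_
      rw [abs_mul]
      exact mul_le_mul (hK' _) h1 (abs_nonneg _) hK
    rw [div_mul_eq_mul_div]
    refine div_le_div_of_nonneg_right ?_ hγ.le
    linarith
  have cz : Continuous (zt γ b (deriv δ) (deriv v)) := by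
    unfold zt
    split_ifs
    · exact continuous_const
    · exact ((((smooth_deriv (smooth_deriv (Fc_smooth γ))).comp hw).continuous).mul
        (smooth_deriv hv).continuous).div_const γ
  have cw := continuous_iteratedDeriv' hw b
  have hp : 0 ≤ k + 1 + b := by positivity
  have i2 : IntegrableOn (fun x => K * √C / γ * √(N c k a v) * (dw c x ^ (k + 1 + b) *
      iteratedDeriv b (deriv δ) x ^ 2)) Ω₀ := (integrableOn_Ω₀_dw hp (cw.pow 2)).const_mul _
  have i1 : IntegrableOn (fun x => dw c x ^ (k + 1 + b) * (zt γ b (deriv δ) (deriv v) x *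
      iteratedDeriv b (deriv δ) x ^ 2)) Ω₀ := integrableOn_Ω₀_dw hp (cz.mul (cw.pow 2))
  have h3 := setIntegral_mono_on i1 i2 measurableSet_Ω₀ fun x hx => by
      have h0 := (dw_pos hc hx).le
      have h4 := hzt x hx
      have h5 : 0 ≤ dw c x ^ (k + 1 + b) * iteratedDeriv b (deriv δ) x ^ 2 := by positivity
      have := mul_le_mul_of_nonneg_left h4 h5
      linarith
  rw [integral_const_mul] at h3
  have h6 := W_le_N hc (k + 1) hb (deriv δ)
  refine h3.trans ?_
  have h7 : 0 ≤ K * √C / γ * √(N c k a v) := by positivity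
  calc K * √C / γ * √(N c k a v) * W c (k + 1 + b) (iteratedDeriv b (deriv δ))
      ≤ K * √C / γ * √(N c k a v) * N c (k + 1) a (deriv δ) := by gcongr
    _ = _ := by ring

lemma EE_lower (hc : 0 < c) (hk : 0 ≤ k) (hγ : 0 < γ) {a : ℕ} {A : ℝ}
    {δ v : ℝ → ℝ} (hδ : ContDiff ℝ ∞ δ) (hz : ∀ x ∈ Ω₀, |zc γ (deriv δ) x| ≤ 1 / 2) :
    A * N c k a v + N c k a δ + γ / 2 * N c (k + 1) a (deriv δ) ≤ EE c k γ a A δ v := by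
  unfold EE N
  rw [Finset.mul_sum, Finset.mul_sum, ← Finset.sum_add_distrib, ← Finset.sum_add_distrib]
  refine Finset.sum_le_sum fun b _ => ?_
  have hw := smooth_deriv hδ
  have h1 := ee_nonneg hc b k hk
  have h2 := W_nonneg hc (k + b) (iteratedDeriv b δ)
  have hp : 0 ≤ k + 1 + b := by positivity
  have h3 : 1 / 2 * W c (k + 1 + b) (iteratedDeriv b (deriv δ)) ≤
      ∫ x in Ω₀, dw c x ^ (k + 1 + b) * (zz γ b (deriv δ) x * iteratedDeriv b (deriv δ) x ^ 2) := by
    unfold W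
    rw [← integral_const_mul]
    have cw := continuous_iteratedDeriv' hw b
    have i1 : IntegrableOn (fun x => 1 / 2 * (dw c x ^ (k + 1 + b) *
      iteratedDeriv b (deriv δ) x ^ 2)) Ω₀ := (integrableOn_Ω₀_dw hp (cw.pow 2)).const_mul _
    refine setIntegral_mono_on i1
      (integrableOn_Ω₀_dw hp ((zz_smooth γ b hw).continuous.mul (cw.pow 2))) measurableSet_Ω₀
      fun x hx => ?_
    have h0 := (dw_pos hc hx).le
    have h4 : 1 / 2 ≤ zz γ b (deriv δ) x := by
      unfold zz
      split_ifs
      · norm_num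
      · have := (abs_le.1 (hz x hx)).1
        linarith
    have h5 : 0 ≤ dw c x ^ (k + 1 + b) * iteratedDeriv b (deriv δ) x ^ 2 := by positivity
    have := mul_le_mul_of_nonneg_left h4 h5
    linarith
  have h4 := mul_le_mul_of_nonneg_left h3 hγ.le
  have h5 := mul_nonneg (mul_nonneg hγ.le h1) h2
  linarith

lemma EEt_le (hc : 0 < c) (hk : 0 ≤ k) (hγ : 0 < γ) {a : ℕ} (ha : k + 3 < a) :
    ∃ ν > (0 : ℝ), ∃ C : ℝ, 0 ≤ C ∧ ∀ δ v : ℝ → ℝ, ContDiff ℝ ∞ δ → ContDiff ℝ ∞ v →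
      N c (k + 1) a (deriv δ) ≤ ν →
      (∀ x ∈ Ω₀, |deriv δ x| ≤ 1 / 2 ∧ |zc γ (deriv δ) x| ≤ 1 / 2) ∧
      ∀ A > 0, ∀ D ≤ 0, EEt c k γ a D δ v ≤ C / √A * EE c k γ a A δ v := by
  obtain ⟨ν, hν, C1, hC1, h1⟩ := RR_le (γ := γ) hc hk hγ ha
  obtain ⟨C2, hC2, h2⟩ := zt_integral_le (γ := γ) hc hk hγ ha
  refine ⟨ν, hν, (a + 1) * (2 * C1 + γ * C2) * √ν * (1 / γ + 1), by positivity,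
    fun δ v hδ hv hN => ?_⟩
  obtain ⟨hs, hR⟩ := h1 δ v hδ hv hN
  refine ⟨hs, fun A hA D hD => ?_⟩
  set M := N c (k + 1) a (deriv δ)
  set V := N c k a v
  have hM : 0 ≤ M := N_nonneg hc _ _ _
  have hV : 0 ≤ V := N_nonneg hc _ _ _
  have e1 : EEt c k γ a D δ v ≤ (a + 1) * (2 * C1 + γ * C2) * (M * √V) := by
    unfold EEt
    have : ∀ b ∈ Finset.range (a + 1), (D * W c (k + b) (iteratedDeriv b v) +
        2 * RR c k γ b δ v + γ * ∫ x in Ω₀, dw c x ^ (k + 1 + b) * (zt γ b (deriv δ) (deriv v) x *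
      iteratedDeriv b (deriv δ) x ^ 2)) ≤ (2 * C1 + γ * C2) * (M * √V) := by
      intro b hb
      have hb' : b ≤ a := by have := Finset.mem_range.1 hb; omega
      have g1 := (le_abs_self _).trans (hR b hb')
      have g2 := mul_le_mul_of_nonneg_left (h2 δ v hδ hv b hb') hγ.le
      have g3 := mul_nonpos_of_nonpos_of_nonneg hD (W_nonneg hc (k + b) (iteratedDeriv b v))
      linarith
    refine (Finset.sum_le_card_nsmul _ _ _ this).trans ?_
    rw [Finset.card_range, nsmul_eq_mul]
    push_cast
    linarith
  have hsA : 0 < √A := Real.sqrt_pos.2 hA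
  have e2 : √A * (M * √V) ≤ √ν * (1 / γ + 1) * EE c k γ a A δ v := by
    have hl := EE_lower hc hk hγ (a := a) (A := A) (v := v) hδ fun x hx => (hs x hx).2
    have hδ0 := N_nonneg hc k a δ
    have f1 : √A * √V = √(A * V) := (Real.sqrt_mul hA.le V).symm
    have f2 : M = √M * √M := (Real.mul_self_sqrt hM).symm
    have f3 : √M ≤ √ν := Real.sqrt_le_sqrt hN
    have f4 : √M * √(A * V) ≤ (1 / γ + 1) * EE c k γ a A δ v := by
      have s1 := Real.sq_sqrt hM
      have s2 := Real.sq_sqrt (mul_nonneg hA.le hV)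
      have s3 : √M * √(A * V) ≤ M / 2 + A * V / 2 := by
        nlinarith [sq_nonneg (√M - √(A * V))]
      have hAV := mul_nonneg hA.le hV
      have s4 : M / 2 ≤ 1 / γ * EE c k γ a A δ v := by
        have : γ / 2 * M ≤ EE c k γ a A δ v := by linarith
        rw [div_mul_eq_mul_div, one_mul, le_div_iff₀ hγ]; linarith
      have s5 : A * V / 2 ≤ EE c k γ a A δ v := by
        have : 0 ≤ γ / 2 * M := by positivity
        linarith
      linarith
    calc √A * (M * √V) = √M * (√M * √(A * V)) := by rw [← f1]; nth_rewrite 1 [f2]; ring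
      _ ≤ √ν * ((1 / γ + 1) * EE c k γ a A δ v) := by gcongr
      _ = _ := by ring
  have e3 : 0 ≤ ((a : ℝ) + 1) * (2 * C1 + γ * C2) := by positivity
  refine e1.trans ?_
  rw [div_mul_eq_mul_div, le_div_iff₀ hsA]
  have := mul_le_mul_of_nonneg_left e2 e3
  linarith

end EnergyInequality

/-- The hypotheses on the expansion factor. -/
structure IsExpansion (γ : ℝ) (α α' : ℝ → ℝ) : Prop where
  pos : ∀ t ∈ Ici (0 : ℝ), 0 < α t
  deriv : ∀ t ∈ Ici (0 : ℝ), HasDerivWithinAt α (α' t) (Ici 0) t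
  deriv' : ∀ t ∈ Ici (0 : ℝ), HasDerivWithinAt α' (α t ^ (-γ)) (Ici 0) t
  zero : α 0 = 1
  zero' : 0 ≤ α' 0

section Expansion

variable {γ : ℝ} {α α' : ℝ → ℝ}

lemma IsExpansion.cont (h : IsExpansion γ α α') : ContinuousOn α (Ici 0) :=
  fun t ht => (h.deriv t ht).continuousWithinAt

lemma IsExpansion.cont' (h : IsExpansion γ α α') : ContinuousOn α' (Ici 0) :=
  fun t ht => (h.deriv' t ht).continuousWithinAt

lemma IsExpansion.hasDerivAt (h : IsExpansion γ α α') {t : ℝ} (ht : 0 < t) :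
    HasDerivAt α (α' t) t := (h.deriv t ht.le).hasDerivAt (Ici_mem_nhds ht)

lemma IsExpansion.hasDerivAt' (h : IsExpansion γ α α') {t : ℝ} (ht : 0 < t) :
    HasDerivAt α' (α t ^ (-γ)) t := (h.deriv' t ht.le).hasDerivAt (Ici_mem_nhds ht)

lemma IsExpansion.strictMono' (h : IsExpansion γ α α') : StrictMonoOn α' (Ici 0) := by
  refine strictMonoOn_of_deriv_pos (convex_Ici 0) h.cont' fun t ht => ?_
  rw [interior_Ici, mem_Ioi] at ht
  rw [(h.hasDerivAt' ht).deriv]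
  exact Real.rpow_pos_of_pos (h.pos t ht.le) _

lemma IsExpansion.nonneg' (h : IsExpansion γ α α') {t : ℝ} (ht : 0 ≤ t) : 0 ≤ α' t :=
  h.zero'.trans (h.strictMono'.monotoneOn self_mem_Ici ht ht)

lemma IsExpansion.mono (h : IsExpansion γ α α') : MonotoneOn α (Ici 0) := by
  refine monotoneOn_of_deriv_nonneg (convex_Ici 0) h.cont ?_ fun t ht => ?_
  · intro t ht
    rw [interior_Ici, mem_Ioi] at ht
    exact (h.hasDerivAt ht).differentiableAt.differentiableWithinAt
  · rw [interior_Ici, mem_Ioi] at ht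
    rw [(h.hasDerivAt ht).deriv]
    exact h.nonneg' ht.le

lemma IsExpansion.one_le (h : IsExpansion γ α α') {t : ℝ} (ht : 0 ≤ t) : 1 ≤ α t :=
  h.zero ▸ h.mono self_mem_Ici ht ht

lemma IsExpansion.growth (h : IsExpansion γ α α') :
    ∃ m > (0 : ℝ), ∀ t, 0 ≤ t → m * (1 + t) ≤ α t := by
  have h1 : 0 < α' 1 := lt_of_le_of_lt h.zero' (h.strictMono' self_mem_Ici
    (by norm_num : (1 : ℝ) ∈ Ici 0) one_pos)
  refine ⟨min (α' 1) (1 / 2), lt_min h1 (by norm_num), fun t ht => ?_⟩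
  set m := min (α' 1) (1 / 2)
  have hm0 : 0 < m := lt_min h1 (by norm_num)
  have hm1 : m ≤ α' 1 := min_le_left _ _
  have hm2 : m ≤ 1 / 2 := min_le_right _ _
  have hone := h.one_le ht
  rcases le_total t 1 with h2 | h2
  · nlinarith
  · have hmono : MonotoneOn (fun s => α s - m * s) (Ici 1) := by
      refine monotoneOn_of_deriv_nonneg (convex_Ici 1) ?_ ?_ ?_
      · exact (h.cont.mono (Ici_subset_Ici.2 zero_le_one)).sub (by fun_prop)
      · intro s hs
        rw [interior_Ici, mem_Ioi] at hs
        exact ((h.hasDerivAt (by linarith)).sub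
          ((hasDerivAt_id s).const_mul m)).differentiableAt.differentiableWithinAt
      · intro s hs
        rw [interior_Ici, mem_Ioi] at hs
        have hd : HasDerivAt (fun s => α s - m * s) (α' s - m * 1) s :=
          (h.hasDerivAt (by linarith)).sub ((hasDerivAt_id s).const_mul m)
        rw [hd.deriv]
        have := h.strictMono'.monotoneOn (by norm_num : (1 : ℝ) ∈ Ici 0)
          (by simp; linarith : s ∈ Ici (0 : ℝ)) hs.le
        linarith
    have h3 : α 1 - m * 1 ≤ α t - m * t := hmono self_mem_Ici h2 h2
    have h4 := h.one_le zero_le_one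
    linarith

end Expansion

lemma bootstrap {f : ℝ → ℝ} {T ν μ : ℝ} (hf : ContinuousOn f (Icc 0 T)) (h0 : f 0 ≤ ν)
    (hμ : μ < ν) (h : ∀ t ∈ Icc 0 T, (∀ s ∈ Icc 0 t, f s ≤ ν) → f t ≤ μ) :
    ∀ t ∈ Icc 0 T, f t ≤ ν := by
  by_contra! hcon
  obtain ⟨t1, ht1, hft1⟩ := hcon
  have hsub : Icc 0 t1 ⊆ Icc 0 T := Icc_subset_Icc_right ht1.2
  have hS : IsCompact (Icc 0 t1 ∩ f ⁻¹' Ici ν) :=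
    isCompact_Icc.of_isClosed_subset
      ((hf.mono hsub).preimage_isClosed_of_isClosed isClosed_Icc isClosed_Ici) inter_subset_left
  obtain ⟨ts, hts, hmin⟩ := hS.exists_isLeast ⟨t1, ⟨ht1.1, le_rfl⟩, hft1.le⟩
  have hlt : ∀ s ∈ Icc 0 ts, s ≠ ts → f s < ν := by
    intro s hs hne
    by_contra! hle
    exact hne (le_antisymm hs.2 (hmin ⟨⟨hs.1, hs.2.trans hts.1.2⟩, hle⟩))
  have hle : f ts ≤ ν := by
    obtain ⟨s, hs, hfs⟩ := intermediate_value_Icc hts.1.1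
      (hf.mono (Icc_subset_Icc_right (hts.1.2.trans ht1.2))) (⟨h0, hts.2⟩ : ν ∈ Icc (f 0) (f ts))
    by_cases hne : s = ts
    · rw [← hne, hfs]
    · exact absurd hfs (hlt s hs hne).ne
  have h1 := h ts (hsub hts.1) fun s hs => by
    by_cases hne : s = ts
    · rw [hne]; exact hle
    · exact (hlt s hs hne).le
  have h2 : ν ≤ f ts := hts.2
  linarith

section Bound

variable {c k γ : ℝ} {α α' : ℝ → ℝ} {n : ℕ} {J : Set ℝ} {q e e' : ℝ → Fin n → ℝ}

lemma Gal.continuousOn_N (hk : 0 ≤ k) (G : Gal c k γ α α' n J q e e') (a : ℕ) :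
    ContinuousOn (fun t => N c (k + 1) a (deriv (pol (q t)))) J := by
  unfold N
  refine continuousOn_finsetSum _ fun j _ t ht => ?_
  simp only [← iteratedDeriv_succ']
  exact (hasDerivAt_W_pol (c := c) (by positivity) G.open_J G.dq G.cv (j + 1)
    ht).continuousAt.continuousWithinAt

lemma Gal.continuousOn_EE (hk : 0 ≤ k) (hγ : 0 < γ) (G : Gal c k γ α α' n J q e e')
    (hα : IsExpansion γ α α') (a : ℕ) :
    ContinuousOn (fun t => EE c k γ a (α t ^ (γ + 1)) (pol (q t)) (pol (e t))) (J ∩ Ici 0) := by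
  unfold EE
  refine continuousOn_finsetSum _ fun j _ t ht => ?_
  have hkb : 0 ≤ k + j := by positivity
  have h1 := (hasDerivAt_W_pol (c := c) hkb G.open_J G.de G.ce j ht.1).continuousAt
  have h2 := (hasDerivAt_W_pol (c := c) hkb G.open_J G.dq G.cv j ht.1).continuousAt
  have h3 := (G.hasDerivAt_top (p := k + 1 + j) (by positivity) j ht.1).continuousAt
  have h4 : ContinuousWithinAt (fun t => α t ^ (γ + 1)) (J ∩ Ici 0) t :=
    ((hα.cont t ht.2).mono inter_subset_right).rpow_const (Or.inr (by linarith))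
  exact ((h4.mul h1.continuousWithinAt).add (continuousWithinAt_const.mul
    h2.continuousWithinAt)).add (continuousWithinAt_const.mul h3.continuousWithinAt)

lemma EE_zero (c k γ : ℝ) (a : ℕ) (A : ℝ) (v : ℝ → ℝ) :
    EE c k γ a A (fun _ => 0) v = A * N c k a v := by
  unfold EE N
  rw [Finset.mul_sum]
  refine Finset.sum_congr rfl fun b _ => ?_
  have h1 : deriv (fun _ : ℝ => (0 : ℝ)) = fun _ => 0 := by funext x; simp
  have h2 : ∀ x, iteratedDeriv b (fun _ : ℝ => (0 : ℝ)) x = 0 := fun x => by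
    simp
  rw [h1]
  simp [W, h2]

/-- Uniform bounds for Galerkin solutions. -/
lemma Gal.bound (hc : 0 < c) (hk : 0 ≤ k) (hγ : 1 < γ) (hγ3 : γ ≤ 3) {a : ℕ} (ha : k + 3 < a)
    (hα : IsExpansion γ α α') :
    ∃ ε > (0 : ℝ), ∃ C : ℝ, 0 ≤ C ∧ ∀ (n : ℕ) (J : Set ℝ) (q e e' : ℝ → Fin n → ℝ),
      Gal c k γ α α' n J q e e' → ∀ T, Icc 0 T ⊆ J → q 0 = 0 → N c k a (pol (e 0)) ≤ ε →
      ∀ t ∈ Icc 0 T, (∀ x ∈ Ω₀, |deriv (pol (q t)) x| ≤ 1 / 2) ∧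
        α t ^ (γ + 1) * N c k a (pol (e t)) + N c k a (pol (q t)) +
          N c (k + 1) a (deriv (pol (q t))) ≤ C * N c k a (pol (e 0)) := by
  have hγ0 : 0 < γ := by linarith
  obtain ⟨ν, hν, C1, hC1, hE⟩ := EEt_le (γ := γ) hc hk hγ0 ha
  obtain ⟨m, hm, hgrow⟩ := hα.growth
  set s := (γ + 1) / 2 with hs
  set lam := C1 / m ^ s * (2 / (γ - 1)) with hlam
  have hγ1 : 0 < γ - 1 := by linarith
  have hlam0 : 0 ≤ lam := by positivity
  set K := Real.exp lam with hK
  have hK0 : 0 < K := Real.exp_pos _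
  refine ⟨γ / 4 * ν / K, by positivity, (1 + 2 / γ) * K, by positivity,
    fun n J q e e' G T hT hq0 hε => ?_⟩
  set f := fun t => N c (k + 1) a (deriv (pol (q t))) with hf
  set E := fun t => EE c k γ a (α t ^ (γ + 1)) (pol (q t)) (pol (e t)) with hEdef
  have hp0 : pol (q 0) = fun _ => 0 := by funext x; simp [pol, hq0]
  have hE0 : E 0 = N c k a (pol (e 0)) := by
    simp only [hEdef]
    rw [hp0, EE_zero, hα.zero, Real.one_rpow, one_mul]
  have hN0 : 0 ≤ N c k a (pol (e 0)) := N_nonneg hc _ _ _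
  have hf0 : f 0 = 0 := by
    simp only [hf, N, ← iteratedDeriv_succ', hp0]
    refine Finset.sum_eq_zero fun j _ => ?_
    simp [W]
  -- the linear differential inequality as long as the solution is small
  have key : ∀ t ∈ Icc 0 T, (∀ r ∈ Icc 0 t, f r ≤ ν) → E t ≤ K * E 0 := by
    intro t ht hsmall
    have hsub : Icc 0 t ⊆ J ∩ Ici 0 := fun r hr => ⟨hT ⟨hr.1, hr.2.trans ht.2⟩, hr.1⟩
    set g : ℝ → ℝ := fun r => lam * (1 + r) ^ (-((γ - 1) / 2)) with hg
    have hgd : ∀ r, 0 ≤ r → HasDerivAt g (-(C1 / m ^ s) * (1 + r) ^ (-s)) r := by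
      intro r hr
      have h1 := (((hasDerivAt_id r).const_add 1).rpow_const (p := -((γ - 1) / 2))
        (Or.inl (by simp; linarith))).const_mul lam
      refine h1.congr_deriv ?_
      have e1 : -((γ - 1) / 2) - 1 = -s := by rw [hs]; ring
      rw [e1, hlam, id]
      field_simp
    have hgcont : ContinuousOn g (Icc 0 t) := fun r hr =>
      (hgd r hr.1).continuousAt.continuousWithinAt
    have hanti : AntitoneOn (fun r => E r * Real.exp (g r)) (Icc 0 t) := by
      have hder : ∀ r ∈ Ioo 0 t, HasDerivAt (fun r => E r * Real.exp (g r))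
          (EEt c k γ a ((γ - 3) * (α r ^ γ * α' r)) (pol (q r)) (pol (e r)) * Real.exp (g r) +
            E r * (Real.exp (g r) * (-(C1 / m ^ s) * (1 + r) ^ (-s)))) r := fun r hr =>
        (G.hasDerivAt_EE hc hk hγ0.ne' a (hsub ⟨hr.1.le, hr.2.le⟩).1 hr.1.le
          (hα.hasDerivAt hr.1) (hα.pos r hr.1.le)).mul (hgd r hr.1.le).exp
      refine antitoneOn_of_deriv_nonpos (convex_Icc 0 t)
        (((G.continuousOn_EE hk hγ0 hα a).mono hsub).mul hgcont.rexp) ?_ ?_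
      · rw [interior_Icc]
        exact fun r hr => (hder r hr).differentiableAt.differentiableWithinAt
      · rw [interior_Icc]
        intro r hr
        rw [(hder r hr).deriv]
        have hr0 : 0 ≤ r := hr.1.le
        have hpos := hα.pos r hr0
        have hA : 0 < α r ^ (γ + 1) := by positivity
        have hD : (γ - 3) * (α r ^ γ * α' r) ≤ 0 :=
          mul_nonpos_of_nonpos_of_nonneg (by linarith)
            (mul_nonneg (by positivity) (hα.nonneg' hr0))
        obtain ⟨hz, h2⟩ := hE (pol (q r)) (pol (e r)) (pol_smooth _) (pol_smooth _)
          (hsmall r ⟨hr0, hr.2.le⟩)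
        have h3 := h2 _ hA _ hD
        have hEr : 0 ≤ E r := by
          have := EE_lower hc hk hγ0 (a := a) (A := α r ^ (γ + 1)) (v := pol (e r)) (pol_smooth (q r))
            fun x hx => (hz x hx).2
          have g1 := mul_nonneg hA.le (N_nonneg hc k a (pol (e r)))
          have g2 := N_nonneg hc k a (pol (q r))
          have g3 := mul_nonneg (by positivity : 0 ≤ γ / 2)
            (N_nonneg hc (k + 1) a (deriv (pol (q r))))
          simp only [hEdef]; linarith
        have h4 : C1 / √(α r ^ (γ + 1)) ≤ C1 / m ^ s * (1 + r) ^ (-s) := by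
          have h5 : √(α r ^ (γ + 1)) = α r ^ s := by
            rw [Real.sqrt_eq_rpow, ← Real.rpow_mul hpos.le]; congr 1; rw [hs]; ring
          have h6 : (m * (1 + r)) ^ s ≤ α r ^ s :=
            Real.rpow_le_rpow (by positivity) (hgrow r hr0) (by positivity)
          rw [h5, Real.rpow_neg (by positivity), ← div_eq_mul_inv, div_div,
            ← Real.mul_rpow hm.le (by positivity)]
          exact div_le_div_of_nonneg_left hC1 (by positivity) h6
        have h7 := mul_le_mul_of_nonneg_right h4 hEr
        have h8 := Real.exp_pos (g r)
        have h9 : EEt c k γ a ((γ - 3) * (α r ^ γ * α' r)) (pol (q r)) (pol (e r)) ≤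
            C1 / m ^ s * (1 + r) ^ (-s) * E r := h3.trans h7
        have := mul_le_mul_of_nonneg_right h9 h8.le
        linarith
    have h1 := hanti (left_mem_Icc.2 ht.1) (right_mem_Icc.2 ht.1) ht.1
    simp only at h1
    have hg0 : g 0 = lam := by simp [hg]
    have hgt : 1 ≤ Real.exp (g t) := Real.one_le_exp (by
      have : 0 ≤ 1 + t := by linarith [ht.1]
      simp only [hg]; positivity)
    rw [hg0] at h1
    rcases le_or_gt 0 (E t) with h2 | h2
    · nlinarith
    · nlinarith [mul_nonneg hK0.le (hE0 ▸ hN0 : 0 ≤ E 0)]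
  have key2 : ∀ t ∈ Icc 0 T, (∀ r ∈ Icc 0 t, f r ≤ ν) →
      (∀ x ∈ Ω₀, |deriv (pol (q t)) x| ≤ 1 / 2) ∧
      α t ^ (γ + 1) * N c k a (pol (e t)) + N c k a (pol (q t)) + γ / 2 * f t ≤
        K * N c k a (pol (e 0)) := by
    intro t ht hsmall
    have h1 := key t ht hsmall
    obtain ⟨hz, -⟩ := hE (pol (q t)) (pol (e t)) (pol_smooth _) (pol_smooth _)
      (hsmall t ⟨ht.1, le_rfl⟩)
    have hA : 0 < α t ^ (γ + 1) := Real.rpow_pos_of_pos (hα.pos t ht.1) _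
    have h2 := EE_lower hc hk hγ0 (a := a) (A := α t ^ (γ + 1)) (v := pol (e t))
      (pol_smooth (q t))
      fun x hx => (hz x hx).2
    rw [hE0] at h1
    exact ⟨fun x hx => (hz x hx).1, h2.trans h1⟩
  have hfν : ∀ t ∈ Icc 0 T, f t ≤ ν := by
    refine bootstrap (μ := ν / 2) ((G.continuousOn_N hk a).mono hT) (by rw [hf0]; exact hν.le)
      (by linarith) fun t ht hsmall => ?_
    have h1 := (key2 t ht hsmall).2
    have g1 := mul_nonneg (Real.rpow_pos_of_pos (hα.pos t ht.1) (γ + 1)).le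
      (N_nonneg hc k a (pol (e t)))
    have g2 := N_nonneg hc k a (pol (q t))
    have h2 : K * N c k a (pol (e 0)) ≤ γ / 4 * ν := by
      have := mul_le_mul_of_nonneg_left hε hK0.le
      rwa [mul_div_cancel₀ _ hK0.ne'] at this
    have h3 : γ / 2 * f t ≤ γ / 2 * (ν / 2) := by linarith
    exact le_of_mul_le_mul_left h3 (by positivity)
  intro t ht
  obtain ⟨h1, h2⟩ := key2 t ht fun r hr => hfν r ⟨hr.1, hr.2.trans ht.2⟩
  refine ⟨h1, ?_⟩
  have g1 := mul_nonneg (Real.rpow_pos_of_pos (hα.pos t ht.1) (γ + 1)).le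
    (N_nonneg hc k a (pol (e t)))
  have g2 := N_nonneg hc k a (pol (q t))
  have g3 : f t ≤ 2 / γ * (K * N c k a (pol (e 0))) := by
    have : γ / 2 * f t ≤ K * N c k a (pol (e 0)) := by linarith
    rw [div_mul_eq_mul_div, le_div_iff₀ hγ0]; linarith
  have g4 : 0 ≤ γ / 2 * f t := mul_nonneg (by positivity) (N_nonneg hc _ _ _)
  simp only [hf] at g3 g4 h2
  linarith

end Bound

/-- Coordinatewise truncation to `[-R, R]`. -/
def clampVec {ι : Type*} (R : ℝ) (x : ι → ℝ) (i : ι) : ℝ := max (-R) (min R (x i))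

lemma abs_clamp_sub_le (R s t : ℝ) : |max (-R) (min R s) - max (-R) (min R t)| ≤ |s - t| := by
  refine (abs_max_sub_max_le_max _ _ _ _).trans ?_
  refine max_le (by simp) ?_
  refine (abs_min_sub_min_le_max _ _ _ _).trans ?_
  simp

lemma clampVec_lipschitz {ι : Type*} [Fintype ι] (R : ℝ) :
    LipschitzWith 1 (clampVec (ι := ι) R) := by
  refine LipschitzWith.of_dist_le_mul fun x y => ?_
  rw [NNReal.coe_one, one_mul, dist_pi_le_iff dist_nonneg]
  intro i
  exact (abs_clamp_sub_le R (x i) (y i)).trans (dist_le_pi_dist x y i)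

lemma clampVec_norm_le {ι : Type*} [Fintype ι] {R : ℝ} (hR : 0 ≤ R) (x : ι → ℝ) :
    ‖clampVec R x‖ ≤ R := by
  rw [pi_norm_le_iff_of_nonneg hR]
  intro i
  rw [Real.norm_eq_abs, abs_le]
  exact ⟨le_max_left _ _, max_le (by linarith) (min_le_left _ _)⟩

lemma clampVec_norm_le' {ι : Type*} [Fintype ι] {R : ℝ} (hR : 0 ≤ R) (x : ι → ℝ) :
    ‖clampVec R x‖ ≤ ‖x‖ := by
  have h0 : clampVec R (0 : ι → ℝ) = 0 := by funext i; simp [clampVec, hR]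
  have := (clampVec_lipschitz R).dist_le_mul x 0
  rwa [h0, dist_zero_right, dist_zero_right, NNReal.coe_one, one_mul] at this

lemma clampVec_eq {ι : Type*} [Fintype ι] {R : ℝ} {x : ι → ℝ} (h : ‖x‖ ≤ R) :
    clampVec R x = x := by
  funext i
  have := abs_le.1 ((norm_le_pi_norm x i).trans h)
  rw [clampVec, min_eq_right this.2, max_eq_right this.1]

lemma exists_ode_solution {ι : Type*} [Fintype ι] (f : ℝ → (ι → ℝ) → ι → ℝ)
    (hf : Continuous fun z : ℝ × (ι → ℝ) => f z.1 z.2) {T : ℝ} (hT : 0 ≤ T) {K : NNReal}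
    (hK : ∀ t ∈ Icc (-1) (T + 1), LipschitzWith K (f t)) (x₀ : ι → ℝ) :
    ∃ (y : ℝ → ι → ℝ) (J : Set ℝ), IsOpen J ∧ Icc 0 T ⊆ J ∧ y 0 = x₀ ∧
      ∀ t ∈ J, HasDerivAt y (f t (y t)) t := by
  obtain ⟨M0, hM0⟩ := (isCompact_Icc (a := (-1 : ℝ)) (b := T + 1)).exists_bound_of_continuousOn
    (f := fun t => f t 0) (by fun_prop)
  have hgc : Continuous fun s => gronwallBound ‖x₀‖ K M0 (s - 0) :=
    continuous_iff_continuousAt.2 fun s =>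
      ((hasDerivAt_gronwallBound_shift ‖x₀‖ K M0 s 0).continuousAt)
  obtain ⟨B, hB⟩ := (isCompact_Icc (a := (0 : ℝ)) (b := T + 1)).exists_bound_of_continuousOn
    hgc.continuousOn
  have hB0 : 0 ≤ B := (norm_nonneg _).trans (hB 0 ⟨le_rfl, by linarith⟩)
  set R := B + 1 with hR
  have hR0 : 0 ≤ R := by linarith
  have hcl : Continuous (clampVec (ι := ι) R) := (clampVec_lipschitz R).continuous
  set g : ℝ → (ι → ℝ) → ι → ℝ := fun t x => f t (clampVec R x) with hg
  have hgcont : Continuous fun z : ℝ × (ι → ℝ) => g z.1 z.2 :=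
    hf.comp (continuous_fst.prodMk (hcl.comp continuous_snd))
  obtain ⟨M, hM⟩ := ((isCompact_Icc (a := (-1 : ℝ)) (b := T + 1)).prod
    (isCompact_closedBall (0 : ι → ℝ) R)).exists_bound_of_continuousOn hf.continuousOn
  have hgM : ∀ t ∈ Icc (-1) (T + 1), ∀ x, ‖g t x‖ ≤ M := fun t ht x =>
    hM (t, clampVec R x) ⟨ht, by simpa using clampVec_norm_le hR0 x⟩
  have hM0' : 0 ≤ M := (norm_nonneg _).trans (hgM 0 ⟨by norm_num, by linarith⟩ 0)
  have h0mem : (0 : ℝ) ∈ Icc (-1) (T + 1) := ⟨by norm_num, by linarith⟩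
  have hPL : IsPicardLindelof g (⟨0, h0mem⟩ : Icc (-1 : ℝ) (T + 1)) x₀
      (Real.toNNReal (M * (T + 1))) 0 (Real.toNNReal M) K := by
    refine ⟨fun t ht => ?_, fun x _ => ?_, fun t ht x _ => ?_, ?_⟩
    · have := (hK t ht).comp (clampVec_lipschitz (ι := ι) R)
      rw [mul_one] at this
      exact this.lipschitzOnWith
    · exact (hgcont.comp (by fun_prop : Continuous fun t : ℝ => (t, x))).continuousOn
    · rw [Real.coe_toNNReal _ hM0']; exact hgM t ht x
    · rw [Real.coe_toNNReal _ hM0', Real.coe_toNNReal _ (by positivity), NNReal.coe_zero,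
        sub_zero (M * (T + 1))]
      refine mul_le_mul_of_nonneg_left ?_ hM0'
      simp; linarith
  obtain ⟨y, hy0, hy⟩ := hPL.exists_eq_forall_mem_Icc_hasDerivWithinAt₀
  simp only at hy0
  have hyc : ContinuousOn y (Icc (-1) (T + 1)) := fun t ht => (hy t ht).continuousWithinAt
  have hyd : ∀ t ∈ Ioo (-1) (T + 1), HasDerivAt y (g t (y t)) t := fun t ht =>
    (hy t (Ioo_subset_Icc_self ht)).hasDerivAt (Icc_mem_nhds ht.1 ht.2)
  have hbd : ∀ t ∈ Icc 0 (T + 1), ‖y t‖ ≤ gronwallBound ‖x₀‖ K M0 (t - 0) := by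
    refine norm_le_gronwallBound_of_norm_deriv_right_le (f' := fun t => g t (y t))
      (hyc.mono (Icc_subset_Icc_left (by norm_num))) (fun t ht => ?_) (by rw [hy0]) fun t ht => ?_
    · exact (hyd t ⟨by linarith [ht.1], ht.2⟩).hasDerivWithinAt
    · have ht' : t ∈ Icc (-1) (T + 1) := ⟨by linarith [ht.1], ht.2.le⟩
      have h1 := (hK t ht').dist_le_mul (clampVec R (y t)) 0
      rw [dist_eq_norm, dist_zero_right] at h1
      have h2 : ‖g t (y t)‖ ≤ ‖f t (clampVec R (y t)) - f t 0‖ + ‖f t 0‖ := by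
        simpa using norm_add_le (f t (clampVec R (y t)) - f t 0) (f t 0)
      have h3 := mul_le_mul_of_nonneg_left (clampVec_norm_le' hR0 (y t)) K.2
      have h4 := hM0 t ht'
      simp only [NNReal.val_eq_coe] at h3
      linarith
  have hycI : ContinuousOn y (Ioo (-1) (T + 1)) := hyc.mono Ioo_subset_Icc_self
  refine ⟨y, Ioo (-1) (T + 1) ∩ y ⁻¹' Metric.ball 0 R,
    hycI.isOpen_inter_preimage isOpen_Ioo Metric.isOpen_ball, fun t ht => ?_, hy0, fun t ht => ?_⟩
  · refine ⟨⟨by linarith [ht.1], by linarith [ht.2]⟩, ?_⟩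
    have ht' : t ∈ Icc 0 (T + 1) := ⟨ht.1, by linarith [ht.2]⟩
    rw [mem_preimage, mem_ball_zero_iff]
    have := (le_abs_self _).trans (hB t ht')
    linarith [hbd t ht']
  · have h := hyd t ht.1
    have h2 : ‖y t‖ ≤ R := (mem_ball_zero_iff.1 ht.2).le
    simpa only [hg, clampVec_eq h2] using h

lemma IP_pol_right {c p : ℝ} (hp : 0 ≤ p) {f : ℝ → ℝ} (hf : Continuous f) {n : ℕ}
    (r : Fin n → ℝ) :
    IP c p f (pol r) = ∑ i, r i * IP c p f (fun x => x ^ (i : ℕ)) := by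
  have h : ∀ i : Fin n, IntegrableOn (fun x => r i * (dw c x ^ p * (f x * x ^ (i : ℕ)))) Ω₀ :=
    fun i => (integrableOn_Ω₀_dw hp (hf.mul (continuous_pow (i : ℕ)))).const_mul _
  unfold IP
  simp_rw [← integral_const_mul]
  rw [← integral_finsetSum _ fun i _ => h i]
  refine integral_congr_ae (Eventually.of_forall fun x => ?_)
  simp only [pol, Finset.mul_sum]
  exact Finset.sum_congr rfl fun i _ => by ring

lemma deriv_pol {n : ℕ} (r : Fin n → ℝ) (x : ℝ) :
    deriv (pol r) x = ∑ i, r i * deriv (fun y : ℝ => y ^ (i : ℕ)) x := by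
  have := iteratedDeriv_pol r 1 x
  simpa only [iteratedDeriv_one] using this

lemma continuous_deriv_pow (i : ℕ) : Continuous (deriv fun y : ℝ => y ^ i) :=
  (contDiff_id.pow i : ContDiff ℝ 1 fun y : ℝ => y ^ i).continuous_deriv le_rfl

lemma IP_deriv_pol_right {c p : ℝ} (hp : 0 ≤ p) {f : ℝ → ℝ} (hf : Continuous f) {n : ℕ}
    (r : Fin n → ℝ) :
    IP c p f (deriv (pol r)) = ∑ i, r i * IP c p f (deriv fun x => x ^ (i : ℕ)) := by
  have h : ∀ i : Fin n, IntegrableOn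
      (fun x => r i * (dw c x ^ p * (f x * deriv (fun y : ℝ => y ^ (i : ℕ)) x))) Ω₀ :=
    fun i => (integrableOn_Ω₀_dw hp (hf.mul (continuous_deriv_pow (i : ℕ)))).const_mul _
  unfold IP
  simp_rw [← integral_const_mul]
  rw [← integral_finsetSum _ fun i _ => h i]
  refine integral_congr_ae (Eventually.of_forall fun x => ?_)
  simp only [deriv_pol, Finset.mul_sum]
  exact Finset.sum_congr rfl fun i _ => by ring

lemma eqOn_zero_of_W_eq_zero {c p : ℝ} (hc : 0 < c) (hp : 0 ≤ p) {f : ℝ → ℝ} (hf : Continuous f)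
    (h : W c p f = 0) : EqOn f 0 Ω₀ := by
  have hpos : ∀ x ∈ Ω₀, 0 < dw c x := fun x hx => dw_pos hc hx
  have hcont : Continuous fun x => dw c x ^ p * f x ^ 2 :=
    (dw_rpow_continuous c hp).mul (hf.pow 2)
  unfold W at h
  rw [setIntegral_eq_zero_iff_of_nonneg_ae] at h
  · have h2 : EqOn (fun x => dw c x ^ p * f x ^ 2) 0 Ω₀ :=
      Measure.eqOn_open_of_ae_eq h isOpen_Ioo hcont.continuousOn continuousOn_const
    intro x hx
    have h3 := h2 hx
    simp only [Pi.zero_apply, mul_eq_zero, pow_eq_zero_iff, ne_eq, OfNat.ofNat_ne_zero,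
      not_false_eq_true] at h3
    exact h3.resolve_left (Real.rpow_pos_of_pos (hpos x hx) p).ne'
  · exact (ae_restrict_iff' measurableSet_Ω₀).2 (Eventually.of_forall fun x hx =>
      mul_nonneg (Real.rpow_nonneg (hpos x hx).le p) (sq_nonneg _))
  · exact integrableOn_Ω₀_dw hp (hf.pow 2)

lemma pol_coeff_eq_zero {n : ℕ} {q : Fin n → ℝ} (h : EqOn (pol q) 0 Ω₀) : q = 0 := by
  set P : Polynomial ℝ := ∑ i, Polynomial.C (q i) * Polynomial.X ^ (i : ℕ) with hP
  have hev : ∀ x, P.eval x = pol q x := fun x => by simp [hP, pol, Polynomial.eval_finsetSum]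
  have h0 : P = 0 := by
    refine Polynomial.eq_zero_of_infinite_isRoot P ((Ioo_infinite (a := (-1 : ℝ)) (b := 1)
      (by norm_num)).mono fun x hx => ?_)
    rw [mem_ofPred_eq, Polynomial.IsRoot.def, hev]
    exact h hx
  funext i
  have : P.coeff i = q i := by
    rw [hP, Polynomial.finsetSum_coeff, Finset.sum_eq_single i]
    · simp
    · intro j _ hj
      rw [Polynomial.coeff_C_mul, Polynomial.coeff_X_pow, if_neg, mul_zero]
      exact fun h => hj (Fin.ext h.symm)
    · simp
  rw [← this, h0]; simp

lemma pol_add {n : ℕ} (q r : Fin n → ℝ) : pol (q + r) = fun x => pol q x + pol r x := by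
  funext x; simp [pol, add_mul, Finset.sum_add_distrib]

lemma pol_smul {n : ℕ} (s : ℝ) (q : Fin n → ℝ) : pol (s • q) = fun x => s * pol q x := by
  funext x; simp [pol, Finset.mul_sum, mul_assoc]

/-- The Gram map of the monomials. -/
def gramMap (c k : ℝ) (hk : 0 ≤ k) (n : ℕ) : (Fin n → ℝ) →ₗ[ℝ] (Fin n → ℝ) where
  toFun q i := IP c k (pol q) fun x => x ^ (i : ℕ)
  map_add' q r := by
    funext i
    rw [pol_add, IP_add_left hk (pol_smooth q).continuous (pol_smooth r).continuous
      (continuous_pow (i : ℕ))]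
    rfl
  map_smul' s q := by
    funext i
    rw [pol_smul, IP_const_mul_left]
    rfl

lemma gramMap_injective {c k : ℝ} (hc : 0 < c) (hk : 0 ≤ k) (n : ℕ) :
    Function.Injective (gramMap c k hk n) := by
  rw [injective_iff_map_eq_zero]
  intro q hq
  refine pol_coeff_eq_zero (eqOn_zero_of_W_eq_zero hc hk (pol_smooth q).continuous ?_)
  rw [← IP_self, IP_pol_right hk (pol_smooth q).continuous]
  refine Finset.sum_eq_zero fun i _ => ?_
  have : IP c k (pol q) (fun x => x ^ (i : ℕ)) = 0 := congrFun hq i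
  rw [this, mul_zero]

/-- The nonlinear load vector. -/
def loadVec (c k γ : ℝ) (n : ℕ) (q : Fin n → ℝ) (i : Fin n) : ℝ :=
  IP c (k + 1) (fun x => Fc γ (deriv (pol q) x)) (deriv fun x => x ^ (i : ℕ))

lemma abs_deriv_pow_le {n : ℕ} (i : Fin n) {x : ℝ} (hx : x ∈ Ω₀) :
    |deriv (fun y : ℝ => y ^ (i : ℕ)) x| ≤ n := by
  rw [deriv_pow_field, abs_mul, abs_pow, Nat.abs_cast]
  have h1 : |x| ^ ((i : ℕ) - 1) ≤ 1 := pow_le_one₀ (abs_nonneg _) (abs_le.2 ⟨hx.1.le, hx.2.le⟩)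
  have h2 : ((i : ℕ) : ℝ) ≤ n := by exact_mod_cast i.2.le
  nlinarith [abs_nonneg x, pow_nonneg (abs_nonneg x) ((i : ℕ) - 1)]

lemma loadVec_lipschitz {c k : ℝ} (hc : 0 < c) (hk : 0 ≤ k) (γ : ℝ) (n : ℕ) :
    ∃ K : NNReal, LipschitzWith K (loadVec c k γ n) := by
  obtain ⟨K, hK, hL⟩ := Fc_lipschitz γ
  have hk1 : 0 ≤ k + 1 := by linarith
  set I := ∫ x in Ω₀, dw c x ^ (k + 1) * 1 with hI
  have hI0 : 0 ≤ I := setIntegral_nonneg measurableSet_Ω₀ fun x hx =>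
    mul_nonneg (Real.rpow_nonneg (dw_pos hc hx).le _) zero_le_one
  set M : ℝ := I * (K * (n * n) * n) with hM
  have hM0 : 0 ≤ M := by positivity
  refine ⟨M.toNNReal, LipschitzWith.of_dist_le_mul fun q r => ?_⟩
  rw [Real.coe_toNNReal _ hM0, dist_pi_le_iff (by positivity)]
  intro i
  have hcont : ∀ q : Fin n → ℝ, Continuous fun x => Fc γ (deriv (pol q) x) := fun q =>
    (Fc_smooth γ).continuous.comp (smooth_deriv (pol_smooth q)).continuous
  have i1 : ∀ q : Fin n → ℝ, IntegrableOn (fun x => dw c x ^ (k + 1) *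
      (Fc γ (deriv (pol q) x) * deriv (fun y : ℝ => y ^ (i : ℕ)) x)) Ω₀ := fun q =>
    integrableOn_Ω₀_dw hk1 ((hcont q).mul (continuous_deriv_pow _))
  have hpt : ∀ x ∈ Ω₀, |dw c x ^ (k + 1) *
      (Fc γ (deriv (pol q) x) * deriv (fun y : ℝ => y ^ (i : ℕ)) x) - dw c x ^ (k + 1) *
      (Fc γ (deriv (pol r) x) * deriv (fun y : ℝ => y ^ (i : ℕ)) x)| ≤
      dw c x ^ (k + 1) * 1 * (K * (n * n * dist q r) * n) := by
    intro x hx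
    have hd : |deriv (pol q) x - deriv (pol r) x| ≤ n * n * dist q r := by
      rw [deriv_pol, deriv_pol, ← Finset.sum_sub_distrib]
      refine (Finset.abs_sum_le_sum_abs _ _).trans ?_
      have : ∀ j ∈ (Finset.univ : Finset (Fin n)), |q j * deriv (fun y : ℝ => y ^ (j : ℕ)) x -
          r j * deriv (fun y : ℝ => y ^ (j : ℕ)) x| ≤ dist q r * n := fun j _ => by
        rw [← sub_mul, abs_mul]
        exact mul_le_mul (dist_le_pi_dist q r j) (abs_deriv_pow_le j hx) (abs_nonneg _) dist_nonneg
      refine (Finset.sum_le_sum this).trans (le_of_eq ?_)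
      simp; ring
    have hw := Real.rpow_nonneg (dw_pos hc hx).le (k + 1)
    rw [← mul_sub, ← sub_mul, abs_mul, abs_mul, abs_of_nonneg hw, mul_one]
    refine mul_le_mul_of_nonneg_left (mul_le_mul ((hL _ _).trans ?_) (abs_deriv_pow_le i hx)
      (abs_nonneg _) (by positivity)) hw
    exact mul_le_mul_of_nonneg_left hd hK
  rw [Real.dist_eq]
  unfold loadVec IP
  rw [← integral_sub (i1 q) (i1 r)]
  refine abs_integral_le_integral_abs.trans ?_
  refine (setIntegral_mono_on ((i1 q).sub (i1 r)).abs ?_ measurableSet_Ω₀ hpt).trans ?_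
  · exact (integrableOn_Ω₀_dw hk1 continuous_const).mul_const _
  · rw [integral_mul_const, ← hI, hM]
    apply le_of_eq; ring

lemma exists_gram_solve {c k : ℝ} (hc : 0 < c) (hk : 0 ≤ k) (γ : ℝ) (n : ℕ) :
    ∃ (Sb : (Fin n → ℝ) → Fin n → ℝ) (K : NNReal), LipschitzWith K Sb ∧
      ∀ q, gramMap c k hk n (Sb q) = loadVec c k γ n q := by
  obtain ⟨Kb, hKb⟩ := loadVec_lipschitz hc hk γ n
  set G := LinearEquiv.ofInjectiveEndo (gramMap c k hk n) (gramMap_injective hc hk n) with hG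
  set S : (Fin n → ℝ) →L[ℝ] (Fin n → ℝ) := LinearMap.toContinuousLinearMap G.symm.toLinearMap
  exact ⟨fun q => S (loadVec c k γ n q), _, S.lipschitz.comp hKb,
    fun q => G.apply_symm_apply (loadVec c k γ n q)⟩

lemma exists_Gal {c k γ : ℝ} {α α' : ℝ → ℝ} (hc : 0 < c) (hk : 0 ≤ k)
    (hα : IsExpansion γ α α') (n : ℕ) {T : ℝ} (hT : 0 ≤ T) (e₀ : Fin n → ℝ) :
    ∃ (J : Set ℝ) (q e e' : ℝ → Fin n → ℝ), Gal c k γ α α' n J q e e' ∧ Icc 0 T ⊆ J ∧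
      q 0 = 0 ∧ e 0 = e₀ := by
  have hk1 : 0 ≤ k + 1 := by linarith
  obtain ⟨Sb, Ks, hSb, hGS⟩ := exists_gram_solve hc hk γ n
  set A : ℝ → ℝ := fun t => (α (max t 0) ^ (γ + 1))⁻¹ with hA
  set B : ℝ → ℝ := fun t => A t * (2 * α (max t 0) ^ γ * α' (max t 0)) with hB
  have hmem : ∀ t : ℝ, max t 0 ∈ Ici (0 : ℝ) := fun t => mem_Ici.2 (le_max_right _ _)
  have hmc : Continuous fun t : ℝ => max t 0 := continuous_id.max continuous_const
  have hαc : Continuous fun t => α (max t 0) := hα.cont.comp_continuous hmc hmem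
  have hαc' : Continuous fun t => α' (max t 0) := hα.cont'.comp_continuous hmc hmem
  have hαp : ∀ t, 0 < α (max t 0) := fun t => hα.pos _ (hmem t)
  have hAc : Continuous A := by
    refine Continuous.inv₀ (hαc.rpow_const fun t => Or.inl (hαp t).ne') fun t => ?_
    exact (Real.rpow_pos_of_pos (hαp t) _).ne'
  have hBc : Continuous B := by
    refine hAc.mul ((continuous_const.mul (hαc.rpow_const fun t => Or.inl (hαp t).ne')).mul hαc')
  obtain ⟨MA, hMA⟩ := (isCompact_Icc (a := (-1 : ℝ)) (b := T + 1)).exists_bound_of_continuousOn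
    hAc.continuousOn
  obtain ⟨MB, hMB⟩ := (isCompact_Icc (a := (-1 : ℝ)) (b := T + 1)).exists_bound_of_continuousOn
    hBc.continuousOn
  have hAα : ∀ t, 0 ≤ t → α t ^ (γ + 1) * A t = 1 := fun t ht => by
    simp only [hA, max_eq_left ht]
    exact mul_inv_cancel₀ (Real.rpow_pos_of_pos (hα.pos t ht) _).ne'
  have hBα : ∀ t, 0 ≤ t → B t = A t * (2 * α t ^ γ * α' t) := fun t ht => by
    simp only [hB, max_eq_left ht]
  clear_value A B
  have hmemT : (0 : ℝ) ∈ Icc (-1) (T + 1) := ⟨by norm_num, by linarith⟩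
  have hMA0 : 0 ≤ MA := (norm_nonneg _).trans (hMA 0 hmemT)
  have hMB0 : 0 ≤ MB := (norm_nonneg _).trans (hMB 0 hmemT)
  set f : ℝ → (Fin n ⊕ Fin n → ℝ) → (Fin n ⊕ Fin n → ℝ) := fun t x =>
    Sum.elim (fun i => x (Sum.inr i)) fun i =>
      -(B t) * x (Sum.inr i) - A t * (x (Sum.inl i) + Sb (fun j => x (Sum.inl j)) i) with hf
  have hSbc : Continuous fun z : Fin n ⊕ Fin n → ℝ => Sb (fun j => z (Sum.inl j)) :=
    hSb.continuous.comp (by fun_prop)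
  have hfc : Continuous fun z : ℝ × (Fin n ⊕ Fin n → ℝ) => f z.1 z.2 := by
    refine continuous_pi fun i => ?_
    rcases i with i | i
    · simp only [hf, Sum.elim_inl]; fun_prop
    · simp only [hf, Sum.elim_inr]
      have h1 : Continuous fun z : ℝ × (Fin n ⊕ Fin n → ℝ) =>
          Sb (fun j => z.2 (Sum.inl j)) i :=
        (continuous_apply i).comp (hSbc.comp continuous_snd)
      have h2 : ∀ j, Continuous fun z : ℝ × (Fin n ⊕ Fin n → ℝ) => z.2 j := fun j =>
        (continuous_apply j).comp continuous_snd
      exact ((hBc.comp continuous_fst).neg.mul (h2 _)).sub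
        ((hAc.comp continuous_fst).mul ((h2 _).add h1))
  set K : ℝ := 1 + MB + MA * (1 + Ks) with hK
  have hK0 : 0 ≤ K := by positivity
  obtain ⟨y, J, hJ, hTJ, hy0, hy⟩ := exists_ode_solution f hfc hT (K := K.toNNReal)
    (fun t ht => LipschitzWith.of_dist_le_mul fun x z => by
      rw [Real.coe_toNNReal _ hK0, dist_pi_le_iff (by positivity)]
      have hD := fun j => dist_le_pi_dist x z j
      have hD0 : 0 ≤ dist x z := dist_nonneg
      have hA1 := hMA t ht
      have hB1 := hMB t ht
      rw [Real.norm_eq_abs] at hA1 hB1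
      intro i
      rcases i with i | i
      · simp only [hf, Sum.elim_inl]
        refine (hD _).trans (le_mul_of_one_le_left hD0 ?_)
        have : 0 ≤ MA * (1 + (Ks : ℝ)) := by positivity
        linarith
      · simp only [hf, Sum.elim_inr]
        have h1 : dist (Sb (fun j => x (Sum.inl j)) i) (Sb (fun j => z (Sum.inl j)) i) ≤
            Ks * dist x z := by
          refine (dist_le_pi_dist _ _ i).trans ((hSb.dist_le_mul _ _).trans ?_)
          refine mul_le_mul_of_nonneg_left ?_ Ks.2
          exact (dist_pi_le_iff hD0).2 fun j => hD _
        have h2 := hD (Sum.inl i)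
        have h3 := hD (Sum.inr i)
        rw [Real.dist_eq] at h1 h2 h3 ⊢
        have e1 : -(B t) * x (Sum.inr i) - A t * (x (Sum.inl i) + Sb (fun j => x (Sum.inl j)) i) -
          (-(B t) * z (Sum.inr i) - A t * (z (Sum.inl i) + Sb (fun j => z (Sum.inl j)) i)) =
          -(B t * (x (Sum.inr i) - z (Sum.inr i))) - A t * ((x (Sum.inl i) - z (Sum.inl i)) +
            (Sb (fun j => x (Sum.inl j)) i - Sb (fun j => z (Sum.inl j)) i)) := by ring
        rw [e1]
        refine (abs_sub _ _).trans ?_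
        rw [abs_neg, abs_mul, abs_mul]
        have h4 := mul_le_mul hB1 h3 (abs_nonneg _) hMB0
        have h5 := mul_le_mul hA1 ((abs_add_le _ _).trans (add_le_add h2 h1)) (abs_nonneg _) hMA0
        rw [hK]
        nlinarith [h4, h5, hD0])
    (Sum.elim 0 e₀)
  refine ⟨J, fun t i => y t (Sum.inl i), fun t i => y t (Sum.inr i),
    fun t i => f t (y t) (Sum.inr i), ⟨hJ, fun t ht => ?_, fun t ht => ?_, ?_, ?_⟩, hTJ, ?_, ?_⟩
  · exact hasDerivAt_pi.2 fun i => (hasDerivAt_pi.1 (hy t ht)) (Sum.inl i)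
  · exact hasDerivAt_pi.2 fun i => (hasDerivAt_pi.1 (hy t ht)) (Sum.inr i)
  · have hyc : ContinuousOn y J := fun t ht => (hy t ht).continuousAt.continuousWithinAt
    have : ContinuousOn (fun t => f t (y t)) J :=
      hfc.comp_continuousOn (continuousOn_id.prodMk hyc)
    exact continuousOn_pi.2 fun i => (continuousOn_pi.1 this) (Sum.inr i)
  · intro t _ ht0 φ hφ
    obtain ⟨r, rfl⟩ := hφ.exists_pol
    have hFc : Continuous fun x => Fc γ (deriv (pol fun i => y t (Sum.inl i)) x) :=
      (Fc_smooth γ).continuous.comp (smooth_deriv (pol_smooth _)).continuous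
    rw [IP_pol_right hk (pol_smooth _).continuous, IP_pol_right hk (pol_smooth _).continuous,
      IP_pol_right hk (pol_smooth _).continuous, IP_deriv_pol_right hk1 hFc, Finset.mul_sum,
      Finset.mul_sum, ← Finset.sum_add_distrib, ← Finset.sum_add_distrib,
      ← Finset.sum_add_distrib]
    refine Finset.sum_eq_zero fun i _ => ?_
    have hvec : (fun i => f t (y t) (Sum.inr i)) = -(B t) • (fun i => y t (Sum.inr i)) -
        A t • ((fun i => y t (Sum.inl i)) + Sb fun i => y t (Sum.inl i)) := rfl
    have hg := congrFun (congrArg (gramMap c k hk n) hvec) i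
    rw [map_sub, map_smul, map_smul, map_add, hGS] at hg
    have hg' : IP c k (pol fun i => f t (y t) (Sum.inr i)) (fun x => x ^ (i : ℕ)) =
        -(B t) * IP c k (pol fun i => y t (Sum.inr i)) (fun x => x ^ (i : ℕ)) -
        A t * (IP c k (pol fun i => y t (Sum.inl i)) (fun x => x ^ (i : ℕ)) +
          IP c (k + 1) (fun x => Fc γ (deriv (pol fun i => y t (Sum.inl i)) x))
            (deriv fun x => x ^ (i : ℕ))) := hg
    rw [hg']
    have hAt := hAα t ht0
    have hBt := hBα t ht0
    rw [hBt]
    linear_combination (-(r i * (2 * α t ^ γ * α' t *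
      IP c k (pol fun i => y t (Sum.inr i)) (fun x => x ^ (i : ℕ)) +
        (IP c k (pol fun i => y t (Sum.inl i)) (fun x => x ^ (i : ℕ)) +
          IP c (k + 1) (fun x => Fc γ (deriv (pol fun i => y t (Sum.inl i)) x))
            (deriv fun x => x ^ (i : ℕ)))))) * hAt
  · funext i; simp only [hy0]; rfl
  · funext i; simp only [hy0]; rfl

lemma Polynomial.exists_antideriv (P : Polynomial ℝ) (s : ℝ) :
    ∃ Q : Polynomial ℝ, Polynomial.derivative Q = P ∧ Q.eval 0 = s := by
  suffices h : ∃ Q : Polynomial ℝ, Polynomial.derivative Q = P by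
    obtain ⟨Q, hQ⟩ := h
    exact ⟨Q + Polynomial.C (s - Q.eval 0), by simp [hQ], by simp⟩
  induction P using Polynomial.induction_on' with
  | add p q hp hq =>
    obtain ⟨P, rfl⟩ := hp
    obtain ⟨Q, rfl⟩ := hq
    exact ⟨P + Q, by simp⟩
  | monomial n r =>
    refine ⟨Polynomial.monomial (n + 1) (r / (n + 1)), ?_⟩
    rw [Polynomial.derivative_monomial]
    have : (n : ℝ) + 1 ≠ 0 := by positivity
    simp [div_mul_cancel₀ _ this]

lemma exists_polynomial_approx (m : ℕ) : ∀ g : ℕ → ℝ → ℝ, ContinuousOn (g m) (Icc (-1) 1) →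
    (∀ j < m, ∀ x ∈ Ω₀, HasDerivAt (g j) (g (j + 1) x) x) → ∀ r > (0 : ℝ),
    ∃ P : Polynomial ℝ, ∀ j ≤ m, ∀ x ∈ Ω₀,
      |iteratedDeriv j (fun y => P.eval y) x - g j x| ≤ r := by
  induction m with
  | zero =>
    intro g hg _ r hr
    obtain ⟨P, hP⟩ := exists_polynomial_near_of_continuousOn (-1) 1 (g 0) hg r hr
    refine ⟨P, fun j hj x hx => ?_⟩
    obtain rfl : j = 0 := by omega
    rw [iteratedDeriv_zero]
    exact (hP x (Ioo_subset_Icc_self hx)).le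
  | succ m ih =>
    intro g hg hd r hr
    obtain ⟨P, hP⟩ := ih (fun j => g (j + 1)) hg (fun j hj => hd (j + 1) (by omega)) r hr
    obtain ⟨Q, hQ, hQ0⟩ := Polynomial.exists_antideriv P (g 0 0)
    have hder : deriv (fun y => Q.eval y) = fun y => P.eval y := by
      funext y; rw [Polynomial.deriv, hQ]
    refine ⟨Q, fun j hj x hx => ?_⟩
    rcases j with _ | j
    · rw [iteratedDeriv_zero]
      have h0 : (0 : ℝ) ∈ Ω₀ := ⟨by norm_num, by norm_num⟩
      have hdiff : ∀ y ∈ Ω₀, HasDerivWithinAt (fun y => Q.eval y - g 0 y)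
          (P.eval y - g 1 y) Ω₀ y := fun y hy => by
        have := (Q.hasDerivAt y).sub (hd 0 (by omega) y hy)
        rw [hQ] at this
        exact this.hasDerivWithinAt
      have hb : ∀ y ∈ Ω₀, ‖P.eval y - g 1 y‖ ≤ r := fun y hy => by
        have := hP 0 (by omega) y hy
        rwa [iteratedDeriv_zero] at this
      have h := (convex_Ioo (-1 : ℝ) 1).norm_image_sub_le_of_norm_hasDerivWithin_le hdiff hb h0 hx
      rw [hQ0, sub_self, sub_zero, sub_zero, Real.norm_eq_abs, Real.norm_eq_abs] at h
      refine h.trans (mul_le_of_le_one_right hr.le ?_)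
      exact abs_le.2 ⟨hx.1.le, hx.2.le⟩
    · rw [iteratedDeriv_succ', hder]
      exact hP j (by omega) x hx

lemma eqOn_iteratedDeriv_of_hasDerivAt {s : Set ℝ} (hs : IsOpen s) {f : ℝ → ℝ} {g : ℕ → ℝ → ℝ}
    {m : ℕ} (h0 : EqOn f (g 0) s) (hd : ∀ j < m, ∀ x ∈ s, HasDerivAt (g j) (g (j + 1) x) x) :
    ∀ j ≤ m, EqOn (iteratedDeriv j f) (g j) s := by
  intro j
  induction j with
  | zero => intro _ x hx; rw [iteratedDeriv_zero]; exact h0 hx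
  | succ j ih =>
    intro hj x hx
    rw [iteratedDeriv_succ]
    have h : iteratedDeriv j f =ᶠ[𝓝 x] g j := (ih (by omega)).eventuallyEq_of_mem (hs.mem_nhds hx)
    rw [h.deriv_eq]
    exact (hd j (by omega) x hx).deriv

lemma exists_jet {u : ℝ → ℝ} (hu : ∀ n : ℕ, ContDiffOn ℝ n u (Icc (-1) 1)) :
    ∃ g : ℕ → ℝ → ℝ, (∀ j, ContinuousOn (g j) (Icc (-1) 1)) ∧
      (∀ j, ∀ x ∈ Ω₀, HasDerivAt (g j) (g (j + 1) x) x) ∧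
      ∀ j, EqOn (iteratedDeriv j u) (g j) Ω₀ := by
  have hud : UniqueDiffOn ℝ (Icc (-1 : ℝ) 1) := uniqueDiffOn_Icc (by norm_num)
  set g : ℕ → ℝ → ℝ := fun j => iteratedDerivWithin j u (Icc (-1) 1) with hg
  have h1 : ∀ j, ContinuousOn (g j) (Icc (-1) 1) := fun j =>
    (hu j).continuousOn_iteratedDerivWithin le_rfl hud
  have h2 : ∀ j, ∀ x ∈ Ω₀, HasDerivAt (g j) (g (j + 1) x) x := fun j x hx => by
    have hx' : x ∈ Icc (-1 : ℝ) 1 := Ioo_subset_Icc_self hx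
    have hd := (hu (j + 1)).differentiableOn_iteratedDerivWithin (m := j)
      (by exact_mod_cast Nat.lt_succ_self j) hud x hx'
    have := hd.hasDerivWithinAt
    rw [← iteratedDerivWithin_succ] at this
    exact this.hasDerivAt (Icc_mem_nhds hx.1 hx.2)
  refine ⟨g, h1, h2, fun j => ?_⟩
  refine eqOn_iteratedDeriv_of_hasDerivAt (m := j) isOpen_Ioo (fun x hx => ?_) (fun i _ => h2 i) j
    le_rfl
  simp [hg]

lemma exists_polynomial_near_initial {c k : ℝ} (hc : 0 < c) (hk : 0 ≤ k) (a : ℕ) {u : ℝ → ℝ}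
    (hu : ∀ n : ℕ, ContDiffOn ℝ n u (Icc (-1) 1)) {ε : ℝ} (hN : N c k a u < ε) {r : ℝ}
    (hr : 0 < r) :
    ∃ P : Polynomial ℝ, N c k a (fun y => P.eval y) < ε ∧ ∀ x ∈ Ω₀, |P.eval x - u x| ≤ r := by
  obtain ⟨g, hgc, hgd, hge⟩ := exists_jet hu
  have hbd : ∀ j, ∃ M, ∀ x ∈ Icc (-1 : ℝ) 1, ‖g j x‖ ≤ M := fun j =>
    isCompact_Icc.exists_bound_of_continuousOn (hgc j)
  choose M hM using hbd
  have hM0 : ∀ j, 0 ≤ M j := fun j => (norm_nonneg _).trans (hM j 0 ⟨by norm_num, by norm_num⟩)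
  have hkj : ∀ j : ℕ, 0 ≤ k + j := fun j => by positivity
  set I : ℕ → ℝ := fun j => ∫ x in Ω₀, dw c x ^ (k + j) * 1 with hI
  have hI0 : ∀ j, 0 ≤ I j := fun j => setIntegral_nonneg measurableSet_Ω₀ fun x hx =>
    mul_nonneg (Real.rpow_nonneg (dw_pos hc hx).le _) zero_le_one
  set S := ∑ j ∈ Finset.range (a + 1), I j * (2 * M j + 1) with hS
  have hS0 : 0 ≤ S := Finset.sum_nonneg fun j _ => mul_nonneg (hI0 j) (by linarith [hM0 j])
  set s := min (min r 1) ((ε - N c k a u) / (2 * (S + 1))) with hs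
  have hgap : 0 < ε - N c k a u := by linarith
  have hs0 : 0 < s := lt_min (lt_min hr one_pos) (by positivity)
  have hs1 : s ≤ 1 := (min_le_left _ _).trans (min_le_right _ _)
  obtain ⟨P, hP⟩ := exists_polynomial_approx a g (hgc a) (fun j _ => hgd j) s hs0
  have hPs : ContDiff ℝ ∞ fun y => P.eval y := PolyLT.smooth (n := P.natDegree + 1)
    ⟨P, fun j hj => Polynomial.coeff_eq_zero_of_natDegree_lt hj, rfl⟩
  refine ⟨P, ?_, fun x hx => ?_⟩
  · have hterm : ∀ j ∈ Finset.range (a + 1), W c (k + j) (iteratedDeriv j fun y => P.eval y) ≤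
        W c (k + j) (iteratedDeriv j u) + s * (I j * (2 * M j + 1)) := by
      intro j hj
      have hja : j ≤ a := by simpa [Nat.lt_succ_iff] using hj
      have e1 : W c (k + j) (iteratedDeriv j u) = W c (k + j) (g j) := by
        unfold W
        exact setIntegral_congr_fun measurableSet_Ω₀ fun x hx => by simp only [hge j hx]
      rw [e1]
      have i1 : IntegrableOn (fun x => dw c x ^ (k + j) * g j x ^ 2) Ω₀ := by
        have : ContinuousOn (fun x => dw c x ^ (k + j) * g j x ^ 2) (Icc (-1) 1) :=
          (dw_rpow_continuous c (hkj j)).continuousOn.mul ((hgc j).pow 2)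
        exact (this.integrableOn_compact isCompact_Icc).mono_set Ioo_subset_Icc_self
      have i2 : IntegrableOn (fun x => dw c x ^ (k + j) * 1 * (s * (2 * M j + 1))) Ω₀ :=
        (integrableOn_Ω₀_dw (hkj j) continuous_const).mul_const _
      have i3 : IntegrableOn (fun x => dw c x ^ (k + j) *
          (iteratedDeriv j fun y => P.eval y) x ^ 2) Ω₀ :=
        integrableOn_Ω₀_dw (hkj j) ((continuous_iteratedDeriv' hPs j).pow 2)
      calc W c (k + j) (iteratedDeriv j fun y => P.eval y)
          ≤ ∫ x in Ω₀, (dw c x ^ (k + j) * g j x ^ 2 +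
              dw c x ^ (k + j) * 1 * (s * (2 * M j + 1))) := by
            refine setIntegral_mono_on i3 (i1.add i2) measurableSet_Ω₀ fun x hx => ?_
            have hw := Real.rpow_nonneg (dw_pos hc hx).le (k + j)
            have h1 := hP j hja x hx
            have h2 := hM j x (Ioo_subset_Icc_self hx)
            rw [Real.norm_eq_abs] at h2
            set p := iteratedDeriv j (fun y => P.eval y) x
            have h3 : p ^ 2 ≤ g j x ^ 2 + s * (2 * M j + 1) := by
              have e : p ^ 2 = g j x ^ 2 + 2 * (g j x * (p - g j x)) + (p - g j x) ^ 2 := by ring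
              have h4 : g j x * (p - g j x) ≤ M j * s :=
                (le_abs_self _).trans (by rw [abs_mul]; gcongr; exact hM0 j)
              have h5 : (p - g j x) ^ 2 ≤ s := by
                rw [← sq_abs]; nlinarith [abs_nonneg (p - g j x)]
              rw [e]; linarith
            nlinarith
        _ = W c (k + j) (g j) + s * (I j * (2 * M j + 1)) := by
            rw [integral_add i1 i2, integral_mul_const]
            unfold W; simp only [hI]; ring
    have h6 : N c k a (fun y => P.eval y) ≤ N c k a u + s * S := by
      unfold N
      rw [hS, Finset.mul_sum, ← Finset.sum_add_distrib]
      exact Finset.sum_le_sum hterm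
    have h7 : s * S ≤ (ε - N c k a u) / 2 := by
      have : s ≤ (ε - N c k a u) / (2 * (S + 1)) := min_le_right _ _
      rw [le_div_iff₀ (by positivity)] at this
      nlinarith
    linarith
  · have := hP 0 (Nat.zero_le _) x hx
    rw [iteratedDeriv_zero, ← hge 0 hx, iteratedDeriv_zero] at this
    exact this.trans ((min_le_left _ _).trans (min_le_left _ _))

lemma exists_pol_initial {c k : ℝ} (hc : 0 < c) (hk : 0 ≤ k) (a : ℕ) {u : ℝ → ℝ}
    (hu : ∀ n : ℕ, ContDiffOn ℝ n u (Icc (-1) 1)) {ε : ℝ} (hN : N c k a u < ε) :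
    ∃ (m : ℕ → ℕ) (e₀ : ∀ n, Fin (m n) → ℝ), (∀ n, n ≤ m n) ∧
      (∀ n, N c k a (pol (e₀ n)) < ε) ∧
      ∀ x ∈ Ω₀, Tendsto (fun n => pol (e₀ n) x) atTop (𝓝 (u x)) := by
  have h : ∀ n : ℕ, ∃ P : Polynomial ℝ, N c k a (fun y => P.eval y) < ε ∧
      ∀ x ∈ Ω₀, |P.eval x - u x| ≤ 1 / ((n : ℝ) + 1) := fun n =>
    exists_polynomial_near_initial hc hk a hu hN (by positivity)
  choose P hPN hPu using h
  have hpol : ∀ n, ∃ q : Fin (max n ((P n).natDegree + 1)) → ℝ, (fun y => (P n).eval y) = pol q :=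
    fun n => PolyLT.exists_pol ⟨P n, fun j hj => Polynomial.coeff_eq_zero_of_natDegree_lt (by
      have := le_max_right n ((P n).natDegree + 1); omega), rfl⟩
  choose q hq using hpol
  refine ⟨_, q, fun n => le_max_left _ _, fun n => by rw [← hq]; exact hPN n, fun x hx => ?_⟩
  rw [tendsto_iff_norm_sub_tendsto_zero]
  refine squeeze_zero (fun _ => norm_nonneg _) (fun n => ?_) tendsto_one_div_add_atTop_nhds_zero_nat
  rw [← hq]
  exact hPu n x hx

lemma exists_bound_sq {f : ℝ → ℝ} (hf : Continuous f) : ∃ S, 0 ≤ S ∧ ∀ x ∈ Ω₀, f x ^ 2 ≤ S := by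
  obtain ⟨S, hS⟩ := (isCompact_Icc (a := (-1 : ℝ)) (b := 1)).exists_bound_of_continuousOn
    (hf.pow 2).continuousOn
  refine ⟨S, (norm_nonneg _).trans (hS 0 ⟨by norm_num, by norm_num⟩), fun x hx => ?_⟩
  exact (le_abs_self _).trans (hS x (Ioo_subset_Icc_self hx))

lemma W_dw_pow_mul_le {c k : ℝ} (hc : 0 < c) (hk : 0 ≤ k) {a : ℕ} (b : ℕ) :
    ∀ (j : ℕ) (q : ℝ), j ≤ a → 0 ≤ q → k + 2 * j - a - 2 * b ≤ q →
    ∃ C : ℝ, 0 ≤ C ∧ ∀ u : ℝ → ℝ, ContDiff ℝ ∞ u →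
      W c q (iteratedDeriv j fun x => dw c x ^ b * u x) ≤ C * N c k a u := by
  induction b with
  | zero =>
    intro j q hj hq h
    obtain ⟨C, hC, hW⟩ := W_le_const_N hc hk hj hq (by push_cast at h; linarith)
    exact ⟨C, hC, fun u hu => by simpa using hW u hu⟩
  | succ b ih =>
    intro j q hj hq h
    push_cast at h
    have hterm : ∀ i ∈ Finset.range (j + 1), ∃ C : ℝ, 0 ≤ C ∧ ∀ u : ℝ → ℝ, ContDiff ℝ ∞ u →
        W c q (fun x => (j.choose i * iteratedDeriv i (dw c) x) *
          iteratedDeriv (j - i) (fun x => dw c x ^ b * u x) x) ≤ C * N c k a u := by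
      intro i hi
      have hij : i ≤ j := by simpa [Nat.lt_succ_iff] using hi
      have hcont : Continuous fun x => (j.choose i * iteratedDeriv i (dw c) x) :=
        continuous_const.mul (continuous_iteratedDeriv' (dw_contDiff c) i)
      have hg : ∀ u : ℝ → ℝ, ContDiff ℝ ∞ u → Continuous
          (iteratedDeriv (j - i) (fun x => dw c x ^ b * u x)) := fun u hu =>
        continuous_iteratedDeriv' (((dw_contDiff c).pow b).mul hu) _
      have hcast : ((j - i : ℕ) : ℝ) = j - i := Nat.cast_sub hij
      rcases Nat.eq_zero_or_pos i with rfl | hi0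
      · obtain ⟨C, hC, hW⟩ := ih (j - 0) (q + 2) (by omega) (by linarith)
          (by rw [hcast]; push_cast; linarith)
        refine ⟨c ^ (q - -2 - (q + 2)) * 1 * C, by positivity, fun u hu => ?_⟩
        refine (W_mul_le hc hq (σ := -2) (q := q + 2) (S := 1) (by linarith) (by linarith) hcont
          (hg u hu) fun x hx => ?_).trans ?_
        · have h0 := dw_pos hc hx
          rw [iteratedDeriv_zero, Nat.choose_zero_right, Nat.cast_one, one_mul,
            ← Real.rpow_natCast, ← Real.rpow_add h0]
          norm_num
        · rw [mul_assoc _ C]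
          exact mul_le_mul_of_nonneg_left (hW u hu) (by positivity)
      · have hi1 : (1 : ℝ) ≤ i := by exact_mod_cast hi0
        obtain ⟨C, hC, hW⟩ := ih (j - i) q (by omega) hq (by rw [hcast]; linarith)
        obtain ⟨S, hS0, hS⟩ := exists_bound_sq hcont
        refine ⟨c ^ (q - 0 - q) * S * C, by positivity, fun u hu => ?_⟩
        refine (W_mul_le hc hq (σ := 0) (q := q) (S := S) (by linarith) hq hcont
          (hg u hu) fun x hx => ?_).trans ?_
        · rw [Real.rpow_zero, one_mul]; exact hS x hx
        · rw [mul_assoc _ C]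
          exact mul_le_mul_of_nonneg_left (hW u hu) (by positivity)
    choose! C hC hW using hterm
    refine ⟨(j + 1) * ∑ i ∈ Finset.range (j + 1), C i,
      mul_nonneg (by positivity) (Finset.sum_nonneg hC), fun u hu => ?_⟩
    have hbu : ContDiff ℝ ∞ fun x => dw c x ^ b * u x := ((dw_contDiff c).pow b).mul hu
    have e : (fun x => dw c x ^ (b + 1) * u x) = fun x => dw c x * (dw c x ^ b * u x) := by
      funext x; ring
    rw [e, W_congr (fun x _ => iD_mul (dw_contDiff c) hbu j x)]
    refine (W_sum_le hc hq _ fun i hi => ?_).trans ?_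
    · exact (continuous_const.mul (continuous_iteratedDeriv' (dw_contDiff c) i)).mul
        (continuous_iteratedDeriv' hbu _)
    · rw [Finset.card_range, mul_assoc, Finset.sum_mul]
      push_cast
      exact mul_le_mul_of_nonneg_left (Finset.sum_le_sum fun i hi => hW i hi u hu) (by positivity)

lemma rpow_sub_le {θ s t : ℝ} (hθ0 : 0 < θ) (hθ1 : θ ≤ 1) (hs : 0 ≤ s) (hst : s ≤ t) :
    t ^ θ - s ^ θ ≤ (t - s) ^ θ := by
  have := Real.rpow_add_le_add_rpow (p := θ) hs (sub_nonneg.2 hst) hθ0.le hθ1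
  rw [add_sub_cancel] at this
  linarith

lemma integral_dw_neg_le {c θ : ℝ} (hc : 0 < c) (hθ0 : 0 < θ) (hθ1 : θ < 1) {x y : ℝ}
    (hx : x ∈ Ω₀) (hy : y ∈ Ω₀) (hxy : x ≤ y) :
    ∫ s in Ioo x y, dw c s ^ (-(1 - θ)) ≤ 2 * c ^ (-(1 - θ)) / θ * (y - x) ^ θ := by
  have hsub : Ioo x y ⊆ Ω₀ := fun s hs => ⟨hx.1.trans hs.1, hs.2.trans hy.2⟩
  set r := -(1 - θ) with hr
  have hr1 : -1 < r := by linarith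
  have hr0 : r ≤ 0 := by linarith
  have hrθ : r + 1 = θ := by linarith
  have i1 : IntervalIntegrable (fun s : ℝ => (1 - s) ^ r) volume x y := by
    have h := intervalIntegral.intervalIntegrable_rpow' (a := 1 - x) (b := 1 - y) hr1
    simpa using h.comp_sub_left (1 : ℝ)
  have i2 : IntervalIntegrable (fun s : ℝ => (1 + s) ^ r) volume x y := by
    have h := intervalIntegral.intervalIntegrable_rpow' (a := 1 + x) (b := 1 + y) hr1
    simpa using h.comp_add_left (1 : ℝ)
  have e1 : ∫ s in x..y, (1 - s) ^ r = ((1 - x) ^ θ - (1 - y) ^ θ) / θ := by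
    rw [intervalIntegral.integral_comp_sub_left (fun s => s ^ r) 1, integral_rpow (Or.inl hr1), hrθ]
  have e2 : ∫ s in x..y, (1 + s) ^ r = ((1 + y) ^ θ - (1 + x) ^ θ) / θ := by
    rw [intervalIntegral.integral_comp_add_left (fun s => s ^ r) 1, integral_rpow (Or.inl hr1), hrθ]
  have hmaj : ∀ s ∈ Ioo x y, dw c s ^ r ≤ c ^ r * ((1 - s) ^ r + (1 + s) ^ r) := by
    intro s hs
    have hs' := hsub hs
    have h1 : 0 < 1 - s := by linarith [hs'.2]
    have h2 : 0 < 1 + s := by linarith [hs'.1]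
    rcases le_total 0 s with h | h
    · have : c * (1 - s) ≤ dw c s :=
        mul_le_mul_of_nonneg_left (by nlinarith [mul_nonneg h h1.le]) hc.le
      have h3 := Real.rpow_le_rpow_of_nonpos (by positivity) this hr0
      rw [Real.mul_rpow hc.le h1.le] at h3
      nlinarith [Real.rpow_nonneg h2.le r, Real.rpow_pos_of_pos hc r]
    · have : c * (1 + s) ≤ dw c s :=
        mul_le_mul_of_nonneg_left (by nlinarith [mul_nonneg (neg_nonneg.2 h) h2.le]) hc.le
      have h3 := Real.rpow_le_rpow_of_nonpos (by positivity) this hr0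
      rw [Real.mul_rpow hc.le h2.le] at h3
      nlinarith [Real.rpow_nonneg h1.le r, Real.rpow_pos_of_pos hc r]
  have i0 : IntegrableOn (fun s => dw c s ^ r) (Ioo x y) :=
    (integrableOn_dw_neg hc (by linarith) (by linarith : 1 - θ < 1)).mono_set hsub
  have i3 : IntegrableOn (fun s : ℝ => c ^ r * ((1 - s) ^ r + (1 + s) ^ r)) (Ioo x y) :=
    (intervalIntegrable_iff_integrableOn_Ioo_of_le hxy).1 ((i1.add i2).const_mul _)
  refine (setIntegral_mono_on i0 i3 measurableSet_Ioo hmaj).trans ?_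
  rw [← integral_Ioc_eq_integral_Ioo, ← intervalIntegral.integral_of_le hxy,
    intervalIntegral.integral_const_mul, intervalIntegral.integral_add i1 i2, e1, e2]
  have h1 := rpow_sub_le hθ0 hθ1.le (s := 1 - y) (t := 1 - x) (by linarith [hy.2]) (by linarith)
  have h2 := rpow_sub_le hθ0 hθ1.le (s := 1 + x) (t := 1 + y) (by linarith [hx.1]) (by linarith)
  rw [show 1 - x - (1 - y) = y - x by ring] at h1
  rw [show 1 + y - (1 + x) = y - x by ring] at h2
  calc c ^ r * (((1 - x) ^ θ - (1 - y) ^ θ) / θ + ((1 + y) ^ θ - (1 + x) ^ θ) / θ)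
      ≤ c ^ r * ((y - x) ^ θ / θ + (y - x) ^ θ / θ) := by gcongr
    _ = _ := by ring

def gagKernel (θ x y s : ℝ) : ENNReal :=
  if -1 < x ∧ x < s ∧ s < y ∧ y < 1 then ENNReal.ofReal ((y - x) ^ (-1 - θ)) else 0

lemma measurable_gagKernel (θ : ℝ) :
    Measurable fun p : ℝ × ℝ × ℝ => gagKernel θ p.1 p.2.1 p.2.2 := by
  unfold gagKernel
  refine Measurable.ite ?_ ?_ measurable_const
  · exact (measurableSet_lt measurable_const measurable_fst).inter
      ((measurableSet_lt measurable_fst (measurable_snd.comp measurable_snd)).inter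
        ((measurableSet_lt (measurable_snd.comp measurable_snd)
          (measurable_fst.comp measurable_snd)).inter
          (measurableSet_lt (measurable_fst.comp measurable_snd) measurable_const)))
  · exact (((measurable_fst.comp measurable_snd).sub measurable_fst).pow_const _).ennreal_ofReal

lemma lintegral_gagKernel_reflect (θ s : ℝ) :
    ∫⁻ x, ∫⁻ y, gagKernel θ x y s = ∫⁻ x, ∫⁻ y, gagKernel θ x y (-s) := by
  have h1 : ∫⁻ x, ∫⁻ y, gagKernel θ x y s = ∫⁻ x, ∫⁻ y, gagKernel θ (-x) (-y) s := by
    rw [← lintegral_neg_eq_self]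
    congr 1; funext x
    rw [← lintegral_neg_eq_self]
  rw [h1, lintegral_lintegral_swap]
  · congr 1; funext y; congr 1; funext x
    unfold gagKernel
    have : (-1 < -x ∧ -x < s ∧ s < -y ∧ -y < 1) ↔ (-1 < y ∧ y < -s ∧ -s < x ∧ x < 1) := by
      constructor <;> rintro ⟨h1, h2, h3, h4⟩ <;> refine ⟨?_, ?_, ?_, ?_⟩ <;> linarith
    simp only [this, show -y - -x = x - y by ring]
  · exact ((measurable_gagKernel θ).comp
      (measurable_fst.neg.prodMk (measurable_snd.neg.prodMk measurable_const))).aemeasurable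

lemma lintegral_gagKernel_le_left {θ : ℝ} (hθ0 : 0 < θ) (hθ1 : θ < 1) {s : ℝ} (hs : -1 < s) :
    ∫⁻ x, ∫⁻ y, gagKernel θ x y s ≤ ENNReal.ofReal ((1 + s) ^ (1 - θ) / (θ * (1 - θ))) := by
  set F : ℝ → ℝ → ENNReal := fun A u =>
    (Ioi A).indicator (fun u => ENNReal.ofReal (u ^ (-1 - θ))) u with hF
  set G : ℝ → ENNReal := fun u =>
    (Ioo 0 (1 + s)).indicator (fun u => ENNReal.ofReal (u ^ (-θ) / θ)) u with hG
  have hinner : ∀ x, ∫⁻ y, gagKernel θ x y s ≤ G (s - x) := by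
    intro x
    by_cases hx : -1 < x ∧ x < s
    · have hA : 0 < s - x := by linarith [hx.2]
      have h1 : ∫⁻ y, gagKernel θ x y s ≤ ∫⁻ y, F (s - x) (y - x) := by
        refine lintegral_mono fun y => ?_
        unfold gagKernel
        split_ifs with h
        · simp only [hF]
          rw [indicator_of_mem (by rw [mem_Ioi]; linarith [h.2.2.1])]
        · exact zero_le
      refine h1.trans ?_
      rw [lintegral_sub_right_eq_self (F (s - x)) x]
      simp only [hF, hG]
      rw [lintegral_indicator measurableSet_Ioi, indicator_of_mem
          (show s - x ∈ Ioo 0 (1 + s) from ⟨hA, by linarith [hx.1]⟩),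
        ← ofReal_integral_eq_lintegral_ofReal (integrableOn_Ioi_rpow_of_lt (by linarith) hA),
        integral_Ioi_rpow_of_lt (by linarith) hA]
      · refine le_of_eq ?_
        rw [show -1 - θ + 1 = -θ by ring, neg_div_neg_eq]
      · exact (ae_restrict_iff' measurableSet_Ioi).2
          (ae_of_all _ fun u hu => Real.rpow_nonneg (hA.trans hu).le _)
    · rw [show (fun y => gagKernel θ x y s) = fun _ => 0 from ?_]
      · simp
      · funext y
        unfold gagKernel
        rw [if_neg fun h => hx ⟨h.1, h.2.1⟩]
  have hs1 : (0 : ℝ) ≤ 1 + s := by linarith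
  have hi : IntegrableOn (fun u : ℝ => u ^ (-θ) / θ) (Ioo 0 (1 + s)) := by
    refine (intervalIntegrable_iff_integrableOn_Ioo_of_le hs1).1 ?_
    exact (intervalIntegral.intervalIntegrable_rpow' (by linarith)).div_const _
  refine (lintegral_mono hinner).trans ?_
  rw [lintegral_sub_left_eq_self G s]
  simp only [hG]
  rw [lintegral_indicator measurableSet_Ioo, ← ofReal_integral_eq_lintegral_ofReal hi,
    ← integral_Ioc_eq_integral_Ioo, ← intervalIntegral.integral_of_le hs1,
    intervalIntegral.integral_div, integral_rpow (Or.inl (by linarith))]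
  · refine le_of_eq ?_
    rw [show -θ + 1 = 1 - θ by ring, Real.zero_rpow (by linarith), sub_zero, div_div, mul_comm θ]
  · exact (ae_restrict_iff' measurableSet_Ioo).2
      (ae_of_all _ fun u hu => div_nonneg (Real.rpow_nonneg hu.1.le _) hθ0.le)

lemma lintegral_gagKernel_le {c θ : ℝ} (hc : 0 < c) (hθ0 : 0 < θ) (hθ1 : θ < 1) {s : ℝ}
    (hs : s ∈ Ω₀) : ∫⁻ x, ∫⁻ y, gagKernel θ x y s ≤
      ENNReal.ofReal (c ^ (-(1 - θ)) / (θ * (1 - θ)) * dw c s ^ (1 - θ)) := by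
  have h1 : 0 < 1 - s := by linarith [hs.2]
  have h2 : 0 < 1 + s := by linarith [hs.1]
  have e : dw c s = c * ((1 - s) * (1 + s)) := by unfold dw; ring
  have hθ' : 0 < 1 - θ := by linarith
  have key : c ^ (-(1 - θ)) / (θ * (1 - θ)) * dw c s ^ (1 - θ) =
      ((1 - s) * (1 + s)) ^ (1 - θ) / (θ * (1 - θ)) := by
    have : c ^ (-(1 - θ)) * c ^ (1 - θ) = 1 := by
      rw [← Real.rpow_add hc]; simp
    rw [e, Real.mul_rpow hc.le (by positivity), div_mul_eq_mul_div, ← mul_assoc, this, one_mul]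
  rw [key]
  rcases le_total 0 s with h | h
  · rw [lintegral_gagKernel_reflect]
    refine (lintegral_gagKernel_le_left hθ0 hθ1 (by linarith)).trans
      (ENNReal.ofReal_le_ofReal ?_)
    have : (1 + -s) ≤ (1 - s) * (1 + s) := by nlinarith
    have := Real.rpow_le_rpow (by linarith) this hθ'.le
    gcongr
  · refine (lintegral_gagKernel_le_left hθ0 hθ1 hs.1).trans
      (ENNReal.ofReal_le_ofReal ?_)
    have : (1 + s) ≤ (1 - s) * (1 + s) := by nlinarith
    have := Real.rpow_le_rpow (by linarith) this hθ'.le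
    gcongr

lemma gagliardo_le {c θ : ℝ} (hc : 0 < c) (hθ0 : 0 < θ) (hθ1 : θ < 1) :
    ∃ C : ℝ, 0 ≤ C ∧ ∀ g : ℝ → ℝ, ContDiff ℝ 1 g →
      ∫⁻ x in Ω₀, ∫⁻ y in Ω₀, ENNReal.ofReal ((g x - g y) ^ 2 / |x - y| ^ (1 + 2 * θ)) ≤
        ENNReal.ofReal (C * W c (2 - 2 * θ) (deriv g)) := by
  set C1 := 4 * (2 * c ^ (-(1 - θ)) / θ) with hC1
  have hC1' : 0 ≤ C1 := by positivity
  set C2 := c ^ (-(1 - θ)) / (θ * (1 - θ)) with hC2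
  have hθ' : 0 < 1 - θ := by linarith
  have hC2' : 0 ≤ C2 := by positivity
  refine ⟨2 * (C1 * C2), by positivity, fun g hg => ?_⟩
  have hgd : Continuous (deriv g) := hg.continuous_deriv le_rfl
  set h : ℝ → ℝ := fun s => C1 * (dw c s ^ (1 - θ) * deriv g s ^ 2) with hh
  have hhc : Continuous h :=
    continuous_const.mul ((dw_rpow_continuous c hθ'.le).mul (hgd.pow 2))
  have hh0 : ∀ s ∈ Ω₀, 0 ≤ h s := fun s hs =>
    mul_nonneg hC1' (mul_nonneg (Real.rpow_nonneg (dw_pos hc hs).le _) (sq_nonneg _))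
  have hhm : Measurable fun s => ENNReal.ofReal (h s) := hhc.measurable.ennreal_ofReal
  set F : ℝ → ℝ → ENNReal := fun x y => ∫⁻ s, gagKernel θ x y s * ENNReal.ofReal (h s) with hF
  have hkh : Measurable fun p : (ℝ × ℝ) × ℝ =>
      gagKernel θ p.1.1 p.1.2 p.2 * ENNReal.ofReal (h p.2) :=
    ((measurable_gagKernel θ).comp ((measurable_fst.comp measurable_fst).prodMk
      ((measurable_snd.comp measurable_fst).prodMk measurable_snd))).mul (hhm.comp measurable_snd)
  have hFm : Measurable fun p : ℝ × ℝ => F p.1 p.2 := hkh.lintegral_prod_right'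
  have hlt : ∀ x ∈ Ω₀, ∀ y ∈ Ω₀, x < y →
      ENNReal.ofReal ((g x - g y) ^ 2 / |x - y| ^ (1 + 2 * θ)) ≤ F x y := by
    intro x hx y hy hxy
    have hyx : 0 < y - x := by linarith
    have hsub : Ioo x y ⊆ Ω₀ := fun s hs => ⟨hx.1.trans hs.1, hs.2.trans hy.2⟩
    have hI0 : 0 ≤ ∫ s in Ioo x y, dw c s ^ (1 - θ) * deriv g s ^ 2 :=
      setIntegral_nonneg measurableSet_Ioo fun s hs =>
        mul_nonneg (Real.rpow_nonneg (dw_pos hc (hsub hs)).le _) (sq_nonneg _)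
    have h1 := sq_sub_le_weighted hc hθ'.le (by linarith : 1 - θ < 1) hg hx hy hxy.le
    have h2 := integral_dw_neg_le hc hθ0 hθ1 hx hy hxy.le
    have h3 : (g x - g y) ^ 2 / |x - y| ^ (1 + 2 * θ) ≤
        ∫ s in Ioo x y, (y - x) ^ (-1 - θ) * h s := by
      rw [integral_const_mul, abs_sub_comm, abs_of_pos hyx, div_le_iff₀ (by positivity),
        show (g x - g y) ^ 2 = (g y - g x) ^ 2 by ring]
      simp only [hh]
      rw [integral_const_mul]
      have e : (y - x) ^ (-1 - θ) * (y - x) ^ (1 + 2 * θ) = (y - x) ^ θ := by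
        rw [← Real.rpow_add hyx]; congr 1; ring
      calc (g y - g x) ^ 2 ≤ 4 * (2 * c ^ (-(1 - θ)) / θ * (y - x) ^ θ) *
            ∫ s in Ioo x y, dw c s ^ (1 - θ) * deriv g s ^ 2 :=
            h1.trans (mul_le_mul_of_nonneg_right (by linarith) hI0)
        _ = C1 * (∫ s in Ioo x y, dw c s ^ (1 - θ) * deriv g s ^ 2) *
            ((y - x) ^ (-1 - θ) * (y - x) ^ (1 + 2 * θ)) := by rw [e, hC1]; ring
        _ = _ := by ring
    refine (ENNReal.ofReal_le_ofReal h3).trans ?_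
    rw [ofReal_integral_eq_lintegral_ofReal]
    · simp only [hF]
      rw [← lintegral_indicator measurableSet_Ioo]
      refine lintegral_mono fun s => ?_
      by_cases hs : s ∈ Ioo x y
      · rw [indicator_of_mem hs, ENNReal.ofReal_mul (by positivity)]
        unfold gagKernel
        rw [if_pos ⟨hx.1, hs.1, hs.2, hy.2⟩]
      · rw [indicator_of_notMem hs]; exact zero_le
    · exact ((continuous_const.mul hhc).integrableOn_Icc (a := x) (b := y)).mono_set
        Ioo_subset_Icc_self
    · exact (ae_restrict_iff' measurableSet_Ioo).2
        (ae_of_all _ fun s hs => mul_nonneg (by positivity) (hh0 s (hsub hs)))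
  have hpt : ∀ x ∈ Ω₀, ∀ y ∈ Ω₀,
      ENNReal.ofReal ((g x - g y) ^ 2 / |x - y| ^ (1 + 2 * θ)) ≤ F x y + F y x := by
    intro x hx y hy
    rcases lt_trichotomy x y with hxy | hxy | hxy
    · exact (hlt x hx y hy hxy).trans le_self_add
    · subst hxy; simp
    · have := hlt y hy x hx hxy
      rw [abs_sub_comm, show (g y - g x) ^ 2 = (g x - g y) ^ 2 by ring] at this
      exact this.trans le_add_self
  have hstep : ∫⁻ x in Ω₀, ∫⁻ y in Ω₀,
      ENNReal.ofReal ((g x - g y) ^ 2 / |x - y| ^ (1 + 2 * θ)) ≤ 2 * ∫⁻ x, ∫⁻ y, F x y := by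
    calc _ ≤ ∫⁻ x in Ω₀, ∫⁻ y, (F x y + F y x) := by
          refine setLIntegral_mono' measurableSet_Ω₀ fun x hx => ?_
          exact (setLIntegral_mono' measurableSet_Ω₀ fun y hy => hpt x hx y hy).trans
            (setLIntegral_le_lintegral _ _)
      _ ≤ ∫⁻ x, ∫⁻ y, (F x y + F y x) := setLIntegral_le_lintegral _ _
      _ = ∫⁻ x, ((∫⁻ y, F x y) + ∫⁻ y, F y x) := by
          congr 1; funext x
          exact lintegral_add_left (hFm.comp (measurable_const.prodMk measurable_id)) _
      _ = (∫⁻ x, ∫⁻ y, F x y) + ∫⁻ x, ∫⁻ y, F y x :=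
          lintegral_add_left hFm.lintegral_prod_right' _
      _ = _ := by
          rw [lintegral_lintegral_swap (f := fun x y => F y x)
            (hFm.comp measurable_swap).aemeasurable, two_mul]
  refine hstep.trans ?_
  have hmain : ∫⁻ x, ∫⁻ y, F x y = ∫⁻ s, (∫⁻ x, ∫⁻ y, gagKernel θ x y s) * ENNReal.ofReal (h s) := by
    have e1 : ∀ x, ∫⁻ y, F x y = ∫⁻ s, (∫⁻ y, gagKernel θ x y s) * ENNReal.ofReal (h s) := by
      intro x
      simp only [hF]
      rw [lintegral_lintegral_swap]
      · congr 1; funext s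
        rw [lintegral_mul_const]
        exact (measurable_gagKernel θ).comp (measurable_const.prodMk
          (measurable_id.prodMk measurable_const))
      · exact (hkh.comp ((measurable_const.prodMk measurable_fst).prodMk
          measurable_snd)).aemeasurable
    have hk2 : Measurable fun p : ℝ × ℝ => ∫⁻ y, gagKernel θ p.1 y p.2 :=
      Measurable.lintegral_prod_right' (f := fun q : (ℝ × ℝ) × ℝ => gagKernel θ q.1.1 q.2 q.1.2)
        ((measurable_gagKernel θ).comp ((measurable_fst.comp measurable_fst).prodMk
          (measurable_snd.prodMk (measurable_snd.comp measurable_fst))))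
    simp only [e1]
    rw [lintegral_lintegral_swap]
    · congr 1; funext s
      rw [lintegral_mul_const]
      exact hk2.comp (measurable_id.prodMk measurable_const)
    · exact (hk2.mul (hhm.comp measurable_snd)).aemeasurable
  have hfin : ∫⁻ s, (∫⁻ x, ∫⁻ y, gagKernel θ x y s) * ENNReal.ofReal (h s) ≤
      ENNReal.ofReal ((C1 * C2) * W c (2 - 2 * θ) (deriv g)) := by
    have hi : IntegrableOn (fun s => (C1 * C2) * (dw c s ^ (2 - 2 * θ) * deriv g s ^ 2)) Ω₀ :=
      (integrableOn_Ω₀_dw (by linarith) (hgd.pow 2)).const_mul _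
    unfold W
    rw [← integral_const_mul, ofReal_integral_eq_lintegral_ofReal hi,
      ← lintegral_indicator measurableSet_Ω₀]
    · refine lintegral_mono fun s => ?_
      by_cases hs : s ∈ Ω₀
      · rw [indicator_of_mem hs]
        refine (mul_le_mul_left (lintegral_gagKernel_le hc hθ0 hθ1 hs) _).trans (le_of_eq ?_)
        have h0 := dw_pos hc hs
        rw [← ENNReal.ofReal_mul (by positivity)]
        congr 1
        simp only [hh]
        rw [show 2 - 2 * θ = (1 - θ) + (1 - θ) by ring, Real.rpow_add h0]
        ring
      · rw [indicator_of_notMem hs]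
        rw [show (fun x => ∫⁻ y, gagKernel θ x y s) = fun _ => 0 from ?_]
        · simp
        · funext x
          rw [show (fun y => gagKernel θ x y s) = fun _ => 0 from ?_]
          · simp
          · funext y
            unfold gagKernel
            exact if_neg fun hxy => hs ⟨hxy.1.trans hxy.2.1, hxy.2.2.1.trans hxy.2.2.2⟩
    · exact (ae_restrict_iff' measurableSet_Ω₀).2 (ae_of_all _ fun s hs => by
        have h0 := dw_pos hc hs
        positivity)
  rw [hmain, mul_assoc, ENNReal.ofReal_mul zero_le_two, ENNReal.ofReal_ofNat]
  gcongr

def EqC (f : ℕ → ℝ → ℝ) : Prop :=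
  ∀ x ∈ Ω₀, ∀ ε > 0, ∃ r > 0, ∀ y ∈ Ω₀, |y - x| < r → ∀ n, |f n y - f n x| ≤ ε

lemma eqC_const (s : ℕ → ℝ) : EqC fun n _ => s n := fun _ _ ε hε =>
  ⟨1, one_pos, fun _ _ _ _ => by simpa using hε.le⟩

lemma exists_subseq_of_countable {ι : Type*} [Countable ι] {U : Filter ℕ} [U.NeBot]
    (hU : U ≤ atTop) {s : ι → ℕ → ℝ} {L : ι → ℝ} (h : ∀ i, Tendsto (s i) U (𝓝 (L i))) :
    ∃ ψ : ℕ → ℕ, StrictMono ψ ∧ ∀ i, Tendsto (fun n => s i (ψ n)) atTop (𝓝 (L i)) := by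
  have h1 : Tendsto (fun n i => s i n) U (𝓝 L) := tendsto_pi_nhds.2 h
  have h2 : MapClusterPt L atTop (fun n i => s i n) := (h1.mapClusterPt).mono hU
  obtain ⟨ψ, hψ, hψ'⟩ := h2.tendsto_subseq
  exact ⟨ψ, hψ, fun i => (tendsto_pi_nhds.1 hψ') i⟩

lemma exists_rat_mem_near {x r : ℝ} (hx : x ∈ Ω₀) (hr : 0 < r) :
    ∃ q : ℚ, (q : ℝ) ∈ Ω₀ ∧ |(q : ℝ) - x| < r := by
  have h : x < min (x + r) 1 := lt_min (by linarith) hx.2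
  obtain ⟨q, h1, h2⟩ := exists_rat_btwn h
  refine ⟨q, ⟨hx.1.trans h1, h2.trans_le (min_le_right _ _)⟩, ?_⟩
  rw [abs_of_pos (by linarith)]
  linarith [h2.trans_le (min_le_left _ _)]

lemma exists_subseq_eqC {ι : Type*} [Countable ι] {U : Filter ℕ} [U.NeBot] (hU : U ≤ atTop)
    {f : ι → ℕ → ℝ → ℝ} {F : ι → ℝ → ℝ} (he : ∀ i, EqC (f i))
    (hF : ∀ i, ∀ x ∈ Ω₀, Tendsto (fun n => f i n x) U (𝓝 (F i x))) :
    ∃ ψ : ℕ → ℕ, StrictMono ψ ∧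
      ∀ i, ∀ x ∈ Ω₀, Tendsto (fun n => f i (ψ n) x) atTop (𝓝 (F i x)) := by
  obtain ⟨ψ, hψ, h⟩ := exists_subseq_of_countable (ι := ι × {q : ℚ // (q : ℝ) ∈ Ω₀}) hU
    (s := fun p n => f p.1 n p.2.1) (L := fun p => F p.1 p.2.1) fun p => hF p.1 _ p.2.2
  refine ⟨ψ, hψ, fun i x hx => ?_⟩
  rw [Metric.tendsto_atTop]
  intro ε hε
  obtain ⟨r, hr, hr'⟩ := he i x hx (ε / 4) (by positivity)
  obtain ⟨q, hq, hqx⟩ := exists_rat_mem_near hx hr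
  have h1 := hr' q hq hqx
  have h2 : |F i q - F i x| ≤ ε / 4 :=
    le_of_tendsto (((hF i q hq).sub (hF i x hx)).abs) (Eventually.of_forall h1)
  obtain ⟨m, hm⟩ := Metric.tendsto_atTop.1 (h (i, ⟨q, hq⟩)) (ε / 4) (by positivity)
  refine ⟨m, fun n hn => ?_⟩
  have h3 := hm n hn
  have h4 := h1 (ψ n)
  rw [Real.dist_eq] at h3 ⊢
  rw [abs_le] at h2 h4
  rw [abs_lt] at h3 ⊢
  constructor <;> linarith [h2.1, h2.2, h3.1, h3.2, h4.1, h4.2]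

lemma EqC.continuousAt {U : Filter ℕ} [U.NeBot] {f : ℕ → ℝ → ℝ} {F : ℝ → ℝ} (he : EqC f)
    (hF : ∀ x ∈ Ω₀, Tendsto (fun n => f n x) U (𝓝 (F x))) {x : ℝ} (hx : x ∈ Ω₀) :
    ContinuousAt F x := by
  rw [Metric.continuousAt_iff]
  intro ε hε
  obtain ⟨r, hr, hr'⟩ := he x hx (ε / 2) (by positivity)
  obtain ⟨r', hr0, hball⟩ := Metric.isOpen_iff.1 (isOpen_Ioo : IsOpen Ω₀) x hx
  refine ⟨min r r', lt_min hr hr0, fun {y} hy => ?_⟩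
  have hyΩ : y ∈ Ω₀ := hball (Metric.mem_ball.2 (hy.trans_le (min_le_right _ _)))
  rw [Real.dist_eq] at hy ⊢
  have : |F y - F x| ≤ ε / 2 := le_of_tendsto (((hF y hyΩ).sub (hF x hx)).abs)
    (Eventually.of_forall (hr' y hyΩ (hy.trans_le (min_le_left _ _))))
  linarith

lemma hasDerivWithinAt_of_tendsto {ι : Type*} {l : Filter ι} [l.NeBot] {s : Set ℝ}
    (hs : Convex ℝ s) {f f' : ι → ℝ → ℝ} {F G : ℝ → ℝ}
    (hd : ∀ᶠ n in l, ∀ x ∈ s, HasDerivWithinAt (f n) (f' n x) s x)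
    (hF : ∀ x ∈ s, Tendsto (fun n => f n x) l (𝓝 (F x))) {x : ℝ} (hx : x ∈ s)
    (hG : Tendsto (fun n => f' n x) l (𝓝 (G x)))
    (he : ∀ ε > 0, ∃ r > 0, ∀ᶠ n in l, ∀ y ∈ s, |y - x| < r → |f' n y - f' n x| ≤ ε) :
    HasDerivWithinAt F (G x) s x := by
  rw [hasDerivWithinAt_iff_isLittleO, Asymptotics.isLittleO_iff]
  intro ε hε
  obtain ⟨r, hr, hr'⟩ := he ε hε
  filter_upwards [self_mem_nhdsWithin, nhdsWithin_le_nhds (Metric.ball_mem_nhds x hr)] with y hy hyr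
  have hconv : Convex ℝ (s ∩ Metric.ball x r) := hs.inter (convex_ball x r)
  have hev : ∀ᶠ n in l, ‖f n y - f n x - (y - x) • f' n x‖ ≤ ε * ‖y - x‖ := by
    filter_upwards [hd, hr'] with n h1 h2
    have h3 : ∀ z ∈ s ∩ Metric.ball x r,
        HasDerivWithinAt (fun z => f n z - z * f' n x) (f' n z - f' n x)
          (s ∩ Metric.ball x r) z := by
      intro z hz
      have := ((h1 z hz.1).mono (inter_subset_left : s ∩ Metric.ball x r ⊆ s)).sub
        ((hasDerivWithinAt_id z (s ∩ Metric.ball x r)).mul_const (f' n x))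
      exact this.congr_deriv (by ring)
    have h4 := hconv.norm_image_sub_le_of_norm_hasDerivWithin_le h3 (C := ε)
      (fun z hz => h2 z hz.1 (by simpa [Real.dist_eq] using hz.2))
      ⟨hx, Metric.mem_ball_self hr⟩ ⟨hy, hyr⟩
    refine le_trans (le_of_eq ?_) h4
    congr 1
    simp only [smul_eq_mul]; ring
  refine le_of_tendsto ?_ hev
  exact (((hF y hy).sub (hF x hx)).sub (hG.const_smul (y - x))).norm

lemma hasDerivAt_of_tendsto_eqC {U : Filter ℕ} [U.NeBot] {f f' : ℕ → ℝ → ℝ} {F G : ℝ → ℝ}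
    (hd : ∀ n, ∀ x, HasDerivAt (f n) (f' n x) x)
    (hF : ∀ x ∈ Ω₀, Tendsto (fun n => f n x) U (𝓝 (F x)))
    (hG : ∀ x ∈ Ω₀, Tendsto (fun n => f' n x) U (𝓝 (G x))) (he : EqC f') {x : ℝ} (hx : x ∈ Ω₀) :
    HasDerivAt F (G x) x := by
  refine (hasDerivWithinAt_of_tendsto (convex_Ioo (-1 : ℝ) 1)
    (Eventually.of_forall fun n x _ => (hd n x).hasDerivWithinAt) hF hx (hG x hx)
    fun ε hε => ?_).hasDerivAt (isOpen_Ioo.mem_nhds hx)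
  obtain ⟨r, hr, h⟩ := he x hx ε hε
  exact ⟨r, hr, Eventually.of_forall fun n y hy hyr => h y hy hyr n⟩

lemma exists_ultrafilter_limit (U : Ultrafilter ℕ) {s : ℕ → ℝ} {B : ℝ} (h : ∀ n, |s n| ≤ B) :
    ∃ L, |L| ≤ B ∧ Tendsto s U (𝓝 L) := by
  have hc : IsCompact (Icc (-B) B) := isCompact_Icc
  obtain ⟨L, hL, hL'⟩ := hc.ultrafilter_le_nhds' (U.map s)
    (Ultrafilter.mem_map.2 (univ_mem' fun n => abs_le.1 (h n)))
  exact ⟨L, abs_le.2 hL, hL'⟩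

lemma local_holder {c ρ : ℝ} (hc : 0 < c) (hρ : 0 ≤ ρ) {A j : ℕ} (hj : j < A) {R : ℝ}
    (hR0 : 0 ≤ R) (hR : R < 1) : ∃ K : ℝ, 0 ≤ K ∧ ∀ u : ℝ → ℝ, ContDiff ℝ ∞ u →
      ∀ x y, |x| ≤ R → |y| ≤ R →
      (iteratedDeriv j u y - iteratedDeriv j u x) ^ 2 ≤ K * |y - x| * N c ρ A u := by
  set m := c * (1 - R ^ 2) with hm
  have hm0 : 0 < m := mul_pos hc (by nlinarith)
  set p := ρ + ((j + 1 : ℕ) : ℝ) with hp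
  have hp0 : 0 ≤ p := by positivity
  refine ⟨4 * m ^ (-p), by positivity, fun u hu => ?_⟩
  have hΩ : ∀ x, |x| ≤ R → x ∈ Ω₀ := fun x hx => abs_lt.1 (hx.trans_lt hR)
  have hWN := W_le_N hc ρ (Nat.succ_le_of_lt hj) u (A := A)
  have key : ∀ x y, |x| ≤ R → |y| ≤ R → x ≤ y →
      (iteratedDeriv j u y - iteratedDeriv j u x) ^ 2 ≤ 4 * m ^ (-p) * |y - x| * N c ρ A u := by
    intro x y hx hy hxy
    have hf : ContDiff ℝ ∞ (iteratedDeriv j u) := smooth_iteratedDeriv hu j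
    have h1 := sq_sub_le_weighted hc le_rfl zero_lt_one (hf.of_le one_le_smooth) (hΩ x hx)
      (hΩ y hy) hxy
    have hsub : Ioo x y ⊆ Ω₀ := fun s hs => ⟨(hΩ x hx).1.trans hs.1, hs.2.trans (hΩ y hy).2⟩
    have hgc : Continuous (deriv (iteratedDeriv j u)) := hf.continuous_deriv one_le_smooth
    simp only [neg_zero, Real.rpow_zero, one_mul] at h1
    have hvol : ∫ _ in Ioo x y, (1 : ℝ) = |y - x| := by
      rw [setIntegral_const]; simp [abs_of_nonneg (sub_nonneg.2 hxy), hxy]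
    rw [hvol] at h1
    have i0 : IntegrableOn (fun s => dw c s ^ p * deriv (iteratedDeriv j u) s ^ 2) Ω₀ :=
      integrableOn_Ω₀_dw hp0 (hgc.pow 2)
    have i1 : IntegrableOn (fun s => deriv (iteratedDeriv j u) s ^ 2) (Ioo x y) :=
      (integrableOn_Ω₀ (hgc.pow 2)).mono_set hsub
    have i2 : IntegrableOn (fun s => m ^ (-p) *
        (dw c s ^ p * deriv (iteratedDeriv j u) s ^ 2)) (Ioo x y) :=
      (i0.mono_set hsub).const_mul _
    have h2 : ∫ s in Ioo x y, deriv (iteratedDeriv j u) s ^ 2 ≤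
        m ^ (-p) * N c ρ A u := by
      calc _ ≤ ∫ s in Ioo x y, m ^ (-p) * (dw c s ^ p * deriv (iteratedDeriv j u) s ^ 2) := by
            refine setIntegral_mono_on i1 i2 measurableSet_Ioo fun s hs => ?_
            have hsR : s ^ 2 ≤ R ^ 2 := by
              have := abs_le.1 hx; have := abs_le.1 hy
              exact sq_le_sq' (by linarith [hs.1]) (by linarith [hs.2])
            have h3 : m ≤ dw c s := mul_le_mul_of_nonneg_left (by linarith) hc.le
            have h4 := Real.rpow_le_rpow hm0.le h3 hp0
            have h5 : 1 ≤ m ^ (-p) * dw c s ^ p := by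
              calc (1 : ℝ) = m ^ (-p) * m ^ p := by rw [← Real.rpow_add hm0]; simp
                _ ≤ _ := by gcongr
            rw [← mul_assoc]
            exact le_mul_of_one_le_left (sq_nonneg _) h5
        _ = m ^ (-p) * ∫ s in Ioo x y, (dw c s ^ p * deriv (iteratedDeriv j u) s ^ 2) :=
            integral_const_mul _ _
        _ ≤ m ^ (-p) * N c ρ A u := by
            refine mul_le_mul_of_nonneg_left (le_trans ?_ hWN) (by positivity)
            unfold W
            rw [iteratedDeriv_succ]
            refine setIntegral_mono_set i0 ?_ hsub.eventuallyLE
            exact (ae_restrict_iff' measurableSet_Ω₀).2 (ae_of_all _ fun s hs =>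
              mul_nonneg (Real.rpow_nonneg (dw_pos hc hs).le _) (sq_nonneg _))
    calc _ ≤ 4 * |y - x| * (m ^ (-p) * N c ρ A u) := h1.trans (by gcongr)
      _ = _ := by ring
  intro x y hx hy
  rcases le_total x y with h | h
  · exact key x y hx hy h
  · have := key y x hy hx h
    rw [abs_sub_comm, show (iteratedDeriv j u x - iteratedDeriv j u y) ^ 2 =
      (iteratedDeriv j u y - iteratedDeriv j u x) ^ 2 by ring] at this
    exact this

lemma eqC_iteratedDeriv {c ρ M : ℝ} (hc : 0 < c) (hρ : 0 ≤ ρ) {A j : ℕ} (hj : j < A)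
    {u : ℕ → ℝ → ℝ} (hu : ∀ n, ContDiff ℝ ∞ (u n)) (hM : ∀ n, N c ρ A (u n) ≤ M) :
    EqC fun n => iteratedDeriv j (u n) := by
  intro x hx ε hε
  have hx1 : |x| < 1 := abs_lt.2 hx
  set R := (|x| + 1) / 2 with hR
  have hxR : |x| < R := by linarith
  obtain ⟨K, hK, h⟩ := local_holder hc hρ hj (R := R) (by positivity) (by linarith)
  have hM0 : 0 ≤ M := (N_nonneg hc _ _ _).trans (hM 0)
  refine ⟨min (R - |x|) (ε ^ 2 / (K * M + 1)), lt_min (by linarith) (by positivity),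
    fun y hy hyr n => ?_⟩
  have hy1 := hyr.trans_le (min_le_left _ _)
  have hy2 := hyr.trans_le (min_le_right _ _)
  have hyR : |y| ≤ R := by
    have := abs_add_le (y - x) x
    rw [sub_add_cancel] at this
    linarith
  refine abs_le_of_sq_le_sq ?_ hε.le
  rw [lt_div_iff₀ (by positivity)] at hy2
  calc _ ≤ K * |y - x| * N c ρ A (u n) := h (u n) (hu n) x y hxR.le hyR
    _ ≤ K * |y - x| * M := by gcongr; exact hM n
    _ ≤ |y - x| * (K * M + 1) := by nlinarith [abs_nonneg (y - x)]
    _ ≤ ε ^ 2 := hy2.le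

lemma exists_jet_bound {c ρ : ℝ} (hc : 0 < c) (hρ : 0 ≤ ρ) {A j : ℕ} (hj : j < A) {x : ℝ}
    (hx : x ∈ Ω₀) (M : ℝ) : ∃ B, ∀ u : ℝ → ℝ, ContDiff ℝ ∞ u → N c ρ A u ≤ M →
      |iteratedDeriv j u x| ≤ B := by
  obtain ⟨C, hC, h⟩ := sup_le_const_N hc hρ hj (σ := max 1 (ρ + 1 + 2 * j - A)) (le_max_left _ _)
    (le_max_right _ _)
  set σ := max 1 (ρ + 1 + 2 * j - A)
  have h0 := dw_pos hc hx
  refine ⟨√(dw c x ^ (-σ) * (C * M)), fun u hu hM => ?_⟩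
  refine Real.abs_le_sqrt ?_
  calc iteratedDeriv j u x ^ 2 = dw c x ^ (-σ) * (dw c x ^ σ * iteratedDeriv j u x ^ 2) := by
        rw [← mul_assoc, ← Real.rpow_add h0]; simp
    _ ≤ _ := by
        refine mul_le_mul_of_nonneg_left ((h u hu x hx).trans ?_) (by positivity)
        gcongr

/-- Jets of a pointwise limit of a sequence bounded in the weighted norm. -/
lemma jets_tendsto {c ρ M : ℝ} (hc : 0 < c) (hρ : 0 ≤ ρ) {A : ℕ}
    {u : ℕ → ℝ → ℝ} (hu : ∀ n, ContDiff ℝ ∞ (u n)) (hM : ∀ n, N c ρ A (u n) ≤ M)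
    (U : Ultrafilter ℕ) {F : ℝ → ℝ} (hF : ∀ x ∈ Ω₀, Tendsto (fun n => u n x) U (𝓝 (F x))) :
    (∀ j < A, ∀ x ∈ Ω₀,
      Tendsto (fun n => iteratedDeriv j (u n) x) U (𝓝 (iteratedDeriv j F x))) ∧
    (∀ j, j + 1 < A → ∀ x ∈ Ω₀,
      HasDerivAt (iteratedDeriv j F) (iteratedDeriv (j + 1) F x) x) := by
  have hex : ∀ j x, ∃ L, j < A → x ∈ Ω₀ → Tendsto (fun n => iteratedDeriv j (u n) x) U (𝓝 L) := by
    intro j x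
    by_cases h : j < A ∧ x ∈ Ω₀
    · obtain ⟨B, hB⟩ := exists_jet_bound hc hρ h.1 h.2 M
      obtain ⟨L, -, hL⟩ := exists_ultrafilter_limit U fun n => hB (u n) (hu n) (hM n)
      exact ⟨L, fun _ _ => hL⟩
    · exact ⟨0, fun h1 h2 => (h ⟨h1, h2⟩).elim⟩
  choose g hg using hex
  have hd : ∀ j, j + 1 < A → ∀ x ∈ Ω₀, HasDerivAt (g j) (g (j + 1) x) x := by
    intro j hj x hx
    refine hasDerivAt_of_tendsto_eqC (f := fun n => iteratedDeriv j (u n))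
      (f' := fun n => iteratedDeriv (j + 1) (u n)) (fun n x => hasDerivAt_iteratedDeriv (hu n) j x)
      (fun x hx => hg j x (by omega) hx) (fun x hx => hg (j + 1) x hj hx)
      (eqC_iteratedDeriv hc hρ hj hu hM) hx
  rcases Nat.eq_zero_or_pos A with hA | hA
  · exact ⟨fun j hj => by omega, fun j hj => by omega⟩
  have h0 : EqOn F (g 0) Ω₀ := by
    intro x hx
    have := hg 0 x hA hx
    simp only [iteratedDeriv_zero] at this
    exact tendsto_nhds_unique (hF x hx) this
  have hE := eqOn_iteratedDeriv_of_hasDerivAt (isOpen_Ioo : IsOpen Ω₀) h0 (m := A - 1)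
    fun j hj x hx => hd j (by omega) x hx
  refine ⟨fun j hj x hx => ?_, fun j hj x hx => ?_⟩
  · rw [hE j (by omega) hx]; exact hg j x hj hx
  · rw [hE (j + 1) (by omega) hx]
    refine (hd j hj x hx).congr_of_eventuallyEq ?_
    filter_upwards [isOpen_Ioo.mem_nhds hx] with y hy
    exact hE j (by omega) hy

/-- The weighted square integral as an extended nonnegative number. -/
def WL (c p : ℝ) (f : ℝ → ℝ) : ENNReal := ∫⁻ x in Ω₀, ENNReal.ofReal (dw c x ^ p * f x ^ 2)

lemma lintegral_le_of_le_liminf {X : Type*} [MeasurableSpace X] {μ : Measure X}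
    {f : ℕ → X → ENNReal} {F : X → ENNReal} {M : ENNReal} (hm : ∀ n, AEMeasurable (f n) μ)
    (hF : ∀ᵐ x ∂μ, F x ≤ liminf (fun n => f n x) atTop) (hM : ∀ n, ∫⁻ x, f n x ∂μ ≤ M) :
    ∫⁻ x, F x ∂μ ≤ M :=
  (lintegral_mono_ae hF).trans ((lintegral_liminf_le' hm).trans
    (liminf_le_of_frequently_le' (Frequently.of_forall hM)))

lemma setIntegral_le_of_lintegral {f : ℝ → ℝ} {s : Set ℝ} (hs : MeasurableSet s)
    (hf : ∀ x ∈ s, 0 ≤ f x) {C : ℝ} (hC : 0 ≤ C)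
    (h : ∫⁻ x in s, ENNReal.ofReal (f x) ≤ ENNReal.ofReal C) : ∫ x in s, f x ≤ C := by
  have h1 : ‖∫ x in s, f x‖ₑ ≤ ∫⁻ x in s, ENNReal.ofReal (f x) := by
    refine (enorm_integral_le_lintegral_enorm _).trans (le_of_eq ?_)
    exact setLIntegral_congr_fun hs fun x hx => Real.enorm_of_nonneg (hf x hx)
  have h0 : 0 ≤ ∫ x in s, f x := setIntegral_nonneg hs hf
  rw [Real.enorm_of_nonneg h0] at h1
  exact (ENNReal.ofReal_le_ofReal_iff hC).1 (h1.trans h)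

lemma ofReal_setIntegral_le {f : ℝ → ℝ} {s : Set ℝ} (hs : MeasurableSet s)
    (hf : ∀ x ∈ s, 0 ≤ f x) :
    ENNReal.ofReal (∫ x in s, f x) ≤ ∫⁻ x in s, ENNReal.ofReal (f x) := by
  rw [← Real.enorm_of_nonneg (setIntegral_nonneg hs hf)]
  refine (enorm_integral_le_lintegral_enorm _).trans (le_of_eq ?_)
  exact setLIntegral_congr_fun hs fun x hx => Real.enorm_of_nonneg (hf x hx)

lemma dw_mul_sq_nonneg {c p : ℝ} (hc : 0 < c) (f : ℝ → ℝ) : ∀ x ∈ Ω₀, 0 ≤ dw c x ^ p * f x ^ 2 :=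
  fun _ hx => mul_nonneg (Real.rpow_nonneg (dw_pos hc hx).le _) (sq_nonneg _)

lemma W_le_of_WL {c p : ℝ} (hc : 0 < c) {f : ℝ → ℝ} {C : ℝ} (hC : 0 ≤ C)
    (h : WL c p f ≤ ENNReal.ofReal C) : W c p f ≤ C :=
  setIntegral_le_of_lintegral measurableSet_Ω₀ (dw_mul_sq_nonneg hc f) hC h

lemma WL_eq {c p : ℝ} (hc : 0 < c) (hp : 0 ≤ p) {f : ℝ → ℝ} (hf : Continuous f) :
    WL c p f = ENNReal.ofReal (W c p f) :=
  (ofReal_integral_eq_lintegral_ofReal (integrableOn_Ω₀_dw hp (hf.pow 2))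
    ((ae_restrict_iff' measurableSet_Ω₀).2 (ae_of_all _ (dw_mul_sq_nonneg hc f)))).symm

lemma WL_le_of_tendsto {c p M : ℝ} (hc : 0 < c) (hp : 0 ≤ p) {f : ℕ → ℝ → ℝ} {F : ℝ → ℝ}
    (hf : ∀ n, Continuous (f n)) (hM : ∀ n, W c p (f n) ≤ M)
    (hF : ∀ x ∈ Ω₀, Tendsto (fun n => f n x) atTop (𝓝 (F x))) : WL c p F ≤ ENNReal.ofReal M := by
  refine lintegral_le_of_le_liminf
    (f := fun n x => ENNReal.ofReal (dw c x ^ p * f n x ^ 2)) (fun n => ?_) ?_ fun n => ?_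
  · exact ((dw_rpow_continuous c hp).mul ((hf n).pow 2)).measurable.ennreal_ofReal.aemeasurable
  · refine (ae_restrict_iff' measurableSet_Ω₀).2 (ae_of_all _ fun x hx => ?_)
    exact (ENNReal.tendsto_ofReal (((hF x hx).pow 2).const_mul _)).liminf_eq.ge
  · exact (WL_eq hc hp (hf n)).le.trans (ENNReal.ofReal_le_ofReal (hM n))

/-- Points which do not move away from the origin under translation by `h`. -/
def inwardSet (h : ℝ) : Set ℝ := {x | x ∈ Ω₀ ∧ |x + h| ≤ |x|}

lemma measurableSet_inwardSet (h : ℝ) : MeasurableSet (inwardSet h) :=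
  measurableSet_Ω₀.inter (isClosed_le (f := fun x : ℝ => |x + h|) (g := fun x : ℝ => |x|)
    (by fun_prop) (by fun_prop)).measurableSet

lemma sq_integral_le {f : ℝ → ℝ} (hf : Continuous f) :
    (∫ τ in (0 : ℝ)..1, f τ) ^ 2 ≤ ∫ τ in (0 : ℝ)..1, f τ ^ 2 := by
  set m := ∫ τ in (0 : ℝ)..1, f τ with hm
  have h0 : 0 ≤ ∫ τ in (0 : ℝ)..1, (f τ - m) ^ 2 :=
    intervalIntegral.integral_nonneg zero_le_one fun _ _ => sq_nonneg _
  have e : (fun τ => (f τ - m) ^ 2) = fun τ => (f τ ^ 2 - 2 * m * f τ) + m ^ 2 := by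
    funext τ; ring
  have i1 : IntervalIntegrable (fun τ => f τ ^ 2) volume 0 1 := (hf.pow 2).intervalIntegrable _ _
  have i2 : IntervalIntegrable (fun τ => 2 * m * f τ) volume 0 1 :=
    (continuous_const.mul hf).intervalIntegrable _ _
  rw [e, intervalIntegral.integral_add (i1.sub i2) (by simp), intervalIntegral.integral_sub i1 i2,
    intervalIntegral.integral_const_mul, ← hm] at h0
  simp only [intervalIntegral.integral_const, sub_zero, one_smul] at h0
  nlinarith

lemma lintegral_inward_quotient_le {c p : ℝ} (hc : 0 < c) (hp : 0 ≤ p) {g : ℝ → ℝ}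
    (hg : ContDiff ℝ 1 g) {h : ℝ} (hh : h ≠ 0) :
    ∫⁻ x in inwardSet h, ENNReal.ofReal (dw c x ^ p * ((g (x + h) - g x) / h) ^ 2) ≤
      ENNReal.ofReal (W c p (deriv g)) := by
  have hgd : Continuous (deriv g) := hg.continuous_deriv le_rfl
  set H : ℝ → ENNReal :=
    Ω₀.indicator fun s => ENNReal.ofReal (dw c s ^ p * deriv g s ^ 2) with hH
  have hHm : Measurable H :=
    (((dw_rpow_continuous c hp).mul (hgd.pow 2)).measurable.ennreal_ofReal).indicator
      measurableSet_Ω₀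
  have hHint : ∫⁻ s, H s = ENNReal.ofReal (W c p (deriv g)) := by
    rw [← WL_eq hc hp hgd, hH, lintegral_indicator measurableSet_Ω₀]; rfl
  have hpt : ∀ x ∈ inwardSet h, ENNReal.ofReal (dw c x ^ p * ((g (x + h) - g x) / h) ^ 2) ≤
      ∫⁻ τ in Ioc (0 : ℝ) 1, H (x + τ * h) := by
    intro x hx
    have hin : ∀ τ ∈ Icc (0 : ℝ) 1, |x + τ * h| ≤ |x| := by
      intro τ hτ
      have e : x + τ * h = (1 - τ) * x + τ * (x + h) := by ring
      have h1 : 0 ≤ 1 - τ := by linarith [hτ.2]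
      rw [e]
      refine (abs_add_le _ _).trans ?_
      rw [abs_mul, abs_mul, abs_of_nonneg h1, abs_of_nonneg hτ.1]
      nlinarith [hx.2, hτ.1]
    have hc1 : Continuous fun τ : ℝ => deriv g (x + τ * h) := hgd.comp (by fun_prop)
    have e1 : (g (x + h) - g x) / h = ∫ τ in (0 : ℝ)..1, deriv g (x + τ * h) := by
      have h1 := intervalIntegral.integral_eq_sub_of_hasDerivAt
        (f := fun τ => g (x + τ * h) / h) (f' := fun τ => deriv g (x + τ * h)) (a := 0) (b := 1)
        (fun τ _ => by
          have h2 : HasDerivAt (fun τ : ℝ => x + τ * h) h τ := by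
            simpa using ((hasDerivAt_id τ).mul_const h).const_add x
          have h3 := ((hg.differentiable one_ne_zero (x + τ * h)).hasDerivAt.comp τ h2).div_const h
          exact h3.congr_deriv (by field_simp)) (hc1.intervalIntegrable _ _)
      rw [h1]; simp; ring
    have hcc : Continuous fun τ : ℝ => dw c (x + τ * h) ^ p * deriv g (x + τ * h) ^ 2 :=
      ((dw_rpow_continuous c hp).comp (by fun_prop)).mul (hc1.pow 2)
    have e2 : dw c x ^ p * ((g (x + h) - g x) / h) ^ 2 ≤
        ∫ τ in (0 : ℝ)..1, dw c (x + τ * h) ^ p * deriv g (x + τ * h) ^ 2 := by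
      rw [e1]
      refine (mul_le_mul_of_nonneg_left (sq_integral_le hc1)
        (Real.rpow_nonneg (dw_pos hc hx.1).le _)).trans ?_
      rw [← intervalIntegral.integral_const_mul]
      refine intervalIntegral.integral_mono_on zero_le_one
        ((continuous_const.mul (hc1.pow 2)).intervalIntegrable _ _) (hcc.intervalIntegrable _ _)
        fun τ hτ => ?_
      refine mul_le_mul_of_nonneg_right (Real.rpow_le_rpow (dw_pos hc hx.1).le ?_ hp) (sq_nonneg _)
      have := sq_le_sq.2 (hin τ hτ)
      exact mul_le_mul_of_nonneg_left (by linarith) hc.le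
    refine (ENNReal.ofReal_le_ofReal e2).trans ?_
    rw [intervalIntegral.integral_of_le zero_le_one]
    have hmem : ∀ τ ∈ Ioc (0 : ℝ) 1, x + τ * h ∈ Ω₀ := fun τ hτ =>
      abs_lt.1 ((hin τ (Ioc_subset_Icc_self hτ)).trans_lt (abs_lt.2 hx.1))
    refine (ofReal_setIntegral_le measurableSet_Ioc fun τ hτ =>
      dw_mul_sq_nonneg hc _ _ (hmem τ hτ)).trans (le_of_eq ?_)
    refine setLIntegral_congr_fun measurableSet_Ioc fun τ hτ => ?_
    simp only [hH]
    rw [indicator_of_mem (hmem τ hτ)]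
  refine (setLIntegral_mono' (measurableSet_inwardSet h) hpt).trans ?_
  refine (setLIntegral_le_lintegral _ _).trans ?_
  rw [lintegral_lintegral_swap]
  · calc ∫⁻ τ in Ioc (0 : ℝ) 1, ∫⁻ x, H (x + τ * h) = ∫⁻ _ in Ioc (0 : ℝ) 1, ∫⁻ x, H x := by
          congr 1; funext τ
          exact lintegral_add_right_eq_self H (τ * h)
      _ = ENNReal.ofReal (W c p (deriv g)) := by rw [setLIntegral_const, hHint]; simp
      _ ≤ _ := le_rfl
  · exact (hHm.comp (measurable_fst.add (measurable_snd.mul_const h))).aemeasurable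

lemma WL_deriv_le_of_tendsto {c p M : ℝ} (hc : 0 < c) (hp : 0 ≤ p) {g : ℕ → ℝ → ℝ} {G : ℝ → ℝ}
    (hg : ∀ n, ContDiff ℝ 1 (g n)) (hM : ∀ n, W c p (deriv (g n)) ≤ M) (hGc : ContinuousOn G Ω₀)
    (hG : ∀ x ∈ Ω₀, Tendsto (fun n => g n x) atTop (𝓝 (G x))) :
    WL c p (deriv G) ≤ ENNReal.ofReal (2 * M) := by
  set Q : ℝ → ℝ → ENNReal := fun h x =>
    ENNReal.ofReal (dw c x ^ p * ((G (x + h) - G x) / h) ^ 2) with hQ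
  have hmem : ∀ h, ∀ x ∈ inwardSet h, x + h ∈ Ω₀ := fun h x hx =>
    abs_lt.1 (hx.2.trans_lt (abs_lt.2 hx.1))
  have hQm : ∀ h, AEMeasurable (Q h) (volume.restrict (inwardSet h)) := by
    intro h
    refine ContinuousOn.aemeasurable ?_ (measurableSet_inwardSet h)
    refine ENNReal.continuous_ofReal.comp_continuousOn ?_
    refine (dw_rpow_continuous c hp).continuousOn.mul (ContinuousOn.pow ?_ 2)
    refine (ContinuousOn.sub ?_ (hGc.mono fun x hx => hx.1)).div_const _
    exact hGc.comp (by fun_prop) (hmem h)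
  have hQint : ∀ h, h ≠ 0 → ∫⁻ x in inwardSet h, Q h x ≤ ENNReal.ofReal M := by
    intro h hh
    refine lintegral_le_of_le_liminf
      (f := fun n x => ENNReal.ofReal (dw c x ^ p * ((g n (x + h) - g n x) / h) ^ 2))
      (fun n => ?_) ?_ fun n => ?_
    · refine (Continuous.measurable ?_).ennreal_ofReal.aemeasurable
      have h1 := (hg n).continuous
      exact (dw_rpow_continuous c hp).mul ((((h1.comp (by fun_prop)).sub h1).div_const _).pow 2)
    · refine (ae_restrict_iff' (measurableSet_inwardSet h)).2 (ae_of_all _ fun x hx => ?_)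
      exact (ENNReal.tendsto_ofReal (((((hG _ (hmem h x hx)).sub (hG x hx.1)).div_const
        h).pow 2).const_mul _)).liminf_eq.ge
    · exact (lintegral_inward_quotient_le hc hp (hg n) hh).trans (ENNReal.ofReal_le_ofReal (hM n))
  set e : ℕ → ℝ := fun m => 1 / ((m : ℝ) + 1) with he
  have he0 : ∀ m, 0 < e m := fun m => by positivity
  have het : Tendsto e atTop (𝓝 0) := tendsto_one_div_add_atTop_nhds_zero_nat
  have hM0 : 0 ≤ M := (W_nonneg hc _ _).trans (hM 0)
  set Φ : ℕ → ℝ → ENNReal := fun m x =>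
    (inwardSet (e m)).indicator (Q (e m)) x + (inwardSet (-e m)).indicator (Q (-e m)) x with hΦ
  have hind : ∀ h, AEMeasurable ((inwardSet h).indicator (Q h)) volume := fun h =>
    (aemeasurable_indicator_iff (measurableSet_inwardSet h)).2 (hQm h)
  have hslope : ∀ x ∈ Ω₀, ∀ s : ℕ → ℝ, (∀ m, s m ≠ 0) → Tendsto s atTop (𝓝 0) →
      DifferentiableAt ℝ G x → Tendsto (fun m => Q (s m) x) atTop
        (𝓝 (ENNReal.ofReal (dw c x ^ p * deriv G x ^ 2))) := by
    intro x hx s hs0 hs hd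
    have h1 := hd.hasDerivAt.tendsto_slope_zero.comp
      (tendsto_nhdsWithin_iff.2 ⟨hs, Eventually.of_forall hs0⟩)
    refine ENNReal.tendsto_ofReal (((h1.congr fun m => ?_).pow 2).const_mul _)
    simp only [Function.comp, smul_eq_mul]; field_simp
  have key : ∀ x ∈ Ω₀, x ≠ 0 → ENNReal.ofReal (dw c x ^ p * deriv G x ^ 2) ≤
      liminf (fun m => Φ m x) atTop := by
    intro x hx hx0
    by_cases hd : DifferentiableAt ℝ G x
    · rcases lt_or_gt_of_ne hx0 with hneg | hpos
      · rw [← (hslope x hx e (fun m => (he0 m).ne') het hd).liminf_eq]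
        refine liminf_le_liminf ?_
        filter_upwards [het.eventually (gt_mem_nhds (show 0 < -x by linarith))] with m hm
        have : x ∈ inwardSet (e m) := ⟨hx, by
          rw [abs_of_nonpos (by linarith), abs_of_neg hneg]; linarith [he0 m]⟩
        simp only [hΦ, indicator_of_mem this]
        exact le_self_add
      · have het' : Tendsto (fun m => -e m) atTop (𝓝 0) := by simpa using het.neg
        rw [← (hslope x hx (fun m => -e m) (fun m => (neg_neg_of_pos (he0 m)).ne) het' hd).liminf_eq]
        refine liminf_le_liminf ?_
        filter_upwards [het.eventually (gt_mem_nhds hpos)] with m hm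
        have : x ∈ inwardSet (-e m) := ⟨hx, by
          rw [abs_of_nonneg (by linarith), abs_of_pos hpos]; linarith [he0 m]⟩
        simp only [hΦ, indicator_of_mem this]
        exact le_add_self
    · rw [deriv_zero_of_not_differentiableAt hd]; simp
  refine lintegral_le_of_le_liminf (f := Φ) (fun m => ?_) ?_ fun m => ?_
  · exact ((hind _).add (hind _)).restrict
  · refine (ae_restrict_iff' measurableSet_Ω₀).2 ?_
    have h0 : ∀ᵐ x : ℝ, x ≠ 0 := by simp [ae_iff, measure_singleton]
    filter_upwards [h0] with x hx0 hx using key x hx hx0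
  · refine (setLIntegral_le_lintegral _ _).trans ?_
    simp only [hΦ]
    rw [lintegral_add_left' (hind _), lintegral_indicator (measurableSet_inwardSet _),
      lintegral_indicator (measurableSet_inwardSet _), two_mul, ENNReal.ofReal_add hM0 hM0]
    exact add_le_add (hQint _ (he0 m).ne') (hQint _ (neg_neg_of_pos (he0 m)).ne)

lemma subseq_single {U : Ultrafilter ℕ} (hU : (U : Filter ℕ) ≤ atTop) {f : ℕ → ℝ → ℝ} {F : ℝ → ℝ}
    (he : EqC f) (hF : ∀ x ∈ Ω₀, Tendsto (fun n => f n x) U (𝓝 (F x))) :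
    ∃ ψ : ℕ → ℕ, ∀ x ∈ Ω₀, Tendsto (fun n => f (ψ n) x) atTop (𝓝 (F x)) := by
  obtain ⟨ψ, -, h⟩ := exists_subseq_eqC (ι := Unit) hU (f := fun _ => f) (F := fun _ => F)
    (fun _ => he) fun _ => hF
  exact ⟨ψ, h ()⟩

lemma W_limit_le {c ρ M : ℝ} (hc : 0 < c) (hρ : 0 ≤ ρ) {A : ℕ} {u : ℕ → ℝ → ℝ}
    (hu : ∀ n, ContDiff ℝ ∞ (u n)) (hM : ∀ n, N c ρ A (u n) ≤ M) {U : Ultrafilter ℕ}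
    (hU : (U : Filter ℕ) ≤ atTop) {F : ℝ → ℝ}
    (hF : ∀ x ∈ Ω₀, Tendsto (fun n => u n x) U (𝓝 (F x))) {j : ℕ} (hj : j ≤ A) (hA : 1 ≤ A) :
    W c (ρ + j) (iteratedDeriv j F) ≤ 2 * M := by
  have hM0 : 0 ≤ M := (N_nonneg hc ρ A (u 0)).trans (hM 0)
  obtain ⟨hjet, -⟩ := jets_tendsto hc hρ hu hM U hF
  have hW : ∀ i ≤ A, ∀ n, W c (ρ + i) (iteratedDeriv i (u n)) ≤ M := fun i hi n =>
    (W_le_N hc ρ hi (u n)).trans (hM n)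
  rcases hj.lt_or_eq with hj | rfl
  · obtain ⟨ψ, hψ⟩ := subseq_single hU (eqC_iteratedDeriv hc hρ hj hu hM) (hjet j hj)
    refine (W_le_of_WL hc hM0 (WL_le_of_tendsto hc (by positivity)
      (fun n => continuous_iteratedDeriv' (hu (ψ n)) j) (fun n => hW j hj.le (ψ n)) hψ)).trans ?_
    linarith
  · obtain ⟨m, rfl⟩ : ∃ m, j = m + 1 := ⟨j - 1, by omega⟩
    have he := eqC_iteratedDeriv hc hρ (Nat.lt_succ_self m) hu hM
    obtain ⟨ψ, hψ⟩ := subseq_single hU he (hjet m (Nat.lt_succ_self m))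
    rw [iteratedDeriv_succ]
    refine W_le_of_WL hc (by linarith) (WL_deriv_le_of_tendsto hc (by positivity)
      (g := fun n => iteratedDeriv m (u (ψ n)))
      (fun n => (smooth_iteratedDeriv (hu (ψ n)) m).of_le one_le_smooth) (fun n => ?_) (fun x hx =>
        (EqC.continuousAt he (hjet m (Nat.lt_succ_self m)) hx).continuousWithinAt) hψ)
    rw [← iteratedDeriv_succ]
    exact hW _ le_rfl _

lemma gagliardo_limit_le {θ K : ℝ} (hK : 0 ≤ K) {g : ℕ → ℝ → ℝ} (hg : ∀ n, Continuous (g n))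
    (h : ∀ n, ∫⁻ x in Ω₀, ∫⁻ y in Ω₀,
      ENNReal.ofReal ((g n x - g n y) ^ 2 / |x - y| ^ (1 + 2 * θ)) ≤ ENNReal.ofReal K)
    {G : ℝ → ℝ} (hG : ∀ x ∈ Ω₀, Tendsto (fun n => g n x) atTop (𝓝 (G x))) :
    ∫ x in Ω₀, ∫ y in Ω₀, (G x - G y) ^ 2 / |x - y| ^ (1 + 2 * θ) ≤ K := by
  have hnn : ∀ x y, 0 ≤ (G x - G y) ^ 2 / |x - y| ^ (1 + 2 * θ) := fun x y => by positivity
  refine setIntegral_le_of_lintegral measurableSet_Ω₀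
    (fun x _ => setIntegral_nonneg measurableSet_Ω₀ fun y _ => hnn x y) hK ?_
  have h1 : ∫⁻ x in Ω₀, ENNReal.ofReal (∫ y in Ω₀, (G x - G y) ^ 2 / |x - y| ^ (1 + 2 * θ)) ≤
      ∫⁻ x in Ω₀, ∫⁻ y in Ω₀, ENNReal.ofReal ((G x - G y) ^ 2 / |x - y| ^ (1 + 2 * θ)) :=
    setLIntegral_mono' measurableSet_Ω₀ fun x _ =>
      ofReal_setIntegral_le measurableSet_Ω₀ fun y _ => hnn x y
  refine h1.trans (lintegral_le_of_le_liminf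
    (f := fun n x => ∫⁻ y in Ω₀, ENNReal.ofReal ((g n x - g n y) ^ 2 / |x - y| ^ (1 + 2 * θ)))
    (fun n => ?_) ?_ h)
  · have hm : Measurable fun p : ℝ × ℝ =>
        ENNReal.ofReal ((g n p.1 - g n p.2) ^ 2 / |p.1 - p.2| ^ (1 + 2 * θ)) := by
      have h1 := ((hg n).measurable.comp measurable_fst).sub ((hg n).measurable.comp measurable_snd)
      refine ((h1.pow_const 2).div (Measurable.pow_const ?_ _)).ennreal_ofReal
      exact (continuous_abs.comp (continuous_fst.sub continuous_snd)).measurable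
    exact hm.lintegral_prod_right'.aemeasurable
  · refine (ae_restrict_iff' measurableSet_Ω₀).2 (ae_of_all _ fun x hx => ?_)
    refine le_trans ?_ (lintegral_liminf_le' fun n => ?_)
    · refine setLIntegral_mono' measurableSet_Ω₀ fun y hy => ?_
      exact (ENNReal.tendsto_ofReal ((((hG x hx).sub (hG y hy)).pow 2).div_const _)).liminf_eq.ge
    · refine Measurable.aemeasurable (Measurable.ennreal_ofReal (Measurable.div ?_ ?_))
      · exact (continuous_const.sub (hg n)).measurable.pow_const 2
      · exact ((continuous_abs.comp (continuous_const.sub continuous_id)).measurable).pow_const _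

lemma SobSq_limit_le {c k : ℝ} (hc : 0 < c) (hk : 0 ≤ k) {a b : ℕ} (hka : k < a)
    (hb : ((a : ℝ) - k) / 2 + b < a) : ∃ C : ℝ, 0 ≤ C ∧ ∀ (u : ℕ → ℝ → ℝ) (M : ℝ),
      (∀ n, ContDiff ℝ ∞ (u n)) → (∀ n, N c k a (u n) ≤ M) → ∀ U : Ultrafilter ℕ,
      (U : Filter ℕ) ≤ atTop → ∀ F : ℝ → ℝ,
      (∀ x ∈ Ω₀, Tendsto (fun n => u n x) U (𝓝 (F x))) →
      SobSq (((a : ℝ) - k) / 2 + b) (fun y => dw c y ^ b * F y) ≤ C * M := by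
  set σ := ((a : ℝ) - k) / 2 + b with hσ
  have hσ0 : 0 ≤ σ := by
    have : 0 ≤ (a : ℝ) - k := by linarith
    positivity
  set m := ⌊σ⌋₊ with hm
  have hmσ : (m : ℝ) ≤ σ := Nat.floor_le hσ0
  have hσm : σ < m + 1 := Nat.lt_floor_add_one σ
  have hma : m < a := by exact_mod_cast hmσ.trans_lt hb
  choose! C₁ hC₁ h₁ using fun (j : ℕ) (hj : j ≤ a) =>
    W_dw_pow_mul_le hc hk b j (k + j) hj (by positivity)
      (by have : (j : ℝ) ≤ a := by exact_mod_cast hj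
          have : (0 : ℝ) ≤ b := by positivity
          linarith)
  choose! C₂ hC₂ h₂ using fun (j : ℕ) (hj : j ≤ m) =>
    W_dw_pow_mul_le hc hk b j (0 : ℝ) (hj.trans hma.le) le_rfl
      (by have : (j : ℝ) ≤ m := by exact_mod_cast hj
          linarith)
  obtain ⟨C₃, hC₃, h₃⟩ := W_dw_pow_mul_le hc hk b (m + 1) (2 - 2 * (σ - m)) hma (by linarith)
    (by push_cast; linarith)
  obtain ⟨C₄, hC₄, h₄⟩ : ∃ C : ℝ, 0 ≤ C ∧ ((m : ℝ) ≠ σ → ∀ g, ContDiff ℝ 1 g →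
      ∫⁻ x in Ω₀, ∫⁻ y in Ω₀, ENNReal.ofReal ((g x - g y) ^ 2 / |x - y| ^ (1 + 2 * (σ - m))) ≤
        ENNReal.ofReal (C * W c (2 - 2 * (σ - m)) (deriv g))) := by
    by_cases h : (m : ℝ) = σ
    · exact ⟨0, le_rfl, fun h' => absurd h h'⟩
    · obtain ⟨C, hC, h'⟩ := gagliardo_le (θ := σ - m) hc
        (sub_pos.2 (lt_of_le_of_ne hmσ h)) (by linarith)
      exact ⟨C, hC, fun _ => h'⟩
  have hC₁s : 0 ≤ ∑ j ∈ Finset.range (a + 1), C₁ j := Finset.sum_nonneg fun j hj =>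
    hC₁ j (Nat.lt_succ_iff.1 (Finset.mem_range.1 hj))
  have hC₂s : 0 ≤ ∑ j ∈ Finset.range (m + 1), C₂ j := Finset.sum_nonneg fun j hj =>
    hC₂ j (Nat.lt_succ_iff.1 (Finset.mem_range.1 hj))
  refine ⟨∑ j ∈ Finset.range (m + 1), C₂ j + C₄ * C₃, by positivity,
    fun u M hu hM U hU F hF => ?_⟩
  have hM0 : 0 ≤ M := (N_nonneg hc k a (u 0)).trans (hM 0)
  set f : ℕ → ℝ → ℝ := fun n x => dw c x ^ b * u n x with hf
  have hfs : ∀ n, ContDiff ℝ ∞ (f n) := fun n => ((dw_contDiff c).pow b).mul (hu n)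
  have hfN : ∀ n, N c k a (f n) ≤ (∑ j ∈ Finset.range (a + 1), C₁ j) * M := fun n => by
    rw [N, Finset.sum_mul]
    refine Finset.sum_le_sum fun j hj => ?_
    have hj' := Nat.lt_succ_iff.1 (Finset.mem_range.1 hj)
    exact (h₁ j hj' (u n) (hu n)).trans (mul_le_mul_of_nonneg_left (hM n) (hC₁ j hj'))
  have hfF : ∀ x ∈ Ω₀, Tendsto (fun n => f n x) U (𝓝 (dw c x ^ b * F x)) := fun x hx =>
    (hF x hx).const_mul _
  obtain ⟨hjet, -⟩ := jets_tendsto (F := fun y => dw c y ^ b * F y) hc hk hfs hfN U hfF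
  have hsub : ∀ j < a, ∃ ψ : ℕ → ℕ, ∀ x ∈ Ω₀, Tendsto (fun n => iteratedDeriv j (f (ψ n)) x) atTop
      (𝓝 (iteratedDeriv j (fun y => dw c y ^ b * F y) x)) := fun j hj =>
    subseq_single hU (eqC_iteratedDeriv hc hk hj hfs hfN) (hjet j hj)
  rw [SobSq, add_mul]
  refine add_le_add ?_ ?_
  · rw [HSq, Finset.sum_mul]
    refine Finset.sum_le_sum fun j hj => ?_
    have hj' := Nat.lt_succ_iff.1 (Finset.mem_range.1 hj)
    obtain ⟨ψ, hψ⟩ := hsub j (hj'.trans_lt hma)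
    have := W_le_of_WL hc (mul_nonneg (hC₂ j hj') hM0) (WL_le_of_tendsto hc (le_refl (0 : ℝ))
      (fun n => continuous_iteratedDeriv' (hfs (ψ n)) j) (fun n =>
        (h₂ j hj' (u (ψ n)) (hu _)).trans (mul_le_mul_of_nonneg_left (hM _) (hC₂ j hj'))) hψ)
    simpa [W] using this
  · split_ifs with h
    · positivity
    · obtain ⟨ψ, hψ⟩ := hsub m hma
      refine gagliardo_limit_le (g := fun n => iteratedDeriv m (f (ψ n))) (by positivity)
        (fun n => continuous_iteratedDeriv' (hfs (ψ n)) m) (fun n => ?_) hψ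
      refine (h₄ h _ ((smooth_iteratedDeriv (hfs (ψ n)) m).of_le one_le_smooth)).trans
        (ENNReal.ofReal_le_ofReal ?_)
      rw [← iteratedDeriv_succ, mul_assoc]
      exact mul_le_mul_of_nonneg_left ((h₃ (u (ψ n)) (hu _)).trans
        (mul_le_mul_of_nonneg_left (hM _) hC₃)) hC₄

lemma integrableOn_IP {c p : ℝ} (hp : 0 ≤ p) {f φ : ℝ → ℝ} (hf : ContinuousOn f Ω₀) {B : ℝ}
    (hB : ∀ x ∈ Ω₀, |f x| ≤ B) (hφ : Continuous φ) :
    IntegrableOn (fun x => dw c x ^ p * (f x * φ x)) Ω₀ := by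
  have i0 : IntegrableOn (fun x => dw c x ^ p * φ x) Ω₀ := integrableOn_Ω₀_dw hp hφ
  refine Integrable.mono' (i0.norm.const_mul B) (ContinuousOn.aestronglyMeasurable
    ((dw_rpow_continuous c hp).continuousOn.mul (hf.mul hφ.continuousOn)) measurableSet_Ω₀) ?_
  refine (ae_restrict_iff' measurableSet_Ω₀).2 (ae_of_all _ fun x hx => ?_)
  have : dw c x ^ p * (f x * φ x) = f x * (dw c x ^ p * φ x) := by ring
  rw [this, norm_mul]
  exact mul_le_mul_of_nonneg_right (hB x hx) (norm_nonneg _)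

lemma IP_abs_le_sup {c p : ℝ} (hp : 0 ≤ p) {f φ : ℝ → ℝ} {B : ℝ} (hB : ∀ x ∈ Ω₀, |f x| ≤ B)
    (hφ : Continuous φ) : |IP c p f φ| ≤ B * ∫ x in Ω₀, |dw c x ^ p * φ x| := by
  have i0 : IntegrableOn (fun x => dw c x ^ p * φ x) Ω₀ := integrableOn_Ω₀_dw hp hφ
  rw [← integral_const_mul]
  change ‖∫ x in Ω₀, dw c x ^ p * (f x * φ x)‖ ≤ ∫ x in Ω₀, B * ‖dw c x ^ p * φ x‖
  refine norm_integral_le_of_norm_le (i0.norm.const_mul B) ?_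
  refine (ae_restrict_iff' measurableSet_Ω₀).2 (ae_of_all _ fun x hx => ?_)
  have : dw c x ^ p * (f x * φ x) = f x * (dw c x ^ p * φ x) := by ring
  rw [this, norm_mul]
  exact mul_le_mul_of_nonneg_right (hB x hx) (norm_nonneg _)

lemma IP_sub_left' {c p : ℝ} (hp : 0 ≤ p) {f g φ : ℝ → ℝ} (hf : ContinuousOn f Ω₀)
    (hg : ContinuousOn g Ω₀) {B B' : ℝ} (hB : ∀ x ∈ Ω₀, |f x| ≤ B) (hB' : ∀ x ∈ Ω₀, |g x| ≤ B')
    (hφ : Continuous φ) : IP c p (fun x => f x - g x) φ = IP c p f φ - IP c p g φ := by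
  unfold IP
  rw [← integral_sub (integrableOn_IP hp hf hB hφ) (integrableOn_IP hp hg hB' hφ)]
  congr 1; funext x; ring

lemma continuous_indicator_dw_mul {c : ℝ} (hc : 0 < c) {r : ℝ → ℝ} (hr : ContinuousOn r Ω₀)
    {B : ℝ} (hB : ∀ x ∈ Ω₀, |r x| ≤ B) : Continuous (Ω₀.indicator fun x => dw c x * r x) := by
  have hB0 : 0 ≤ B := (abs_nonneg _).trans (hB 0 ⟨by norm_num, by norm_num⟩)
  rw [continuous_iff_continuousAt]
  intro x
  by_cases hx : x ∈ Ω₀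
  · have hn : Ω₀ ∈ 𝓝 x := isOpen_Ioo.mem_nhds hx
    have h1 : ContinuousAt (fun x => dw c x * r x) x :=
      (dw_continuous c).continuousAt.mul (hr.continuousAt hn)
    refine h1.congr ?_
    filter_upwards [hn] with y hy
    rw [indicator_of_mem hy]
  · have h0 : Ω₀.indicator (fun x => dw c x * r x) x = 0 := indicator_of_notMem hx _
    have hdx : dw c x ≤ 0 := by
      unfold dw
      have : 1 ≤ x ^ 2 := by
        by_contra! h
        exact hx (abs_lt.1 ((sq_lt_one_iff_abs_lt_one x).1 h))
      nlinarith
    rw [ContinuousAt, h0]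
    have hlim : Tendsto (fun y => max (dw c y) 0 * B) (𝓝 x) (𝓝 0) := by
      have : Continuous fun y => max (dw c y) 0 * B :=
        ((dw_continuous c).max continuous_const).mul continuous_const
      simpa [max_eq_right hdx] using this.tendsto x
    refine squeeze_zero_norm (fun y => ?_) hlim
    by_cases hy : y ∈ Ω₀
    · have := dw_pos hc hy
      rw [indicator_of_mem hy, norm_mul, Real.norm_of_nonneg this.le, max_eq_left this.le]
      exact mul_le_mul_of_nonneg_left (hB y hy) this.le
    · rw [indicator_of_notMem hy, norm_zero]
      positivity

lemma eqOn_zero_of_IP_polynomial {c p : ℝ} (hc : 0 < c) (hp : 0 ≤ p) {r : ℝ → ℝ}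
    (hr : ContinuousOn r Ω₀) {B : ℝ} (hB : ∀ x ∈ Ω₀, |r x| ≤ B)
    (h : ∀ P : Polynomial ℝ, IP c p r (fun x => P.eval x) = 0) : ∀ x ∈ Ω₀, r x = 0 := by
  have hB0 : 0 ≤ B := (abs_nonneg _).trans (hB 0 ⟨by norm_num, by norm_num⟩)
  set ρ := Ω₀.indicator fun x => dw c x * r x with hρ
  have hρc : Continuous ρ := continuous_indicator_dw_mul hc hr hB
  have hψc : Continuous fun x => dw c x * ρ x := (dw_continuous c).mul hρc
  have hzero : IP c p r (fun x => dw c x * ρ x) = 0 := by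
    set K := ∫ x in Ω₀, |dw c x ^ p * (1 : ℝ)| with hK
    have hK0 : 0 ≤ K := integral_nonneg fun _ => abs_nonneg _
    refine abs_nonpos_iff.1 (le_of_forall_pos_le_add fun ε hε => ?_)
    obtain ⟨P, hP⟩ := exists_polynomial_near_of_continuousOn (-1) 1 _ hψc.continuousOn
      (ε / (B * K + 1)) (by positivity)
    have hPc : Continuous fun x => P.eval x := P.continuous
    have e1 : IP c p r (fun x => dw c x * ρ x) =
        IP c p (fun x => r x * (dw c x * ρ x - P.eval x)) (fun _ => 1) := by
      have e2 : IP c p (fun x => r x * (dw c x * ρ x - P.eval x)) (fun _ => 1) =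
          IP c p r (fun x => dw c x * ρ x) - IP c p r (fun x => P.eval x) := by
        unfold IP
        rw [← integral_sub (integrableOn_IP hp hr hB hψc) (integrableOn_IP hp hr hB hPc)]
        congr 1; funext x; ring
      rw [e2, h P, sub_zero]
    rw [e1]
    refine (IP_abs_le_sup (B := B * (ε / (B * K + 1))) hp (fun x hx => ?_)
      continuous_const).trans ?_
    · rw [abs_mul, abs_sub_comm]
      exact mul_le_mul (hB x hx) (hP x (Ioo_subset_Icc_self hx)).le (abs_nonneg _) hB0
    · rw [← hK, zero_add]
      have : B * (ε / (B * K + 1)) * K = ε * (B * K / (B * K + 1)) := by ring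
      rw [this]
      refine mul_le_of_le_one_right hε.le ?_
      rw [div_le_one (by positivity)]
      linarith
  have hW : W c p ρ = 0 := by
    rw [← hzero]
    unfold W IP
    refine setIntegral_congr_fun measurableSet_Ω₀ fun x hx => ?_
    simp only [hρ, indicator_of_mem hx]
    ring
  intro x hx
  have := eqOn_zero_of_W_eq_zero hc hp hρc hW hx
  rw [hρ, indicator_of_mem hx] at this
  simpa [(dw_pos hc hx).ne'] using this

/-- A weak time derivative against polynomials which is continuous in time is a pointwise one. -/
lemma hasDerivWithinAt_of_weak {c p : ℝ} (hc : 0 < c) (hp : 0 ≤ p) {f g : ℝ → ℝ → ℝ} {B : ℝ}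
    (hf : ∀ t, 0 ≤ t → ContinuousOn (f t) Ω₀)
    (hfB : ∀ t, 0 ≤ t → ∃ B', ∀ x ∈ Ω₀, |f t x| ≤ B')
    (hg : ∀ t, 0 ≤ t → ContinuousOn (g t) Ω₀) (hgB : ∀ t, 0 ≤ t → ∀ x ∈ Ω₀, |g t x| ≤ B)
    (hgt : ∀ x ∈ Ω₀, ContinuousOn (fun t => g t x) (Ici 0))
    (h : ∀ P : Polynomial ℝ, ∀ t, 0 ≤ t → HasDerivWithinAt (fun s => IP c p (f s) fun x => P.eval x)
      (IP c p (g t) fun x => P.eval x) (Ici 0) t) {x : ℝ} (hx : x ∈ Ω₀) {t : ℝ} (ht : 0 ≤ t) :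
    HasDerivWithinAt (fun s => f s x) (g t x) (Ici 0) t := by
  set G : ℝ → ℝ → ℝ := fun s x => g (max s 0) x with hG
  have hGB : ∀ s, ∀ x ∈ Ω₀, |G s x| ≤ B := fun s => hgB _ (le_max_right _ _)
  have hGc : ∀ s, ContinuousOn (G s) Ω₀ := fun s => hg _ (le_max_right _ _)
  have hGt : ∀ x ∈ Ω₀, Continuous fun s => G s x := fun x hx =>
    (hgt x hx).comp_continuous (continuous_id.max continuous_const) fun s =>
      mem_Ici.2 (le_max_right _ _)
  set I : ℝ → ℝ → ℝ := fun t x => ∫ s in (0 : ℝ)..t, G s x with hI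
  have hIt : ∀ x ∈ Ω₀, ∀ t, HasDerivAt (fun t => I t x) (G t x) t := fun x hx t =>
    intervalIntegral.integral_hasDerivAt_right ((hGt x hx).intervalIntegrable _ _)
      ((hGt x hx).stronglyMeasurableAtFilter _ _) (hGt x hx).continuousAt
  have hIc : ∀ t, ContinuousOn (I t) Ω₀ := fun t x hx => by
    have hn : Ω₀ ∈ 𝓝 x := isOpen_Ioo.mem_nhds hx
    refine ContinuousAt.continuousWithinAt ?_
    refine intervalIntegral.continuousAt_of_dominated_interval (F := fun x s => G s x)
      (bound := fun _ => B) ?_ ?_ (by simp) ?_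
    · filter_upwards [hn] with y hy
      exact (hGt y hy).aestronglyMeasurable
    · filter_upwards [hn] with y hy
      exact ae_of_all _ fun s _ => hGB s y hy
    · exact ae_of_all _ fun s _ => (hGc s).continuousAt hn
  have hIB : ∀ t, ∀ x ∈ Ω₀, |I t x| ≤ B * |t - 0| := fun t x hx =>
    intervalIntegral.norm_integral_le_of_norm_le_const (f := fun s => G s x)
      fun s _ => hGB s x hx
  have hIP : ∀ P : Polynomial ℝ, ∀ t, HasDerivAt (fun s => IP c p (I s) fun x => P.eval x)
      (IP c p (G t) fun x => P.eval x) t := by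
    intro P t
    have hPc : Continuous fun x => P.eval x := P.continuous
    have i0 : IntegrableOn (fun x => dw c x ^ p * P.eval x) Ω₀ := integrableOn_Ω₀_dw hp hPc
    refine (hasDerivAt_integral_of_dominated_loc_of_deriv_le (μ := volume.restrict Ω₀)
      (F := fun s x => dw c x ^ p * (I s x * P.eval x))
      (F' := fun s x => dw c x ^ p * (G s x * P.eval x))
      (bound := fun x => B * ‖dw c x ^ p * P.eval x‖) (s := univ) univ_mem
      (Eventually.of_forall fun s => (integrableOn_IP hp (hIc s) (hIB s) hPc).1)
      (integrableOn_IP hp (hIc t) (hIB t) hPc)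
      (integrableOn_IP hp (hGc t) (hGB t) hPc).1 ?_ (i0.norm.const_mul B) ?_).2
    · refine (ae_restrict_iff' measurableSet_Ω₀).2 (ae_of_all _ fun x hx s _ => ?_)
      have : dw c x ^ p * (G s x * P.eval x) = G s x * (dw c x ^ p * P.eval x) := by ring
      rw [this, norm_mul]
      exact mul_le_mul_of_nonneg_right (hGB s x hx) (norm_nonneg _)
    · exact (ae_restrict_iff' measurableSet_Ω₀).2 (ae_of_all _ fun x hx s _ =>
        ((hIt x hx s).mul_const _).const_mul _)
  have hGeq : ∀ s, 0 ≤ s → G s = g s := fun s hs => by rw [hG]; simp only [max_eq_left hs]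
  have hkey : ∀ s, 0 ≤ s → ∀ y ∈ Ω₀, f s y = f 0 y + I s y := by
    intro s hs
    obtain ⟨B₁, hB₁⟩ := hfB s hs
    obtain ⟨B₀, hB₀⟩ := hfB 0 le_rfl
    have hc1 : ContinuousOn (fun y => f s y - I s y) Ω₀ := (hf s hs).sub (hIc s)
    have hb1 : ∀ y ∈ Ω₀, |f s y - I s y| ≤ B₁ + B * |s - 0| := fun y hy =>
      (abs_sub _ _).trans (add_le_add (hB₁ y hy) (hIB s y hy))
    have := eqOn_zero_of_IP_polynomial (r := fun y => (f s y - I s y) - f 0 y) hc hp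
      (hc1.sub (hf 0 le_rfl)) (B := B₁ + B * |s - 0| + B₀)
      (fun y hy => (abs_sub _ _).trans (add_le_add (hb1 y hy) (hB₀ y hy))) fun P => ?_
    · intro y hy
      linarith [this y hy]
    · have hPc : Continuous fun x => P.eval x := P.continuous
      rw [IP_sub_left' (f := fun y => f s y - I s y) hp hc1 (hf 0 le_rfl) hb1 hB₀ hPc,
        IP_sub_left' hp (hf s hs) (hIc s) hB₁ (hIB s) hPc]
      have hd : ∀ r, 0 ≤ r → HasDerivWithinAt (fun s => IP c p (f s) (fun x => P.eval x) -
          IP c p (I s) fun x => P.eval x) 0 (Ici 0) r := fun r hr =>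
        ((h P r hr).sub (hIP P r).hasDerivWithinAt).congr_deriv (by rw [hGeq r hr, sub_self])
      have hcst := constant_of_has_deriv_right_zero (a := 0) (b := s)
        (fun r hr => ((hd r hr.1).continuousWithinAt).mono Icc_subset_Ici_self)
        (fun r hr => (hd r hr.1).mono (Ici_subset_Ici.2 hr.1)) s ⟨hs, le_rfl⟩
      have hI0 : IP c p (I 0) (fun x => P.eval x) = 0 := by simp [IP, hI]
      rw [hcst, hI0]
      ring
  have h1 : HasDerivWithinAt (fun s => f 0 x + I s x) (g t x) (Ici 0) t := by
    have := ((hIt x hx t).const_add (f 0 x)).hasDerivWithinAt (s := Ici 0)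
    rwa [hGeq t ht] at this
  exact h1.congr (fun s hs => hkey s hs x hx) (hkey t ht x hx)

lemma IP_tendsto {c p : ℝ} (hp : 0 ≤ p) {ι : Type*} [Countable ι] {U : Ultrafilter ℕ}
    (hU : (U : Filter ℕ) ≤ atTop) {f : ι → ℕ → ℝ → ℝ} {F : ι → ℝ → ℝ} (he : ∀ i, EqC (f i))
    (hF : ∀ i, ∀ x ∈ Ω₀, Tendsto (fun n => f i n x) U (𝓝 (F i x))) {g : ℕ → ℝ → ℝ} {G : ℝ → ℝ}
    (hg : ∀ n, Continuous (g n)) {B : ℝ} (hB : ∀ n, ∀ x ∈ Ω₀, |g n x| ≤ B)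
    (hG : ∀ ψ : ℕ → ℕ, (∀ i, ∀ x ∈ Ω₀, Tendsto (fun n => f i (ψ n) x) atTop (𝓝 (F i x))) →
      ∀ x ∈ Ω₀, Tendsto (fun n => g (ψ n) x) atTop (𝓝 (G x))) {φ : ℝ → ℝ} (hφ : Continuous φ) :
    Tendsto (fun n => IP c p (g n) φ) U (𝓝 (IP c p G φ)) := by
  obtain ⟨L, -, hL⟩ := exists_ultrafilter_limit U fun n => IP_abs_le_sup (c := c) hp (hB n) hφ
  obtain ⟨ψ, -, hψ⟩ := exists_subseq_eqC (ι := Option ι) hU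
    (f := fun o => o.elim (fun n _ => IP c p (g n) φ) f) (F := fun o => o.elim (fun _ => L) F)
    (fun o => by cases o with
      | none => exact eqC_const _
      | some i => exact he i)
    (fun o x hx => by cases o with
      | none => exact hL
      | some i => exact hF i x hx)
  have h1 : Tendsto (fun n => IP c p (g (ψ n)) φ) atTop (𝓝 L) :=
    hψ none 0 ⟨by norm_num, by norm_num⟩
  have h2 := hG ψ fun i => hψ (some i)
  have i0 : IntegrableOn (fun x => dw c x ^ p * φ x) Ω₀ := integrableOn_Ω₀_dw hp hφ
  have h3 : Tendsto (fun n => IP c p (g (ψ n)) φ) atTop (𝓝 (IP c p G φ)) := by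
    refine tendsto_integral_of_dominated_convergence (fun x => B * ‖dw c x ^ p * φ x‖)
      (fun n => ((dw_rpow_continuous c hp).mul ((hg (ψ n)).mul hφ)).aestronglyMeasurable)
      (i0.norm.const_mul B) (fun n => ?_) ?_
    · refine (ae_restrict_iff' measurableSet_Ω₀).2 (ae_of_all _ fun x hx => ?_)
      have : dw c x ^ p * (g (ψ n) x * φ x) = g (ψ n) x * (dw c x ^ p * φ x) := by ring
      rw [this, norm_mul]
      exact mul_le_mul_of_nonneg_right (hB _ x hx) (norm_nonneg _)
    · exact (ae_restrict_iff' measurableSet_Ω₀).2 (ae_of_all _ fun x hx =>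
        ((h2 x hx).mul_const _).const_mul _)
  rw [tendsto_nhds_unique h3 h1]
  exact hL

lemma W1InfSq_le_of_bound {f : ℝ → ℝ} {B₀ B₁ : ℝ} (h₀ : ∀ x ∈ Ω₀, f x ^ 2 ≤ B₀)
    (h₁ : ∀ x ∈ Ω₀, deriv f x ^ 2 ≤ B₁) : W1InfSq f ≤ B₀ + B₁ := by
  have key : ∀ (g : ℝ → ℝ) (B : ℝ), (∀ x ∈ Ω₀, g x ^ 2 ≤ B) →
      (sSup ((fun x => |g x|) '' Ω₀)) ^ 2 ≤ B := by
    intro g B h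
    have hB0 : 0 ≤ B := (sq_nonneg _).trans (h 0 ⟨by norm_num, by norm_num⟩)
    have h1 : sSup ((fun x => |g x|) '' Ω₀) ≤ √B := by
      refine Real.sSup_le ?_ (Real.sqrt_nonneg _)
      rintro _ ⟨x, hx, rfl⟩
      exact Real.abs_le_sqrt (h x hx)
    have h2 : 0 ≤ sSup ((fun x => |g x|) '' Ω₀) := by
      refine Real.sSup_nonneg ?_
      rintro _ ⟨x, hx, rfl⟩
      exact abs_nonneg _
    calc _ ≤ √B ^ 2 := pow_le_pow_left₀ h2 h1 2
      _ = B := Real.sq_sqrt hB0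
  exact add_le_add (key f B₀ h₀) (key (deriv f) B₁ h₁)

/-- The right-hand side of the evolution, up to the factor `-α ^ (1 - γ)`. -/
def force (c k γ : ℝ) (δ : ℝ → ℝ) (x : ℝ) : ℝ :=
  δ x - DD c k (fun y => Fc γ (deriv δ y)) x

lemma force_smooth {c k γ : ℝ} {δ : ℝ → ℝ} (hδ : ContDiff ℝ ∞ δ) :
    ContDiff ℝ ∞ (force c k γ δ) :=
  hδ.sub (DD_smooth ((Fc_smooth γ).comp (smooth_deriv hδ)))

lemma IP_force {c k γ : ℝ} (hc : 0 < c) (hk : 0 ≤ k) {δ φ : ℝ → ℝ} (hδ : ContDiff ℝ ∞ δ)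
    (hφ : ContDiff ℝ ∞ φ) : IP c k (force c k γ δ) φ =
      IP c k δ φ + IP c (k + 1) (fun x => Fc γ (deriv δ x)) (deriv φ) := by
  have hF : ContDiff ℝ ∞ fun y => Fc γ (deriv δ y) := (Fc_smooth γ).comp (smooth_deriv hδ)
  have h1 := IP_DD hc hk hφ hF
  have h2 := IP_add_left (f := δ) (g := fun x => -1 * DD c k (fun y => Fc γ (deriv δ y)) x) hk
    (c := c) hδ.continuous (continuous_const.mul (DD_smooth hF).continuous) hφ.continuous
  have h3 := IP_const_mul_left c k (-1) (DD c k fun y => Fc γ (deriv δ y)) φ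
  have e : force c k γ δ = fun x => δ x + -1 * DD c k (fun y => Fc γ (deriv δ y)) x := by
    funext x; unfold force; ring
  rw [e, h2, h3, h1]
  ring

lemma hasDerivAt_IP_pol {c p : ℝ} (hp : 0 ≤ p) {n : ℕ} {q : ℝ → Fin n → ℝ} {q' : Fin n → ℝ}
    {t : ℝ} (h : HasDerivAt q q' t) {φ : ℝ → ℝ} (hφ : Continuous φ) :
    HasDerivAt (fun s => IP c p (pol (q s)) φ) (IP c p (pol q') φ) t := by
  simp only [fun r : Fin n → ℝ => IP_comm c p (pol r) φ, IP_pol_right (c := c) hp hφ]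
  exact HasDerivAt.fun_sum fun i _ => ((hasDerivAt_pi.1 h) i).mul_const _

lemma Gal.hasDerivWithinAt_IP {c k γ : ℝ} {α α' : ℝ → ℝ} {n : ℕ} {J : Set ℝ}
    {q e e' : ℝ → Fin n → ℝ} (hc : 0 < c) (hk : 0 ≤ k) (hα : IsExpansion γ α α')
    (G : Gal c k γ α α' n J q e e') {φ : ℝ → ℝ} (hφ : PolyLT n φ) {t : ℝ} (htJ : t ∈ J)
    (ht : 0 ≤ t) : HasDerivWithinAt (fun s => α s ^ 2 * IP c k (pol (e s)) φ)
      (-α t ^ (1 - γ) * IP c k (force c k γ (pol (q t))) φ) (Ici 0) t := by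
  have h1 := (hα.deriv t ht).pow 2
  have h2 := (hasDerivAt_IP_pol (c := c) hk (G.de t htJ) hφ.smooth.continuous).hasDerivWithinAt
    (s := Ici 0)
  refine (h1.mul h2).congr_deriv ?_
  have hw := G.weak t htJ ht φ hφ
  rw [IP_force hc hk (pol_smooth _) hφ.smooth]
  have hα0 := hα.pos t ht
  have e1 : α t ^ (1 - γ) * α t ^ (γ + 1) = α t ^ 2 := by
    rw [← Real.rpow_add hα0, ← Real.rpow_natCast]
    congr 1
    push_cast
    ring
  have e2 : α t ^ (1 - γ) * α t ^ γ = α t := by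
    rw [← Real.rpow_add hα0]
    simp
  simp only [Pi.pow_apply] at *
  push_cast
  linear_combination (α t ^ (1 - γ)) * hw + (-IP c k (pol (e' t)) φ) * e1 -
    (2 * α' t * IP c k (pol (e t)) φ) * e2

/-- Smooth approximate solutions with uniform bounds, solving the weak form asymptotically. -/
structure Approx (c k γ : ℝ) (α : ℝ → ℝ) (a : ℕ) (M : ℝ) (u : ℝ → ℝ) (δ v : ℕ → ℝ → ℝ → ℝ) :
    Prop where
  smδ : ∀ n t, ContDiff ℝ ∞ (δ n t)
  smv : ∀ n t, ContDiff ℝ ∞ (v n t)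
  Nv : ∀ n t, 0 ≤ t → α t ^ (γ + 1) * N c k a (v n t) ≤ M
  Nδ : ∀ n t, 0 ≤ t → N c k a (δ n t) ≤ M
  Nw : ∀ n t, 0 ≤ t → N c (k + 1) a (deriv (δ n t)) ≤ M
  half : ∀ n t, 0 ≤ t → ∀ x ∈ Ω₀, |deriv (δ n t) x| ≤ 1 / 2
  jet : ∀ T, ∀ᶠ n in atTop, ∀ t ∈ Icc 0 T, ∀ j x, HasDerivWithinAt
    (fun s => iteratedDeriv j (δ n s) x) (iteratedDeriv j (v n t) x) (Icc 0 T) t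
  dI : ∀ (P : Polynomial ℝ) (T : ℝ), ∀ᶠ n in atTop, ∀ t ∈ Icc 0 T, HasDerivWithinAt
    (fun s => IP c k (δ n s) fun x => P.eval x) (IP c k (v n t) fun x => P.eval x) (Icc 0 T) t
  dV : ∀ (P : Polynomial ℝ) (T : ℝ), ∀ᶠ n in atTop, ∀ t ∈ Icc 0 T, HasDerivWithinAt
    (fun s => α s ^ 2 * IP c k (v n s) fun x => P.eval x)
    (-α t ^ (1 - γ) * IP c k (force c k γ (δ n t)) fun x => P.eval x) (Icc 0 T) t
  zero : ∀ n, ∀ x ∈ Ω₀, δ n 0 x = 0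
  init : ∀ x ∈ Ω₀, Tendsto (fun n => v n 0 x) atTop (𝓝 (u x))

lemma N_zero_fun (c ρ : ℝ) (A : ℕ) : N c ρ A (fun _ => 0) = 0 := by
  unfold N
  refine Finset.sum_eq_zero fun j _ => ?_
  have : iteratedDeriv j (fun _ : ℝ => (0 : ℝ)) = fun _ => 0 := by
    funext x
    simp
  rw [this]
  simp [W]

lemma exists_approx {c k γ : ℝ} {α α' : ℝ → ℝ} (hc : 0 < c) (hk : 0 ≤ k) (hγ : 1 < γ) (hγ3 : γ ≤ 3)
    {a : ℕ} (ha : k + 3 < a) (hα : IsExpansion γ α α') :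
    ∃ ε₀ > (0 : ℝ), ∃ C : ℝ, 0 ≤ C ∧ ∀ ε, 0 < ε → ε ≤ ε₀ → ∀ u : ℝ → ℝ,
      (∀ n : ℕ, ContDiffOn ℝ n u (Icc (-1) 1)) → N c k a u < ε →
      ∃ δ v, Approx c k γ α a (C * ε) u δ v := by
  obtain ⟨ε₀, hε₀, C, hC, hbd⟩ := Gal.bound (γ := γ) hc hk hγ hγ3 ha hα
  refine ⟨ε₀, hε₀, C, hC, fun ε hε hεε u hu hN => ?_⟩
  obtain ⟨m, e₀, hm, he₀, hlim⟩ := exists_pol_initial hc hk a hu hN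
  choose J q e e' hG hJ hq0 he0 using fun n : ℕ =>
    exists_Gal hc hk hα (m n) (Nat.cast_nonneg (α := ℝ) n) (e₀ n)
  have hb := fun (n : ℕ) (t : ℝ) (ht : t ∈ Icc (0 : ℝ) n) =>
    hbd (m n) (J n) (q n) (e n) (e' n) (hG n) n (hJ n) (hq0 n)
      (by rw [he0 n]; exact (he₀ n).le.trans hεε) t ht
  have hCε : ∀ n, C * N c k a (pol (e n 0)) ≤ C * ε := fun n =>
    mul_le_mul_of_nonneg_left (by rw [he0 n]; exact (he₀ n).le) hC
  set δ : ℕ → ℝ → ℝ → ℝ := fun n t => if t ≤ n then pol (q n t) else fun _ => 0 with hδ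
  set v : ℕ → ℝ → ℝ → ℝ := fun n t => if t ≤ n then pol (e n t) else fun _ => 0 with hv
  have hδe : ∀ (n : ℕ) (t : ℝ), t ≤ n → δ n t = pol (q n t) := fun n t h => if_pos h
  have hve : ∀ (n : ℕ) (t : ℝ), t ≤ n → v n t = pol (e n t) := fun n t h => if_pos h
  have hδz : ∀ (n : ℕ) (t : ℝ), ¬ t ≤ n → δ n t = fun _ => 0 := fun n t h => if_neg h
  have hvz : ∀ (n : ℕ) (t : ℝ), ¬ t ≤ n → v n t = fun _ => 0 := fun n t h => if_neg h
  have hmem : ∀ (n : ℕ) (T t : ℝ), T ≤ n → t ∈ Icc 0 T → t ∈ Icc (0 : ℝ) n := fun n T t hT ht =>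
    ⟨ht.1, ht.2.trans hT⟩
  have hα1 : ∀ t, 0 ≤ t → 0 ≤ α t ^ (γ + 1) := fun t ht => Real.rpow_nonneg (hα.pos t ht).le _
  have hCε0 : 0 ≤ C * ε := by positivity
  refine ⟨δ, v, ?_, ?_, ?_, ?_, ?_, ?_, ?_, ?_, ?_, ?_, ?_⟩
  · intro n t
    by_cases h : t ≤ n
    · rw [hδe n t h]; exact pol_smooth _
    · rw [hδz n t h]; exact contDiff_const
  · intro n t
    by_cases h : t ≤ n
    · rw [hve n t h]; exact pol_smooth _
    · rw [hvz n t h]; exact contDiff_const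
  · intro n t ht
    by_cases h : t ≤ n
    · rw [hve n t h]
      linarith [(hb n t ⟨ht, h⟩).2, hCε n, N_nonneg hc k a (pol (q n t)),
        N_nonneg hc (k + 1) a (deriv (pol (q n t)))]
    · rw [hvz n t h, N_zero_fun]
      simpa using hCε0
  · intro n t ht
    by_cases h : t ≤ n
    · rw [hδe n t h]
      linarith [(hb n t ⟨ht, h⟩).2, hCε n, mul_nonneg (hα1 t ht) (N_nonneg hc k a (pol (e n t))),
        N_nonneg hc (k + 1) a (deriv (pol (q n t)))]
    · rw [hδz n t h, N_zero_fun]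
      exact hCε0
  · intro n t ht
    by_cases h : t ≤ n
    · rw [hδe n t h]
      linarith [(hb n t ⟨ht, h⟩).2, hCε n, mul_nonneg (hα1 t ht) (N_nonneg hc k a (pol (e n t))),
        N_nonneg hc k a (pol (q n t))]
    · have : deriv (fun _ : ℝ => (0 : ℝ)) = fun _ => 0 := by funext x; simp
      rw [hδz n t h, this, N_zero_fun]
      exact hCε0
  · intro n t ht x hx
    by_cases h : t ≤ n
    · rw [hδe n t h]
      exact (hb n t ⟨ht, h⟩).1 x hx
    · rw [hδz n t h]
      simp
  · intro T
    filter_upwards [eventually_ge_atTop ⌈T⌉₊] with n hn t ht j x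
    have hT : T ≤ n := (Nat.le_ceil T).trans (by exact_mod_cast hn)
    rw [hve n t (ht.2.trans hT)]
    refine (hasDerivAt_pol ((hG n).dq t (hJ n (hmem n T t hT ht))) j x).hasDerivWithinAt.congr
      (fun s hs => by rw [hδe n s (hs.2.trans hT)]) (by rw [hδe n t (ht.2.trans hT)])
  · intro P T
    filter_upwards [eventually_ge_atTop ⌈T⌉₊] with n hn t ht
    have hT : T ≤ n := (Nat.le_ceil T).trans (by exact_mod_cast hn)
    rw [hve n t (ht.2.trans hT)]
    refine (hasDerivAt_IP_pol hk ((hG n).dq t (hJ n (hmem n T t hT ht)))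
      P.continuous).hasDerivWithinAt.congr
      (fun s hs => by rw [hδe n s (hs.2.trans hT)]) (by rw [hδe n t (ht.2.trans hT)])
  · intro P T
    filter_upwards [eventually_ge_atTop ⌈T⌉₊, eventually_gt_atTop P.natDegree] with n hn hP t ht
    have hT : T ≤ n := (Nat.le_ceil T).trans (by exact_mod_cast hn)
    rw [hδe n t (ht.2.trans hT)]
    have hφ : PolyLT (m n) fun x => P.eval x :=
      ⟨P, fun j hj => Polynomial.coeff_eq_zero_of_natDegree_lt
        (hP.trans_le ((hm n).trans hj)), rfl⟩
    refine (((hG n).hasDerivWithinAt_IP hc hk hα hφ (hJ n (hmem n T t hT ht)) ht.1).mono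
      Icc_subset_Ici_self).congr
      (fun s hs => by rw [hve n s (hs.2.trans hT)]) (by rw [hve n t (ht.2.trans hT)])
  · intro n x _
    rw [hδe n 0 (Nat.cast_nonneg n), hq0 n]
    simp [pol]
  · intro x hx
    refine (hlim x hx).congr fun n => ?_
    rw [hve n 0 (Nat.cast_nonneg n), he0 n]

lemma force_eq_of_hasDerivAt {c k γ x w : ℝ} {δ : ℝ → ℝ} (h : HasDerivAt (deriv δ) w x) :
    force c k γ δ x = δ x - (dw c x * (deriv (Fc γ) (deriv δ x) * w) +
      (k + 1) * (-2 * c * x) * Fc γ (deriv δ x)) := by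
  have h1 : HasDerivAt (fun y => Fc γ (deriv δ y)) (deriv (Fc γ) (deriv δ x) * w) x :=
    (((Fc_smooth γ).differentiable (by simp)) (deriv δ x)).hasDerivAt.comp x h
  unfold force DD
  rw [h1.deriv]

lemma continuous_deriv_Fc (γ : ℝ) : Continuous (deriv (Fc γ)) :=
  (smooth_deriv (Fc_smooth γ)).continuous

lemma force_tendsto {ι : Type*} {l : Filter ι} {c k γ x : ℝ} {δ : ι → ℝ → ℝ} {D : ℝ → ℝ}
    (hδ : ∀ᶠ i in l, HasDerivAt (deriv (δ i)) (iteratedDeriv 2 (δ i) x) x)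
    (hD : HasDerivAt (deriv D) (iteratedDeriv 2 D x) x)
    (h0 : Tendsto (fun i => δ i x) l (𝓝 (D x)))
    (h1 : Tendsto (fun i => deriv (δ i) x) l (𝓝 (deriv D x)))
    (h2 : Tendsto (fun i => iteratedDeriv 2 (δ i) x) l (𝓝 (iteratedDeriv 2 D x))) :
    Tendsto (fun i => force c k γ (δ i) x) l (𝓝 (force c k γ D x)) := by
  rw [force_eq_of_hasDerivAt hD]
  refine Tendsto.congr' (hδ.mono fun i hi => (force_eq_of_hasDerivAt hi).symm) ?_
  exact h0.sub ((((((continuous_deriv_Fc γ).tendsto _).comp h1).mul h2).const_mul _).add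
    ((((Fc_smooth γ).continuous.tendsto _).comp h1).const_mul _))

lemma hasDerivAt_deriv_two {f : ℝ → ℝ} (hf : ContDiff ℝ ∞ f) (x : ℝ) :
    HasDerivAt (deriv f) (iteratedDeriv 2 f x) x := by
  have := hasDerivAt_iteratedDeriv hf 1 x
  rwa [iteratedDeriv_one] at this

lemma exists_sup_bound {c k : ℝ} (hc : 0 < c) (hk : 0 ≤ k) {a : ℕ} (ha : k + 3 < a) :
    ∃ K, 0 ≤ K ∧ ∀ f : ℝ → ℝ, ContDiff ℝ ∞ f → ∀ M, N c k a f ≤ M → ∀ x ∈ Ω₀,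
      f x ^ 2 ≤ K * M ∧ deriv f x ^ 2 ≤ K * M := by
  have ha1 : 1 ≤ a := by
    have : (0 : ℝ) < a := by linarith
    exact_mod_cast this
  obtain ⟨K0, hK0, h0⟩ := sup0_le_const_N (ρ := k) hc hk ha1 (by linarith)
  obtain ⟨K1, hK1, h1⟩ := sup_deriv_le hc hk ha
  refine ⟨K0 + K1, by positivity, fun f hf M hM x hx => ?_⟩
  have hN := N_nonneg hc k a f
  constructor
  · nlinarith [h0 f hf x hx, mul_nonneg hK1 (hN.trans hM), mul_le_mul_of_nonneg_left hM hK0]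
  · nlinarith [h1 f hf x hx, mul_nonneg hK0 (hN.trans hM), mul_le_mul_of_nonneg_left hM hK1]

lemma exists_force_bound {c k : ℝ} (γ : ℝ) (hc : 0 < c) (hk : 0 ≤ k) {a : ℕ} (ha : k + 3 < a)
    (M : ℝ) : ∃ B, ∀ δ : ℝ → ℝ, ContDiff ℝ ∞ δ → N c k a δ ≤ M → N c (k + 1) a (deriv δ) ≤ M →
      (∀ x ∈ Ω₀, |deriv δ x| ≤ 1 / 2) → ∀ x ∈ Ω₀, |force c k γ δ x| ≤ B := by
  obtain ⟨K, hK, h0⟩ := exists_sup_bound hc hk ha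
  have ha1 : 1 < a := by
    have : (1 : ℝ) < a := by linarith
    exact_mod_cast this
  obtain ⟨K1, hK1, h1⟩ := sup_le_const_N (ρ := k + 1) (σ := 1) (i := 1) hc (by linarith) ha1 le_rfl
    (by push_cast; linarith)
  obtain ⟨L1, hL1, hF⟩ := Fc_lipschitz γ
  obtain ⟨L2, hL2, hF'⟩ := deriv_Fc_lipschitz γ
  refine ⟨√(K * M) + (√(c * (K1 * M)) * (|deriv (Fc γ) 0| + L2) + (k + 1) * (2 * c) * L1),
    fun δ hδ hN hN1 hh x hx => ?_⟩
  rw [force_eq_of_hasDerivAt (hasDerivAt_deriv_two hδ x)]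
  have hx' : |x| ≤ 1 := abs_le.2 ⟨hx.1.le, hx.2.le⟩
  have hd := dw_pos hc hx
  have hdc := dw_le hc x
  have e1 : |δ x| ≤ √(K * M) := Real.abs_le_sqrt (h0 δ hδ M hN x hx).1
  have e2 : |dw c x * iteratedDeriv 2 δ x| ≤ √(c * (K1 * M)) := by
    refine Real.abs_le_sqrt ?_
    have := h1 (deriv δ) (smooth_deriv hδ) x hx
    rw [Real.rpow_one, iteratedDeriv_one] at this
    have h3 : iteratedDeriv 2 δ x = deriv (deriv δ) x := by
      rw [iteratedDeriv_succ, iteratedDeriv_one]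
    rw [h3]
    have h4 : K1 * N c (k + 1) a (deriv δ) ≤ K1 * M := mul_le_mul_of_nonneg_left hN1 hK1
    calc (dw c x * deriv (deriv δ) x) ^ 2 = dw c x * (dw c x * deriv (deriv δ) x ^ 2) := by ring
      _ ≤ c * (K1 * M) := by
        refine mul_le_mul hdc (this.trans h4) (by positivity) hc.le
  have e3 : |deriv (Fc γ) (deriv δ x)| ≤ |deriv (Fc γ) 0| + L2 := by
    have h3 := hF' (deriv δ x) 0
    rw [sub_zero] at h3
    have h4 := abs_sub_abs_le_abs_sub (deriv (Fc γ) (deriv δ x)) (deriv (Fc γ) 0)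
    nlinarith [hh x hx]
  have e4 : |Fc γ (deriv δ x)| ≤ L1 := by
    have h3 := hF (deriv δ x) 0
    rw [sub_zero, Fc_zero, sub_zero] at h3
    nlinarith [hh x hx]
  have e5 : |(k + 1) * (-2 * c * x)| ≤ (k + 1) * (2 * c) := by
    rw [abs_mul, abs_mul, abs_of_nonneg (by linarith : 0 ≤ k + 1),
      show |-2 * c| = 2 * c by rw [abs_mul, abs_of_pos hc]; norm_num]
    have : 0 ≤ (k + 1) * (2 * c) := by positivity
    nlinarith
  refine (abs_sub _ _).trans (add_le_add e1 ((abs_add_le _ _).trans (add_le_add ?_ ?_)))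
  · rw [show dw c x * (deriv (Fc γ) (deriv δ x) * iteratedDeriv 2 δ x) =
      dw c x * iteratedDeriv 2 δ x * deriv (Fc γ) (deriv δ x) by ring, abs_mul]
    exact mul_le_mul e2 e3 (abs_nonneg _) (Real.sqrt_nonneg _)
  · rw [abs_mul]
    exact mul_le_mul e5 e4 (abs_nonneg _) (by positivity)

lemma lipschitz_of_jet {T : ℝ} {f f' : ℝ → ℝ} {B : ℝ}
    (h : ∀ t ∈ Icc 0 T, HasDerivWithinAt f (f' t) (Icc 0 T) t) (hB : ∀ t ∈ Icc 0 T, |f' t| ≤ B)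
    {s t : ℝ} (hs : s ∈ Icc 0 T) (ht : t ∈ Icc 0 T) : |f s - f t| ≤ B * |s - t| :=
  (convex_Icc 0 T).norm_image_sub_le_of_norm_hasDerivWithin_le h hB ht hs

lemma equicontinuousAt_of_modulus {l : Filter ℕ} {s : Set ℝ} {f : ℕ → ℝ → ℝ} {β : ℝ → ℝ}
    {L B x : ℝ} (hβ : ContinuousWithinAt β s x)
    (h : ∀ᶠ n in l, ∀ y ∈ s, |f n y - f n x| ≤ L * |y - x| + B * |β y - β x|) :
    ∀ ε > 0, ∃ r > 0, ∀ᶠ n in l, ∀ y ∈ s, |y - x| < r → |f n y - f n x| ≤ ε := by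
  intro ε hε
  have hω : Tendsto (fun y => L * |y - x| + B * |β y - β x|) (𝓝[s] x) (𝓝 0) := by
    have h1 : Tendsto (fun y => y - x) (𝓝[s] x) (𝓝 (x - x)) :=
      (tendsto_id.sub_const x).mono_left nhdsWithin_le_nhds
    have h2 : Tendsto (fun y => β y - β x) (𝓝[s] x) (𝓝 (β x - β x)) := hβ.tendsto.sub_const _
    have := (h1.abs.const_mul L).add (h2.abs.const_mul B)
    simpa using this
  obtain ⟨r, hr, hr'⟩ := Metric.mem_nhdsWithin_iff.1 (hω.eventually (eventually_le_nhds hε))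
  refine ⟨r, hr, h.mono fun n hn y hy hyx => (hn y hy).trans (hr' ⟨?_, hy⟩)⟩
  rwa [Metric.mem_ball, Real.dist_eq]

lemma IP_sub_left {c p : ℝ} (hp : 0 ≤ p) {f g h : ℝ → ℝ} (hf : Continuous f) (hg : Continuous g)
    (hh : Continuous h) : IP c p (fun x => f x - g x) h = IP c p f h - IP c p g h := by
  have h1 := IP_add_left (c := c) (f := f) (g := fun x => -1 * g x) hp hf
    (continuous_const.mul hg) hh
  have h2 := IP_const_mul_left c p (-1) g h
  have e : (fun x => f x - g x) = fun x => f x + -1 * g x := by funext x; ring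
  rw [e, h1, h2]
  ring

lemma IP_limit {c k M : ℝ} (hc : 0 < c) (hk : 0 ≤ k) {a : ℕ} (ha : 0 < a) {f : ℕ → ℝ → ℝ}
    (hf : ∀ n, ContDiff ℝ ∞ (f n)) (hM : ∀ n, N c k a (f n) ≤ M) {B : ℝ}
    (hB : ∀ n, ∀ x ∈ Ω₀, |f n x| ≤ B) {U : Ultrafilter ℕ} (hU : (U : Filter ℕ) ≤ atTop)
    {F : ℝ → ℝ} (hF : ∀ x ∈ Ω₀, Tendsto (fun n => f n x) U (𝓝 (F x))) {φ : ℝ → ℝ}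
    (hφ : Continuous φ) : Tendsto (fun n => IP c k (f n) φ) U (𝓝 (IP c k F φ)) := by
  refine IP_tendsto (ι := Unit) (f := fun _ => f) (F := fun _ => F) hk hU (fun _ => ?_)
    (fun _ => hF) (fun n => (hf n).continuous) hB (fun ψ h => h ()) hφ
  have := eqC_iteratedDeriv hc hk ha hf hM
  simpa only [iteratedDeriv_zero] using this

/-- Pointwise limits of approximate solutions along an ultrafilter. -/
structure IsLim (U : Ultrafilter ℕ) (δ v : ℕ → ℝ → ℝ → ℝ) (D V : ℝ → ℝ → ℝ) : Prop where
  le : (U : Filter ℕ) ≤ atTop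
  limδ : ∀ t, 0 ≤ t → ∀ x ∈ Ω₀, Tendsto (fun n => δ n t x) U (𝓝 (D t x))
  limv : ∀ t, 0 ≤ t → ∀ x ∈ Ω₀, Tendsto (fun n => v n t x) U (𝓝 (V t x))

section ApproxLimit

variable {c k γ M : ℝ} {α α' u : ℝ → ℝ} {a : ℕ} {δ v : ℕ → ℝ → ℝ → ℝ} {U : Ultrafilter ℕ}
  {D V : ℝ → ℝ → ℝ}

lemma IsExpansion.one_le_rpow (hα : IsExpansion γ α α') (hγ : 1 < γ) {t : ℝ} (ht : 0 ≤ t) :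
    1 ≤ α t ^ (γ + 1) :=
  Real.one_le_rpow (hα.one_le ht) (by linarith)

lemma IsExpansion.rpow_le_one (hα : IsExpansion γ α α') (hγ : 1 < γ) {t : ℝ} (ht : 0 ≤ t) :
    |α t ^ (1 - γ)| ≤ 1 := by
  rw [abs_of_nonneg (Real.rpow_nonneg (hα.pos t ht).le _)]
  exact Real.rpow_le_one_of_one_le_of_nonpos (hα.one_le ht) (by linarith)

lemma IsExpansion.continuousOn_rpow (hα : IsExpansion γ α α') (p : ℝ) :
    ContinuousOn (fun t => α t ^ p) (Ici 0) :=
  hα.cont.rpow_const fun t ht => Or.inl (hα.pos t ht).ne'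

lemma Approx.N_v_le (A : Approx c k γ α a M u δ v) (hc : 0 < c) (hα : IsExpansion γ α α')
    (hγ : 1 < γ) (n : ℕ) {t : ℝ} (ht : 0 ≤ t) : N c k a (v n t) ≤ M := by
  nlinarith [A.Nv n t ht, hα.one_le_rpow hγ ht, N_nonneg hc k a (v n t)]

lemma Approx.exists_isLim (A : Approx c k γ α a M u δ v) (hc : 0 < c) (hk : 0 ≤ k) (ha : 0 < a)
    (hα : IsExpansion γ α α') (hγ : 1 < γ) : ∃ U D V, IsLim U δ v D V := by
  have h1 : ∀ t x : ℝ, ∃ L : ℝ, 0 ≤ t → x ∈ Ω₀ →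
      Tendsto (fun n => δ n t x) (hyperfilter ℕ : Filter ℕ) (𝓝 L) := by
    intro t x
    by_cases h : 0 ≤ t ∧ x ∈ Ω₀
    · obtain ⟨B, hB⟩ := exists_jet_bound hc hk ha h.2 M
      simp only [iteratedDeriv_zero] at hB
      obtain ⟨L, -, hL⟩ := exists_ultrafilter_limit (hyperfilter ℕ)
        fun n => hB (δ n t) (A.smδ n t) (A.Nδ n t h.1)
      exact ⟨L, fun _ _ => hL⟩
    · exact ⟨0, fun ht hx => absurd ⟨ht, hx⟩ h⟩
  have h2 : ∀ t x : ℝ, ∃ L : ℝ, 0 ≤ t → x ∈ Ω₀ →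
      Tendsto (fun n => v n t x) (hyperfilter ℕ : Filter ℕ) (𝓝 L) := by
    intro t x
    by_cases h : 0 ≤ t ∧ x ∈ Ω₀
    · obtain ⟨B, hB⟩ := exists_jet_bound hc hk ha h.2 M
      simp only [iteratedDeriv_zero] at hB
      obtain ⟨L, -, hL⟩ := exists_ultrafilter_limit (hyperfilter ℕ)
        fun n => hB (v n t) (A.smv n t) (A.N_v_le hc hα hγ n h.1)
      exact ⟨L, fun _ _ => hL⟩
    · exact ⟨0, fun ht hx => absurd ⟨ht, hx⟩ h⟩
  choose D hD using h1
  choose V hV using h2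
  exact ⟨hyperfilter ℕ, D, V, Nat.hyperfilter_le_atTop, fun t ht x hx => hD t x ht hx,
    fun t ht x hx => hV t x ht hx⟩

lemma IsLim.jets (L : IsLim U δ v D V) (A : Approx c k γ α a M u δ v) (hc : 0 < c) (hk : 0 ≤ k)
    {t : ℝ} (ht : 0 ≤ t) :
    (∀ j < a, ∀ x ∈ Ω₀, Tendsto (fun n => iteratedDeriv j (δ n t) x) U
      (𝓝 (iteratedDeriv j (D t) x))) ∧
    ∀ j, j + 1 < a → ∀ x ∈ Ω₀,
      HasDerivAt (iteratedDeriv j (D t)) (iteratedDeriv (j + 1) (D t) x) x :=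
  jets_tendsto hc hk (fun n => A.smδ n t) (fun n => A.Nδ n t ht) U (L.limδ t ht)

lemma IsLim.hasDerivAt_deriv (L : IsLim U δ v D V) (A : Approx c k γ α a M u δ v) (hc : 0 < c)
    (hk : 0 ≤ k) (ha : 3 < a) {t : ℝ} (ht : 0 ≤ t) {x : ℝ} (hx : x ∈ Ω₀) :
    HasDerivAt (deriv (D t)) (iteratedDeriv 2 (D t) x) x := by
  have := (L.jets A hc hk ht).2 1 (by omega) x hx
  rwa [iteratedDeriv_one] at this

lemma IsLim.force_tendsto (L : IsLim U δ v D V) (A : Approx c k γ α a M u δ v) (hc : 0 < c)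
    (hk : 0 ≤ k) (ha : 3 < a) {t : ℝ} (ht : 0 ≤ t) {x : ℝ} (hx : x ∈ Ω₀) {ι : Type*}
    {l : Filter ι} {ψ : ι → ℕ} (h : ∀ j < 3, Tendsto (fun i => iteratedDeriv j (δ (ψ i) t) x) l
      (𝓝 (iteratedDeriv j (D t) x))) :
    Tendsto (fun i => force c k γ (δ (ψ i) t) x) l (𝓝 (force c k γ (D t) x)) := by
  refine _root_.force_tendsto (Eventually.of_forall fun i => hasDerivAt_deriv_two (A.smδ _ t) x)
    (L.hasDerivAt_deriv A hc hk ha ht hx) ?_ ?_ (h 2 (by norm_num))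
  · simpa only [iteratedDeriv_zero] using h 0 (by norm_num)
  · simpa only [iteratedDeriv_one] using h 1 (by norm_num)

lemma IsLim.IP_force_tendsto (L : IsLim U δ v D V) (A : Approx c k γ α a M u δ v) (hc : 0 < c)
    (hk : 0 ≤ k) (ha : k + 3 < a) {t : ℝ} (ht : 0 ≤ t) {φ : ℝ → ℝ} (hφ : Continuous φ) :
    Tendsto (fun n => IP c k (force c k γ (δ n t)) φ) U (𝓝 (IP c k (force c k γ (D t)) φ)) := by
  have ha3 : 3 < a := by
    have : (3 : ℝ) < a := by linarith
    exact_mod_cast this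
  obtain ⟨B, hB⟩ := exists_force_bound γ hc hk ha M
  refine IP_tendsto (ι := Fin 3) (f := fun i n => iteratedDeriv i (δ n t))
    (F := fun i => iteratedDeriv i (D t)) hk L.le
    (fun i => eqC_iteratedDeriv hc hk (by omega) (fun n => A.smδ n t) fun n => A.Nδ n t ht)
    (fun i x hx => (L.jets A hc hk ht).1 i (by omega) x hx)
    (fun n => (force_smooth (A.smδ n t)).continuous)
    (fun n => hB _ (A.smδ n t) (A.Nδ n t ht) (A.Nw n t ht) (A.half n t ht))
    (fun ψ h x hx => L.force_tendsto A hc hk ha3 ht hx fun j hj => h ⟨j, hj⟩ x hx) hφ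

lemma Approx.exists_v_bound (A : Approx c k γ α a M u δ v) (hc : 0 < c) (hk : 0 ≤ k)
    (ha : k + 3 < a) (hα : IsExpansion γ α α') (hγ : 1 < γ) : ∃ B, 0 ≤ B ∧ ∀ n t, 0 ≤ t →
      ∀ x ∈ Ω₀, |v n t x| ≤ B ∧ |deriv (v n t) x| ≤ B := by
  obtain ⟨K, hK, h⟩ := exists_sup_bound hc hk ha
  refine ⟨√(K * M), Real.sqrt_nonneg _, fun n t ht x hx => ?_⟩
  have := h (v n t) (A.smv n t) M (A.N_v_le hc hα hγ n ht) x hx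
  exact ⟨Real.abs_le_sqrt this.1, Real.abs_le_sqrt this.2⟩

lemma Approx.exists_δ_bound (A : Approx c k γ α a M u δ v) (hc : 0 < c) (hk : 0 ≤ k)
    (ha : k + 3 < a) : ∃ B, 0 ≤ B ∧ ∀ n t, 0 ≤ t → ∀ x ∈ Ω₀, |δ n t x| ≤ B := by
  obtain ⟨K, hK, h⟩ := exists_sup_bound hc hk ha
  refine ⟨√(K * M), Real.sqrt_nonneg _, fun n t ht x hx => ?_⟩
  exact Real.abs_le_sqrt (h (δ n t) (A.smδ n t) M (A.Nδ n t ht) x hx).1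

lemma Approx.IP_force_lipschitz (A : Approx c k γ α a M u δ v) (hc : 0 < c) (hk : 0 ≤ k)
    (ha : k + 3 < a) (hα : IsExpansion γ α α') (hγ : 1 < γ) (P : Polynomial ℝ) :
    ∃ K, 0 ≤ K ∧ ∀ T, ∀ᶠ n in atTop, ∀ s ∈ Icc 0 T, ∀ t ∈ Icc 0 T,
      |IP c k (force c k γ (δ n s)) (fun x => P.eval x) -
        IP c k (force c k γ (δ n t)) (fun x => P.eval x)| ≤ K * |s - t| := by
  obtain ⟨B, hB0, hB⟩ := A.exists_v_bound hc hk ha hα hγ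
  obtain ⟨L, hL, hF⟩ := Fc_lipschitz γ
  have hP : ContDiff ℝ ∞ fun x => P.eval x := by
    simpa using Polynomial.contDiff_aeval P (𝕜 := ℝ) (∞ : WithTop ℕ∞)
  have hP' := smooth_deriv hP
  set I0 := ∫ x in Ω₀, |dw c x ^ k * P.eval x|
  set I1 := ∫ x in Ω₀, |dw c x ^ (k + 1) * deriv (fun x => P.eval x) x|
  have hI0 : 0 ≤ I0 := integral_nonneg fun _ => abs_nonneg _
  have hI1 : 0 ≤ I1 := integral_nonneg fun _ => abs_nonneg _
  refine ⟨B * I0 + L * B * I1, by positivity, fun T => (A.jet T).mono fun n hn s hs t ht => ?_⟩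
  have hk1 : 0 ≤ k + 1 := by linarith
  have cF : ∀ t, Continuous fun x => Fc γ (deriv (δ n t) x) := fun t =>
    (Fc_smooth γ).continuous.comp (smooth_deriv (A.smδ n t)).continuous
  have e0 : ∀ x ∈ Ω₀, |δ n s x - δ n t x| ≤ B * |s - t| := fun x hx =>
    lipschitz_of_jet (f' := fun r => v n r x) (f := fun r => δ n r x)
      (fun r hr => by simpa only [iteratedDeriv_zero] using hn r hr 0 x)
      (fun r hr => (hB n r hr.1 x hx).1) hs ht
  have e1 : ∀ x ∈ Ω₀, |Fc γ (deriv (δ n s) x) - Fc γ (deriv (δ n t) x)| ≤ L * B * |s - t| := by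
    intro x hx
    have := lipschitz_of_jet (f' := fun r => deriv (v n r) x) (f := fun r => deriv (δ n r) x)
      (fun r hr => by simpa only [iteratedDeriv_one] using hn r hr 1 x)
      (fun r hr => (hB n r hr.1 x hx).2) hs ht
    rw [mul_assoc]
    exact (hF _ _).trans (mul_le_mul_of_nonneg_left this hL)
  rw [IP_force hc hk (A.smδ n s) hP, IP_force hc hk (A.smδ n t) hP, add_sub_add_comm,
    ← IP_sub_left hk (A.smδ n s).continuous (A.smδ n t).continuous hP.continuous,
    ← IP_sub_left hk1 (cF s) (cF t) hP'.continuous]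
  have h1 := IP_abs_le_sup hk e0 hP.continuous (c := c)
  have h2 := IP_abs_le_sup hk1 e1 hP'.continuous (c := c)
  refine (abs_add_le _ _).trans ((add_le_add h1 h2).trans_eq ?_)
  ring

end ApproxLimit

lemma HasDerivWithinAt.Ici_of_Icc {f : ℝ → ℝ} {f' t : ℝ}
    (h : HasDerivWithinAt f f' (Icc 0 (t + 1)) t) : HasDerivWithinAt f f' (Ici 0) t := by
  refine h.mono_of_mem_nhdsWithin ?_
  rw [← Ici_inter_Iic]
  exact inter_mem_nhdsWithin _ (Iic_mem_nhds (by linarith))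

section ApproxLimit

variable {c k γ M : ℝ} {α α' u : ℝ → ℝ} {a : ℕ} {δ v : ℕ → ℝ → ℝ → ℝ} {U : Ultrafilter ℕ}
  {D V : ℝ → ℝ → ℝ}

lemma IsLim.IP_v_tendsto (L : IsLim U δ v D V) (A : Approx c k γ α a M u δ v) (hc : 0 < c)
    (hk : 0 ≤ k) (ha : k + 3 < a) (hα : IsExpansion γ α α') (hγ : 1 < γ) {t : ℝ} (ht : 0 ≤ t)
    {φ : ℝ → ℝ} (hφ : Continuous φ) :
    Tendsto (fun n => IP c k (v n t) φ) U (𝓝 (IP c k (V t) φ)) := by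
  obtain ⟨B, -, hB⟩ := A.exists_v_bound hc hk ha hα hγ
  have ha0 : 0 < a := by
    have : (0 : ℝ) < a := by linarith
    exact_mod_cast this
  exact IP_limit hc hk ha0 (A.smv · t) (fun n => A.N_v_le hc hα hγ n ht)
    (fun n x hx => (hB n t ht x hx).1) L.le (L.limv t ht) hφ

lemma IsLim.IP_δ_tendsto (L : IsLim U δ v D V) (A : Approx c k γ α a M u δ v) (hc : 0 < c)
    (hk : 0 ≤ k) (ha : k + 3 < a) {t : ℝ} (ht : 0 ≤ t) {φ : ℝ → ℝ} (hφ : Continuous φ) :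
    Tendsto (fun n => IP c k (δ n t) φ) U (𝓝 (IP c k (D t) φ)) := by
  obtain ⟨B, -, hB⟩ := A.exists_δ_bound hc hk ha
  have ha0 : 0 < a := by
    have : (0 : ℝ) < a := by linarith
    exact_mod_cast this
  exact IP_limit hc hk ha0 (A.smδ · t) (fun n => A.Nδ n t ht)
    (fun n x hx => hB n t ht x hx) L.le (L.limδ t ht) hφ

lemma Approx.exists_IP_force_bound (A : Approx c k γ α a M u δ v) (hc : 0 < c) (hk : 0 ≤ k)
    (ha : k + 3 < a) {φ : ℝ → ℝ} (hφ : Continuous φ) : ∃ B, 0 ≤ B ∧ ∀ n t, 0 ≤ t →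
      |IP c k (force c k γ (δ n t)) φ| ≤ B := by
  obtain ⟨B, hB⟩ := exists_force_bound γ hc hk ha M
  have h : ∀ n t, 0 ≤ t → |IP c k (force c k γ (δ n t)) φ| ≤ B * ∫ x in Ω₀, |dw c x ^ k * φ x| :=
    fun n t ht => IP_abs_le_sup hk
      (hB _ (A.smδ n t) (A.Nδ n t ht) (A.Nw n t ht) (A.half n t ht)) hφ
  exact ⟨_, (abs_nonneg _).trans (h 0 0 le_rfl), h⟩

lemma IsLim.hasDerivWithinAt_IP_v (L : IsLim U δ v D V) (A : Approx c k γ α a M u δ v)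
    (hc : 0 < c) (hk : 0 ≤ k) (ha : k + 3 < a) (hα : IsExpansion γ α α') (hγ : 1 < γ)
    (P : Polynomial ℝ) {t : ℝ} (ht : 0 ≤ t) :
    HasDerivWithinAt (fun s => α s ^ 2 * IP c k (V s) fun x => P.eval x)
      (-α t ^ (1 - γ) * IP c k (force c k γ (D t)) fun x => P.eval x) (Ici 0) t := by
  refine HasDerivWithinAt.Ici_of_Icc ?_
  have htm : t ∈ Icc 0 (t + 1) := ⟨ht, by linarith⟩
  obtain ⟨B, hB0, hB⟩ := A.exists_IP_force_bound hc hk ha P.continuous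
  obtain ⟨K, hK, hL⟩ := A.IP_force_lipschitz hc hk ha hα hγ P
  refine hasDerivWithinAt_of_tendsto (l := (U : Filter ℕ)) (convex_Icc _ _)
    (f := fun n s => α s ^ 2 * IP c k (v n s) fun x => P.eval x)
    (f' := fun n s => -α s ^ (1 - γ) * IP c k (force c k γ (δ n s)) fun x => P.eval x)
    (G := fun s => -α s ^ (1 - γ) * IP c k (force c k γ (D s)) fun x => P.eval x)
    (L.le (A.dV P (t + 1)))
    (fun s hs => (L.IP_v_tendsto A hc hk ha hα hγ hs.1 P.continuous).const_mul _) htm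
    ((L.IP_force_tendsto A hc hk ha ht P.continuous).const_mul _)
    (equicontinuousAt_of_modulus (L := K) (B := B) (β := fun s => α s ^ (1 - γ))
      ((hα.continuousOn_rpow (1 - γ) t ht).mono Icc_subset_Ici_self)
      (L.le ((hL (t + 1)).mono fun n hn s hs => ?_)))
  have h1 := hn s hs t htm
  have h2 := hB n t ht
  have h3 := hα.rpow_le_one hγ hs.1
  set I := IP c k (force c k γ (δ n s)) fun x => P.eval x
  set J := IP c k (force c k γ (δ n t)) fun x => P.eval x
  have e : -α s ^ (1 - γ) * I - -α t ^ (1 - γ) * J =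
      -(α s ^ (1 - γ) * (I - J) + J * (α s ^ (1 - γ) - α t ^ (1 - γ))) := by ring
  rw [e, abs_neg]
  refine (abs_add_le _ _).trans (add_le_add ?_ ?_)
  · rw [abs_mul]
    exact (mul_le_of_le_one_left (abs_nonneg _) h3).trans h1
  · rw [abs_mul]
    exact mul_le_mul_of_nonneg_right h2 (abs_nonneg _)

lemma IsLim.hasDerivWithinAt_IP_δ (L : IsLim U δ v D V) (A : Approx c k γ α a M u δ v)
    (hc : 0 < c) (hk : 0 ≤ k) (ha : k + 3 < a) (hα : IsExpansion γ α α') (hγ : 1 < γ)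
    (P : Polynomial ℝ) {t : ℝ} (ht : 0 ≤ t) :
    HasDerivWithinAt (fun s => IP c k (D s) fun x => P.eval x)
      (IP c k (V t) fun x => P.eval x) (Ici 0) t := by
  refine HasDerivWithinAt.Ici_of_Icc ?_
  have htm : t ∈ Icc 0 (t + 1) := ⟨ht, by linarith⟩
  obtain ⟨B, hB0, hB⟩ := A.exists_IP_force_bound hc hk ha P.continuous
  obtain ⟨B', -, hB'⟩ := A.exists_v_bound hc hk ha hα hγ
  have hI : ∀ n s, 0 ≤ s → |IP c k (v n s) fun x => P.eval x| ≤
      B' * ∫ x in Ω₀, |dw c x ^ k * P.eval x| := fun n s hs =>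
    IP_abs_le_sup hk (fun x hx => (hB' n s hs x hx).1) P.continuous
  set B'' := B' * ∫ x in Ω₀, |dw c x ^ k * P.eval x|
  have hα2 : ContinuousWithinAt (fun s => α s ^ 2) (Icc 0 (t + 1)) t :=
    ((hα.cont.pow 2) t ht).mono Icc_subset_Ici_self
  refine hasDerivWithinAt_of_tendsto (l := (U : Filter ℕ)) (convex_Icc _ _)
    (f := fun n s => IP c k (δ n s) fun x => P.eval x)
    (f' := fun n s => IP c k (v n s) fun x => P.eval x)
    (G := fun s => IP c k (V s) fun x => P.eval x)
    (L.le (A.dI P (t + 1)))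
    (fun s hs => L.IP_δ_tendsto A hc hk ha hs.1 P.continuous) htm
    (L.IP_v_tendsto A hc hk ha hα hγ ht P.continuous)
    (equicontinuousAt_of_modulus (L := B) (B := B'') hα2
      (L.le ((A.dV P (t + 1)).mono fun n hn s hs => ?_)))
  have h1 := lipschitz_of_jet (B := B) hn (fun r hr => by
    rw [abs_mul, abs_neg]
    exact (mul_le_of_le_one_left (abs_nonneg _) (hα.rpow_le_one hγ hr.1)).trans (hB n r hr.1))
    hs htm
  have h2 := hI n s hs.1
  have h3 : 1 ≤ α t ^ 2 := one_le_pow₀ (hα.one_le ht)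
  set I := IP c k (v n s) fun x => P.eval x
  set J := IP c k (v n t) fun x => P.eval x
  calc |I - J| ≤ α t ^ 2 * |I - J| := le_mul_of_one_le_left (abs_nonneg _) h3
    _ = |(α s ^ 2 * I - α t ^ 2 * J) - I * (α s ^ 2 - α t ^ 2)| := by
      rw [← abs_of_nonneg (by positivity : 0 ≤ α t ^ 2), ← abs_mul,
        abs_of_nonneg (by positivity : 0 ≤ α t ^ 2)]
      congr 1
      ring
    _ ≤ B * |s - t| + B'' * |α s ^ 2 - α t ^ 2| := by
      refine (abs_sub _ _).trans (add_le_add h1 ?_)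
      rw [abs_mul]
      exact mul_le_mul_of_nonneg_right h2 (abs_nonneg _)

lemma IsLim.jet_lipschitz (L : IsLim U δ v D V) (A : Approx c k γ α a M u δ v) (hc : 0 < c)
    (hk : 0 ≤ k) (hα : IsExpansion γ α α') (hγ : 1 < γ) {j : ℕ} (hj : j < a) {x : ℝ}
    (hx : x ∈ Ω₀) : ∃ B, ∀ s, 0 ≤ s → ∀ t, 0 ≤ t →
      |iteratedDeriv j (D s) x - iteratedDeriv j (D t) x| ≤ B * |s - t| := by
  obtain ⟨B, hB⟩ := exists_jet_bound hc hk hj hx M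
  refine ⟨B, fun s hs t ht => ?_⟩
  refine le_of_tendsto (((L.jets A hc hk hs).1 j hj x hx).sub
    ((L.jets A hc hk ht).1 j hj x hx)).abs (L.le ((A.jet (max s t)).mono fun n hn => ?_))
  exact lipschitz_of_jet (fun r hr => hn r hr j x)
    (fun r hr => hB _ (A.smv n r) (A.N_v_le hc hα hγ n hr.1))
    ⟨hs, le_max_left _ _⟩ ⟨ht, le_max_right _ _⟩

lemma IsLim.continuousOn_jet (L : IsLim U δ v D V) (A : Approx c k γ α a M u δ v) (hc : 0 < c)
    (hk : 0 ≤ k) (hα : IsExpansion γ α α') (hγ : 1 < γ) {j : ℕ} (hj : j < a) {x : ℝ}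
    (hx : x ∈ Ω₀) : ContinuousOn (fun t => iteratedDeriv j (D t) x) (Ici 0) := by
  obtain ⟨B, hB⟩ := L.jet_lipschitz A hc hk hα hγ hj hx
  refine LipschitzOnWith.continuousOn (K := B.toNNReal) (LipschitzOnWith.of_dist_le_mul ?_)
  intro s hs t ht
  rw [Real.dist_eq, Real.dist_eq]
  exact (hB s hs t ht).trans (mul_le_mul_of_nonneg_right (Real.le_coe_toNNReal B) (abs_nonneg _))

lemma IsLim.continuousOn_force_time (L : IsLim U δ v D V) (A : Approx c k γ α a M u δ v)
    (hc : 0 < c) (hk : 0 ≤ k) (ha : 3 < a) (hα : IsExpansion γ α α') (hγ : 1 < γ) {x : ℝ}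
    (hx : x ∈ Ω₀) : ContinuousOn (fun t => force c k γ (D t) x) (Ici 0) := by
  intro t ht
  refine _root_.force_tendsto ?_ (L.hasDerivAt_deriv A hc hk ha ht hx) ?_ ?_ ?_
  · filter_upwards [self_mem_nhdsWithin] with s hs
    exact L.hasDerivAt_deriv A hc hk ha hs hx
  · simpa only [iteratedDeriv_zero] using
      (L.continuousOn_jet A hc hk hα hγ (by omega : 0 < a) hx t ht).tendsto
  · simpa only [iteratedDeriv_one] using
      (L.continuousOn_jet A hc hk hα hγ (by omega : 1 < a) hx t ht).tendsto
  · exact L.continuousOn_jet A hc hk hα hγ (by omega : 2 < a) hx t ht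

lemma IsLim.continuousOn_force (L : IsLim U δ v D V) (A : Approx c k γ α a M u δ v)
    (hc : 0 < c) (hk : 0 ≤ k) (ha : 3 < a) {t : ℝ} (ht : 0 ≤ t) :
    ContinuousOn (force c k γ (D t)) Ω₀ := by
  have hj : ∀ j, j < 3 → ContinuousOn (iteratedDeriv j (D t)) Ω₀ := fun j hj x hx =>
    ((L.jets A hc hk ht).2 j (by omega) x hx).continuousAt.continuousWithinAt
  have h0 := hj 0 (by norm_num)
  have h1 := hj 1 (by norm_num)
  have h2 := hj 2 (by norm_num)
  rw [iteratedDeriv_zero] at h0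
  rw [iteratedDeriv_one] at h1
  refine ContinuousOn.congr ?_
    fun x hx => force_eq_of_hasDerivAt (L.hasDerivAt_deriv A hc hk ha ht hx)
  refine h0.sub (((dw_continuous c).continuousOn.mul
    (((continuous_deriv_Fc γ).comp_continuousOn h1).mul h2)).add
    ((by fun_prop : Continuous fun x => (k + 1) * (-2 * c * x)).continuousOn.mul
      ((Fc_smooth γ).continuous.comp_continuousOn h1)))

lemma IsLim.hasDerivWithinAt_v (L : IsLim U δ v D V) (A : Approx c k γ α a M u δ v)
    (hc : 0 < c) (hk : 0 ≤ k) (ha : k + 3 < a) (hα : IsExpansion γ α α') (hγ : 1 < γ)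
    {x : ℝ} (hx : x ∈ Ω₀) {t : ℝ} (ht : 0 ≤ t) :
    HasDerivWithinAt (fun s => α s ^ 2 * V s x) (-α t ^ (1 - γ) * force c k γ (D t) x)
      (Ici 0) t := by
  have ha3 : 3 < a := by
    have : (3 : ℝ) < a := by linarith
    exact_mod_cast this
  obtain ⟨B, hB⟩ := exists_force_bound γ hc hk ha M
  obtain ⟨B', hB'0, hB'⟩ := A.exists_v_bound hc hk ha hα hγ
  have hV : ∀ t, 0 ≤ t → ContinuousOn (V t) Ω₀ := by
    intro t ht y hy
    have := (eqC_iteratedDeriv hc hk (by omega : 0 < a) (A.smv · t)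
      (fun n => A.N_v_le hc hα hγ n ht)).continuousAt (U := (U : Filter ℕ)) (F := V t)
      (by simpa only [iteratedDeriv_zero] using L.limv t ht) hy
    exact this.continuousWithinAt
  have hVB : ∀ t, 0 ≤ t → ∀ y ∈ Ω₀, |V t y| ≤ B' := fun t ht y hy =>
    le_of_tendsto (L.limv t ht y hy).abs (Eventually.of_forall fun n => (hB' n t ht y hy).1)
  have hf : ∀ t, 0 ≤ t → ∀ y ∈ Ω₀, |force c k γ (D t) y| ≤ B := fun t ht y hy =>
    le_of_tendsto (L.force_tendsto A hc hk ha3 ht hy (ψ := id) fun j hj =>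
      (L.jets A hc hk ht).1 j (by omega) y hy).abs
      (Eventually.of_forall fun n => hB _ (A.smδ n t) (A.Nδ n t ht) (A.Nw n t ht) (A.half n t ht)
        y hy)
  refine hasDerivWithinAt_of_weak (B := B) hc hk (f := fun s x => α s ^ 2 * V s x)
    (g := fun t x => -α t ^ (1 - γ) * force c k γ (D t) x)
    (fun t ht => continuousOn_const.mul (hV t ht))
    (fun t ht => ⟨α t ^ 2 * B', fun y hy => ?_⟩)
    (fun t ht => continuousOn_const.mul (L.continuousOn_force A hc hk ha3 ht))
    (fun t ht y hy => ?_)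
    (fun y hy => (hα.continuousOn_rpow _).neg.mul
      (L.continuousOn_force_time A hc hk ha3 hα hγ hy)) (fun P t ht => ?_) hx ht
  · rw [abs_mul, abs_of_nonneg (by positivity : 0 ≤ α t ^ 2)]
    exact mul_le_mul_of_nonneg_left (hVB t ht y hy) (by positivity)
  · rw [abs_mul, abs_neg]
    exact (mul_le_of_le_one_left (abs_nonneg _) (hα.rpow_le_one hγ ht)).trans (hf t ht y hy)
  · simp only [IP_const_mul_left]
    exact L.hasDerivWithinAt_IP_v A hc hk ha hα hγ P ht

lemma IsLim.continuousOn_v_time (L : IsLim U δ v D V) (A : Approx c k γ α a M u δ v)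
    (hc : 0 < c) (hk : 0 ≤ k) (ha : k + 3 < a) (hα : IsExpansion γ α α') (hγ : 1 < γ)
    {x : ℝ} (hx : x ∈ Ω₀) : ContinuousOn (fun t => V t x) (Ici 0) := by
  have h : ContinuousOn (fun s => α s ^ 2 * V s x) (Ici 0) := fun t ht =>
    (L.hasDerivWithinAt_v A hc hk ha hα hγ hx ht).continuousWithinAt
  refine (h.div (hα.cont.pow 2) fun t ht => pow_ne_zero 2 (hα.pos t ht).ne').congr fun t ht => ?_
  have := (hα.pos t ht).ne'
  change V t x = α t ^ 2 * V t x / α t ^ 2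
  field_simp

lemma IsLim.hasDerivWithinAt_δ (L : IsLim U δ v D V) (A : Approx c k γ α a M u δ v)
    (hc : 0 < c) (hk : 0 ≤ k) (ha : k + 3 < a) (hα : IsExpansion γ α α') (hγ : 1 < γ)
    {x : ℝ} (hx : x ∈ Ω₀) {t : ℝ} (ht : 0 ≤ t) :
    HasDerivWithinAt (fun s => D s x) (V t x) (Ici 0) t := by
  have ha3 : 3 < a := by
    have : (3 : ℝ) < a := by linarith
    exact_mod_cast this
  obtain ⟨B, hB0, hB⟩ := A.exists_δ_bound hc hk ha
  obtain ⟨B', hB'0, hB'⟩ := A.exists_v_bound hc hk ha hα hγ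
  refine hasDerivWithinAt_of_weak (B := B') hc hk
    (fun t ht y hy => ?_)
    (fun t ht => ⟨B, fun y hy => le_of_tendsto (L.limδ t ht y hy).abs
      (Eventually.of_forall fun n => hB n t ht y hy)⟩)
    (fun t ht y hy => ?_)
    (fun t ht y hy => le_of_tendsto (L.limv t ht y hy).abs
      (Eventually.of_forall fun n => (hB' n t ht y hy).1))
    (fun y hy => L.continuousOn_v_time A hc hk ha hα hγ hy)
    (fun P t ht => L.hasDerivWithinAt_IP_δ A hc hk ha hα hγ P ht) hx ht
  · have := (eqC_iteratedDeriv hc hk (by omega : 0 < a) (A.smδ · t)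
      (fun n => A.Nδ n t ht)).continuousAt (U := (U : Filter ℕ)) (F := D t)
      (by simpa only [iteratedDeriv_zero] using L.limδ t ht) hy
    exact this.continuousWithinAt
  · have := (eqC_iteratedDeriv hc hk (by omega : 0 < a) (A.smv · t)
      (fun n => A.N_v_le hc hα hγ n ht)).continuousAt (U := (U : Filter ℕ)) (F := V t)
      (by simpa only [iteratedDeriv_zero] using L.limv t ht) hy
    exact this.continuousWithinAt

end ApproxLimit

section ApproxLimit

variable {c k γ M : ℝ} {α α' u : ℝ → ℝ} {a : ℕ} {δ v : ℕ → ℝ → ℝ → ℝ} {U : Ultrafilter ℕ}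
  {D V : ℝ → ℝ → ℝ}

lemma IsLim.abs_deriv_le (L : IsLim U δ v D V) (A : Approx c k γ α a M u δ v)
    (hc : 0 < c) (hk : 0 ≤ k) (ha : 1 < a) {t : ℝ} (ht : 0 ≤ t) {x : ℝ} (hx : x ∈ Ω₀) :
    |deriv (D t) x| ≤ 1 / 2 := by
  have := (L.jets A hc hk ht).1 1 ha x hx
  simp only [iteratedDeriv_one] at this
  exact le_of_tendsto this.abs (Eventually.of_forall fun n => A.half n t ht x hx)

lemma IsLim.hasDerivAt (L : IsLim U δ v D V) (A : Approx c k γ α a M u δ v) (hc : 0 < c)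
    (hk : 0 ≤ k) (ha : 1 < a) {t : ℝ} (ht : 0 ≤ t) {x : ℝ} (hx : x ∈ Ω₀) :
    HasDerivAt (D t) (deriv (D t) x) x := by
  have := (L.jets A hc hk ht).2 0 (by omega) x hx
  rwa [iteratedDeriv_zero, zero_add, iteratedDeriv_one] at this

lemma IsLim.contDiffOn (L : IsLim U δ v D V) (A : Approx c k γ α a M u δ v) (hc : 0 < c)
    (hk : 0 ≤ k) (ha : 3 < a) {t : ℝ} (ht : 0 ≤ t) : ContDiffOn ℝ 2 (D t) Ω₀ := by
  have ho : IsOpen Ω₀ := isOpen_Ioo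
  have h2 : ContinuousOn (iteratedDeriv 2 (D t)) Ω₀ := fun x hx =>
    ((L.jets A hc hk ht).2 2 (by omega) x hx).continuousAt.continuousWithinAt
  have h1 : ContDiffOn ℝ 1 (deriv (D t)) Ω₀ := by
    rw [show (1 : WithTop ℕ∞) = 0 + 1 by norm_num, contDiffOn_succ_iff_deriv_of_isOpen ho]
    refine ⟨fun x hx => (L.hasDerivAt_deriv A hc hk ha ht hx).differentiableAt
      |>.differentiableWithinAt, by simp, ?_⟩
    rw [contDiffOn_zero]
    exact h2.congr fun x hx => (L.hasDerivAt_deriv A hc hk ha ht hx).deriv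
  rw [show (2 : WithTop ℕ∞) = 1 + 1 by norm_num, contDiffOn_succ_iff_deriv_of_isOpen ho]
  exact ⟨fun x hx => (L.hasDerivAt A hc hk (by omega) ht hx).differentiableAt
      |>.differentiableWithinAt, by simp, h1⟩

lemma force_eq_of_abs_le {γ : ℝ} (hγ : 1 < γ) {D : ℝ → ℝ} {w x : ℝ}
    (h : HasDerivAt (deriv D) w x) (hD : |deriv D x| ≤ 1 / 2) :
    force ((γ - 1) / (2 * γ)) (1 / (γ - 1)) γ D x = x + D x
      + γ / (γ - 1) * deriv (ddg γ) x * (1 + deriv D x) ^ (-γ)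
      - γ * ddg γ x * (1 + deriv D x) ^ (-γ - 1) * w := by
  have h58 : |deriv D x| < 5 / 8 := by linarith
  have hd : deriv (ddg γ) x = (γ - 1) / (2 * γ) * (-2 * x) := by
    have h1 := dw_hasDerivAt ((γ - 1) / (2 * γ)) x
    have h2 : ddg γ = dw ((γ - 1) / (2 * γ)) := rfl
    rw [h2, h1.deriv]
    ring
  have hg : γ - 1 ≠ 0 := by linarith
  have hg' : γ ≠ 0 := by linarith
  rw [force_eq_of_hasDerivAt h, Fc_eq h58, (Fc_hasDerivAt h58).deriv, hd]
  unfold dw ddg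
  field_simp
  ring

lemma IsLim.hasDerivAt_v (L : IsLim U δ v D V) (A : Approx c k γ α a M u δ v)
    (hc : 0 < c) (hk : 0 ≤ k) (ha : k + 3 < a) (hα : IsExpansion γ α α') (hγ : 1 < γ)
    {x : ℝ} (hx : x ∈ Ω₀) {t : ℝ} (ht : 0 < t) :
    DifferentiableAt ℝ (fun s => V s x) t ∧ α t ^ (γ + 1) * deriv (fun s => V s x) t +
      2 * α t ^ γ * α' t * V t x = -force c k γ (D t) x := by
  have hI : Ici (0 : ℝ) ∈ 𝓝 t := Ici_mem_nhds ht
  have h1 := (L.hasDerivWithinAt_v A hc hk ha hα hγ hx ht.le).hasDerivAt hI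
  have h2 : HasDerivAt (fun s => α s ^ 2) (2 * α t * α' t) t := by
    have := ((hα.deriv t ht.le).hasDerivAt hI).fun_pow 2
    simpa using this
  have hα0 := hα.pos t ht.le
  have hd : DifferentiableAt ℝ (fun s => V s x) t := by
    have h3 := (h1.div h2 (pow_ne_zero 2 hα0.ne')).differentiableAt
    refine h3.congr_of_eventuallyEq ?_
    filter_upwards [hI] with s hs
    have := (hα.pos s hs).ne'
    change V s x = α s ^ 2 * V s x / α s ^ 2
    field_simp
  refine ⟨hd, ?_⟩
  have h4 := (h2.mul hd.hasDerivAt).unique h1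
  have e1 : α t ^ (γ + 1) = α t ^ (γ - 1) * α t ^ 2 := by
    rw [← Real.rpow_natCast, ← Real.rpow_add hα0]
    congr 1
    push_cast
    ring
  have e2 : α t ^ γ = α t ^ (γ - 1) * α t := by
    rw [← Real.rpow_add_one hα0.ne']
    congr 1
    ring
  have e3 : α t ^ (γ - 1) * α t ^ (1 - γ) = 1 := by
    rw [← Real.rpow_add hα0]
    simp
  rw [e1, e2]
  linear_combination (α t ^ (γ - 1)) * h4 - force c k γ (D t) x * e3

lemma IsLim.isSol {γ : ℝ} (hγ : 1 < γ)
    (A : Approx ((γ - 1) / (2 * γ)) (1 / (γ - 1)) γ α a M u δ v) (L : IsLim U δ v D V)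
    (ha : 1 / (γ - 1) + 3 < a) (hα : IsExpansion γ α α') :
    IsSolγ γ α α' (fun x t => x + D t x) (fun x t => V t x) := by
  have hg : 0 < γ - 1 := by linarith
  have hc : 0 < (γ - 1) / (2 * γ) := by positivity
  have hk : 0 ≤ 1 / (γ - 1) := by positivity
  have ha3 : 3 < a := by
    have : (3 : ℝ) < a := by linarith
    exact_mod_cast this
  have hd : ∀ t, 0 ≤ t → ∀ x ∈ Ω₀, HasDerivAt (fun y => y + D t y) (1 + deriv (D t) x) x :=
    fun t ht x hx => (hasDerivAt_id x).add (L.hasDerivAt A hc hk (by omega) ht hx)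
  have hd2 : ∀ t, 0 ≤ t → ∀ x ∈ Ω₀,
      iteratedDeriv 2 (fun y => y + D t y) x = iteratedDeriv 2 (D t) x := by
    intro t ht x hx
    have e : deriv (fun y => y + D t y) =ᶠ[𝓝 x] fun y => 1 + deriv (D t) y := by
      filter_upwards [(isOpen_Ioo : IsOpen Ω₀).mem_nhds hx] with y hy
      exact (hd t ht y hy).deriv
    rw [show iteratedDeriv 2 (fun y => y + D t y) = deriv (deriv fun y => y + D t y) by
      rw [iteratedDeriv_succ, iteratedDeriv_one], e.deriv_eq]
    exact ((L.hasDerivAt_deriv A hc hk ha3 ht hx).const_add 1).deriv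
  refine ⟨fun t ht => contDiffOn_id.add (L.contDiffOn A hc hk ha3 ht), fun x hx t ht => ?_,
    fun x hx t ht => (L.hasDerivWithinAt_δ A hc hk ha hα hγ hx ht).const_add x,
    fun x hx t ht => (L.hasDerivAt_v A hc hk ha hα hγ hx ht).1, fun x hx t ht => ?_⟩
  · rw [(hd t ht x hx).deriv]
    linarith [(abs_le.1 (L.abs_deriv_le A hc hk (by omega) ht hx)).1]
  · rw [(hd t ht.le x hx).deriv, hd2 t ht.le x hx]
    have h1 := (L.hasDerivAt_v A hc hk ha hα hγ hx ht).2
    rw [force_eq_of_abs_le hγ (L.hasDerivAt_deriv A hc hk ha3 ht.le hx)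
      (L.abs_deriv_le A hc hk (by omega) ht.le hx)] at h1
    linear_combination h1

lemma IsLim.zero_init (L : IsLim U δ v D V) (A : Approx c k γ α a M u δ v) {x : ℝ}
    (hx : x ∈ Ω₀) : D 0 x = 0 ∧ V 0 x = u x := by
  refine ⟨tendsto_nhds_unique (L.limδ 0 le_rfl x hx) ?_,
    tendsto_nhds_unique (L.limv 0 le_rfl x hx) ((A.init x hx).mono_left L.le)⟩
  simp only [A.zero _ x hx]
  exact tendsto_const_nhds

end ApproxLimit

lemma exists_W1InfSq_limit_le {c k : ℝ} (hc : 0 < c) (hk : 0 ≤ k) {a : ℕ} (ha : k + 3 < a) :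
    ∃ K, 0 ≤ K ∧ ∀ (f : ℕ → ℝ → ℝ) (M : ℝ), (∀ n, ContDiff ℝ ∞ (f n)) →
      (∀ n, N c k a (f n) ≤ M) → ∀ (U : Ultrafilter ℕ) (F : ℝ → ℝ),
      (∀ x ∈ Ω₀, Tendsto (fun n => f n x) U (𝓝 (F x))) → W1InfSq F ≤ K * M := by
  obtain ⟨K, hK, h⟩ := exists_sup_bound hc hk ha
  have ha1 : 1 < a := by
    have : (1 : ℝ) < a := by linarith
    exact_mod_cast this
  refine ⟨2 * K, by positivity, fun f M hf hM U F hF => ?_⟩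
  have h1 := (jets_tendsto hc hk hf hM U hF).1 1 ha1
  simp only [iteratedDeriv_one] at h1
  have := W1InfSq_le_of_bound (f := F) (B₀ := K * M) (B₁ := K * M)
    (fun x hx => le_of_tendsto ((hF x hx).pow 2)
      (Eventually.of_forall fun n => (h _ (hf n) M (hM n) x hx).1))
    (fun x hx => le_of_tendsto ((h1 x hx).pow 2)
      (Eventually.of_forall fun n => (h _ (hf n) M (hM n) x hx).2))
  linarith

lemma exists_energy_bound {γ : ℝ} (hγ : 1 < γ) {a L : ℕ} (ha : 1 / (γ - 1) + 3 < a)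
    (hL : (L : ℝ) < (a : ℝ) - ((a : ℝ) - 1 / (γ - 1)) / 2) :
    ∃ C, 0 ≤ C ∧ ∀ {α α' u : ℝ → ℝ} {M : ℝ} {δ v : ℕ → ℝ → ℝ → ℝ} {U : Ultrafilter ℕ}
      {D V : ℝ → ℝ → ℝ}, IsExpansion γ α α' →
      Approx ((γ - 1) / (2 * γ)) (1 / (γ - 1)) γ α a M u δ v → IsLim U δ v D V → ∀ t, 0 ≤ t →
      EγLow γ a L α (fun x t => x + D t x) (fun x t => V t x) t ≤ C * M := by
  have hg : 0 < γ - 1 := by linarith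
  have hd : ∀ x, ddg γ x = dw ((γ - 1) / (2 * γ)) x := fun _ => rfl
  have e1 : ∀ b : ℝ, (1 + b * (γ - 1)) / (γ - 1) = 1 / (γ - 1) + b := fun b => by field_simp
  have e2 : ((a : ℝ) * (γ - 1) - 1) / (2 * γ - 2) = ((a : ℝ) - 1 / (γ - 1)) / 2 := by
    rw [show 2 * γ - 2 = 2 * (γ - 1) by ring]
    field_simp
  have hc : 0 < (γ - 1) / (2 * γ) := by positivity
  have hk : 0 ≤ 1 / (γ - 1) := by positivity
  unfold EγLow eγLow
  simp only [e1, e2, hd, add_sub_cancel_left]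
  set c := (γ - 1) / (2 * γ)
  set k := 1 / (γ - 1)
  have ha1 : 1 < a := by
    have : (1 : ℝ) < a := by linarith
    exact_mod_cast this
  obtain ⟨K, hK, hW⟩ := exists_W1InfSq_limit_le hc hk ha
  have hS : ∀ b : ℕ, ∃ C, 0 ≤ C ∧ (b < L + 1 → ∀ (f : ℕ → ℝ → ℝ) (M : ℝ),
      (∀ n, ContDiff ℝ ∞ (f n)) → (∀ n, N c k a (f n) ≤ M) → ∀ (U : Ultrafilter ℕ),
      (U : Filter ℕ) ≤ atTop → ∀ (F : ℝ → ℝ),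
      (∀ x ∈ Ω₀, Tendsto (fun n => f n x) U (𝓝 (F x))) →
      SobSq (((a : ℝ) - k) / 2 + b) (fun y => dw c y ^ b * F y) ≤ C * M) := by
    intro b
    by_cases hb : b < L + 1
    · have hb' : (b : ℝ) ≤ L := by exact_mod_cast Nat.lt_succ_iff.1 hb
      obtain ⟨C, hC, h⟩ := SobSq_limit_le hc hk (by linarith : k < a)
        (by linarith : ((a : ℝ) - k) / 2 + b < a)
      exact ⟨C, hC, fun _ => h⟩
    · exact ⟨0, le_rfl, fun h => absurd h hb⟩
  choose S hS0 hS using hS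
  refine ⟨2 + (a + 1) * 4 + 2 * K + ∑ b ∈ Finset.range (L + 1), 2 * S b, ?_, ?_⟩
  · have := Finset.sum_nonneg fun b (_ : b ∈ Finset.range (L + 1)) =>
      mul_nonneg zero_le_two (hS0 b)
    positivity
  intro α α' u M δ v U D V hα A Lm t ht
  have hα0 : 0 < α t ^ (γ + 1) := Real.rpow_pos_of_pos (hα.pos t ht) _
  set r := α t ^ (γ + 1)
  have hNv : ∀ n, N c k a (v n t) ≤ M / r := fun n => by
    rw [le_div_iff₀ hα0, mul_comm]
    exact A.Nv n t ht
  have scale : ∀ {x K : ℝ}, x ≤ K * (M / r) → r * x ≤ K * M := fun {x K} h => by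
    refine (mul_le_mul_of_nonneg_left h hα0.le).trans_eq ?_
    field_simp
  have hv := Lm.limv t ht
  have hδ := Lm.limδ t ht
  have b1 : (∫ x in Ω₀, dw c x ^ (k + ((a : ℝ) + 1)) * iteratedDeriv (a + 1) (D t) x ^ 2) ≤
      2 * M := by
    have hd := (Lm.jets A hc hk ht).1 1 ha1
    simp only [iteratedDeriv_one] at hd
    have := W_limit_le hc (by linarith : 0 ≤ k + 1) (fun n => smooth_deriv (A.smδ n t))
      (fun n => A.Nw n t ht) Lm.le hd le_rfl ha1.le
    rw [← iteratedDeriv_succ', show k + 1 + (a : ℝ) = k + (a + 1) by ring] at this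
    exact this
  have b2 : ∑ b ∈ Finset.range (a + 1),
      ((r * ∫ x in Ω₀, dw c x ^ (k + (b : ℝ)) * iteratedDeriv b (V t) x ^ 2) +
        ∫ x in Ω₀, dw c x ^ (k + (b : ℝ)) * iteratedDeriv b (D t) x ^ 2) ≤
      (a + 1) * (4 * M) := by
    refine (Finset.sum_le_card_nsmul _ _ (4 * M) fun b hb => ?_).trans_eq (by simp)
    have hb' : b ≤ a := Nat.lt_succ_iff.1 (Finset.mem_range.1 hb)
    have h1 := scale (W_limit_le hc hk (A.smv · t) hNv Lm.le hv hb' ha1.le)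
    have h2 := W_limit_le hc hk (A.smδ · t) (fun n => A.Nδ n t ht) Lm.le hδ hb' ha1.le
    unfold W at h1 h2
    linarith
  have b3 : W1InfSq (D t) ≤ K * M := hW _ M (A.smδ · t) (fun n => A.Nδ n t ht) U _ hδ
  have b4 : r * W1InfSq (V t) ≤ K * M := scale (hW _ _ (A.smv · t) hNv U _ hv)
  have b5 : ∑ b ∈ Finset.range (L + 1),
      (r * SobSq (((a : ℝ) - k) / 2 + b) (fun y => dw c y ^ b * V t y) +
        SobSq (((a : ℝ) - k) / 2 + b) (fun y => dw c y ^ b * D t y)) ≤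
      (∑ b ∈ Finset.range (L + 1), 2 * S b) * M := by
    rw [Finset.sum_mul]
    refine Finset.sum_le_sum fun b hb => ?_
    have hb' := Finset.mem_range.1 hb
    have h1 := scale (hS b hb' _ _ (A.smv · t) hNv U Lm.le _ hv)
    have h2 := hS b hb' _ M (A.smδ · t) (fun n => A.Nδ n t ht) U Lm.le _ hδ
    linarith
  linarith

end EulerAux

/-- Global existence for the 1-d compressible Euler equations with `1 < γ ≤ 3`: for
`a > (3γ−2)/(γ−1)` and `L < a − (a(γ−1)−1)/(2γ−2)`, small data `u₀` yield a global solution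
of the perturbation system with `E_γ(t) ≤ Cε` for all `t ≥ 0`. -/
theorem stmt19 (γ : ℝ) (hγ1 : 1 < γ) (hγ3 : γ ≤ 3) (a L : ℕ)
    (ha : (3 * γ - 2) / (γ - 1) < (a : ℝ))
    (hL : (L : ℝ) < (a : ℝ) - ((a : ℝ) * (γ - 1) - 1) / (2 * γ - 2))
    (α α' : ℝ → ℝ)
    (hαpos : ∀ t ∈ Ici (0 : ℝ), 0 < α t)
    (hα : ∀ t ∈ Ici (0 : ℝ), HasDerivWithinAt α (α' t) (Ici 0) t)
    (hα' : ∀ t ∈ Ici (0 : ℝ), HasDerivWithinAt α' (α t ^ (-γ)) (Ici 0) t)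
    (hα0 : α 0 = 1) (hα'0 : 0 ≤ α' 0) :
    ∃ ε₀ > (0 : ℝ), ∃ C ≥ (1 : ℝ),
      ∀ ε : ℝ, 0 < ε → ε ≤ ε₀ →
      ∀ u₀ : ℝ → ℝ, (∀ n : ℕ, ContDiffOn ℝ n u₀ (Icc (-1) 1)) →
      (∑ b ∈ Finset.range (a + 1),
          ∫ x in Ω₀, ddg γ x ^ ((1 + (b : ℝ) * (γ - 1)) / (γ - 1)) *
            (iteratedDeriv b u₀ x) ^ 2) < ε →
      ∃ η v : ℝ → ℝ → ℝ,
        IsSolγ γ α α' η v ∧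
        (∀ x ∈ Ω₀, η x 0 = x ∧ v x 0 = u₀ x) ∧
        (∀ t ∈ Ici (0 : ℝ), EγLow γ a L α η v t ≤ C * ε) := by
  have hg : 0 < γ - 1 := by linarith
  have hc : 0 < (γ - 1) / (2 * γ) := by positivity
  have hk : 0 ≤ 1 / (γ - 1) := by positivity
  have hexp : IsExpansion γ α α' := ⟨hαpos, hα, hα', hα0, hα'0⟩
  have ha' : 1 / (γ - 1) + 3 < a := by
    rwa [show 1 / (γ - 1) + 3 = (3 * γ - 2) / (γ - 1) by field_simp; ring]
  have hL' : (L : ℝ) < (a : ℝ) - ((a : ℝ) - 1 / (γ - 1)) / 2 := by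
    rwa [show ((a : ℝ) - 1 / (γ - 1)) / 2 = ((a : ℝ) * (γ - 1) - 1) / (2 * γ - 2) by
      rw [show 2 * γ - 2 = 2 * (γ - 1) by ring]
      field_simp]
  obtain ⟨ε₀, hε₀, C₁, hC₁, happ⟩ := exists_approx hc hk hγ1 hγ3 ha' hexp
  obtain ⟨C₂, hC₂, henergy⟩ := exists_energy_bound hγ1 ha' hL'
  refine ⟨ε₀, hε₀, max 1 (C₂ * C₁), le_max_left _ _, fun ε hε hεε u₀ hu hsum => ?_⟩
  have hN : N ((γ - 1) / (2 * γ)) (1 / (γ - 1)) a u₀ < ε := by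
    refine lt_of_eq_of_lt (Finset.sum_congr rfl fun b _ => ?_) hsum
    rw [show (1 + (b : ℝ) * (γ - 1)) / (γ - 1) = 1 / (γ - 1) + b by field_simp]
    rfl
  obtain ⟨δ, v, A⟩ := happ ε hε hεε u₀ hu hN
  have ha0 : 0 < a := by
    have : (0 : ℝ) < a := by linarith
    exact_mod_cast this
  obtain ⟨U, D, V, hlim⟩ := A.exists_isLim hc hk ha0 hexp hγ1
  refine ⟨fun x t => x + D t x, fun x t => V t x, hlim.isSol hγ1 A ha' hexp, fun x hx => ?_,
    fun t ht => (henergy hexp A hlim t ht).trans ?_⟩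
  · obtain ⟨h1, h2⟩ := hlim.zero_init A hx
    exact ⟨by simp [h1], h2⟩
  · rw [← mul_assoc]
    exact mul_le_mul_of_nonneg_right (le_max_right _ _) hε.le
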